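/- Let 5 ≤ n ≤ 7 and let s satisfy n/2 − 2 < s < 2 and s ≥ max{(n−2)/3, 1}; let N ≫ 1, u₀ ∈ C₀^∞(ℝ^n) with E(Iu₀) ≲ 1, and let u be a solution of i∂_t u + Δ²u + |u|²u = 0, u(0) = u₀, on [0,T]×ℝ^n with ‖u‖_{M([0,T])} ≤ δ for a sufficiently small constant δ. Then for every ε > 0 there is C such that for all t ∈ [0,T], |E(Iu)(t) − E(Iu₀)| ≤ C max{ N^{(n−8)/2 + ε}, N^{−1 + ε} }. -/

import Mathlib

open MeasureTheory Real FourierTransform Filter Topology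
open scoped ENNReal NNReal

noncomputable section

abbrev Rn (n : ℕ) := EuclideanSpace ℝ (Fin n)

variable {n : ℕ}

/-- Fourier multiplier operator with symbol `m`. -/
def fmul (m : Rn n → ℂ) (f : Rn n → ℂ) : Rn n → ℂ :=
  𝓕⁻ fun ξ => m ξ * 𝓕 f ξ

/-- The operator `|∇|^σ`. -/
def absGrad (σ : ℝ) (f : Rn n → ℂ) : Rn n → ℂ :=
  fmul (fun ξ => ((‖ξ‖ ^ σ : ℝ) : ℂ)) f

/-- Squared inhomogeneous Sobolev `H^s` norm. -/
def HsNormSq (s : ℝ) (f : Rn n → ℂ) : ℝ≥0∞ :=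
  ∫⁻ ξ, ENNReal.ofReal ((1 + ‖ξ‖ ^ 2) ^ s) * (‖𝓕 f ξ‖₊ : ℝ≥0∞) ^ 2

def HsN (s : ℝ) (f : Rn n → ℂ) : ℝ≥0∞ := (HsNormSq s f) ^ ((1:ℝ)/2)

/-- Squared homogeneous Sobolev `Ḣ^σ` norm. -/
def HdotNormSq (σ : ℝ) (f : Rn n → ℂ) : ℝ≥0∞ :=
  ∫⁻ ξ, ENNReal.ofReal (‖ξ‖ ^ (2 * σ)) * (‖𝓕 f ξ‖₊ : ℝ≥0∞) ^ 2

/-- `L^p` norm. -/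
def LpN (p : ℝ) (f : Rn n → ℂ) : ℝ≥0∞ :=
  (∫⁻ x, (‖f x‖₊ : ℝ≥0∞) ^ p) ^ (1 / p)

/-- Space-time norm `L^q_t L^r_x` on a time set `I`. -/
def SpaceTimeN (q r : ℝ) (I : Set ℝ) (u : ℝ → Rn n → ℂ) : ℝ≥0∞ :=
  (∫⁻ t in I, (LpN r (u t)) ^ q) ^ (1 / q)

/-- partial derivative in the `i`-th coordinate direction -/
def pd (i : Fin n) (f : Rn n → ℂ) (x : Rn n) : ℂ :=
  fderiv ℝ f x (EuclideanSpace.single i 1)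

def pdR (i : Fin n) (f : Rn n → ℝ) (x : Rn n) : ℝ :=
  fderiv ℝ f x (EuclideanSpace.single i 1)

def lap (f : Rn n → ℂ) (x : Rn n) : ℂ := ∑ i, pd i (pd i f) x
def lapR (f : Rn n → ℝ) (x : Rn n) : ℝ := ∑ i, pdR i (pdR i f) x
def bilap (f : Rn n → ℂ) (x : Rn n) : ℂ := lap (fun y => lap f y) x

/-- cubic nonlinearity `|u|²u` -/
def cubic (f : Rn n → ℂ) (x : Rn n) : ℂ := (‖f x‖ : ℂ) ^ 2 * f x

/-- solves the defocusing cubic fourth-order NLS on the time set `I` -/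
def Solves4NLS (I : Set ℝ) (u : ℝ → Rn n → ℂ) : Prop :=
  ∀ t ∈ I, ∀ x, Complex.I * deriv (fun τ => u τ x) t + bilap (u t) x + cubic (u t) x = 0

/-- Schrödinger admissible pair -/
def SAdm (n : ℕ) (q r : ℝ) : Prop := 2 ≤ q ∧ 2 ≤ r ∧ 2 / q = n * (1/2 - 1/r)
/-- biharmonic admissible pair -/
def BAdm (n : ℕ) (q r : ℝ) : Prop := 2 ≤ q ∧ 2 ≤ r ∧ 4 / q = n * (1/2 - 1/r)

/-- The symbol `m_N` of the smoothing operator `I`: smooth, radial, nonincreasing in `|ξ|`,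
equal to `1` for `|ξ| ≤ N` and to `(N/|ξ|)^{2-s}` for `|ξ| ≥ 2N`. -/
def IsISymbol {n : ℕ} (N s : ℝ) (m : Rn n → ℝ) : Prop :=
  ContDiff ℝ (⊤ : ℕ∞) m ∧
  (∀ x y : Rn n, ‖x‖ = ‖y‖ → m x = m y) ∧
  (∀ x y : Rn n, ‖x‖ ≤ ‖y‖ → m y ≤ m x) ∧
  (∀ ξ : Rn n, ‖ξ‖ ≤ N → m ξ = 1) ∧
  (∀ ξ : Rn n, 2 * N ≤ ‖ξ‖ → m ξ = (N / ‖ξ‖) ^ (2 - s))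

/-- The smoothing operator `I` with symbol `m`. -/
def Iop {n : ℕ} (m : Rn n → ℝ) (f : Rn n → ℂ) : Rn n → ℂ :=
  fmul (fun ξ => (m ξ : ℂ)) f

/-- The interaction Morawetz norm `‖u‖_{M(I)} = ‖|∇|^{-(n-5)/4}u‖_{L⁴(I;L⁴)}`. -/
def MNorm {n : ℕ} (I : Set ℝ) (u : ℝ → Rn n → ℂ) : ℝ≥0∞ :=
  SpaceTimeN 4 4 I (fun t => absGrad (-(((n : ℝ) - 5) / 4)) (u t))

/-- The energy `E(v) = ∫ ½|Δv|² + ¼|v|⁴ dx`. -/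
def Energy {n : ℕ} (v : Rn n → ℂ) : ℝ :=
  ∫ x : Rn n, ((1/2) * ‖lap v x‖ ^ 2 + (1/4) * ‖v x‖ ^ 4)

/-- Complex-valued Schwartz functions on `ℝⁿ`. -/
abbrev Sch (n : ℕ) := SchwartzMap (Rn n) ℂ

open ENNReal (ofReal ofReal_mul ofReal_le_ofReal ofReal_add ofReal_ofNat ofReal_toReal ofReal_ne_top
  ofReal_le_ofReal_iff ofReal_pow ofReal_rpow_of_pos ofReal_rpow_of_nonneg
  mul_rpow_of_nonneg lintegral_mul_le_Lp_mul_Lq ofReal_one)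
open Complex (I conj_ofReal norm_real real_smul norm_exp_ofReal_mul_I conj_I mul_conj' mul_conj
  sq_norm norm_I add_re sub_re mul_re add_im conj_re conj_im reCLM reCLM_apply exp_conj)
open SchwartzMap (fourierInv_coe fourier_coe toLp_fourier_eq smulLeftCLM_apply_apply toLpCLM
  inner_toL2_toL2_eq norm_le_seminorm)
open Set (Icc uIcc_of_le Ioo Ioc Icc_subset_Icc)
open Finset (range sum_range_succ)
open Metric (ball closedBall)
open intervalIntegral (continuous_parametric_intervalIntegral_of_continuous' integral_of_le integral_mono_on
  integral_eq_sub_of_hasDerivAt_of_le)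

lemma exists_smooth_inv {c : ℝ} (hc : 0 < c) :
    ∃ Θ : ℝ → ℝ, ContDiff ℝ (⊤ : ℕ∞) Θ ∧ ∀ x, c ≤ x → Θ x = x⁻¹ := by
  let s : ℝ → ℝ := fun x => smoothTransition (2 * x / c - 1)
  have hs : ContDiff ℝ (⊤ : ℕ∞) s := smoothTransition.contDiff.comp (by fun_prop)
  let g : ℝ → ℝ := fun x => c / 2 * (1 - s x) + x * s x
  have hg : ContDiff ℝ (⊤ : ℕ∞) g := by fun_prop
  have hpos : ∀ x, 0 < g x := by
    intro x
    have h0 : 0 ≤ s x := smoothTransition.nonneg _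
    have h1 : s x ≤ 1 := smoothTransition.le_one _
    rcases le_or_gt x (c / 2) with h | h
    · have : s x = 0 := smoothTransition.zero_of_nonpos (by
        have : 2 * x / c ≤ 1 := by rw [div_le_one hc]; linarith
        linarith)
      simp only [g, this]; linarith
    · have : c / 2 * (1 - s x) + c / 2 * s x ≤ g x := by
        simp only [g]; gcongr
      linarith
  refine ⟨fun x => (g x)⁻¹, hg.inv fun x => (hpos x).ne', fun x hx => ?_⟩
  have : s x = 1 := smoothTransition.one_of_one_le (by
    have : 2 ≤ 2 * x / c := by rw [le_div_iff₀ hc]; linarith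
    linarith)
  simp [g, this]

/-- Smooth amplitudes depending on parameters, supported in a fixed annulus. -/
structure AnnAmp (n : ℕ) (r R : ℝ) (A : ℝ × Rn n × Rn n → ℂ) : Prop where
  smooth : ContDiff ℝ (⊤ : ℕ∞) A
  supp : ∀ p : ℝ × Rn n × Rn n, (‖p.2.2‖ < r ∨ R < ‖p.2.2‖) → A p = 0

/-- `(|η + ρ e|⁴ - |η|⁴) / ρ` for unit `e`. -/
def diffPhase (p : ℝ × Rn n × Rn n) : ℝ :=
  2 * ‖p.2.2‖ ^ 2 * (2 * inner ℝ p.2.2 p.2.1 + p.1) + p.1 * (2 * inner ℝ p.2.2 p.2.1 + p.1) ^ 2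

/-- derivative of `diffPhase` in the direction `e`. -/
def diffPhaseD (p : ℝ × Rn n × Rn n) : ℝ :=
  4 * ‖p.2.2‖ ^ 2 + 8 * inner ℝ p.2.2 p.2.1 ^ 2 + 12 * p.1 * inner ℝ p.2.2 p.2.1 + 4 * p.1 ^ 2

lemma contDiff_normsq_snd : ContDiff ℝ (⊤ : ℕ∞) (fun p : ℝ × Rn n × Rn n => ‖p.2.2‖ ^ 2) :=
  (contDiff_norm_sq ℝ).comp (by fun_prop)

lemma contDiff_diffPhaseD : ContDiff ℝ (⊤ : ℕ∞) (diffPhaseD (n := n)) := by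
  unfold diffPhaseD
  have := contDiff_normsq_snd (n := n)
  have h : ContDiff ℝ (⊤ : ℕ∞) (fun p : ℝ × Rn n × Rn n => inner ℝ p.2.2 p.2.1) :=
    ContDiff.inner ℝ (by fun_prop) (by fun_prop)
  fun_prop

lemma diffPhaseD_ge {ρ : ℝ} {e η : Rn n} (he : ‖e‖ = 1) : ‖η‖ ^ 2 ≤ diffPhaseD (ρ, e, η) := by
  have h := abs_real_inner_le_norm η e
  rw [he, mul_one] at h
  have h2 : inner ℝ η e ^ 2 ≤ ‖η‖ ^ 2 := sq_le_sq' (abs_le.1 h).1 (abs_le.1 h).2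
  simp only [diffPhaseD]
  nlinarith [sq_nonneg (inner ℝ η e + 2 / 3 * ρ), sq_nonneg (inner ℝ η e), sq_nonneg ρ,
    sq_nonneg (11 * inner ℝ η e + 6 * ρ)]

lemma hasFDerivAt_diffPhase {ρ : ℝ} {e : Rn n} (he : ‖e‖ = 1) (η : Rn n) :
    ∃ L : Rn n →L[ℝ] ℝ, HasFDerivAt (fun η => diffPhase (ρ, e, η)) L η ∧
      L e = diffPhaseD (ρ, e, η) := by
  have h1 : HasFDerivAt (fun η : Rn n => ‖η‖ ^ 2) (2 • (innerSL ℝ η)) η :=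
    (hasStrictFDerivAt_norm_sq η).hasFDerivAt
  have h2 : HasFDerivAt (fun η : Rn n => inner ℝ η e) (innerSL ℝ e) η := by
    have := (innerSL ℝ e).hasFDerivAt (x := η)
    refine this.congr_of_eventuallyEq (Eventually.of_forall fun x => ?_)
    simp [real_inner_comm]
  have h3 := ((h2.const_mul 2).add_const ρ)
  have h := ((h1.const_mul 2).mul h3).add ((h3.pow 2).const_mul ρ)
  refine ⟨_, h, ?_⟩
  simp [diffPhaseD, he, real_inner_comm]
  ring

lemma AnnAmp.ibp {r R : ℝ} {A : ℝ × Rn n × Rn n → ℂ} (hr : 0 < r) (hA : AnnAmp n r R A) :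
    ∃ B, AnnAmp n r R B ∧ ∀ (l ρ : ℝ) (e : Rn n), ‖e‖ = 1 → 
      (l : ℂ) * ∫ η, Complex.exp (I * (l * diffPhase (ρ, e, η) : ℝ)) * A (ρ, e, η) =
        I * ∫ η, Complex.exp (I * (l * diffPhase (ρ, e, η) : ℝ)) * B (ρ, e, η) := by
  obtain ⟨Θ, hΘ, hΘ1⟩ := exists_smooth_inv (c := r ^ 2) (by positivity)
  let G : ℝ × Rn n × Rn n → ℂ := fun p => A p * ((Θ (diffPhaseD p) : ℝ) : ℂ)
  have hΘD : ContDiff ℝ (⊤ : ℕ∞) (fun p : ℝ × Rn n × Rn n => ((Θ (diffPhaseD p) : ℝ) : ℂ)) :=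
    Complex.ofRealCLM.contDiff.comp (hΘ.comp contDiff_diffPhaseD)
  have hG : ContDiff ℝ (⊤ : ℕ∞) G := hA.smooth.mul hΘD
  have hG0 : ∀ p : ℝ × Rn n × Rn n, (‖p.2.2‖ < r ∨ R < ‖p.2.2‖) → G p = 0 := by
    intro p hp; simp [G, hA.supp p hp]
  let B : ℝ × Rn n × Rn n → ℂ := fun p => fderiv ℝ G p (0, 0, p.2.1)
  refine ⟨B, ⟨?_, ?_⟩, ?_⟩
  · exact (hG.fderiv_right (by simp)).clm_apply (by fun_prop)
  · intro p hp
    have : G =ᶠ[𝓝 p] fun _ => 0 := by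
      rcases hp with h | h
      · filter_upwards [(isOpen_lt (f := fun q : ℝ × Rn n × Rn n => ‖q.2.2‖) (by fun_prop)
          continuous_const).mem_nhds h] with q hq using hG0 q (Or.inl hq)
      · filter_upwards [(isOpen_lt (g := fun q : ℝ × Rn n × Rn n => ‖q.2.2‖) continuous_const
          (by fun_prop)).mem_nhds h] with q hq using hG0 q (Or.inr hq)
    simp [B, this.fderiv_eq]
  · intro l ρ e he
    let f : Rn n → ℂ := fun η => Complex.exp (I * (l * diffPhase (ρ, e, η) : ℝ))
    let g : Rn n → ℂ := fun η => G (ρ, e, η)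
    have hsub : ∀ η, HasFDerivAt (fun η : Rn n => ((ρ, e, η) : ℝ × Rn n × Rn n))
        ((0 : Rn n →L[ℝ] ℝ).prod ((0 : Rn n →L[ℝ] Rn n).prod (ContinuousLinearMap.id ℝ _))) η :=
      fun η => (hasFDerivAt_const _ _).prodMk ((hasFDerivAt_const _ _).prodMk (hasFDerivAt_id η))
    have hgd : ∀ η, HasFDerivAt g ((fderiv ℝ G (ρ, e, η)).comp
        ((0 : Rn n →L[ℝ] ℝ).prod ((0 : Rn n →L[ℝ] Rn n).prod (ContinuousLinearMap.id ℝ _)))) η :=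
      fun η => HasFDerivAt.comp (g := G) η
        ((hG.differentiable (by simp)) (ρ, e, η)).hasFDerivAt (hsub η)
    have hg' : ∀ η, fderiv ℝ g η e = B (ρ, e, η) := by
      intro η; rw [(hgd η).fderiv]; simp [B]
    have hfd : ∀ η, ∃ L : Rn n →L[ℝ] ℂ, HasFDerivAt f L η ∧
        L e = f η * (I * (l * diffPhaseD (ρ, e, η) : ℝ)) := by
      intro η
      obtain ⟨L, hL, hLe⟩ := hasFDerivAt_diffPhase (ρ := ρ) he η
      refine ⟨_, ((Complex.ofRealCLM.hasFDerivAt.comp η (hL.const_mul l)).const_mul I).cexp,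
        ?_⟩
      simp [f, hLe]
    have hf' : ∀ η, fderiv ℝ f η e = f η * (I * (l * diffPhaseD (ρ, e, η) : ℝ)) := by
      intro η; obtain ⟨L, hL, hLe⟩ := hfd η; rw [hL.fderiv, hLe]
    have hgc : HasCompactSupport g := by
      refine HasCompactSupport.intro (isCompact_closedBall (0 : Rn n) R) fun η hη => ?_
      exact hG0 _ (Or.inr (by simpa using hη))
    have hfc : Continuous f := continuous_iff_continuousAt.2 fun η => by
      obtain ⟨L, hL, -⟩ := hfd η; exact hL.continuousAt
    have hgcont : ContDiff ℝ (⊤ : ℕ∞) g := hG.comp (by fun_prop)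
    have hDc : Continuous fun η => diffPhaseD (ρ, e, η) :=
      (contDiff_diffPhaseD (n := n)).continuous.comp (by fun_prop)
    have hBc : Continuous fun η => fderiv ℝ g η e := 
      (hgcont.continuous_fderiv (by simp)).clm_apply continuous_const
    have hgc' : HasCompactSupport fun η => fderiv ℝ g η e := hgc.fderiv_apply ℝ e
    have key := integral_mul_fderiv_eq_neg_fderiv_mul_of_integrable (μ := volume) 
      (f := f) (g := g) (v := e) ?_ ?_ ?_ (fun x _ => (hfd x).choose_spec.1.differentiableAt)
        (fun x _ => (hgd x).differentiableAt)
    · simp_rw [hg', hf'] at key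
      rw [← integral_const_mul, ← integral_const_mul]
      have e1 : ∀ η, (l : ℂ) * (Complex.exp (I * (l * diffPhase (ρ, e, η) : ℝ))
          * A (ρ, e, η)) = 
          -I * (f η * (I * (l * diffPhaseD (ρ, e, η) : ℝ)) * g η) := by
        intro η
        by_cases hη : ‖η‖ < r
        · simp [g, G, hA.supp (ρ, e, η) (Or.inl hη)]
        · have hD : r ^ 2 ≤ diffPhaseD (ρ, e, η) :=
            (pow_le_pow_left₀ hr.le (not_lt.1 hη) 2).trans (diffPhaseD_ge he)
          have hD0 : diffPhaseD (ρ, e, η) ≠ 0 := by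
            have : 0 < r ^ 2 := by positivity
            linarith
          simp only [g, G, hΘ1 _ hD, f]
          push_cast
          have : (diffPhaseD (ρ, e, η) : ℂ) ≠ 0 := by exact_mod_cast hD0
          field_simp
          ring_nf
          rw [Complex.I_sq]; ring
      simp_rw [e1]
      rw [integral_const_mul, integral_const_mul, key]
      ring
    · simp_rw [hf']
      exact Continuous.integrable_of_hasCompactSupport (by fun_prop) (hgc.mul_left)
    · exact Continuous.integrable_of_hasCompactSupport (by fun_prop) (hgc'.mul_left)
    · exact Continuous.integrable_of_hasCompactSupport (by fun_prop) (hgc.mul_left)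

lemma AnnAmp.bound {r R : ℝ} {A : ℝ × Rn n × Rn n → ℂ} (hA : AnnAmp n r R A) (M : ℝ) :
    ∃ C, 0 ≤ C ∧ ∀ (ρ : ℝ) (e η : Rn n), |ρ| ≤ M → ‖e‖ = 1 → ‖A (ρ, e, η)‖ ≤ C := by
  have hK : IsCompact ((Icc (-M) M) ×ˢ (Metric.sphere (0 : Rn n) 1) ×ˢ
      (closedBall (0 : Rn n) R)) :=
    isCompact_Icc.prod ((isCompact_sphere _ _).prod (isCompact_closedBall _ _))
  obtain ⟨C, hC⟩ := hK.exists_bound_of_continuousOn hA.smooth.continuous.continuousOn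
  refine ⟨max C 0, le_max_right _ _, fun ρ e η hρ he => ?_⟩
  by_cases hη : R < ‖η‖
  · rw [hA.supp (ρ, e, η) (Or.inr hη)]; simp
  · have hm : (ρ, e, η) ∈ (Icc (-M) M) ×ˢ (Metric.sphere (0 : Rn n) 1) ×ˢ
        (closedBall (0 : Rn n) R) := by
      refine Set.mk_mem_prod (abs_le.1 hρ) (Set.mk_mem_prod ?_ ?_)
      · simp [he]
      · simpa using hη
    exact (hC _ hm).trans (le_max_left _ _)

lemma AnnAmp.decay {r R : ℝ} (hr : 0 < r) (M : ℝ) (k : ℕ) : ∀ {A : ℝ × Rn n × Rn n → ℂ},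
    AnnAmp n r R A → ∃ C, 0 ≤ C ∧ ∀ (l ρ : ℝ) (e : Rn n), |ρ| ≤ M → ‖e‖ = 1 →
      |l| ^ k * ‖∫ η, Complex.exp (I * (l * diffPhase (ρ, e, η) : ℝ)) * A (ρ, e, η)‖
        ≤ C := by
  induction k with
  | zero =>
    intro A hA
    obtain ⟨C, hC0, hC⟩ := hA.bound M
    refine ⟨C * volume.real (closedBall (0 : Rn n) R), by positivity,
      fun l ρ e hρ he => ?_⟩
    rw [pow_zero, one_mul, ← setIntegral_eq_integral_of_forall_compl_eq_zero
      (s := closedBall (0 : Rn n) R)]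
    · refine norm_setIntegral_le_of_norm_le_const (measure_closedBall_lt_top) fun η _ => ?_
      rw [norm_mul, mul_comm I, norm_exp_ofReal_mul_I, one_mul]
      exact hC ρ e η hρ he
    · intro η hη
      rw [hA.supp (ρ, e, η) (Or.inr (by simpa using hη)), mul_zero]
  | succ k ih =>
    intro A hA
    obtain ⟨B, hB, hAB⟩ := hA.ibp hr
    obtain ⟨C, hC0, hC⟩ := ih hB
    refine ⟨C, hC0, fun l ρ e hρ he => ?_⟩
    have h1 := congrArg norm (hAB l ρ e he)
    rw [norm_mul, norm_mul, norm_I, one_mul, norm_real, norm_eq_abs] at h1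
    calc _ = |l| ^ k * (|l| * ‖∫ η, Complex.exp (I * (l * diffPhase (ρ, e, η) : ℝ))
            * A (ρ, e, η)‖) := by ring
      _ ≤ C := by rw [h1]; exact hC l ρ e hρ he

lemma norm_add_smul_pow_four {ρ : ℝ} {e η : Rn n} (he : ‖e‖ = 1) :
    ‖η + ρ • e‖ ^ 4 - ‖η‖ ^ 4 = ρ * diffPhase (ρ, e, η) := by
  have h : ‖η + ρ • e‖ ^ 2 = ‖η‖ ^ 2 + ρ * (2 * inner ℝ η e + ρ) := by
    rw [norm_add_sq_real, norm_smul, real_inner_smul_right, he, mul_one, norm_eq_abs, sq_abs]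
    ring
  have h4 : ‖η + ρ • e‖ ^ 4 = (‖η + ρ • e‖ ^ 2) ^ 2 := by ring
  rw [h4, h]; simp only [diffPhase]; ring

lemma annAmp_corr {a : Rn n → ℂ} (ha : ContDiff ℝ (⊤ : ℕ∞) a) {r R : ℝ}
    (h0 : ∀ ξ, ‖ξ‖ < r → a ξ = 0) (hR : ∀ ξ, R < ‖ξ‖ → a ξ = 0) :
    AnnAmp n r R (fun p => a (p.2.2 + p.1 • p.2.1) * (starRingEnd ℂ) (a p.2.2)) := by
  refine ⟨?_, ?_⟩
  · refine (ha.comp (by fun_prop)).mul ?_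
    exact Complex.conjCLE.contDiff.comp (ha.comp (by fun_prop))
  · rintro p (h | h)
    · simp [h0 _ h]
    · simp [hR _ h]

lemma dispersive_corr {a : Rn n → ℂ} (ha : ContDiff ℝ (⊤ : ℕ∞) a) {r R : ℝ} (hr : 0 < r)
    (h0 : ∀ ξ, ‖ξ‖ < r → a ξ = 0) (hR : ∀ ξ, R < ‖ξ‖ → a ξ = 0) :
    ∃ C, 0 ≤ C ∧ ∀ (t : ℝ) (x h : Rn n), t ≠ 0 → h ≠ 0 →
      ‖∫ η, (Complex.exp (I * (t * ‖η + h‖ ^ 4 + inner ℝ (η + h) x : ℝ)) * a (η + h)) *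
        (starRingEnd ℂ) (Complex.exp (I * (t * ‖η‖ ^ 4 + inner ℝ η x : ℝ)) * a η)‖
      ≤ C * |t| ^ (-(9 / 2) : ℝ) *
        (ball (0 : Rn n) (2 * |R| + 1)).indicator (fun h => ‖h‖ ^ (-(9 / 2) : ℝ)) h := by
  obtain ⟨C0, hC0, hC0b⟩ := (annAmp_corr ha h0 hR).decay hr (2 * |R| + 1) 0
  obtain ⟨C5, hC5, hC5b⟩ := (annAmp_corr ha h0 hR).decay hr (2 * |R| + 1) 5
  refine ⟨max C0 C5, le_max_of_le_left hC0, fun t x h ht hh => ?_⟩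
  have hh' : 0 < ‖h‖ := norm_pos_iff.2 hh
  by_cases hb : h ∈ ball (0 : Rn n) (2 * |R| + 1)
  · rw [Set.indicator_of_mem hb]
    have hbn : ‖h‖ < 2 * |R| + 1 := by simpa using hb
    let e : Rn n := ‖h‖⁻¹ • h
    have he : ‖e‖ = 1 := by simp [e, norm_smul, hh'.ne']
    have hhe : h = ‖h‖ • e := by simp [e, smul_smul, hh'.ne']
    have hρ : |‖h‖| ≤ 2 * |R| + 1 := by rw [abs_norm]; exact hbn.le
    have b0 := hC0b (t * ‖h‖) ‖h‖ e hρ he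
    have b5 := hC5b (t * ‖h‖) ‖h‖ e hρ he
    set J := ∫ η, Complex.exp (I * (t * ‖h‖ * diffPhase (‖h‖, e, η) : ℝ)) *
      (a (η + ‖h‖ • e) * (starRingEnd ℂ) (a η)) with hJ
    have hexp : ∀ η, (Complex.exp (I * (t * ‖η + h‖ ^ 4 + inner ℝ (η + h) x : ℝ))
        * a (η + h)) *
        (starRingEnd ℂ) (Complex.exp (I * (t * ‖η‖ ^ 4 + inner ℝ η x : ℝ)) * a η) =
        Complex.exp (I * (inner ℝ h x : ℝ)) *
        (Complex.exp (I * (t * ‖h‖ * diffPhase (‖h‖, e, η) : ℝ)) *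
          (a (η + ‖h‖ • e) * (starRingEnd ℂ) (a η))) := by
      intro η
      have h1 : t * ‖h‖ * diffPhase (‖h‖, e, η) = t * (‖η + h‖ ^ 4 - ‖η‖ ^ 4) := by
        rw [mul_assoc, ← norm_add_smul_pow_four he, ← hhe]
      rw [h1, ← hhe, map_mul, ← exp_conj, map_mul, conj_I, conj_ofReal,
        inner_add_left]
      have : Complex.exp (I * ((t * ‖η + h‖ ^ 4 + (inner ℝ η x + inner ℝ h x) : ℝ) : ℂ)) *
          Complex.exp (-I * ((t * ‖η‖ ^ 4 + inner ℝ η x : ℝ) : ℂ)) =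
          Complex.exp (I * ((inner ℝ h x : ℝ) : ℂ)) *
          Complex.exp (I * ((t * (‖η + h‖ ^ 4 - ‖η‖ ^ 4) : ℝ) : ℂ)) := by
        rw [← Complex.exp_add, ← Complex.exp_add]
        congr 1
        push_cast; ring
      linear_combination (a (η + h) * (starRingEnd ℂ) (a η)) * this
    simp_rw [hexp]
    rw [integral_const_mul, norm_mul, mul_comm I, norm_exp_ofReal_mul_I, one_mul]
    simp only [pow_zero, one_mul] at b0
    have hX : 0 < |t| * ‖h‖ := mul_pos (abs_pos.2 ht) hh'
    rw [abs_mul, abs_norm] at b5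
    rw [mul_assoc, ← mul_rpow (abs_nonneg _) (norm_nonneg _)]
    change ‖J‖ ≤ C0 at b0
    change (|t| * ‖h‖) ^ 5 * ‖J‖ ≤ C5 at b5
    set X := |t| * ‖h‖
    rcases le_or_gt 1 X with h1 | h1
    · have : ‖J‖ ≤ C5 * X ^ (-5 : ℝ) := by
        rw [rpow_neg hX.le, ← div_eq_mul_inv, le_div_iff₀ (by positivity), mul_comm]
        exact_mod_cast b5
      refine this.trans ?_
      gcongr
      · exact le_max_right _ _
      · norm_num
    · have : (1 : ℝ) ≤ X ^ (-(9 / 2) : ℝ) :=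
        one_le_rpow_of_pos_of_le_one_of_nonpos hX h1.le (by norm_num)
      calc ‖J‖ ≤ C0 * 1 := by simpa using b0
        _ ≤ _ := by gcongr; exact le_max_left _ _
  · rw [Set.indicator_of_notMem hb, mul_zero]
    have hbn : 2 * |R| + 1 ≤ ‖h‖ := by simpa using hb
    have : ∀ η, (Complex.exp (I * (t * ‖η + h‖ ^ 4 + inner ℝ (η + h) x : ℝ)) * a (η + h)) *
        (starRingEnd ℂ) (Complex.exp (I * (t * ‖η‖ ^ 4 + inner ℝ η x : ℝ)) * a η) = 0 := by
      intro η
      by_cases h1 : R < ‖η‖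
      · simp [hR η h1]
      · have : R < ‖η + h‖ := by
          have := norm_sub_le (η + h) η
          rw [add_sub_cancel_left] at this
          have := le_abs_self R
          push Not at h1
          linarith
        simp [hR _ this]
    simp_rw [this]
    simp

lemma integrable_ball_norm_rpow (hn : 5 ≤ n) (M : ℝ) :
    Integrable ((ball (0 : Rn n) M).indicator (fun h => ‖h‖ ^ (-(9 / 2) : ℝ))) := by
  rw [integrable_indicator_iff measurableSet_ball]
  have : Nontrivial (Rn n) := by
    have : Nonempty (Fin n) := ⟨⟨0, by omega⟩⟩
    infer_instance
  refine (integrableOn_fun_norm_addHaar (f := fun y => y ^ (-(9 / 2) : ℝ)) volume).2 ?_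
  rcases le_or_gt M 0 with hM | hM
  · simp [Set.Ioo_eq_empty_of_le hM]
  have : IntegrableOn (fun y : ℝ => y ^ ((n : ℝ) - 1 - 9 / 2)) (Ioo 0 M) := by
    rw [intervalIntegral.integrableOn_Ioo_rpow_iff hM]
    have : (5 : ℝ) ≤ n := by exact_mod_cast hn
    linarith
  refine this.congr_fun (fun y hy => ?_) measurableSet_Ioo
  have hy0 : 0 < y := hy.1
  simp only [finrank_euclideanSpace, Fintype.card_fin, smul_eq_mul]
  rw [← rpow_natCast, ← rpow_add hy0, Nat.cast_sub (by omega)]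
  congr 1; simp; ring

lemma dispersive_unit (hn : 5 ≤ n) {a : Rn n → ℂ} (ha : ContDiff ℝ (⊤ : ℕ∞) a) {r R : ℝ}
    (hr : 0 < r) (h0 : ∀ ξ, ‖ξ‖ < r → a ξ = 0) (hR : ∀ ξ, R < ‖ξ‖ → a ξ = 0) :
    ∃ C, 0 ≤ C ∧ ∀ (t : ℝ) (x : Rn n),
      ‖∫ ξ, Complex.exp (I * (t * ‖ξ‖ ^ 4 + inner ℝ ξ x : ℝ)) * a ξ‖
        ≤ C * (1 + |t|) ^ (-(9 / 4) : ℝ) := by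
  obtain ⟨C1, hC1, hJ⟩ := dispersive_corr ha hr h0 hR
  have hac : HasCompactSupport a :=
    HasCompactSupport.intro (isCompact_closedBall (0 : Rn n) R) fun η hη => hR η (by simpa using hη)
  set D := ∫ h, (ball (0 : Rn n) (2 * |R| + 1)).indicator
    (fun h => ‖h‖ ^ (-(9 / 2) : ℝ)) h with hD
  have hD0 : 0 ≤ D := integral_nonneg fun h => Set.indicator_nonneg (fun _ _ => by positivity) h
  set A0 := ∫ ξ, ‖a ξ‖ with hA0
  have hA00 : 0 ≤ A0 := integral_nonneg fun _ => norm_nonneg _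
  have hK0 : ∀ (t : ℝ) (x : Rn n),
      ‖∫ ξ, Complex.exp (I * (t * ‖ξ‖ ^ 4 + inner ℝ ξ x : ℝ)) * a ξ‖ ≤ A0 := by
    intro t x
    refine (norm_integral_le_integral_norm _).trans_eq (integral_congr_ae (ae_of_all _ fun ξ => ?_))
    simp only [norm_mul]
    rw [mul_comm I, norm_exp_ofReal_mul_I, one_mul]
  have hK1 : ∀ (t : ℝ) (x : Rn n), t ≠ 0 →
      ‖∫ ξ, Complex.exp (I * (t * ‖ξ‖ ^ 4 + inner ℝ ξ x : ℝ)) * a ξ‖ ^ 2 ≤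
        C1 * |t| ^ (-(9 / 2) : ℝ) * D := by
    intro t x ht
    set g : Rn n → ℂ := fun ξ => Complex.exp (I * (t * ‖ξ‖ ^ 4 + inner ℝ ξ x : ℝ)) * a ξ
    have hgc : Continuous g := by
      have := ha.continuous
      fun_prop
    have hgs : HasCompactSupport g := hac.mul_left
    have h1 : (((‖∫ ξ, g ξ‖ ^ 2 : ℝ)) : ℂ) =
        ∫ h, ∫ η, g (η + h) * (starRingEnd ℂ) (g η) := by
      rw [← integral_integral_swap (f := fun η h => g (η + h) * (starRingEnd ℂ) (g η))]
      · have e1 : ∀ η, ∫ h, g (η + h) * (starRingEnd ℂ) (g η) =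
            (∫ ξ, g ξ) * (starRingEnd ℂ) (g η) := by
          intro η
          rw [integral_mul_const, integral_add_left_eq_self]
        simp_rw [e1]
        rw [integral_const_mul, integral_conj, mul_conj, Complex.normSq_eq_norm_sq]
      · refine Continuous.integrable_of_hasCompactSupport ?_ ?_
        · simp only [Function.uncurry_def]
          have : Continuous fun p : Rn n × Rn n => g p.1 := hgc.comp continuous_fst
          have h2 : Continuous fun p : Rn n × Rn n => g (p.1 + p.2) := hgc.comp (by fun_prop)
          exact h2.mul (Complex.continuous_conj.comp this)
        · refine HasCompactSupport.intro ((isCompact_closedBall (0 : Rn n) |R|).prod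
            (isCompact_closedBall (0 : Rn n) (2 * |R|))) fun p hp => ?_
          have hga : ∀ ξ, |R| < ‖ξ‖ → g ξ = 0 := fun ξ hξ => by
            simp [g, hR ξ ((le_abs_self R).trans_lt hξ)]
          simp only [Function.uncurry_def]
          by_cases h1 : |R| < ‖p.1‖
          · simp [hga _ h1]
          · have h2 : 2 * |R| < ‖p.2‖ := by
              by_contra h2
              exact hp (Set.mem_prod.2 ⟨by simpa using h1, by simpa using h2⟩)
            have : |R| < ‖p.1 + p.2‖ := by
              have := norm_sub_le (p.1 + p.2) p.1
              rw [add_sub_cancel_left] at this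
              push Not at h1
              linarith
            simp [hga _ this]
    have h2 : ‖∫ ξ, g ξ‖ ^ 2 = ‖∫ h, ∫ η, g (η + h) * (starRingEnd ℂ) (g η)‖ := by
      rw [← h1, norm_real, norm_of_nonneg (by positivity)]
    rw [h2, hD, ← integral_const_mul]
    refine norm_integral_le_of_norm_le ((integrable_ball_norm_rpow hn _).const_mul _) ?_
    have : Nontrivial (Rn n) := by
      have : Nonempty (Fin n) := ⟨⟨0, by omega⟩⟩
      infer_instance
    filter_upwards [compl_mem_ae_iff.2 (measure_singleton (0 : Rn n))] with h hh
    exact hJ t x h ht (by simpa using hh)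
  refine ⟨(A0 + √(C1 * D)) * 2 ^ (9 / 4 : ℝ), by positivity, fun t x => ?_⟩
  set k := ‖∫ ξ, Complex.exp (I * (t * ‖ξ‖ ^ 4 + inner ℝ ξ x : ℝ)) * a ξ‖
  have e2 : ∀ y : ℝ, 0 < y → (2 : ℝ) ^ (9 / 4 : ℝ) * (2 * y) ^ (-(9 / 4) : ℝ) =
      y ^ (-(9 / 4) : ℝ) := by
    intro y hy
    rw [mul_rpow (by norm_num) hy.le, ← mul_assoc, ← rpow_add (by norm_num)]
    norm_num
  rcases le_or_gt |t| 1 with h | h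
  · calc k ≤ A0 * 1 := by rw [mul_one]; exact hK0 t x
      _ ≤ (A0 + √(C1 * D)) * (2 ^ (9 / 4 : ℝ) * (2 * 1) ^ (-(9 / 4) : ℝ)) := by
          rw [e2 1 one_pos]
          gcongr
          · exact le_add_of_nonneg_right (by positivity)
          · simp
      _ ≤ (A0 + √(C1 * D)) * (2 ^ (9 / 4 : ℝ) * (1 + |t|) ^ (-(9 / 4) : ℝ)) := by
          gcongr _ * (_ * ?_)
          exact rpow_le_rpow_of_nonpos (by positivity) (by linarith) (by norm_num)
      _ = _ := by ring
  · have ht : t ≠ 0 := by rintro rfl; simp at h; linarith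
    have h3 : k ≤ √(C1 * D) * |t| ^ (-(9 / 4) : ℝ) := by
      refine le_sqrt_of_sq_le (hK1 t x ht) |>.trans_eq ?_
      rw [mul_right_comm, sqrt_mul (by positivity), sqrt_eq_rpow (|t| ^ _),
        ← rpow_mul (by positivity)]
      norm_num
    calc k ≤ _ := h3
      _ = √(C1 * D) * (2 ^ (9 / 4 : ℝ) * (2 * |t|) ^ (-(9 / 4) : ℝ)) := by
        rw [e2 _ (by linarith)]
      _ ≤ (A0 + √(C1 * D)) * (2 ^ (9 / 4 : ℝ) * (1 + |t|) ^ (-(9 / 4) : ℝ)) := by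
          gcongr ?_ * (_ * ?_)
          · exact le_add_of_nonneg_left hA00
          · exact rpow_le_rpow_of_nonpos (by positivity) (by linarith) (by norm_num)
      _ = _ := by ring

section Interp

lemma exists_tsum_geom_int : ∃ S : ℝ≥0∞, S ≠ ∞ ∧
    ∀ L : ℤ, ∑' l : ℤ, ofReal ((2 : ℝ) ^ (-(|((l - L : ℤ) : ℝ)| / 3))) ≤ S := by
  have hs : Summable fun m : ℤ => (2 : ℝ) ^ (-(|(m : ℝ)| / 3)) := by
    have h0 : Summable fun m : ℕ => (2 : ℝ) ^ (-((m : ℝ) / 3)) := by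
      have : Summable fun m : ℕ => ((2 : ℝ) ^ (-(1 / 3) : ℝ)) ^ m :=
        summable_geometric_of_lt_one (by positivity)
          (rpow_lt_one_of_one_lt_of_neg (by norm_num) (by norm_num))
      refine this.congr fun m => ?_
      rw [← rpow_natCast, ← rpow_mul (by norm_num)]
      congr 1; ring
    refine Summable.of_nat_of_neg ?_ ?_ <;> simpa using h0
  refine ⟨∑' m : ℤ, ofReal ((2 : ℝ) ^ (-(|(m : ℝ)| / 3))), ?_, fun L => ?_⟩
  · rw [← ENNReal.ofReal_tsum_of_nonneg (fun _ => by positivity) hs]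
    exact ofReal_ne_top
  · exact ((Equiv.subRight L).tsum_eq
      (fun m : ℤ => ofReal ((2 : ℝ) ^ (-(|(m : ℝ)| / 3))))).le

lemma min_geom_le {A : ℝ} (hA : 0 < A) : ∃ L : ℤ, ∀ l : ℤ,
    min (A * 2 ^ (-(l : ℝ) / 3)) (2 ^ (((l : ℝ) + 2) / 3)) ≤
      4 * √A * (2 : ℝ) ^ (-(|((l - L : ℤ) : ℝ)| / 3)) := by
  obtain ⟨L, hL1, hL2⟩ := exists_mem_Ico_zpow (x := √A) (y := (2 : ℝ) ^ (1 / 3 : ℝ))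
    (sqrt_pos.2 hA) (one_lt_rpow (by norm_num) (by norm_num))
  rw [← rpow_intCast, ← rpow_mul (by norm_num)] at hL1 hL2
  refine ⟨L, fun l => ?_⟩
  have hp : ∀ x y : ℝ, (2 : ℝ) ^ (x + y) = 2 ^ x * 2 ^ y := fun x y => rpow_add (by norm_num) _ _
  have h2 : (2 : ℝ) ^ (1 / 3 : ℝ) ≤ 2 := by
    calc (2 : ℝ) ^ (1 / 3 : ℝ) ≤ 2 ^ (1 : ℝ) := by gcongr <;> norm_num
      _ = 2 := by norm_num
  have h3 : (2 : ℝ) ^ (2 / 3 : ℝ) ≤ 2 := by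
    calc (2 : ℝ) ^ (2 / 3 : ℝ) ≤ 2 ^ (1 : ℝ) := by gcongr <;> norm_num
      _ = 2 := by norm_num
  have hsq : A = √A * √A := (mul_self_sqrt hA.le).symm
  have hs := sqrt_pos.2 hA
  push_cast
  rcases le_total (0 : ℝ) (l - L) with h | h
  · rw [abs_of_nonneg h]
    refine (min_le_left _ _).trans ?_
    have e : (2 : ℝ) ^ (-(l : ℝ) / 3) = 2 ^ (-(1 / 3 * ((L + 1 : ℤ) : ℝ))) * (2 ^ (1 / 3 : ℝ) *
        2 ^ (-((l - L : ℝ) / 3))) := by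
      rw [← hp, ← hp]; congr 1; push_cast; ring
    have e2 : √A * 2 ^ (-(1 / 3 * ((L + 1 : ℤ) : ℝ))) ≤ 1 := by
      rw [rpow_neg (by norm_num), ← div_eq_mul_inv, div_le_one (by positivity)]
      exact hL2.le
    calc A * 2 ^ (-(l : ℝ) / 3) = √A * (√A * 2 ^ (-(1 / 3 * ((L + 1 : ℤ) : ℝ)))) *
          (2 ^ (1 / 3 : ℝ) * 2 ^ (-((l - L : ℝ) / 3))) := by
          rw [e]; nth_rewrite 1 [hsq]; ring
      _ ≤ √A * 1 * (4 * 2 ^ (-((l - L : ℝ) / 3))) := by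
          gcongr; linarith
      _ = _ := by ring
  · rw [abs_of_nonpos h]
    refine (min_le_right _ _).trans ?_
    have e : (2 : ℝ) ^ (((l : ℝ) + 2) / 3) = 2 ^ (1 / 3 * (L : ℝ)) * 2 ^ (2 / 3 : ℝ) *
        2 ^ (-(-(l - L : ℝ) / 3)) := by
      rw [← hp, ← hp]; congr 1; ring
    rw [e]
    calc _ ≤ √A * 4 * (2 : ℝ) ^ (-(-(l - L : ℝ) / 3)) := by gcongr; linarith
      _ = _ := by ring

variable {X : Type*}

/-- dyadic level sets of `f` -/
def lvl (f : X → ℂ) (j : ℤ) : Set X := {x | ‖f x‖ ∈ Ioc ((2 : ℝ) ^ j) (2 ^ (j + 1))}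

lemma lvl_unique {f : X → ℂ} {i j : ℤ} {x : X} (hi : x ∈ lvl f i) (hj : x ∈ lvl f j) : i = j := by
  have h1 : (2 : ℝ) ^ i < 2 ^ (j + 1) := hi.1.trans_le hj.2
  have h2 : (2 : ℝ) ^ j < 2 ^ (i + 1) := hj.1.trans_le hi.2
  have := (zpow_lt_zpow_iff_right₀ (by norm_num : (1 : ℝ) < 2)).1 h1
  have := (zpow_lt_zpow_iff_right₀ (by norm_num : (1 : ℝ) < 2)).1 h2
  omega

lemma exists_mem_lvl {f : X → ℂ} {x : X} (hx : f x ≠ 0) : ∃ j, x ∈ lvl f j :=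
  exists_mem_Ioc_zpow (norm_pos_iff.2 hx) (by norm_num)

variable [MeasurableSpace X] {μ : Measure X}

lemma measurableSet_lvl {f : X → ℂ} (hf : Measurable f) (j : ℤ) : MeasurableSet (lvl f j) :=
  hf.norm measurableSet_Ioc

lemma lvl_l1 {f : X → ℂ} (hf : Measurable f) (j : ℤ) :
    ∫⁻ x in lvl f j, ‖f x‖ₑ ∂μ ≤ ofReal (2 ^ (-(j : ℝ) / 3)) *
      ∫⁻ x in lvl f j, ‖f x‖ₑ ^ (4 / 3 : ℝ) ∂μ := by
  rw [← lintegral_const_mul _ (by fun_prop)]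
  refine setLIntegral_mono (by fun_prop) fun x hx => ?_
  have h0 : 0 < ‖f x‖ := (zpow_pos (by norm_num) j).trans hx.1
  rw [← ofReal_norm, ofReal_rpow_of_pos h0, ← ofReal_mul (by positivity)]
  refine ofReal_le_ofReal ?_
  have h1 : (2 : ℝ) ^ ((j : ℝ) / 3) ≤ ‖f x‖ ^ (1 / 3 : ℝ) := by
    have := rpow_le_rpow (by positivity) hx.1.le (by norm_num : (0 : ℝ) ≤ 1 / 3)
    rw [← rpow_intCast, ← rpow_mul (by norm_num)] at this
    convert this using 2; ring
  have h2 : ‖f x‖ ^ (4 / 3 : ℝ) = ‖f x‖ * ‖f x‖ ^ (1 / 3 : ℝ) := by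
    nth_rewrite 2 [← rpow_one ‖f x‖]
    rw [← rpow_add h0]; norm_num
  rw [h2, neg_div, rpow_neg (by norm_num)]
  have h3 : (0 : ℝ) < 2 ^ ((j : ℝ) / 3) := by positivity
  rw [inv_mul_eq_div, le_div_iff₀ h3]
  gcongr

lemma lvl_l2 {f : X → ℂ} (hf : Measurable f) (j : ℤ) :
    ∫⁻ x in lvl f j, ‖f x‖ₑ ^ (2 : ℝ) ∂μ ≤ ofReal (2 ^ (((j : ℝ) + 1) / 3)) ^ (2 : ℝ) *
      ∫⁻ x in lvl f j, ‖f x‖ₑ ^ (4 / 3 : ℝ) ∂μ := by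
  rw [← lintegral_const_mul _ (by fun_prop)]
  refine setLIntegral_mono (by fun_prop) fun x hx => ?_
  have h0 : 0 < ‖f x‖ := (zpow_pos (by norm_num) j).trans hx.1
  rw [← ofReal_norm, ofReal_rpow_of_pos h0, ofReal_rpow_of_pos h0,
    ofReal_rpow_of_pos (by positivity), ← ofReal_mul (by positivity)]
  refine ofReal_le_ofReal ?_
  have h1 : ‖f x‖ ^ (2 / 3 : ℝ) ≤ ((2 : ℝ) ^ (((j : ℝ) + 1) / 3)) ^ (2 : ℝ) := by
    have := rpow_le_rpow (by positivity) hx.2 (by norm_num : (0 : ℝ) ≤ 2 / 3)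
    rw [← rpow_intCast, ← rpow_mul (by norm_num)] at this
    rw [← rpow_mul (by norm_num)]
    convert this using 2; push_cast; ring
  have h2 : ‖f x‖ ^ (2 : ℝ) = ‖f x‖ ^ (2 / 3 : ℝ) * ‖f x‖ ^ (4 / 3 : ℝ) := by
    rw [← rpow_add h0]; norm_num
  rw [h2]
  gcongr

lemma tsum_lvl_le {f : X → ℂ} (hf : Measurable f) :
    ∑' j, ∫⁻ x in lvl f j, ‖f x‖ₑ ^ (4 / 3 : ℝ) ∂μ ≤ ∫⁻ x, ‖f x‖ₑ ^ (4 / 3 : ℝ) ∂μ := by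
  rw [← lintegral_iUnion (fun j => measurableSet_lvl hf j)
    (fun i j hij => Set.disjoint_left.2 fun x hi hj => hij (lvl_unique hi hj))]
  exact setLIntegral_le_lintegral _ _

variable [SFinite μ]

lemma interp_piece {k : X × X → ℂ} {A : ℝ} (hA0 : 0 < A) (hA : ∀ p, ‖k p‖ ≤ A)
    (hL2 : ∀ f g : X → ℂ, Integrable f μ → Integrable g μ → MemLp f 2 μ → MemLp g 2 μ →
      ‖∫ p, k p * (f p.2 * g p.1) ∂(μ.prod μ)‖ₑ ≤ eLpNorm f 2 μ * eLpNorm g 2 μ)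
    {f g : X → ℂ} (hfm : Measurable f) (hgm : Measurable g)
    (hf : Integrable f μ) (hg : Integrable g μ) (hf2 : MemLp f 2 μ) (hg2 : MemLp g 2 μ)
    (hf1 : ∫⁻ x, ‖f x‖ₑ ^ (4 / 3 : ℝ) ∂μ ≤ 1) (hg1 : ∫⁻ x, ‖g x‖ₑ ^ (4 / 3 : ℝ) ∂μ ≤ 1) (i j : ℤ) :
    ‖∫ p in (lvl g j) ×ˢ (lvl f i), k p * (f p.2 * g p.1) ∂(μ.prod μ)‖ₑ ≤
      ofReal (min (A * 2 ^ (-((i + j : ℤ) : ℝ) / 3)) (2 ^ ((((i + j : ℤ) : ℝ) + 2) / 3))) *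
      ((∫⁻ x in lvl f i, ‖f x‖ₑ ^ (4 / 3 : ℝ) ∂μ) + ∫⁻ x in lvl g j, ‖g x‖ₑ ^ (4 / 3 : ℝ) ∂μ) := by
  set a := ∫⁻ x in lvl f i, ‖f x‖ₑ ^ (4 / 3 : ℝ) ∂μ with ha
  set b := ∫⁻ x in lvl g j, ‖g x‖ₑ ^ (4 / 3 : ℝ) ∂μ with hb
  have ha1 : a ≤ 1 := (setLIntegral_le_lintegral _ _).trans hf1
  have hb1 : b ≤ 1 := (setLIntegral_le_lintegral _ _).trans hg1
  have hmi := measurableSet_lvl hfm i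
  have hmj := measurableSet_lvl hgm j
  let fi := (lvl f i).indicator f
  let gj := (lvl g j).indicator g
  have e1 : ∫ p in (lvl g j) ×ˢ (lvl f i), k p * (f p.2 * g p.1) ∂(μ.prod μ) =
      ∫ p, k p * (fi p.2 * gj p.1) ∂(μ.prod μ) := by
    rw [← integral_indicator (hmj.prod hmi)]
    congr 1; ext p
    by_cases h1 : p.2 ∈ lvl f i <;> by_cases h2 : p.1 ∈ lvl g j <;>
      simp [fi, gj, h1, h2, Set.indicator, Set.mem_prod]
  have b1 : ‖∫ p, k p * (fi p.2 * gj p.1) ∂(μ.prod μ)‖ₑ ≤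
      ofReal (A * 2 ^ (-((i + j : ℤ) : ℝ) / 3)) * (a + b) := by
    calc _ ≤ ∫⁻ p, ‖k p * (fi p.2 * gj p.1)‖ₑ ∂(μ.prod μ) := enorm_integral_le_lintegral_enorm _
      _ ≤ ∫⁻ p, ofReal A * (‖gj p.1‖ₑ * ‖fi p.2‖ₑ) ∂(μ.prod μ) := by
          refine lintegral_mono fun p => ?_
          rw [enorm_mul, enorm_mul, mul_comm ‖fi _‖ₑ]
          gcongr
          rw [← ofReal_norm]
          exact ofReal_le_ofReal (hA p)
      _ = ofReal A * ((∫⁻ x, ‖gj x‖ₑ ∂μ) * ∫⁻ x, ‖fi x‖ₑ ∂μ) := by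
          have m1 : Measurable gj := hgm.indicator hmj
          have m2 : Measurable fi := hfm.indicator hmi
          have m3 : Measurable fun x => ‖gj x‖ₑ := m1.enorm
          have m4 : Measurable fun x => ‖fi x‖ₑ := m2.enorm
          have m5 : Measurable fun p : X × X => ‖gj p.1‖ₑ * ‖fi p.2‖ₑ :=
            (m3.comp measurable_fst).mul (m4.comp measurable_snd)
          rw [lintegral_const_mul _ m5]
          exact congrArg _ (lintegral_prod_mul (μ := μ) (ν := μ) m3.aemeasurable m4.aemeasurable)
      _ ≤ ofReal A * ((ofReal (2 ^ (-(j : ℝ) / 3)) * b) *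
            (ofReal (2 ^ (-(i : ℝ) / 3)) * a)) := by
          have i1 : ∫⁻ x, ‖gj x‖ₑ ∂μ = ∫⁻ x in lvl g j, ‖g x‖ₑ ∂μ := by
            rw [← lintegral_indicator hmj]; simp only [gj, enorm_indicator_eq_indicator_enorm]
          have i2 : ∫⁻ x, ‖fi x‖ₑ ∂μ = ∫⁻ x in lvl f i, ‖f x‖ₑ ∂μ := by
            rw [← lintegral_indicator hmi]; simp only [fi, enorm_indicator_eq_indicator_enorm]
          rw [i1, i2]
          gcongr
          · exact lvl_l1 hgm j
          · exact lvl_l1 hfm i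
      _ = ofReal (A * 2 ^ (-((i + j : ℤ) : ℝ) / 3)) * (a * b) := by
          have : (2 : ℝ) ^ (-((i + j : ℤ) : ℝ) / 3) = 2 ^ (-(j : ℝ) / 3) * 2 ^ (-(i : ℝ) / 3) := by
            rw [← rpow_add (by norm_num)]; congr 1; push_cast; ring
          rw [this, ofReal_mul hA0.le, ofReal_mul (by positivity)]
          ring
      _ ≤ _ := by
          gcongr
          calc a * b ≤ a * 1 := by gcongr
            _ ≤ a + b := by rw [mul_one]; exact le_self_add
  have b2 : ‖∫ p, k p * (fi p.2 * gj p.1) ∂(μ.prod μ)‖ₑ ≤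
      ofReal (2 ^ ((((i + j : ℤ) : ℝ) + 2) / 3)) * (a + b) := by
    have n1 : eLpNorm fi 2 μ ≤ ofReal (2 ^ (((i : ℝ) + 1) / 3)) * a ^ (1 / 2 : ℝ) := by
      rw [eLpNorm_indicator_eq_eLpNorm_restrict hmi, eLpNorm_eq_lintegral_rpow_enorm_toReal
        (by norm_num) (by norm_num)]
      simp only [ENNReal.toReal_ofNat]
      refine (ENNReal.rpow_le_rpow (lvl_l2 hfm i) (by norm_num)).trans_eq ?_
      rw [mul_rpow_of_nonneg _ _ (by norm_num), ← ENNReal.rpow_mul]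
      norm_num [ha, hb]
    have n2 : eLpNorm gj 2 μ ≤ ofReal (2 ^ (((j : ℝ) + 1) / 3)) * b ^ (1 / 2 : ℝ) := by
      rw [eLpNorm_indicator_eq_eLpNorm_restrict hmj, eLpNorm_eq_lintegral_rpow_enorm_toReal
        (by norm_num) (by norm_num)]
      simp only [ENNReal.toReal_ofNat]
      refine (ENNReal.rpow_le_rpow (lvl_l2 hgm j) (by norm_num)).trans_eq ?_
      rw [mul_rpow_of_nonneg _ _ (by norm_num), ← ENNReal.rpow_mul]
      norm_num [ha, hb]
    calc _ ≤ eLpNorm fi 2 μ * eLpNorm gj 2 μ := hL2 fi gj (hf.indicator hmi) (hg.indicator hmj)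
          (hf2.indicator hmi) (hg2.indicator hmj)
      _ ≤ (ofReal (2 ^ (((i : ℝ) + 1) / 3)) * a ^ (1 / 2 : ℝ)) *
            (ofReal (2 ^ (((j : ℝ) + 1) / 3)) * b ^ (1 / 2 : ℝ)) := by gcongr
      _ = ofReal (2 ^ ((((i + j : ℤ) : ℝ) + 2) / 3)) *
            (a ^ (1 / 2 : ℝ) * b ^ (1 / 2 : ℝ)) := by
          have : (2 : ℝ) ^ ((((i + j : ℤ) : ℝ) + 2) / 3) =
              2 ^ (((i : ℝ) + 1) / 3) * 2 ^ (((j : ℝ) + 1) / 3) := by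
            rw [← rpow_add (by norm_num)]; congr 1; push_cast; ring
          rw [this, ofReal_mul (by positivity)]
          ring
      _ ≤ _ := by
          gcongr
          have h : ∀ c d : ℝ≥0∞, c ≤ d → c ^ (1 / 2 : ℝ) * d ^ (1 / 2 : ℝ) ≤ d := fun c d h => by
            calc _ ≤ d ^ (1 / 2 : ℝ) * d ^ (1 / 2 : ℝ) := by gcongr
              _ = d := by rw [← ENNReal.rpow_add_of_nonneg _ _ (by norm_num) (by norm_num)]; norm_num
          rcases le_total a b with hab | hab
          · exact (h a b hab).trans le_add_self
          · rw [mul_comm]; exact (h b a hab).trans le_self_add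
  rw [e1]
  rcases min_choice (A * 2 ^ (-((i + j : ℤ) : ℝ) / 3)) (2 ^ ((((i + j : ℤ) : ℝ) + 2) / 3))
    with h | h <;> rw [h] <;> assumption

lemma interp_normalized : ∃ C : ℝ, 0 ≤ C ∧ ∀ {X : Type} [MeasurableSpace X] {μ : Measure X}
    [SFinite μ] {k : X × X → ℂ} {A : ℝ} (_ : Measurable k) (_ : 0 < A) (_ : ∀ p, ‖k p‖ ≤ A)
    (_ : ∀ f g : X → ℂ, Integrable f μ → Integrable g μ → MemLp f 2 μ → MemLp g 2 μ →
      ‖∫ p, k p * (f p.2 * g p.1) ∂(μ.prod μ)‖ₑ ≤ eLpNorm f 2 μ * eLpNorm g 2 μ)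
    {f g : X → ℂ} (_ : Measurable f) (_ : Measurable g)
    (_ : Integrable f μ) (_ : Integrable g μ) (_ : MemLp f 2 μ) (_ : MemLp g 2 μ)
    (_ : ∫⁻ x, ‖f x‖ₑ ^ (4 / 3 : ℝ) ∂μ ≤ 1) (_ : ∫⁻ x, ‖g x‖ₑ ^ (4 / 3 : ℝ) ∂μ ≤ 1),
    ‖∫ p, k p * (f p.2 * g p.1) ∂(μ.prod μ)‖ₑ ≤ ofReal (C * √A) := by
  obtain ⟨S, hS, hSb⟩ := exists_tsum_geom_int
  refine ⟨8 * S.toReal, by positivity, ?_⟩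
  intro X _ μ _ k A hk hA0 hA hL2 f g hfm hgm hf hg hf2 hg2 hf1 hg1
  obtain ⟨L, hL⟩ := min_geom_le hA0
  have hFi : Integrable (fun p : X × X => k p * (f p.2 * g p.1)) (μ.prod μ) := by
    have h1 : Integrable (fun p : X × X => f p.2 * g p.1) (μ.prod μ) := by
      simpa [mul_comm] using hg.mul_prod hf
    exact h1.bdd_mul hk.aestronglyMeasurable (ae_of_all _ hA)
  let s : ℤ × ℤ → Set (X × X) := fun q => (lvl g q.2) ×ˢ (lvl f q.1)
  have hsum := hasSum_integral_iUnion (μ := μ.prod μ) (s := s)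
    (f := fun p : X × X => k p * (f p.2 * g p.1))
    (fun q => (measurableSet_lvl hgm _).prod (measurableSet_lvl hfm _))
    (fun q q' hq => Set.disjoint_left.2 fun p hp hp' => hq (Prod.ext
      (lvl_unique hp.2 hp'.2) (lvl_unique hp.1 hp'.1))) hFi.integrableOn
  have hU : ∫ p in ⋃ q, s q, k p * (f p.2 * g p.1) ∂(μ.prod μ) =
      ∫ p, k p * (f p.2 * g p.1) ∂(μ.prod μ) := by
    refine setIntegral_eq_integral_of_forall_compl_eq_zero fun p hp => ?_
    by_contra h
    obtain ⟨i, hi⟩ := exists_mem_lvl (f := f) (x := p.2) (fun h0 => h (by simp [h0]))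
    obtain ⟨j, hj⟩ := exists_mem_lvl (f := g) (x := p.1) (fun h0 => h (by simp [h0]))
    exact hp (Set.mem_iUnion.2 ⟨(i, j), ⟨hj, hi⟩⟩)
  rw [← hU, ← hsum.tsum_eq]
  set a : ℤ → ℝ≥0∞ := fun i => ∫⁻ x in lvl f i, ‖f x‖ₑ ^ (4 / 3 : ℝ) ∂μ
  set b : ℤ → ℝ≥0∞ := fun i => ∫⁻ x in lvl g i, ‖g x‖ₑ ^ (4 / 3 : ℝ) ∂μ
  set c : ℤ → ℝ≥0∞ := fun l => ofReal (min (A * 2 ^ (-(l : ℝ) / 3)) (2 ^ (((l : ℝ) + 2) / 3)))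
  have ha : ∑' i, a i ≤ 1 := (tsum_lvl_le hfm).trans hf1
  have hb : ∑' i, b i ≤ 1 := (tsum_lvl_le hgm).trans hg1
  have hc : ∑' l, c l ≤ ofReal (4 * √A) * S := by
    calc ∑' l, c l ≤ ∑' l : ℤ, ofReal (4 * √A) *
          ofReal ((2 : ℝ) ^ (-(|((l - L : ℤ) : ℝ)| / 3))) := by
          refine ENNReal.tsum_le_tsum fun l => ?_
          rw [← ofReal_mul (by positivity)]
          exact ofReal_le_ofReal (hL l)
      _ ≤ _ := by rw [ENNReal.tsum_mul_left]; gcongr; exact hSb L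
  calc _ ≤ ∑' q : ℤ × ℤ, ‖∫ p in s q, k p * (f p.2 * g p.1) ∂(μ.prod μ)‖ₑ :=
        enorm_tsum_le_tsum_enorm
    _ ≤ ∑' q : ℤ × ℤ, c (q.1 + q.2) * (a q.1 + b q.2) :=
        ENNReal.tsum_le_tsum fun q => interp_piece hA0 hA hL2 hfm hgm hf hg hf2 hg2 hf1 hg1 q.1 q.2
    _ = (∑' i, a i * ∑' j, c (i + j)) + ∑' j, b j * ∑' i, c (i + j) := by
        simp_rw [mul_add]
        rw [ENNReal.tsum_add, ENNReal.tsum_prod', ENNReal.tsum_prod', ENNReal.tsum_comm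
          (f := fun i j => c (i + j) * b j)]
        simp_rw [ENNReal.tsum_mul_right, mul_comm]
    _ = (∑' i, a i) * (∑' l, c l) + (∑' i, b i) * ∑' l, c l := by
        have e1 : ∀ i, ∑' j, c (i + j) = ∑' l, c l := fun i => (Equiv.addLeft i).tsum_eq c
        have e2 : ∀ j, ∑' i, c (i + j) = ∑' l, c l := fun j => (Equiv.addRight j).tsum_eq c
        simp_rw [e1, e2, ENNReal.tsum_mul_right]
    _ ≤ 1 * (ofReal (4 * √A) * S) + 1 * (ofReal (4 * √A) * S) := by gcongr
    _ = _ := by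
        have : 8 * S.toReal * √A = (4 * √A + 4 * √A) * S.toReal := by ring
        rw [this, ofReal_mul (p := 4 * √A + 4 * √A) (by positivity),
          ofReal_add (by positivity) (by positivity), ofReal_toReal hS]
        ring

end Interp

lemma fourier_toLp_ae_eq {f : Rn n → ℂ} (hf : Integrable f) (hf2 : MemLp f 2) :
    (𝓕 (hf2.toLp f) : Lp ℂ 2 (volume : Measure (Rn n))) =ᵐ[volume] 𝓕 f := by
  set F : Lp ℂ 2 (volume : Measure (Rn n)) := 𝓕 (hf2.toLp f)
  have hc : Continuous (𝓕 f) :=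
    VectorFourier.fourierIntegral_continuous continuous_fourierChar (by exact continuous_inner) hf
  refine ae_eq_of_integral_contDiff_smul_eq ((Lp.memLp F).locallyIntegrable (by norm_num))
    hc.locallyIntegrable fun g hg hgc => ?_
  have hgc' : HasCompactSupport fun x => (g x : ℂ) := hgc.comp_left (g := fun r : ℝ => (r : ℂ)) (by simp)
  have hg' : ContDiff ℝ (⊤ : ℕ∞) fun x => (g x : ℂ) := Complex.ofRealCLM.contDiff.comp hg
  let φ : Sch n := hgc'.toSchwartzMap hg'
  have h1 := congrArg (fun T => T φ) (Lp.fourier_toTemperedDistribution_eq (hf2.toLp f))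
  simp only [TemperedDistribution.fourier_apply, Lp.toTemperedDistribution_apply] at h1
  have h2 : ∫ x, g x • F x = ∫ x, φ x • F x := by
    refine integral_congr_ae (ae_of_all _ fun x => ?_); simp [φ]
  rw [h2, ← h1]
  have h3 := VectorFourier.integral_fourierIntegral_smul_eq_flip (μ := volume) (ν := volume)
    (L := innerₗ (Rn n)) (f := φ) (g := f) continuous_fourierChar
    (by exact continuous_inner) φ.integrable hf
  have h4 : ∫ x, (𝓕 φ : Sch n) x • (hf2.toLp f) x = ∫ x, (𝓕 φ : Sch n) x • f x := by
    refine integral_congr_ae ?_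
    filter_upwards [hf2.coeFn_toLp] with x hx; rw [hx]
  rw [h4]
  have h5 : ∫ x, g x • 𝓕 f x = ∫ x, φ x • 𝓕 f x := by
    refine integral_congr_ae (ae_of_all _ fun x => ?_); simp [φ]
  rw [h5]
  simp_rw [fourier_coe]
  have e : (innerₗ (Rn n)).flip = innerₗ (Rn n) := by ext; simp
  rw [e] at h3
  exact h3

lemma eLpNorm_fourier_le {f : Rn n → ℂ} (hf : Integrable f) (hf2 : MemLp f 2) :
    eLpNorm (𝓕 f) 2 volume = eLpNorm f 2 volume := by
  rw [← eLpNorm_congr_ae (fourier_toLp_ae_eq hf hf2)]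
  have := Lp.norm_fourier_eq (hf2.toLp f)
  rw [Lp.norm_def, Lp.norm_def, ENNReal.toReal_eq_toReal_iff' (Lp.eLpNorm_ne_top _)
    (Lp.eLpNorm_ne_top _)] at this
  rw [this, eLpNorm_congr_ae hf2.coeFn_toLp]

lemma eLpNorm_fourierInv_le {f : Rn n → ℂ} (hf : Integrable f) (hf2 : MemLp f 2) :
    eLpNorm (𝓕⁻ f) 2 volume = eLpNorm f 2 volume := by
  have e : 𝓕⁻ f = 𝓕 f ∘ (fun x => -x) := by
    ext x; rw [fourierInv_eq_fourier_neg]; rfl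
  have hm : AEStronglyMeasurable (𝓕 f) (volume : Measure (Rn n)) :=
    (VectorFourier.fourierIntegral_continuous continuous_fourierChar
      (by exact continuous_inner) hf).aestronglyMeasurable
  rw [e, eLpNorm_comp_measurePreserving hm (Measure.measurePreserving_neg volume),
    eLpNorm_fourier_le hf hf2]

/-- kernel form of a Fourier multiplier pairing -/
lemma integral_kernel_eq {q f g : Rn n → ℂ} (hq : Integrable q) (hf : Integrable f)
    (hg : Integrable g) :
    ∫ p : Rn n × Rn n, 𝓕⁻ q (p.1 - p.2) * (f p.2 * g p.1) =
      ∫ ξ, q ξ * (𝓕⁻ g ξ * 𝓕 f ξ) := by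
  have hgf : Integrable (fun p : Rn n × Rn n => f p.2 * g p.1) := by
    simpa [mul_comm, Measure.volume_eq_prod] using hg.mul_prod hf
  have e1 : ∀ p : Rn n × Rn n, 𝓕⁻ q (p.1 - p.2) * (f p.2 * g p.1) =
      ∫ ξ, (fourierChar (inner ℝ ξ (p.1 - p.2)) : ℂ) * (q ξ * (f p.2 * g p.1)) := fun p => by
    rw [fourierInv_eq, ← integral_mul_const]
    congr 1; ext ξ; rw [Circle.smul_def]; simp [mul_assoc]
  simp_rw [e1]
  rw [integral_integral_swap]
  · refine integral_congr_ae (ae_of_all _ fun ξ => ?_)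
    simp only
    rw [fourierInv_eq, fourier_eq, ← integral_prod_mul, ← integral_const_mul]
    refine integral_congr_ae (ae_of_all _ fun p => ?_)
    simp only [Circle.smul_def, smul_eq_mul]
    rw [inner_sub_right, sub_eq_add_neg, AddChar.map_add_eq_mul, real_inner_comm p.1,
      real_inner_comm p.2]
    push_cast
    ring
  · have h1 : Integrable (fun z : (Rn n × Rn n) × Rn n => (f z.1.2 * g z.1.1) * q z.2)
      (volume.prod volume) := hgf.mul_prod hq
    have h2 : Integrable (fun z : (Rn n × Rn n) × Rn n =>
        (fourierChar (inner ℝ z.2 (z.1.1 - z.1.2)) : ℂ) * ((f z.1.2 * g z.1.1) * q z.2))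
        (volume.prod volume) := by
      refine h1.bdd_mul (c := 1) ?_ (ae_of_all _ fun z => (Circle.norm_coe _).le)
      refine Continuous.aestronglyMeasurable ?_
      have := continuous_fourierChar
      fun_prop
    refine h2.congr (ae_of_all _ fun z => ?_)
    simp only [Function.uncurry]
    ring

lemma eLpNorm_four_thirds {X : Type*} [MeasurableSpace X] {μ : Measure X} (f : X → ℂ) :
    eLpNorm f (4 / 3) μ = (∫⁻ x, ‖f x‖ₑ ^ (4 / 3 : ℝ) ∂μ) ^ (3 / 4 : ℝ) := by
  have h : (4 / 3 : ℝ≥0∞) ≠ 0 := by simp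
  have h' : (4 / 3 : ℝ≥0∞) ≠ ∞ := ENNReal.div_ne_top (by norm_num) (by norm_num)
  rw [eLpNorm_eq_lintegral_rpow_enorm_toReal h h']
  have : (4 / 3 : ℝ≥0∞).toReal = 4 / 3 := by simp
  rw [this]; norm_num

lemma interp_four_thirds : ∃ C : ℝ, 0 ≤ C ∧ ∀ {X : Type} [MeasurableSpace X] {μ : Measure X}
    [SFinite μ] {k : X × X → ℂ} {A : ℝ} (_ : Measurable k) (_ : 0 < A) (_ : ∀ p, ‖k p‖ ≤ A)
    (_ : ∀ f g : X → ℂ, Integrable f μ → Integrable g μ → MemLp f 2 μ → MemLp g 2 μ →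
      ‖∫ p, k p * (f p.2 * g p.1) ∂(μ.prod μ)‖ₑ ≤ eLpNorm f 2 μ * eLpNorm g 2 μ)
    {f g : X → ℂ} (_ : Measurable f) (_ : Measurable g)
    (_ : Integrable f μ) (_ : Integrable g μ) (_ : MemLp f 2 μ) (_ : MemLp g 2 μ)
    (_ : MemLp f (4 / 3) μ) (_ : MemLp g (4 / 3) μ),
    ‖∫ p, k p * (f p.2 * g p.1) ∂(μ.prod μ)‖ₑ ≤
      ofReal (C * √A) * (eLpNorm f (4 / 3) μ * eLpNorm g (4 / 3) μ) := by
  obtain ⟨C, hC, H⟩ := interp_normalized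
  refine ⟨C, hC, ?_⟩
  intro X _ μ _ k A hk hA0 hA hL2 f g hfm hgm hf hg hf2 hg2 hf4 hg4
  have hp0 : (4 / 3 : ℝ≥0∞) ≠ 0 := by simp
  by_cases hf0 : eLpNorm f (4 / 3) μ = 0
  · have h := (eLpNorm_eq_zero_iff hf.aestronglyMeasurable hp0).1 hf0
    have h2 : ∀ᵐ p ∂(μ.prod μ), k p * (f p.2 * g p.1) = 0 := by
      filter_upwards [Measure.quasiMeasurePreserving_snd.ae h] with p hp
      simp [hp]
    rw [integral_eq_zero_of_ae h2]; simp
  by_cases hg0 : eLpNorm g (4 / 3) μ = 0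
  · have h := (eLpNorm_eq_zero_iff hg.aestronglyMeasurable hp0).1 hg0
    have h2 : ∀ᵐ p ∂(μ.prod μ), k p * (f p.2 * g p.1) = 0 := by
      filter_upwards [Measure.quasiMeasurePreserving_fst.ae h] with p hp
      simp [hp]
    rw [integral_eq_zero_of_ae h2]; simp
  set a := (eLpNorm f (4 / 3) μ).toReal with ha
  set b := (eLpNorm g (4 / 3) μ).toReal with hb
  have ha0 : 0 < a := ENNReal.toReal_pos hf0 hf4.2.ne
  have hb0 : 0 < b := ENNReal.toReal_pos hg0 hg4.2.ne
  have key : ∀ {h : X → ℂ} {c : ℝ}, MemLp h (4 / 3) μ → c = (eLpNorm h (4 / 3) μ).toReal → 0 < c →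
      ∫⁻ x, ‖((c⁻¹ : ℝ) : ℂ) * h x‖ₑ ^ (4 / 3 : ℝ) ∂μ ≤ 1 := by
    intro h c hh hc hc0
    have h1 : eLpNorm (fun x => ((c⁻¹ : ℝ) : ℂ) * h x) (4 / 3) μ = 1 := by
      have := eLpNorm_const_smul ((c⁻¹ : ℝ) : ℂ) h (4 / 3) μ
      simp only [Pi.smul_def, smul_eq_mul] at this
      rw [this, ← ofReal_toReal hh.2.ne, ← hc, ← ofReal_norm, ← ofReal_mul (by positivity)]
      simp [abs_of_pos hc0, hc0.ne']
    rw [eLpNorm_four_thirds] at h1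
    have h2 := congrArg (fun z => z ^ (4 / 3 : ℝ)) h1
    simp only [← ENNReal.rpow_mul] at h2
    norm_num at h2
    push_cast
    simp_rw [enorm_mul]
    exact h2.le
  have := H hk hA0 hA hL2 (f := fun x => ((a⁻¹ : ℝ) : ℂ) * f x) (g := fun x => ((b⁻¹ : ℝ) : ℂ) * g x)
    (hfm.const_mul _) (hgm.const_mul _) (hf.const_mul _) (hg.const_mul _) (hf2.const_mul _)
    (hg2.const_mul _) (key hf4 ha ha0) (key hg4 hb hb0)
  have e : ∫ p, k p * (f p.2 * g p.1) ∂(μ.prod μ) = ((a * b : ℝ) : ℂ) *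
      ∫ p, k p * (((a⁻¹ : ℝ) : ℂ) * f p.2 * (((b⁻¹ : ℝ) : ℂ) * g p.1)) ∂(μ.prod μ) := by
    rw [← integral_const_mul]
    congr 1; ext p
    have : (a : ℂ) ≠ 0 := by exact_mod_cast ha0.ne'
    have : (b : ℂ) ≠ 0 := by exact_mod_cast hb0.ne'
    push_cast; field_simp
  rw [e, enorm_mul, mul_comm]
  refine mul_le_mul' this (le_of_eq ?_)
  rw [← ofReal_norm, norm_real, norm_of_nonneg (by positivity),
    ofReal_mul ha0.le, ofReal_toReal hf4.2.ne, ofReal_toReal hg4.2.ne]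

/-- frequency symbol of the free flow -/
def om (ξ : Rn n) : ℝ := (2 * π * ‖ξ‖) ^ 4

lemma om_eq (ξ : Rn n) : om ξ = (2 * π) ^ 4 * (‖ξ‖ ^ 2) ^ 2 := by unfold om; ring

lemma contDiff_om : ContDiff ℝ (⊤ : ℕ∞) (om (n := n)) := by
  have : (om (n := n)) = fun ξ => (2 * π) ^ 4 * (‖ξ‖ ^ 2) ^ 2 := funext om_eq
  rw [this]
  exact contDiff_const.mul ((contDiff_norm_sq ℝ).pow 2)

/-- localized symbol of the free flow -/
def qsym (a : Rn n → ℂ) (K τ : ℝ) (ξ : Rn n) : ℂ := Complex.exp (I * (τ * om ξ : ℝ)) * a (K⁻¹ • ξ)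

lemma norm_qsym (a : Rn n → ℂ) (K τ : ℝ) (ξ : Rn n) : ‖qsym a K τ ξ‖ = ‖a (K⁻¹ • ξ)‖ := by
  rw [qsym, norm_mul, mul_comm I, norm_exp_ofReal_mul_I, one_mul]

lemma dispersive_scaled (hn : 5 ≤ n) {a : Rn n → ℂ} {r R : ℝ} (ha : ContDiff ℝ (⊤ : ℕ∞) a) (hr : 0 < r)
    (h0 : ∀ ξ, ‖ξ‖ < r → a ξ = 0) (hR : ∀ ξ, R < ‖ξ‖ → a ξ = 0) :
    ∃ C, 0 < C ∧ ∀ (K τ : ℝ), 0 < K → ∀ z : Rn n,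
      ‖𝓕⁻ (qsym a K τ) z‖ ≤ C * (K ^ n * (1 + K ^ 4 * |τ|) ^ (-(9 / 4) : ℝ)) := by
  obtain ⟨C, hC, H⟩ := dispersive_unit hn ha hr h0 hR
  refine ⟨C + 1, by positivity, fun K τ hK z => ?_⟩
  have e : 𝓕⁻ (qsym a K τ) z = (K ^ n : ℝ) • ∫ η, Complex.exp (I *
      ((τ * (2 * π * K) ^ 4 : ℝ) * ‖η‖ ^ 4 + inner ℝ η ((2 * π * K) • z) : ℝ)) * a η := by
    have := Measure.integral_comp_inv_smul_of_nonneg (μ := (volume : Measure (Rn n)))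
      (fun η => Complex.exp (I *
      ((τ * (2 * π * K) ^ 4 : ℝ) * ‖η‖ ^ 4 + inner ℝ η ((2 * π * K) • z) : ℝ)) * a η) hK.le
    rw [finrank_euclideanSpace_fin] at this
    rw [← this, fourierInv_eq']
    congr 1; ext ξ
    rw [qsym, smul_eq_mul, ← mul_assoc, ← Complex.exp_add]
    congr 2
    rw [mul_comm _ I, ← mul_add, ← Complex.ofReal_add]
    congr 2
    rw [norm_smul, norm_of_nonneg (by positivity), real_inner_smul_left, real_inner_smul_right, om]
    field_simp
    ring
  rw [e, norm_smul, norm_of_nonneg (by positivity)]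
  have h1 := H (τ * (2 * π * K) ^ 4) ((2 * π * K) • z)
  have h2 : (1 + |τ * (2 * π * K) ^ 4|) ^ (-(9 / 4) : ℝ) ≤ (1 + K ^ 4 * |τ|) ^ (-(9 / 4) : ℝ) := by
    refine rpow_le_rpow_of_nonpos (by positivity) ?_ (by norm_num)
    rw [abs_mul, abs_of_nonneg (by positivity : (0 : ℝ) ≤ (2 * π * K) ^ 4), mul_comm (K ^ 4)]
    have : K ^ 4 ≤ (2 * π * K) ^ 4 := by
      gcongr; nlinarith [pi_gt_three]
    gcongr
  calc _ ≤ K ^ n * (C * (1 + K ^ 4 * |τ|) ^ (-(9 / 4) : ℝ)) := by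
        gcongr; exact h1.trans (by gcongr)
    _ ≤ K ^ n * ((C + 1) * (1 + K ^ 4 * |τ|) ^ (-(9 / 4) : ℝ)) := by gcongr; linarith
    _ = _ := by ring

lemma ttstar_bilin (hn : 5 ≤ n) {a : Rn n → ℂ} {r R : ℝ} (ha : ContDiff ℝ (⊤ : ℕ∞) a) (hr : 0 < r)
    (h0 : ∀ ξ, ‖ξ‖ < r → a ξ = 0) (hR : ∀ ξ, R < ‖ξ‖ → a ξ = 0) (ha1 : ∀ ξ, ‖a ξ‖ ≤ 1) :
    ∃ C, 0 < C ∧ ∀ (K τ : ℝ), 0 < K → ∀ f g : Sch n,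
      ‖∫ ξ, qsym a K τ ξ * (𝓕⁻ g ξ * 𝓕 f ξ)‖ₑ ≤
        ofReal (C * √(K ^ n * (1 + K ^ 4 * |τ|) ^ (-(9 / 4) : ℝ))) *
          (eLpNorm f (4 / 3) * eLpNorm g (4 / 3)) := by
  obtain ⟨C1, hC1, H1⟩ := dispersive_scaled hn ha hr h0 hR
  obtain ⟨C2, hC2, H2⟩ := interp_four_thirds
  refine ⟨(C2 + 1) * √C1, by positivity, fun K τ hK f g => ?_⟩
  have hq : Continuous (qsym a K τ) := by
    unfold qsym
    have := contDiff_om (n := n).continuous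
    have := ha.continuous
    fun_prop
  have hqc : HasCompactSupport (qsym a K τ) := by
    refine HasCompactSupport.intro (isCompact_closedBall 0 (K * R)) fun ξ hξ => ?_
    rw [Metric.mem_closedBall, dist_zero_right, not_le] at hξ
    rw [qsym, hR, mul_zero]
    rw [norm_smul, norm_inv, norm_of_nonneg hK.le, inv_mul_eq_div, lt_div_iff₀ hK]
    linarith
  have hqi := hq.integrable_of_hasCompactSupport hqc (μ := volume)
  have hker : Continuous (𝓕⁻ (qsym a K τ)) := by
    have : 𝓕⁻ (qsym a K τ) = 𝓕 (qsym a K τ) ∘ (fun x => -x) := by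
      ext x; rw [fourierInv_eq_fourier_neg]; rfl
    rw [this]
    exact (VectorFourier.fourierIntegral_continuous continuous_fourierChar
      (by exact continuous_inner) hqi).comp continuous_neg
  set A := C1 * (K ^ n * (1 + K ^ 4 * |τ|) ^ (-(9 / 4) : ℝ)) with hA
  have hA0 : 0 < A := by positivity
  have hk2 : ∀ f g : Rn n → ℂ, Integrable f → Integrable g → MemLp f 2 → MemLp g 2 →
      ‖∫ p : Rn n × Rn n, 𝓕⁻ (qsym a K τ) (p.1 - p.2) * (f p.2 * g p.1) ∂(volume.prod volume)‖ₑ ≤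
      eLpNorm f 2 * eLpNorm g 2 := by
    intro f g hf hg hf2 hg2
    have := integral_kernel_eq hqi hf hg
    rw [Measure.volume_eq_prod] at this
    rw [this, ← eLpNorm_fourier_le hf hf2, ← eLpNorm_fourierInv_le hg hg2]
    have hm1 : AEStronglyMeasurable (𝓕 f) (volume : Measure (Rn n)) :=
      (VectorFourier.fourierIntegral_continuous continuous_fourierChar
        (by exact continuous_inner) hf).aestronglyMeasurable
    have hm2 : AEStronglyMeasurable (𝓕⁻ g) (volume : Measure (Rn n)) := by
      have : 𝓕⁻ g = 𝓕 g ∘ (fun x => -x) := by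
        ext x; rw [fourierInv_eq_fourier_neg]; rfl
      rw [this]
      exact ((VectorFourier.fourierIntegral_continuous continuous_fourierChar
        (by exact continuous_inner) hg).comp continuous_neg).aestronglyMeasurable
    calc _ ≤ ∫⁻ ξ, ‖qsym a K τ ξ * (𝓕⁻ g ξ * 𝓕 f ξ)‖ₑ := enorm_integral_le_lintegral_enorm _
      _ ≤ ∫⁻ ξ, ‖𝓕 f ξ‖ₑ * ‖𝓕⁻ g ξ‖ₑ := by
          refine lintegral_mono fun ξ => ?_
          rw [enorm_mul, enorm_mul, mul_comm ‖𝓕 f ξ‖ₑ]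
          refine (mul_le_mul_left (a := ‖𝓕⁻ g ξ‖ₑ * ‖𝓕 f ξ‖ₑ) (c := 1) ?_).trans (one_mul _).le
          rw [← ofReal_norm, norm_qsym]
          exact ENNReal.ofReal_le_one.2 (ha1 _)
      _ ≤ _ := by
          have := lintegral_mul_le_Lp_mul_Lq volume (p := 2) (q := 2) (by constructor <;> norm_num)
            hm1.enorm hm2.enorm
          rw [eLpNorm_eq_lintegral_rpow_enorm_toReal (by norm_num) (by norm_num),
            eLpNorm_eq_lintegral_rpow_enorm_toReal (by norm_num) (by norm_num)]
          simpa using this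
  have h3 := H2 (X := Rn n) (μ := volume) (k := fun p => 𝓕⁻ (qsym a K τ) (p.1 - p.2)) (A := A)
    (hker.comp (by fun_prop)).measurable hA0 (fun p => H1 K τ hK _) hk2
    (f := f) (g := g) f.continuous.measurable g.continuous.measurable f.integrable g.integrable
    (f.memLp 2) (g.memLp 2) (f.memLp _) (g.memLp _)
  have h4 := integral_kernel_eq hqi f.integrable g.integrable
  rw [Measure.volume_eq_prod] at h4
  simp_rw [fourier_coe, fourierInv_coe]
  rw [← h4]
  refine h3.trans (mul_le_mul_left ?_ _)
  refine ofReal_le_ofReal ?_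
  calc C2 * √A = C2 * (√C1 * √(K ^ n * (1 + K ^ 4 * |τ|) ^ (-(9 / 4) : ℝ))) := by
        rw [hA, sqrt_mul hC1.le]
    _ ≤ (C2 + 1) * (√C1 * √(K ^ n * (1 + K ^ 4 * |τ|) ^ (-(9 / 4) : ℝ))) := by
        gcongr; linarith
    _ = _ := by ring

lemma ContinuousOn.exists_extend {E : Type*} [TopologicalSpace E] {a b : ℝ} (hab : a ≤ b) {g : ℝ → E}
    (hg : ContinuousOn g (Icc a b)) : ∃ g' : ℝ → E, Continuous g' ∧ Set.EqOn g' g (Icc a b) := by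
  refine ⟨Set.IccExtend hab ((Icc a b).domRestrict g), ?_, fun x hx => ?_⟩
  · exact (continuousOn_iff_continuous_domRestrict.1 hg).Icc_extend'
  · rw [Set.IccExtend_of_mem _ _ hx]; rfl

section TTstar
variable {H : Type*} [NormedAddCommGroup H] [InnerProductSpace ℂ H] [CompleteSpace H]

lemma ttstar_gamma {a b : ℝ} {g : ℝ → H} (hg : Continuous g) {c k : ℝ → ℝ}
    (hc : Continuous c) (hk : Continuous k) (hk0 : ∀ t, 0 ≤ k t)
    (hki : Integrable k) (hgk : ∀ t ∈ Icc a b, ∀ s ∈ Icc a b,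
      ‖inner ℂ (g t) (g s)‖ ≤ k (t - s) * (c t * c s)) {t : ℝ} (ht : t ∈ Icc a b) :
    ‖∫ s in t..b, g s‖ ≤ √((∫ s, k s) * ∫ s in a..b, c s ^ 2) := by
  apply le_sqrt_of_sq_le
  have hab : a ≤ b := ht.1.trans ht.2
  have e1 : (‖∫ s in t..b, g s‖ ^ 2 : ℝ) ≤ ∫ s in t..b, ∫ s' in t..b, ‖inner ℂ (g s) (g s')‖ := by
    have h1 : ‖∫ s in t..b, g s‖ ^ 2 = ‖inner ℂ (∫ s in t..b, g s) (∫ s in t..b, g s)‖ := by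
      rw [inner_self_eq_norm_sq_to_K]; simp
    have h2 : inner ℂ (∫ s in t..b, g s) (∫ s in t..b, g s)
        = ∫ s in t..b, inner ℂ (∫ s' in t..b, g s') (g s) := by
      have := ((innerSL ℂ (∫ s in t..b, g s)).intervalIntegral_comp_comm
        (hg.intervalIntegrable (μ := volume) t b))
      simpa using this.symm
    rw [h1, h2]
    refine (intervalIntegral.norm_integral_le_integral_norm ht.2).trans ?_
    have hcont : Continuous fun s => ∫ s' in t..b, ‖inner ℂ (g s) (g s')‖ :=
      continuous_parametric_intervalIntegral_of_continuous' (by fun_prop) _ _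
    refine integral_mono_on ht.2 ?_ (hcont.intervalIntegrable _ _) fun s hs => ?_
    · exact Continuous.intervalIntegrable (by fun_prop) _ _
    rw [norm_inner_symm]
    have h3 := ((innerSL ℂ (g s)).intervalIntegral_comp_comm
        (hg.intervalIntegrable (μ := volume) t b))
    have h4 : inner ℂ (g s) (∫ s' in t..b, g s') = ∫ s' in t..b, inner ℂ (g s) (g s') := by
      simpa using h3.symm
    rw [h4]
    exact intervalIntegral.norm_integral_le_integral_norm ht.2
  refine e1.trans ?_
  have e2 : ∀ s ∈ Icc t b, ∫ s' in t..b, ‖inner ℂ (g s) (g s')‖ ≤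
      ∫ s' in t..b, k (s - s') * ((c s ^ 2 + c s' ^ 2) / 2) := by
    intro s hs
    refine integral_mono_on ht.2 (Continuous.intervalIntegrable (by fun_prop) _ _)
      (Continuous.intervalIntegrable (by fun_prop) _ _) fun s' hs' => ?_
    refine (hgk s ⟨ht.1.trans hs.1, hs.2⟩ s' ⟨ht.1.trans hs'.1, hs'.2⟩).trans ?_
    exact mul_le_mul_of_nonneg_left (by nlinarith [sq_nonneg (c s - c s')]) (hk0 _)
  have kint : ∀ s, ∫ s' in t..b, k (s - s') ≤ ∫ s, k s := by
    intro s
    rw [integral_of_le ht.2]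
    have : ∫ s', k (s - s') = ∫ s, k s := integral_sub_left_eq_self k volume s
    rw [← this]
    exact setIntegral_le_integral (hki.comp_sub_left s) (Eventually.of_forall fun _ => hk0 _)
  have kint' : ∀ s', ∫ s in t..b, k (s - s') ≤ ∫ s, k s := by
    intro s
    rw [integral_of_le ht.2]
    have : ∫ s', k (s' - s) = ∫ s, k s := integral_sub_right_eq_self k s
    rw [← this]
    exact setIntegral_le_integral (hki.comp_sub_right s) (Eventually.of_forall fun _ => hk0 _)
  have hk1 : 0 ≤ ∫ s, k s := integral_nonneg hk0
  have i1 : Continuous fun s => ∫ s' in t..b, k (s - s') * ((c s ^ 2 + c s' ^ 2) / 2) :=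
    continuous_parametric_intervalIntegral_of_continuous' (by fun_prop) _ _
  have i2 : Continuous fun s => ∫ s' in t..b, k (s - s') :=
    continuous_parametric_intervalIntegral_of_continuous' (by fun_prop) _ _
  have i3 : Continuous fun s => ∫ s' in t..b, k (s - s') * c s' ^ 2 :=
    continuous_parametric_intervalIntegral_of_continuous' (by fun_prop) _ _
  have i4 : Continuous fun s => ∫ s' in t..b, k (s' - s) :=
    continuous_parametric_intervalIntegral_of_continuous' (by fun_prop) _ _
  have i0 : Continuous fun s => ∫ s' in t..b, ‖inner ℂ (g s) (g s')‖ :=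
    continuous_parametric_intervalIntegral_of_continuous' (by fun_prop) _ _
  have hP : ∫ s in t..b, c s ^ 2 ≤ ∫ s in a..b, c s ^ 2 := by
    rw [integral_of_le hab, integral_of_le ht.2]
    refine setIntegral_mono_set ?_ (Eventually.of_forall fun _ => sq_nonneg _)
      (Set.Ioc_subset_Ioc_left ht.1).eventuallyLE
    exact ((hc.pow 2).intervalIntegrable a b).1
  calc ∫ s in t..b, ∫ s' in t..b, ‖inner ℂ (g s) (g s')‖
      ≤ ∫ s in t..b, ∫ s' in t..b, k (s - s') * ((c s ^ 2 + c s' ^ 2) / 2) :=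
        integral_mono_on ht.2 (i0.intervalIntegrable _ _)
          (i1.intervalIntegrable _ _) e2
    _ = ∫ s in t..b, ((c s ^ 2 / 2) * (∫ s' in t..b, k (s - s')) +
          (1 / 2) * ∫ s' in t..b, k (s - s') * c s' ^ 2) := by
        congr 1; ext s
        rw [← intervalIntegral.integral_const_mul, ← intervalIntegral.integral_const_mul,
          ← intervalIntegral.integral_add (Continuous.intervalIntegrable (by fun_prop) _ _)
          (Continuous.intervalIntegrable (by fun_prop) _ _)]
        congr 1; ext s'; ring
    _ = (∫ s in t..b, (c s ^ 2 / 2) * (∫ s' in t..b, k (s - s'))) +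
          (1 / 2) * ∫ s in t..b, c s ^ 2 * ∫ s' in t..b, k (s' - s) := by
        rw [intervalIntegral.integral_add (Continuous.intervalIntegrable (by fun_prop) _ _)
          (Continuous.intervalIntegrable (by fun_prop) _ _), intervalIntegral.integral_const_mul]
        congr 2
        rw [intervalIntegral_intervalIntegral_swap (F := fun s s' => k (s - s') * c s' ^ 2)
          ((Continuous.continuousOn (by fun_prop)).integrableOn_compact
            (isCompact_uIcc.prod isCompact_uIcc) |>.mono_set
            (Set.prod_mono Set.uIoc_subset_uIcc Set.uIoc_subset_uIcc))]
        congr 1; ext s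
        rw [← intervalIntegral.integral_const_mul]
        congr 1; ext s'; ring
    _ ≤ (∫ s in t..b, (c s ^ 2 / 2) * (∫ s, k s)) + (1 / 2) * ∫ s in t..b, c s ^ 2 * ∫ s, k s := by
        gcongr
        · refine integral_mono_on ht.2 (Continuous.intervalIntegrable (by fun_prop) _ _)
            (Continuous.intervalIntegrable (by fun_prop) _ _) fun s hs => ?_
          exact mul_le_mul_of_nonneg_left (kint s) (by positivity)
        · refine integral_mono_on ht.2 (Continuous.intervalIntegrable (by fun_prop) _ _)
            (Continuous.intervalIntegrable (by fun_prop) _ _) fun s hs => ?_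
          exact mul_le_mul_of_nonneg_left (kint' s) (by positivity)
    _ = (∫ s, k s) * ∫ s in t..b, c s ^ 2 := by
        rw [intervalIntegral.integral_mul_const, intervalIntegral.integral_mul_const,
          intervalIntegral.integral_div]
        ring
    _ ≤ _ := by gcongr

lemma ttstar_abstract {a b : ℝ} (hab : a ≤ b) {y y' g : ℝ → H} (hy : ContinuousOn y (Icc a b))
    (hyd : ∀ t ∈ Ioo a b, HasDerivAt y (y' t) t) (hy' : ContinuousOn y' (Icc a b))
    (hg : ContinuousOn g (Icc a b)) {c k : ℝ → ℝ} (hc : ContinuousOn c (Icc a b))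
    (hk : Continuous k) (hk0 : ∀ t, 0 ≤ k t) (hki : Integrable k)
    (hgk : ∀ t ∈ Icc a b, ∀ s ∈ Icc a b,
      ‖inner ℂ (g t) (g s)‖ ≤ k (t - s) * (c t * c s)) :
    ‖∫ t in a..b, inner ℂ (g t) (y t)‖ ≤
      √((∫ s, k s) * ∫ s in a..b, c s ^ 2) * (‖y a‖ + ∫ t in a..b, ‖y' t‖) := by
  obtain ⟨g', hg', hge⟩ := hg.exists_extend hab
  obtain ⟨c', hc', hce⟩ := hc.exists_extend hab
  have uI : Set.uIcc a b = Icc a b := uIcc_of_le hab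
  have e1 : ∫ t in a..b, inner ℂ (g t) (y t) = ∫ t in a..b, inner ℂ (g' t) (y t) :=
    intervalIntegral.integral_congr fun t ht => by
      rw [uI] at ht; simp only [hge ht]
  have e2 : ∫ s in a..b, c s ^ 2 = ∫ s in a..b, c' s ^ 2 :=
    intervalIntegral.integral_congr fun t ht => by
      rw [uI] at ht; simp only [hce ht]
  rw [e1, e2]
  have hΓ : ∀ t ∈ Icc a b, ‖∫ s in t..b, g' s‖ ≤ √((∫ s, k s) * ∫ s in a..b, c' s ^ 2) := by
    intro t ht
    refine ttstar_gamma hg' hc' hk hk0 hki (fun t ht s hs => ?_) ht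
    rw [hge ht, hge hs, hce ht, hce hs]; exact hgk t ht s hs
  set D := √((∫ s, k s) * ∫ s in a..b, c' s ^ 2)
  set Γ : ℝ → H := fun t => ∫ s in t..b, g' s with hΓd
  have hΓ' : ∀ t, HasDerivAt Γ (-g' t) t := fun t =>
    intervalIntegral.integral_hasDerivAt_left (hg'.intervalIntegrable _ _)
      (hg'.stronglyMeasurableAtFilter _ _) hg'.continuousAt
  have hΓc : Continuous Γ := continuous_iff_continuousAt.2 fun t => (hΓ' t).continuousAt
  have hint1 : ContinuousOn (fun t => inner ℂ (g' t) (y t)) (Icc a b) := hg'.continuousOn.inner hy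
  have hint2 : ContinuousOn (fun t => inner ℂ (Γ t) (y' t)) (Icc a b) := hΓc.continuousOn.inner hy'
  have hi1 : IntervalIntegrable (fun t => inner ℂ (g' t) (y t)) volume a b :=
    ContinuousOn.intervalIntegrable (by rwa [uI])
  have hi2 : IntervalIntegrable (fun t => inner ℂ (Γ t) (y' t)) volume a b :=
    ContinuousOn.intervalIntegrable (by rwa [uI])
  have hi3 : IntervalIntegrable (fun t => ‖y' t‖) volume a b :=
    ContinuousOn.intervalIntegrable (by rw [uI]; exact hy'.norm)
  have ftc := integral_eq_sub_of_hasDerivAt_of_le hab (hΓc.continuousOn.inner (𝕜 := ℂ) hy)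
    (f' := fun t => inner ℂ (Γ t) (y' t) - inner ℂ (g' t) (y t))
    (fun t ht => by
      have := (hΓ' t).inner ℂ (hyd t ht)
      simpa [inner_neg_left, sub_eq_add_neg] using this)
    (hi2.sub hi1)
  rw [intervalIntegral.integral_sub hi2 hi1] at ftc
  have hb : Γ b = 0 := by simp [hΓd]
  rw [hb, inner_zero_left, zero_sub] at ftc
  have : ∫ t in a..b, inner ℂ (g' t) (y t) = inner ℂ (Γ a) (y a) + ∫ t in a..b, inner ℂ (Γ t) (y' t) := by
    linear_combination -ftc
  rw [this, mul_add]
  refine (norm_add_le _ _).trans (add_le_add ?_ ?_)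
  · exact (norm_inner_le_norm _ _).trans (by gcongr; exact hΓ a ⟨le_rfl, hab⟩)
  · rw [← intervalIntegral.integral_const_mul]
    refine (intervalIntegral.norm_integral_le_integral_norm hab).trans ?_
    refine integral_mono_on hab hi2.norm (hi3.const_mul _) fun t ht => ?_
    exact (norm_inner_le_norm _ _).trans (by gcongr; exact hΓ t ht)

end TTstar

open scoped BoundedContinuousFunction

/-- The Hilbert space `L²(ℝⁿ)`. -/
abbrev LL (n : ℕ) := Lp ℂ 2 (volume : Measure (Rn n))

section LpMul

lemma memLp_bcf_mul (g : Rn n →ᵇ ℂ) (h : LL n) : MemLp (fun ξ => g ξ * h ξ) 2 (volume : Measure (Rn n)) :=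
  (Lp.memLp h).of_le_mul (c := ‖g‖)
    (g.continuous.aestronglyMeasurable.mul (Lp.aestronglyMeasurable h))
    (Eventually.of_forall fun ξ => by
      rw [norm_mul]; gcongr; exact g.norm_coe_le_norm ξ)

/-- Multiplication by a bounded continuous function, as a bounded operator on `L²`. -/
def lpMul : (Rn n →ᵇ ℂ) →L[ℂ] (LL n →L[ℂ] LL n) :=
  LinearMap.mkContinuous₂
    (LinearMap.mk₂ ℂ (fun g h => (memLp_bcf_mul g h).toLp)
      (fun g g' h => by
        rw [← MemLp.toLp_add]
        refine MemLp.toLp_congr _ _ (Eventually.of_forall fun ξ => ?_)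
        simp [add_mul])
      (fun c g h => by
        rw [← MemLp.toLp_const_smul]
        refine MemLp.toLp_congr _ _ (Eventually.of_forall fun ξ => ?_)
        simp [mul_assoc])
      (fun g h h' => by
        rw [← MemLp.toLp_add]
        refine MemLp.toLp_congr _ _ ?_
        filter_upwards [Lp.coeFn_add h h'] with ξ hξ
        show g ξ * (h + h' : LL n) ξ = g ξ * h ξ + g ξ * h' ξ
        rw [hξ, Pi.add_apply, mul_add])
      (fun c g h => by
        rw [← MemLp.toLp_const_smul]
        refine MemLp.toLp_congr _ _ ?_
        filter_upwards [Lp.coeFn_smul c h] with ξ hξ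
        show g ξ * (c • h : LL n) ξ = c * (g ξ * h ξ)
        rw [hξ, Pi.smul_apply, smul_eq_mul, mul_left_comm])) 1
    (fun g h => by
      rw [one_mul, LinearMap.mk₂_apply]
      refine Lp.norm_le_mul_norm_of_ae_le_mul ?_
      filter_upwards [MemLp.coeFn_toLp (memLp_bcf_mul g h)] with ξ hξ
      rw [hξ, norm_mul]; gcongr; exact g.norm_coe_le_norm ξ)

lemma coeFn_lpMul (g : Rn n →ᵇ ℂ) (h : LL n) : lpMul g h =ᵐ[volume] fun ξ => g ξ * h ξ :=
  MemLp.coeFn_toLp (memLp_bcf_mul g h)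

lemma norm_lpMul_le (g : Rn n →ᵇ ℂ) (h : LL n) : ‖lpMul g h‖ ≤ ‖g‖ * ‖h‖ := by
  refine Lp.norm_le_mul_norm_of_ae_le_mul ?_
  filter_upwards [coeFn_lpMul g h] with ξ hξ
  rw [hξ, norm_mul]; gcongr; exact g.norm_coe_le_norm ξ

end LpMul

/-- `|f|²f` for a Schwartz function. -/
def cub (f : Sch n) : Sch n :=
  SchwartzMap.pairing (ContinuousLinearMap.mul ℝ ℂ) f
    (SchwartzMap.pairing (ContinuousLinearMap.mul ℝ ℂ) f
      (SchwartzMap.postcompCLM (𝕜 := ℝ) (Complex.conjCLE : ℂ →L[ℝ] ℂ) f))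

@[simp] lemma cub_apply (f : Sch n) (x : Rn n) : cub f x = (‖f x‖ : ℂ) ^ 2 * f x := by
  have := mul_conj' (f x)
  simp only [cub, SchwartzMap.pairing_apply_apply, ContinuousLinearMap.mul_apply',
    SchwartzMap.postcompCLM_apply]
  rw [← this]; simp; ring

lemma coe_cub (f : Sch n) : ⇑(cub f) = cubic f := by ext x; rw [cub_apply]; rfl

lemma norm_cubic_sub_le (z w : ℂ) :
    ‖(‖z‖ : ℂ) ^ 2 * z - (‖w‖ : ℂ) ^ 2 * w‖ ≤ 3 / 2 * (‖z‖ ^ 2 + ‖w‖ ^ 2) * ‖z - w‖ := by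
  have h1 : (‖z‖ : ℂ) ^ 2 * z - (‖w‖ : ℂ) ^ 2 * w =
      (((‖z‖ ^ 2 + ‖w‖ ^ 2) / 2 : ℝ) : ℂ) * (z - w) + ((‖z‖ ^ 2 - ‖w‖ ^ 2 : ℝ) : ℂ) * ((z + w) / 2) := by
    push_cast; ring
  rw [h1]
  refine (norm_add_le _ _).trans ?_
  rw [norm_mul, norm_mul, norm_real, norm_real,
    norm_of_nonneg (by positivity : 0 ≤ (‖z‖ ^ 2 + ‖w‖ ^ 2) / 2)]
  have h2 : ‖(‖z‖ ^ 2 - ‖w‖ ^ 2 : ℝ)‖ ≤ (‖z‖ + ‖w‖) * ‖z - w‖ := by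
    rw [sq_sub_sq, norm_eq_abs, abs_mul, abs_of_nonneg (by positivity)]
    gcongr; exact abs_norm_sub_norm_le z w
  have h3 : ‖z + w‖ / ‖(2 : ℂ)‖ ≤ (‖z‖ + ‖w‖) / 2 := by
    simp only [Complex.norm_ofNat]; gcongr; exact norm_add_le _ _
  calc _ ≤ (‖z‖ ^ 2 + ‖w‖ ^ 2) / 2 * ‖z - w‖ + (‖z‖ + ‖w‖) * ‖z - w‖ * ((‖z‖ + ‖w‖) / 2) := by
        rw [← norm_div] at h3; gcongr
    _ ≤ _ := by nlinarith [sq_nonneg (‖z‖ - ‖w‖), norm_nonneg (z - w),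
        mul_nonneg (sq_nonneg (‖z‖ - ‖w‖)) (norm_nonneg (z - w))]

/-- The class in `L²` of a Schwartz function. -/
abbrev L2 (f : Sch n) : LL n := f.toLp 2 volume

lemma norm_L2_sq (f : Sch n) : ‖L2 f‖ ^ 2 = ∫ x, ‖f x‖ ^ 2 := by
  have h := inner_self_eq_norm_sq_to_K (𝕜 := ℂ) (L2 f)
  have h0 := inner_toL2_toL2_eq f f volume
  rw [h0] at h
  have h2 : ∫ x, inner ℂ (f x) (f x) = ((∫ x, ‖f x‖ ^ 2 : ℝ) : ℂ) := by
    rw [← integral_complex_ofReal]; congr 1; ext x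
    rw [inner_self_eq_norm_sq_to_K]; norm_cast
  rw [h2] at h
  exact (Complex.ofReal_injective (by rw [h]; simp)).symm

lemma norm_L2_le_of_forall {f g : Sch n} {c : ℝ} (h : ∀ x, ‖f x‖ ≤ c * ‖g x‖) :
    ‖L2 f‖ ≤ c * ‖L2 g‖ := by
  refine Lp.norm_le_mul_norm_of_ae_le_mul ?_
  filter_upwards [f.coeFn_toLp 2 volume, g.coeFn_toLp 2 volume] with x h1 h2
  rw [h1, h2]; exact h x

lemma L2_sub (f g : Sch n) : L2 (f - g) = L2 f - L2 g :=
  (toLpCLM ℂ ℂ 2 volume).map_sub f g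

lemma norm_L2_cub_sub_le {f g : Sch n} {R : ℝ} (hf : ∀ x, ‖f x‖ ≤ R) (hg : ∀ x, ‖g x‖ ≤ R) :
    ‖L2 (cub f) - L2 (cub g)‖ ≤ 3 * R ^ 2 * ‖L2 f - L2 g‖ := by
  rw [← L2_sub, ← L2_sub]
  refine norm_L2_le_of_forall fun x => ?_
  simp only [sub_apply, cub_apply]
  refine (norm_cubic_sub_le _ _).trans ?_
  have h1 := hf x
  have h2 := hg x
  have h1' : ‖f x‖ ^ 2 ≤ R ^ 2 := by gcongr
  have h2' : ‖g x‖ ^ 2 ≤ R ^ 2 := by gcongr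
  refine mul_le_mul_of_nonneg_right ?_ (norm_nonneg _)
  linarith

lemma ContinuousOn.cub {v : ℝ → Sch n} {J : Set ℝ} {R : ℝ}
    (hv : ContinuousOn (fun t => L2 (v t)) J) (hR : ∀ t ∈ J, ∀ x, ‖v t x‖ ≤ R) :
    ContinuousOn (fun t => L2 (cub (v t))) J := by
  intro t ht
  have h := hv t ht
  rw [ContinuousWithinAt, tendsto_iff_norm_sub_tendsto_zero] at h ⊢
  refine squeeze_zero' (Eventually.of_forall fun _ => norm_nonneg _) ?_
    (by simpa using h.const_mul (3 * R ^ 2))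
  filter_upwards [self_mem_nhdsWithin] with s hs
  exact norm_L2_cub_sub_le (hR s hs) (hR t ht)

section Propagator
variable (W : ℝ) (χ : Rn n →ᵇ ℂ)

/-- `-i·min(ω, W)` as a bounded continuous function. -/
def genZ (hW : 0 ≤ W) : Rn n →ᵇ ℂ :=
  BoundedContinuousFunction.ofNormedAddCommGroup (fun ξ => -(I * (min (om ξ) W : ℝ)))
    (by have := contDiff_om (n := n).continuous; fun_prop) W
    (fun ξ => by
      have : 0 ≤ om ξ := by unfold om; positivity
      rw [norm_neg, norm_mul, norm_I, one_mul, norm_real, norm_of_nonneg (by positivity)]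
      exact min_le_right _ _)

/-- The localized propagator `exp(-itω)χ`. -/
def propE (hW : 0 ≤ W) (t : ℝ) : Rn n →ᵇ ℂ := NormedSpace.exp (t • genZ (n := n) W hW) * χ

lemma propE_apply (hW : 0 ≤ W) (t : ℝ) (ξ : Rn n) :
    propE W χ hW t ξ = Complex.exp (-(I * (t * min (om ξ) W : ℝ))) * χ ξ := by
  let ev : (Rn n →ᵇ ℂ) →+* ℂ :=
    { toFun := fun f => f ξ, map_one' := rfl, map_mul' := fun _ _ => rfl, map_zero' := rfl,
      map_add' := fun _ _ => rfl }
  have hev : Continuous ev := (continuous_apply ξ).comp BoundedContinuousFunction.continuous_coe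
  rw [propE, BoundedContinuousFunction.mul_apply]
  congr 1
  have := NormedSpace.map_exp ev hev (t • genZ (n := n) W hW)
  change ev _ = _
  rw [this, Complex.exp_eq_exp_ℂ]
  congr 1
  change (t • genZ (n := n) W hW) ξ = _
  rw [BoundedContinuousFunction.smul_apply, genZ]
  simp only [BoundedContinuousFunction.coe_ofNormedAddCommGroup, real_smul]
  push_cast; ring

lemma hasDerivAt_propE (hW : 0 ≤ W) (t : ℝ) :
    HasDerivAt (propE W χ hW) (propE W χ hW t * genZ W hW) t := by
  have := (hasDerivAt_exp_smul_const (𝕂 := ℝ) (genZ (n := n) W hW) t).mul_const χ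
  refine this.congr_deriv ?_
  change _ = NormedSpace.exp (t • genZ (n := n) W hW) * χ * genZ W hW
  ring

lemma continuous_propE (hW : 0 ≤ W) : Continuous (propE W χ hW) :=
  continuous_iff_continuousAt.2 fun t => (hasDerivAt_propE W χ hW t).continuousAt

lemma norm_propE_le (hW : 0 ≤ W) (hχ : ∀ ξ, ‖χ ξ‖ ≤ 1) (t : ℝ) : ‖propE W χ hW t‖ ≤ 1 := by
  refine (BoundedContinuousFunction.norm_le zero_le_one).2 fun ξ => ?_
  rw [propE_apply, norm_mul]
  have : ‖Complex.exp (-(I * (t * min (om ξ) W : ℝ)))‖ = 1 := by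
    rw [show -(I * (t * min (om ξ) W : ℝ)) = ((-(t * min (om ξ) W) : ℝ) : ℂ) * I by
      push_cast; ring, norm_exp_ofReal_mul_I]
  rw [this, one_mul]; exact hχ ξ

/-- Interaction-picture equation: `e^{-itω}χ v̂` has derivative `i e^{-itω}χ Φ̂`. -/
lemma hasDerivAt_interaction (hW : 0 ≤ W) (hχW : ∀ ξ, χ ξ ≠ 0 → om ξ ≤ W)
    {v : ℝ → Sch n} {w Φ : Sch n} {t : ℝ}
    (hv : HasDerivAt (fun t => L2 (v t)) (L2 w) t)
    (hw : ∀ ξ, 𝓕 w ξ = I * (om ξ * 𝓕 (v t) ξ + 𝓕 Φ ξ)) :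
    HasDerivAt (fun t => lpMul (propE W χ hW t) (L2 (𝓕 (v t))))
      (lpMul (propE W χ hW t) (I • L2 (𝓕 Φ))) t := by
  have hv' : HasDerivAt (fun t => L2 (𝓕 (v t))) (L2 (𝓕 w)) t := by
    have := ((Lp.fourierTransformₗᵢ (Rn n) ℂ).toContinuousLinearEquiv.toContinuousLinearMap.restrictScalars ℝ).hasFDerivAt.comp_hasDerivAt t hv
    have e : ∀ f : Sch n, L2 (𝓕 f) = Lp.fourierTransformₗᵢ (Rn n) ℂ (L2 f) :=
      fun f => (toLp_fourier_eq f).symm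
    simp_rw [e]
    exact this
  have h := ((lpMul (n := n)).bilinearRestrictScalars ℝ).hasDerivAt_of_bilinear
    (fun _ => hasDerivAt_propE W χ hW t) (fun _ => hv')
  refine h.congr_deriv ?_
  symm
  change _ = lpMul (propE W χ hW t) (L2 (𝓕 w)) + lpMul (propE W χ hW t * genZ W hW) (L2 (𝓕 (v t)))
  apply Lp.ext
  filter_upwards [coeFn_lpMul (propE W χ hW t) (I • L2 (𝓕 Φ)), coeFn_lpMul (propE W χ hW t) (L2 (𝓕 w)),
    coeFn_lpMul (propE W χ hW t * genZ W hW) (L2 (𝓕 (v t))),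
    Lp.coeFn_add (lpMul (propE W χ hW t) (L2 (𝓕 w))) (lpMul (propE W χ hW t * genZ W hW) (L2 (𝓕 (v t)))),
    Lp.coeFn_smul I (L2 (𝓕 Φ)), SchwartzMap.coeFn_toLp (𝓕 Φ) 2 volume,
    SchwartzMap.coeFn_toLp (𝓕 w) 2 volume, SchwartzMap.coeFn_toLp (𝓕 (v t)) 2 volume] with ξ h1 h2 h3 h4 h5 h6 h7 h8
  rw [h1, h4, Pi.add_apply, h2, h3, h5, Pi.smul_apply, h6, h7, h8, smul_eq_mul]
  have hw' := hw ξ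
  rw [hw', BoundedContinuousFunction.mul_apply]
  by_cases hx : χ ξ = 0
  · rw [propE_apply, hx]; ring
  · have : genZ W hW ξ = -(I * (om ξ : ℝ)) := by
      rw [genZ, BoundedContinuousFunction.coe_ofNormedAddCommGroup, min_eq_left (hχW ξ hx)]
    rw [this]; ring

end Propagator

/-- `∫ |f|⁴`. -/
def Q4 (f : Sch n) : ℝ := ∫ x, ‖f x‖ ^ 4

lemma Q4_nonneg (f : Sch n) : 0 ≤ Q4 f := integral_nonneg fun _ => by positivity

lemma inner_cub_self (f : Sch n) : inner ℂ (L2 (cub f)) (L2 f) = (Q4 f : ℂ) := by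
  have := inner_toL2_toL2_eq (cub f) f volume
  rw [this, Q4, ← integral_complex_ofReal]
  congr 1; ext x
  rw [cub_apply, RCLike.inner_apply, map_mul, map_pow]
  have := mul_conj' (f x)
  simp only [conj_ofReal]
  push_cast
  linear_combination ((‖f x‖ : ℂ) ^ 2) * this

lemma integrable_pow_four (f : Sch n) : Integrable fun x => ‖f x‖ ^ 4 := by
  have := (f.memLp 4 volume).integrable_norm_rpow (by norm_num) (by norm_num)
  simpa using this

lemma continuousOn_Q4 {v : ℝ → Sch n} {J : Set ℝ} {R : ℝ}
    (hv : ContinuousOn (fun t => L2 (v t)) J) (hR : ∀ t ∈ J, ∀ x, ‖v t x‖ ≤ R) :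
    ContinuousOn (fun t => Q4 (v t)) J := by
  have h := ContinuousOn.inner (𝕜 := ℂ) (hv.cub hR) hv
  have : (fun t => Q4 (v t)) = fun t => Complex.re (inner ℂ (L2 (cub (v t))) (L2 (v t))) := by
    ext t; rw [inner_cub_self, Complex.ofReal_re]
  rw [this]
  exact Complex.continuous_re.comp_continuousOn h

lemma eLpNorm_cub_four_thirds (f : Sch n) :
    eLpNorm (cub f) (4 / 3) volume = ofReal (Q4 f ^ (3 / 4 : ℝ)) := by
  rw [eLpNorm_four_thirds, Q4, ← ofReal_rpow_of_nonneg (integral_nonneg fun _ => by positivity) (by norm_num),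
    ofReal_integral_eq_lintegral_ofReal (integrable_pow_four f) (Eventually.of_forall fun _ => by positivity)]
  congr 1
  refine lintegral_congr fun x => ?_
  rw [cub_apply, ← ofReal_norm, ofReal_rpow_of_nonneg (by positivity) (by norm_num), norm_mul, norm_pow,
    norm_real, norm_norm, ← pow_succ, ← rpow_natCast, ← rpow_mul (norm_nonneg _)]
  congr 1
  rw [← rpow_natCast]; norm_num

/-- The `TT*` decay kernel. -/
def kker (n : ℕ) (C K τ : ℝ) : ℝ := C * √(K ^ n * (1 + K ^ 4 * |τ|) ^ (-(9 / 4) : ℝ))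

lemma kker_nonneg {C K τ : ℝ} (hC : 0 ≤ C) : 0 ≤ kker n C K τ := by unfold kker; positivity

lemma kker_eq {C K : ℝ} (hK : 0 < K) (τ : ℝ) : kker n C K τ =
    C * K ^ ((n : ℝ) / 2) * (1 + ‖K ^ 4 * τ‖) ^ (-(9 / 8) : ℝ) := by
  have h1 : |K ^ 4 * τ| = K ^ 4 * |τ| := by rw [abs_mul, abs_of_pos (by positivity)]
  rw [kker, sqrt_mul (by positivity), norm_eq_abs, h1, mul_assoc]
  congr 2
  · rw [sqrt_eq_rpow, ← rpow_natCast, ← rpow_mul hK.le]; congr 1; ring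
  · rw [sqrt_eq_rpow, ← rpow_mul (by positivity)]; norm_num

lemma integrable_base : Integrable fun τ : ℝ => (1 + ‖τ‖) ^ (-(9 / 8) : ℝ) :=
  integrable_one_add_norm (by simp; norm_num)

lemma kker_integrable {C K : ℝ} (hK : 0 < K) : Integrable (kker n C K) := by
  have : kker n C K = fun τ => C * K ^ ((n : ℝ) / 2) * (1 + ‖K ^ 4 * τ‖) ^ (-(9 / 8) : ℝ) := by
    ext τ; exact kker_eq hK τ
  rw [this]
  exact ((integrable_base.comp_mul_left' (by positivity : K ^ 4 ≠ 0))).const_mul _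

lemma continuous_kker {C K : ℝ} (hK : 0 < K) : Continuous (kker n C K) := by
  unfold kker
  have : Continuous fun τ : ℝ => (1 + K ^ 4 * |τ|) ^ (-(9 / 4) : ℝ) :=
    Continuous.rpow_const (by fun_prop) fun τ => Or.inl (by positivity)
  fun_prop

lemma integral_kker {C K : ℝ} (hK : 0 < K) : ∫ τ, kker n C K τ =
    C * (∫ τ : ℝ, (1 + ‖τ‖) ^ (-(9 / 8) : ℝ)) * K ^ ((n : ℝ) / 2 - 4) := by
  simp_rw [kker_eq hK]
  rw [integral_const_mul, Measure.integral_comp_mul_left (fun τ : ℝ => (1 + ‖τ‖) ^ (-(9 / 8) : ℝ)) (K ^ 4),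
    abs_of_pos (by positivity), smul_eq_mul, rpow_sub hK]
  have : K ^ (4 : ℝ) = K ^ 4 := by norm_cast
  rw [this]
  field_simp

/-- Complex conjugation of a Schwartz function. -/
def sconj (f : Sch n) : Sch n :=
  SchwartzMap.postcompCLM (𝕜 := ℝ) (Complex.conjCLE : ℂ →L[ℝ] ℂ) f

@[simp] lemma sconj_apply (f : Sch n) (x : Rn n) : sconj f x = starRingEnd ℂ (f x) := rfl

lemma fourierInv_sconj (f : Sch n) (ξ : Rn n) :
    𝓕⁻ (sconj f) ξ = starRingEnd ℂ (𝓕 f ξ) := by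
  simp_rw [fourier_coe, fourierInv_coe]
  rw [fourierInv_eq', fourier_eq', ← integral_conj]
  congr 1; ext x
  rw [sconj_apply, smul_eq_mul, smul_eq_mul, map_mul, ← exp_conj]
  congr 2
  simp only [map_mul, conj_I, conj_ofReal]
  push_cast; ring

lemma eLpNorm_sconj (f : Sch n) (p : ℝ≥0∞) : eLpNorm (sconj f) p volume = eLpNorm f p volume :=
  eLpNorm_congr_norm_ae (Eventually.of_forall fun x => by simp)

lemma inner_propE (W : ℝ) (χ : Rn n →ᵇ ℂ) (hW : 0 ≤ W) (hχW : ∀ ξ, χ ξ ≠ 0 → om ξ ≤ W) (t s : ℝ)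
    (f g : Sch n) :
    inner ℂ (lpMul (propE W χ hW t) (L2 f)) (lpMul (propE W χ hW s) (L2 g)) =
      ∫ ξ, Complex.exp (I * ((t - s) * om ξ : ℝ)) * ((starRingEnd ℂ (χ ξ) * χ ξ) * (starRingEnd ℂ (f ξ) * g ξ)) := by
  rw [L2.inner_def]
  refine integral_congr_ae ?_
  filter_upwards [coeFn_lpMul (propE W χ hW t) (L2 f), coeFn_lpMul (propE W χ hW s) (L2 g), f.coeFn_toLp 2 volume,
    g.coeFn_toLp 2 volume] with ξ h1 h2 h3 h4
  rw [h1, h2, RCLike.inner_apply, show (L2 f : Rn n → ℂ) ξ = f ξ from h3, show (L2 g : Rn n → ℂ) ξ = g ξ from h4,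
    propE_apply, propE_apply]
  by_cases h : χ ξ = 0
  · simp [h]
  rw [min_eq_left (hχW ξ h)]
  simp only [map_mul, ← exp_conj, map_neg, conj_I, conj_ofReal]
  have : Complex.exp (I * ((t - s) * om ξ : ℝ)) = Complex.exp (-(I * (s * om ξ : ℝ))) * Complex.exp (-(-I * (t * om ξ : ℝ))) := by
    rw [← Complex.exp_add]; congr 1; push_cast; ring
  rw [this]; ring

set_option maxHeartbeats 1600000 in
lemma strichartz (hn : 5 ≤ n) {χ : Rn n → ℝ} {r R : ℝ} (hχ : ContDiff ℝ (⊤ : ℕ∞) χ) (hr : 0 < r)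
    (h0 : ∀ ξ, ‖ξ‖ < r → χ ξ = 0) (hR : ∀ ξ, R < ‖ξ‖ → χ ξ = 0) (hχ0 : ∀ ξ, 0 ≤ χ ξ) (hχ1 : ∀ ξ, χ ξ ≤ 1) :
    ∃ C, 0 < C ∧ ∀ K : ℝ, 0 < K → ∀ a b : ℝ, a ≤ b → ∀ v w Φ : ℝ → Sch n,
      (∀ t ∈ Icc a b, ∀ ξ, 𝓕 (v t) ξ ≠ 0 → χ (K⁻¹ • ξ) = 1) →
      ContinuousOn (fun t => L2 (v t)) (Icc a b) → ContinuousOn (fun t => L2 (Φ t)) (Icc a b) →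
      (∀ t ∈ Ioo a b, HasDerivAt (fun t => L2 (v t)) (L2 (w t)) t) →
      (∀ t ∈ Ioo a b, ∀ ξ, 𝓕 (w t) ξ = I * (om ξ * 𝓕 (v t) ξ + 𝓕 (Φ t) ξ)) →
      (∃ B, ∀ t ∈ Icc a b, ∀ x, ‖v t x‖ ≤ B) →
      ∫ t in a..b, √(Q4 (v t)) ≤ C * K ^ ((n : ℝ) / 2 - 4) * (‖L2 (v a)‖ + ∫ t in a..b, ‖L2 (Φ t)‖) ^ 2 := by
  obtain ⟨C, hC, HC⟩ := ttstar_bilin hn (a := fun ξ => ((χ ξ ^ 2 : ℝ) : ℂ)) (r := r) (R := R)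
    (Complex.ofRealCLM.contDiff.comp (hχ.pow 2)) hr (fun ξ h => by simp [h0 ξ h]) (fun ξ h => by simp [hR ξ h])
    (fun ξ => by
      rw [norm_real, norm_of_nonneg (by positivity)]
      exact pow_le_one₀ (hχ0 ξ) (hχ1 ξ))
  set I0 := ∫ τ : ℝ, (1 + ‖τ‖) ^ (-(9 / 8) : ℝ)
  have hI0 : 0 ≤ I0 := integral_nonneg fun _ => by positivity
  refine ⟨C * I0 + 1, by positivity, fun K hK a b hab v w Φ hsupp hv hΦ hvd hw hB => ?_⟩
  obtain ⟨B, hB⟩ := hB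
  set χK : Rn n →ᵇ ℂ := BoundedContinuousFunction.ofNormedAddCommGroup (fun ξ => ((χ (K⁻¹ • ξ) : ℝ) : ℂ))
    (by have := hχ.continuous; fun_prop) 1 (fun ξ => by
      rw [norm_real, norm_of_nonneg (hχ0 _)]; exact hχ1 _) with hχK
  have hχK1 : ∀ ξ, ‖χK ξ‖ ≤ 1 := fun ξ => by
    change ‖((χ (K⁻¹ • ξ) : ℝ) : ℂ)‖ ≤ 1
    rw [norm_real, norm_of_nonneg (hχ0 _)]; exact hχ1 _
  set W := (2 * π * (K * R)) ^ 4 with hWd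
  have hW : 0 ≤ W := by positivity
  have hχW : ∀ ξ, χK ξ ≠ 0 → om ξ ≤ W := by
    intro ξ h
    have h1 : ‖K⁻¹ • ξ‖ ≤ R := by
      by_contra h2
      exact h (by change ((χ (K⁻¹ • ξ) : ℝ) : ℂ) = 0; rw [hR _ (not_le.1 h2)]; simp)
    rw [norm_smul, norm_inv, norm_of_nonneg hK.le, inv_mul_le_iff₀ hK] at h1
    unfold om; rw [hWd]; gcongr
  set E := propE W χK hW
  set y : ℝ → LL n := fun t => lpMul (E t) (L2 (𝓕 (v t)))
  set y' : ℝ → LL n := fun t => lpMul (E t) (I • L2 (𝓕 (Φ t)))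
  have hF : ∀ {f : ℝ → Sch n}, ContinuousOn (fun t => L2 (f t)) (Icc a b) →
      ContinuousOn (fun t => L2 (𝓕 (f t))) (Icc a b) := by
    intro f hf
    have e : (fun t => L2 (𝓕 (f t))) = fun t => Lp.fourierTransformₗᵢ (Rn n) ℂ (L2 (f t)) := by
      ext1 t; exact (toLp_fourier_eq (f t)).symm
    rw [e]
    exact (Lp.fourierTransformₗᵢ (Rn n) ℂ).continuous.comp_continuousOn hf
  have hEc : Continuous E := continuous_propE W χK hW
  have hmul : ∀ {f : ℝ → LL n}, ContinuousOn f (Icc a b) →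
      ContinuousOn (fun t => lpMul (E t) (f t)) (Icc a b) := by
    intro f hf
    exact ((lpMul (n := n)).continuous.comp hEc).continuousOn.clm_apply hf
  have hy : ContinuousOn y (Icc a b) := hmul (hF hv)
  have hy' : ContinuousOn y' (Icc a b) := hmul ((hF hΦ).const_smul I)
  have hyd : ∀ t ∈ Ioo a b, HasDerivAt y (y' t) t := fun t ht =>
    hasDerivAt_interaction W χK hW hχW (hvd t ht) (hw t ht)
  have hE1 : ∀ t (h : LL n), ‖lpMul (E t) h‖ ≤ ‖h‖ := fun t h =>
    (norm_lpMul_le _ _).trans (mul_le_of_le_one_left (norm_nonneg _) (norm_propE_le W χK hW hχK1 t))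
  have hFn : ∀ f : Sch n, ‖L2 (𝓕 f)‖ = ‖L2 f‖ := SchwartzMap.norm_fourier_toL2_eq
  have hqc : ContinuousOn (fun t => Q4 (v t)) (Icc a b) := continuousOn_Q4 hv hB
  have hq0 : ∀ t, 0 ≤ Q4 (v t) := fun t => Q4_nonneg _
  set X := ‖L2 (v a)‖ + ∫ t in a..b, ‖L2 (Φ t)‖
  have uI : Set.uIcc a b = Icc a b := uIcc_of_le hab
  have hX : ‖y a‖ + ∫ t in a..b, ‖y' t‖ ≤ X := by
    refine add_le_add ((hE1 _ _).trans (hFn _).le) ?_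
    refine integral_mono_on hab (ContinuousOn.intervalIntegrable (by rw [uI]; exact hy'.norm))
      (ContinuousOn.intervalIntegrable (by rw [uI]; exact hΦ.norm)) fun t _ => ?_
    refine (hE1 _ _).trans ?_
    rw [norm_smul, norm_I, one_mul]; exact (hFn _).le
  have hX0 : 0 ≤ X := le_trans (by
    have : 0 ≤ ∫ t in a..b, ‖y' t‖ := intervalIntegral.integral_nonneg hab fun _ _ => norm_nonneg _
    positivity) hX
  have hkint := integral_kker (n := n) (C := C) hK
  -- the estimate with regularization parameter `η`
  have main : ∀ η : ℝ, 0 < η → ∫ t in a..b, √(Q4 (v t)) ≤ C * I0 * K ^ ((n : ℝ) / 2 - 4) * X ^ 2 + η * (b - a) := by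
    intro η hη
    set d : ℝ → ℝ := fun t => √(Q4 (v t)) + η with hd
    have hd0 : ∀ t, 0 < d t := fun t => by positivity
    have hdc : ContinuousOn d (Icc a b) := (continuous_sqrt.comp_continuousOn hqc).add continuousOn_const
    set G : ℝ → Sch n := fun t => (((d t)⁻¹ : ℝ) : ℂ) • cub (v t)
    have hL2G : ∀ t, L2 (G t) = (((d t)⁻¹ : ℝ) : ℂ) • L2 (cub (v t)) := fun t =>
      (toLpCLM ℂ ℂ 2 volume).map_smul _ _
    have hGc : ContinuousOn (fun t => L2 (G t)) (Icc a b) := by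
      simp_rw [hL2G]
      exact (Complex.continuous_ofReal.comp_continuousOn (hdc.inv₀ fun t _ => (hd0 t).ne')).smul (hv.cub hB)
    set g : ℝ → LL n := fun t => lpMul (E t) (L2 (𝓕 (G t)))
    have hg : ContinuousOn g (Icc a b) := hmul (hF hGc)
    set c : ℝ → ℝ := fun t => (d t)⁻¹ * Q4 (v t) ^ (3 / 4 : ℝ)
    have hc0 : ∀ t, 0 ≤ c t := fun t => mul_nonneg (inv_nonneg.2 (hd0 t).le) (rpow_nonneg (hq0 t) _)
    have hcc : ContinuousOn c (Icc a b) :=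
      (hdc.inv₀ fun t _ => (hd0 t).ne').mul (hqc.rpow_const fun t _ => Or.inr (by norm_num))
    have hcG : ∀ t, eLpNorm (G t) (4 / 3) volume = ofReal (c t) := by
      intro t
      have : ⇑(G t) = (((d t)⁻¹ : ℝ) : ℂ) • ⇑(cub (v t)) := rfl
      rw [this, eLpNorm_const_smul, eLpNorm_cub_four_thirds, ofReal_mul (inv_nonneg.2 (hd0 t).le)]
      congr 1
      rw [← ofReal_norm, norm_real, norm_of_nonneg (inv_nonneg.2 (hd0 t).le)]
    have hgk : ∀ t ∈ Icc a b, ∀ s ∈ Icc a b,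
        ‖inner ℂ (g t) (g s)‖ ≤ kker n C K (t - s) * (c t * c s) := by
      intro t _ s _
      have e : inner ℂ (g t) (g s) = ∫ ξ, qsym (fun ξ => ((χ ξ ^ 2 : ℝ) : ℂ)) K (t - s) ξ *
          (𝓕⁻ (sconj (G t)) ξ * 𝓕 (G s) ξ) := by
        refine (inner_propE W χK hW hχW t s (𝓕 (G t)) (𝓕 (G s))).trans ?_
        refine integral_congr_ae (Eventually.of_forall fun ξ => ?_)
        simp only []
        rw [fourierInv_sconj, qsym, show χK ξ = ((χ (K⁻¹ • ξ) : ℝ) : ℂ) from rfl, conj_ofReal]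
        push_cast; ring
      rw [e]
      have := HC K (t - s) hK (G s) (sconj (G t))
      rw [eLpNorm_sconj, hcG, hcG, ← ofReal_mul (hc0 s), ← ofReal_mul (by positivity), ← ofReal_norm,
        ofReal_le_ofReal_iff (by have := hc0 t; have := hc0 s; positivity), mul_comm (c s)] at this
      exact this
    have hgy : ∀ t ∈ Icc a b, inner ℂ (g t) (y t) = ((Q4 (v t) / d t : ℝ) : ℂ) := by
      intro t ht
      have e : inner ℂ (g t) (y t) = inner ℂ (L2 (𝓕 (G t))) (L2 (𝓕 (v t))) := by
        refine (inner_propE W χK hW hχW t t (𝓕 (G t)) (𝓕 (v t))).trans ?_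
        have h2 := inner_toL2_toL2_eq (𝓕 (G t)) (𝓕 (v t)) volume
        rw [h2]
        refine integral_congr_ae (Eventually.of_forall fun ξ => ?_)
        simp only []
        rw [show χK ξ = ((χ (K⁻¹ • ξ) : ℝ) : ℂ) from rfl, conj_ofReal, RCLike.inner_apply]
        by_cases h : 𝓕 (v t) ξ = 0
        · simp [h]
        · rw [hsupp t ht ξ h]; simp [mul_comm]
      rw [e, show L2 (𝓕 (G t)) = Lp.fourierTransformₗᵢ (Rn n) ℂ (L2 (G t)) from (toLp_fourier_eq (G t)).symm,
        show L2 (𝓕 (v t)) = Lp.fourierTransformₗᵢ (Rn n) ℂ (L2 (v t)) from (toLp_fourier_eq (v t)).symm]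
      refine ((Lp.fourierTransformₗᵢ (Rn n) ℂ).inner_map_map _ _).trans ?_
      rw [hL2G, inner_smul_left, inner_cub_self, conj_ofReal]
      push_cast; field_simp
    have H := ttstar_abstract hab hy hyd hy' hg hcc (continuous_kker (n := n) (C := C) hK)
      (fun _ => kker_nonneg hC.le) (kker_integrable hK) hgk
    set A := ∫ t in a..b, Q4 (v t) / d t
    have hAc : ContinuousOn (fun t => Q4 (v t) / d t) (Icc a b) := hqc.div hdc fun t _ => (hd0 t).ne'
    have hA0 : 0 ≤ A := intervalIntegral.integral_nonneg hab fun t _ => div_nonneg (hq0 t) (hd0 t).le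
    have hA1 : ‖∫ t in a..b, inner ℂ (g t) (y t)‖ = A := by
      rw [intervalIntegral.integral_congr (g := fun t => ((Q4 (v t) / d t : ℝ) : ℂ)) fun t ht => hgy t (by rwa [← uI]),
        intervalIntegral.integral_ofReal, norm_real, norm_of_nonneg hA0]
    have hA2 : ∫ s in a..b, c s ^ 2 ≤ A := by
      refine integral_mono_on hab (ContinuousOn.intervalIntegrable (by rw [uI]; exact hcc.pow 2))
        (ContinuousOn.intervalIntegrable (by rwa [uI])) fun t _ => ?_
      have e : (Q4 (v t) ^ (3 / 4 : ℝ)) ^ 2 = Q4 (v t) * √(Q4 (v t)) := by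
        rw [← rpow_natCast, ← rpow_mul (hq0 t), sqrt_eq_rpow]
        nth_rw 2 [← rpow_one (Q4 (v t))]
        rw [← rpow_add_of_nonneg (hq0 t) (by norm_num) (by norm_num)]; norm_num
      simp only [c]
      rw [mul_pow, e, inv_pow, div_eq_mul_inv, mul_comm, mul_assoc]
      refine mul_le_mul_of_nonneg_left ?_ (hq0 t)
      rw [mul_inv_le_iff₀ (by have := hd0 t; positivity), sq, inv_mul_cancel_left₀ (hd0 t).ne']
      simp only [hd]; linarith
    have hA3 : A ≤ √((∫ s, kker n C K s) * A) * X := by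
      rw [← hA1]
      refine H.trans ?_
      rw [hA1]
      have hk1 : 0 ≤ ∫ s, kker n C K s := integral_nonneg fun _ => kker_nonneg hC.le
      refine mul_le_mul (sqrt_le_sqrt (mul_le_mul_of_nonneg_left hA2 hk1)) hX ?_ (sqrt_nonneg _)
      exact add_nonneg (norm_nonneg _) (intervalIntegral.integral_nonneg hab fun _ _ => norm_nonneg _)
    have hA4 : A ≤ (∫ s, kker n C K s) * X ^ 2 := by
      have hk1 : 0 ≤ ∫ s, kker n C K s := integral_nonneg fun _ => kker_nonneg hC.le
      rcases hA0.eq_or_lt with h | h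
      · rw [← h]; positivity
      · have h2 : A ^ 2 ≤ (∫ s, kker n C K s) * A * X ^ 2 := by
          calc A ^ 2 ≤ (√((∫ s, kker n C K s) * A) * X) ^ 2 := pow_le_pow_left₀ hA0 hA3 2
            _ = _ := by rw [mul_pow, sq_sqrt (by positivity)]
        nlinarith
    have hA5 : ∫ t in a..b, √(Q4 (v t)) ≤ A + η * (b - a) := by
      have : A + η * (b - a) = ∫ t in a..b, (Q4 (v t) / d t + η) := by
        rw [intervalIntegral.integral_add (ContinuousOn.intervalIntegrable (by rwa [uI])) (by simp)]
        simp [mul_comm, A]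
      rw [this]
      refine integral_mono_on hab
        (ContinuousOn.intervalIntegrable (by rw [uI]; exact continuous_sqrt.comp_continuousOn hqc))
        (ContinuousOn.intervalIntegrable (by rw [uI]; exact hAc.add continuousOn_const)) fun t _ => ?_
      rw [← sub_le_iff_le_add, le_div_iff₀ (hd0 t)]
      have := sq_sqrt (hq0 t)
      simp only [hd]; nlinarith [sq_nonneg η]
    refine hA5.trans (add_le_add_left (hA4.trans_eq ?_) _)
    rw [hkint]
  have lim : ∫ t in a..b, √(Q4 (v t)) ≤ C * I0 * K ^ ((n : ℝ) / 2 - 4) * X ^ 2 := by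
    refine le_of_forall_pos_le_add fun ε hε => ?_
    refine (main (ε / (b - a + 1)) (div_pos hε (by linarith))).trans (by
      gcongr
      rw [div_mul_eq_mul_div, div_le_iff₀ (by linarith)]; nlinarith)
  refine lim.trans ?_
  gcongr
  linarith

/-! ### Fourier multipliers with Schwartz symbols -/

/-- The Fourier multiplier with Schwartz symbol `θ`. -/
def T (θ f : Sch n) : Sch n :=
  SchwartzMap.fourierMultiplierCLM ℂ (θ : Rn n → ℂ) f

lemma fourier_T (θ f : Sch n) (ξ : Rn n) : 𝓕 (T θ f) ξ = θ ξ * 𝓕 f ξ := by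
  rw [T, SchwartzMap.fourierMultiplierCLM_apply, fourier_fourierInv_eq,
    smulLeftCLM_apply_apply θ.hasTemperateGrowth, smul_eq_mul]

lemma T_eq (θ f : Sch n) : ⇑(T θ f) = 𝓕⁻ fun ξ => θ ξ * 𝓕 f ξ := by
  have h : (fun ξ => θ ξ * 𝓕 f ξ) = ⇑(𝓕 (T θ f) : Sch n) := by ext ξ; rw [fourier_T]
  rw [h, ← fourierInv_coe, fourierInv_fourier_eq]

lemma T_add (θ f g : Sch n) : T θ (f + g) = T θ f + T θ g := map_add _ _ _
lemma T_sub (θ f g : Sch n) : T θ (f - g) = T θ f - T θ g := map_sub _ _ _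
lemma T_smul (θ : Sch n) (c : ℂ) (f : Sch n) : T θ (c • f) = c • T θ f := map_smul _ _ _

lemma fourier_injective {f g : Sch n} (h : ∀ ξ, 𝓕 f ξ = 𝓕 g ξ) : f = g := by
  have : 𝓕 f = 𝓕 g := by ext ξ; exact h ξ
  rw [← fourierInv_fourier_eq (E := Sch n) (F := Sch n) f, this,
    fourierInv_fourier_eq]

lemma fourier_add_apply (f g : Sch n) (ξ : Rn n) : 𝓕 (f + g) ξ = 𝓕 f ξ + 𝓕 g ξ := by
  rw [FourierTransform.fourier_add]; rfl

lemma fourier_sub_apply (f g : Sch n) (ξ : Rn n) : 𝓕 (f - g) ξ = 𝓕 f ξ - 𝓕 g ξ := by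
  rw [eq_sub_iff_add_eq, ← fourier_add_apply, sub_add_cancel]

lemma fourier_smul_apply (c : ℂ) (f : Sch n) (ξ : Rn n) : 𝓕 (c • f) ξ = c * 𝓕 f ξ := by
  rw [fourier_smul]; rfl

lemma continuous_fourierInv {h : Rn n → ℂ} (hh : Integrable h) : Continuous (𝓕⁻ h) := by
  have e : 𝓕⁻ h = 𝓕 h ∘ (fun x => -x) := by
    ext x; rw [fourierInv_eq_fourier_neg]; rfl
  rw [e]
  exact (VectorFourier.fourierIntegral_continuous continuous_fourierChar (by exact continuous_inner) hh).comp
    continuous_neg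

lemma fourierInv_mul_eq (θ : Sch n) {h : Rn n → ℂ} (hh : Integrable h) (x : Rn n) :
    𝓕⁻ (fun ξ => θ ξ * h ξ) x = ∫ y, (𝓕⁻ θ : Sch n) y * 𝓕⁻ h (x - y) := by
  set κ : Sch n := 𝓕⁻ θ
  set g : Rn n → ℂ := fun ξ => (fourierChar (inner ℝ ξ x) : ℂ) * h ξ
  have hg : Integrable g := by
    refine hh.bdd_mul (c := 1) ?_ (ae_of_all _ fun z => (Circle.norm_coe _).le)
    refine Continuous.aestronglyMeasurable ?_
    have := continuous_fourierChar
    fun_prop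
  have h3 := VectorFourier.integral_fourierIntegral_smul_eq_flip (μ := volume) (ν := volume)
    (L := innerₗ (Rn n)) (f := κ) (g := g) continuous_fourierChar
    (by exact continuous_inner) κ.integrable hg
  have e : (innerₗ (Rn n)).flip = innerₗ (Rn n) := by ext; simp
  rw [e] at h3
  have e1 : ∀ ξ, VectorFourier.fourierIntegral fourierChar volume (innerₗ (Rn n)) κ ξ = θ ξ := by
    intro ξ
    have : (𝓕 κ : Sch n) = θ := fourier_fourierInv_eq θ
    rw [← this, fourier_coe]; rfl
  have e2 : ∀ y, VectorFourier.fourierIntegral fourierChar volume (innerₗ (Rn n)) g y = 𝓕⁻ h (x - y) := by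
    intro y
    change 𝓕 g y = _
    rw [fourier_eq, fourierInv_eq]
    refine integral_congr_ae (ae_of_all _ fun ξ => ?_)
    simp only [g, Circle.smul_def, smul_eq_mul]
    rw [inner_sub_right, sub_eq_add_neg, AddChar.map_add_eq_mul]
    push_cast; ring
  simp_rw [e1, e2, smul_eq_mul] at h3
  rw [← h3, fourierInv_eq]
  refine integral_congr_ae (ae_of_all _ fun ξ => ?_)
  simp only [g, Circle.smul_def, smul_eq_mul]
  ring

/-! ### Young's inequality -/

lemma lintegral_young {κ g : Rn n → ℝ≥0∞} (hκ : Measurable κ) (hg : Measurable g) {p : ℝ} (hp : 1 ≤ p) :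
    ∫⁻ x, (∫⁻ y, κ y * g (x - y)) ^ p ≤ (∫⁻ y, κ y) ^ p * ∫⁻ x, g x ^ p := by
  have hp0 : 0 < p := by linarith
  set A := ∫⁻ y, κ y
  have h1 : ∀ x, (∫⁻ y, κ y * g (x - y)) ^ p ≤ A ^ (p - 1) * ∫⁻ y, κ y * g (x - y) ^ p := by
    intro x
    set ν := (volume : Measure (Rn n)).withDensity κ
    have hgx : Measurable fun y => g (x - y) := hg.comp (measurable_const.sub measurable_id)
    have H := eLpNorm'_le_eLpNorm'_mul_rpow_measure_univ (μ := ν) (f := fun y => g (x - y)) zero_lt_one hp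
      hgx.aestronglyMeasurable
    have e1 : ∀ q : ℝ, ∫⁻ y, g (x - y) ^ q ∂ν = ∫⁻ y, κ y * g (x - y) ^ q := fun q =>
      lintegral_withDensity_eq_lintegral_mul _ hκ (hgx.pow_const q)
    have e2 : ν Set.univ = A := by rw [withDensity_apply _ MeasurableSet.univ, Measure.restrict_univ]
    have e3 : ∫⁻ y, g (x - y) ∂ν = ∫⁻ y, κ y * g (x - y) := by simpa using e1 1
    simp only [eLpNorm', enorm_eq_self, e1, ENNReal.rpow_one, div_one, e2, e3] at H
    calc (∫⁻ y, κ y * g (x - y)) ^ p ≤ ((∫⁻ y, κ y * g (x - y) ^ p) ^ (1 / p) * A ^ (1 - 1 / p)) ^ p := by gcongr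
      _ = A ^ (p - 1) * ∫⁻ y, κ y * g (x - y) ^ p := by
        rw [mul_rpow_of_nonneg _ _ hp0.le, ← ENNReal.rpow_mul, ← ENNReal.rpow_mul, one_div_mul_cancel hp0.ne',
          ENNReal.rpow_one, sub_mul, one_mul, one_div_mul_cancel hp0.ne', mul_comm]
  refine (lintegral_mono h1).trans ?_
  rw [lintegral_const_mul'' _ (by
    refine (Measurable.lintegral_prod_right' (f := fun z : Rn n × Rn n => κ z.2 * g (z.1 - z.2) ^ p) ?_).aemeasurable
    exact (hκ.comp measurable_snd).mul ((hg.comp (measurable_fst.sub measurable_snd)).pow_const p)),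
    lintegral_lintegral_swap (by
      exact ((hκ.comp measurable_snd).mul ((hg.comp (measurable_fst.sub measurable_snd)).pow_const p)).aemeasurable)]
  have h2 : ∀ y, ∫⁻ x, κ y * g (x - y) ^ p = κ y * ∫⁻ x, g x ^ p := fun y => by
    have hm : Measurable fun x => g (x - y) ^ p := (hg.comp (measurable_id.sub_const y)).pow_const p
    rw [lintegral_const_mul _ hm,
      lintegral_sub_right_eq_self (fun x => g x ^ p) y]
  simp_rw [h2]
  rw [lintegral_mul_const _ hκ, ← mul_assoc]
  gcongr
  change A ^ (p - 1) * A ≤ A ^ p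
  rcases eq_or_ne A 0 with h | h
  · simp [h]
  rcases eq_or_ne A ∞ with h' | h'
  · rw [h', ENNReal.top_rpow_of_pos hp0]; exact le_top
  · nth_rw 2 [← ENNReal.rpow_one A]
    rw [← ENNReal.rpow_add _ _ h h', sub_add_cancel]

lemma eLpNorm_fourierInv_mul_le (θ : Sch n) {h : Rn n → ℂ} (hh : Integrable h) {p : ℝ≥0∞} (hp : 1 ≤ p)
    (hp' : p ≠ ∞) :
    eLpNorm (𝓕⁻ fun ξ => θ ξ * h ξ) p volume ≤ eLpNorm (𝓕⁻ θ : Sch n) 1 volume * eLpNorm (𝓕⁻ h) p volume := by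
  have hc := continuous_fourierInv hh
  have hp1 : 1 ≤ p.toReal := by
    rw [← ENNReal.toReal_one]; exact (ENNReal.toReal_le_toReal (by simp) hp').2 hp
  have hp0 : p ≠ 0 := by rintro rfl; simp at hp
  have hy := lintegral_young (κ := fun y => ‖(𝓕⁻ θ : Sch n) y‖ₑ) (g := fun y => ‖𝓕⁻ h y‖ₑ)
    (𝓕⁻ θ : Sch n).continuous.enorm.measurable hc.enorm.measurable hp1
  rw [eLpNorm_eq_lintegral_rpow_enorm_toReal hp0 hp', eLpNorm_eq_lintegral_rpow_enorm_toReal hp0 hp',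
    eLpNorm_one_eq_lintegral_enorm]
  calc _ ≤ ((∫⁻ y, ‖(𝓕⁻ θ : Sch n) y‖ₑ) ^ p.toReal * ∫⁻ x, ‖𝓕⁻ h x‖ₑ ^ p.toReal) ^ (1 / p.toReal) := by
        refine ENNReal.rpow_le_rpow (le_trans (lintegral_mono fun x => ?_) hy) (by positivity)
        refine ENNReal.rpow_le_rpow ?_ (by positivity)
        rw [fourierInv_mul_eq θ hh]
        refine (enorm_integral_le_lintegral_enorm _).trans_eq ?_
        simp_rw [enorm_mul]
    _ = _ := by
        rw [mul_rpow_of_nonneg _ _ (by positivity), ← ENNReal.rpow_mul, mul_one_div_cancel (by positivity),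
          ENNReal.rpow_one]

lemma enorm_fourierInv_mul_le (θ : Sch n) {h : Rn n → ℂ} (hh : Integrable h) {p q : ℝ}
    (hpq : q.HolderConjugate p) (x : Rn n) :
    ‖𝓕⁻ (fun ξ => θ ξ * h ξ) x‖ₑ ≤ eLpNorm' (𝓕⁻ θ : Sch n) q volume * eLpNorm' (𝓕⁻ h) p volume := by
  have hc := continuous_fourierInv hh
  rw [fourierInv_mul_eq θ hh]
  refine (enorm_integral_le_lintegral_enorm _).trans ?_
  simp_rw [enorm_mul]
  refine (lintegral_mul_le_Lp_mul_Lq volume hpq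
    (𝓕⁻ θ : Sch n).continuous.enorm.measurable.aemeasurable
    (hc.comp (continuous_const.sub continuous_id)).enorm.measurable.aemeasurable).trans_eq ?_
  rw [eLpNorm', eLpNorm']
  congr 2
  exact lintegral_sub_left_eq_self (fun y => ‖𝓕⁻ h y‖ₑ ^ p) x

/-! ### Dyadic dilations -/

/-- The symbol `θ(2^{-k} ξ)`. -/
def dil (k : ℤ) (θ : Sch n) : Sch n :=
  SchwartzMap.compCLMOfContinuousLinearEquiv ℂ
    (ContinuousLinearEquiv.smulLeft (R₁ := ℝ) (M₁ := Rn n) (Units.mk0 (((2 : ℝ) ^ k)⁻¹) (by positivity))) θ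

lemma dil_apply (k : ℤ) (θ : Sch n) (ξ : Rn n) : dil k θ ξ = θ (((2 : ℝ) ^ k)⁻¹ • ξ) := rfl

lemma fourierInv_dil (k : ℤ) (θ : Sch n) (x : Rn n) :
    (𝓕⁻ (dil k θ) : Sch n) x = (((2 : ℝ) ^ k) ^ n : ℝ) * (𝓕⁻ θ : Sch n) ((2 : ℝ) ^ k • x) := by
  set K := (2 : ℝ) ^ k
  have hK : 0 < K := by positivity
  simp_rw [fourierInv_coe]
  rw [fourierInv_eq, fourierInv_eq]
  have := Measure.integral_comp_smul (volume : Measure (Rn n))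
    (fun ξ => fourierChar (inner ℝ ξ (K • x)) • θ ξ) K⁻¹
  simp only [finrank_euclideanSpace, Fintype.card_fin, inv_pow, inv_inv, abs_of_pos (pow_pos hK n)] at this
  rw [← real_smul, ← this]
  refine integral_congr_ae (ae_of_all _ fun ξ => ?_)
  simp only [dil_apply]
  rw [real_inner_smul_left, real_inner_smul_right, inv_mul_cancel_left₀ hK.ne']

lemma eLpNorm'_fourierInv_dil (k : ℤ) (θ : Sch n) {q : ℝ} (hq : 0 < q) :
    eLpNorm' (𝓕⁻ (dil k θ) : Sch n) q volume =
      ofReal (((2 : ℝ) ^ k) ^ (n * (1 - 1 / q))) * eLpNorm' (𝓕⁻ θ : Sch n) q volume := by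
  set K := (2 : ℝ) ^ k
  have hK : 0 < K := by positivity
  unfold eLpNorm'
  have h0 : ∀ x, ‖(𝓕⁻ (dil k θ) : Sch n) x‖ₑ = ‖((K ^ n : ℝ) : ℂ)‖ₑ * ‖(𝓕⁻ θ : Sch n) (K • x)‖ₑ := fun x => by
    rw [fourierInv_dil, enorm_mul]
  simp_rw [h0]
  have h1 : ‖((K ^ n : ℝ) : ℂ)‖ₑ = ofReal (K ^ n) := by
    rw [← ofReal_norm, norm_real, norm_of_nonneg (by positivity)]
  have hm : Measurable fun x => ‖(𝓕⁻ θ : Sch n) x‖ₑ ^ q :=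
    (𝓕⁻ θ : Sch n).continuous.enorm.measurable.pow_const q
  have h2 : ∫⁻ x, ‖(𝓕⁻ θ : Sch n) (K • x)‖ₑ ^ q =
      ofReal (K ^ n)⁻¹ * ∫⁻ x, ‖(𝓕⁻ θ : Sch n) x‖ₑ ^ q := by
    have := Measure.map_addHaar_smul (volume : Measure (Rn n)) hK.ne'
    rw [← lintegral_map hm (measurable_const_smul K), this, lintegral_smul_measure]
    simp [abs_of_pos hK]
  simp_rw [h1, mul_rpow_of_nonneg _ _ hq.le]
  have hm' : Measurable fun x => ‖(𝓕⁻ θ : Sch n) (K • x)‖ₑ ^ q := hm.comp (measurable_const_smul K)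
  rw [lintegral_const_mul _ hm', h2, ← mul_assoc,
    mul_rpow_of_nonneg _ _ (by positivity)]
  congr 1
  rw [ofReal_rpow_of_nonneg (by positivity) hq.le, ← ofReal_mul (by positivity),
    ofReal_rpow_of_nonneg (by positivity) (by positivity), ← rpow_natCast, ← rpow_mul hK.le,
    ← rpow_neg hK.le, ← rpow_add hK, ← rpow_mul hK.le]
  congr 2
  field_simp; ring

/-! ### Littlewood–Paley projections -/

/-- The spatial `L^p` norm with a real exponent. -/
abbrev nL (p : ℝ) (f : Rn n → ℂ) : ℝ≥0∞ := eLpNorm' f p volume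

/-- A smooth bump on `ℝⁿ`, equal to `1` on the unit ball and supported in the ball of radius `2`. -/
def bmp (n : ℕ) : ContDiffBump (0 : Rn n) := ⟨1, 2, one_pos, one_lt_two⟩

def lpφ (n : ℕ) : Sch n :=
  HasCompactSupport.toSchwartzMap (f := fun x => ((bmp n x : ℝ) : ℂ))
    ((bmp n).hasCompactSupport.comp_left (g := fun r : ℝ => (r : ℂ)) Complex.ofReal_zero)
    (Complex.ofRealCLM.contDiff.comp (bmp n).contDiff)

lemma lpφ_apply (ξ : Rn n) : lpφ n ξ = ((bmp n ξ : ℝ) : ℂ) := rfl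

lemma lpφ_one {ξ : Rn n} (h : ‖ξ‖ ≤ 1) : lpφ n ξ = 1 := by
  rw [lpφ_apply, (bmp n).one_of_mem_closedBall (by simpa [bmp] using h)]; simp

lemma lpφ_zero {ξ : Rn n} (h : 2 ≤ ‖ξ‖) : lpφ n ξ = 0 := by
  rw [lpφ_apply, (bmp n).zero_of_le_dist (by simpa [bmp] using h)]; simp

lemma norm_lpφ_le (ξ : Rn n) : ‖lpφ n ξ‖ ≤ 1 := by
  rw [lpφ_apply, norm_real, norm_of_nonneg (bmp n).nonneg]; exact (bmp n).le_one

lemma norm_dil_arg (k : ℤ) (ξ : Rn n) : ‖((2 : ℝ) ^ k)⁻¹ • ξ‖ = ‖ξ‖ / 2 ^ k := by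
  rw [norm_smul, norm_of_nonneg (by positivity), div_eq_inv_mul]

lemma dil_lpφ_one {k : ℤ} {ξ : Rn n} (h : ‖ξ‖ ≤ 2 ^ k) : dil k (lpφ n) ξ = 1 := by
  rw [dil_apply, lpφ_one]; rw [norm_dil_arg, div_le_one (by positivity)]; exact h

lemma dil_lpφ_zero {k : ℤ} {ξ : Rn n} (h : 2 ^ (k + 1) ≤ ‖ξ‖) : dil k (lpφ n) ξ = 0 := by
  rw [dil_apply, lpφ_zero]; rw [norm_dil_arg, le_div_iff₀ (by positivity), mul_comm, ← zpow_add_one₀ two_ne_zero]; exact h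

lemma norm_dil_lpφ_le (k : ℤ) (ξ : Rn n) : ‖dil k (lpφ n) ξ‖ ≤ 1 := norm_lpφ_le _

/-- The symbol of the Littlewood–Paley piece at unit frequency. -/
def lpψ (n : ℕ) : Sch n := lpφ n - dil (-1) (lpφ n)

lemma dil_lpψ (k : ℤ) : dil k (lpψ n) = dil k (lpφ n) - dil (k - 1) (lpφ n) := by
  ext ξ
  rw [sub_apply, dil_apply, lpψ, sub_apply, dil_apply, dil_apply, dil_apply, smul_smul]
  congr 3
  rw [zpow_sub₀ two_ne_zero]; simp [div_eq_mul_inv]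

lemma norm_dil_lpψ_le (k : ℤ) (ξ : Rn n) : ‖dil k (lpψ n) ξ‖ ≤ 2 := by
  rw [dil_lpψ, sub_apply]
  refine (norm_sub_le _ _).trans ?_
  linarith [norm_dil_lpφ_le k ξ, norm_dil_lpφ_le (k - 1) ξ]

lemma dil_lpψ_low {k : ℤ} {ξ : Rn n} (h : ‖ξ‖ ≤ 2 ^ (k - 1)) : dil k (lpψ n) ξ = 0 := by
  rw [dil_lpψ, sub_apply, dil_lpφ_one h, dil_lpφ_one (h.trans ?_), sub_self]
  exact zpow_le_zpow_right₀ one_le_two (by omega)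

lemma dil_lpψ_high {k : ℤ} {ξ : Rn n} (h : 2 ^ (k + 1) ≤ ‖ξ‖) : dil k (lpψ n) ξ = 0 := by
  rw [dil_lpψ, sub_apply, dil_lpφ_zero h, dil_lpφ_zero (le_trans ?_ h), sub_self]
  exact zpow_le_zpow_right₀ one_le_two (by omega)

/-- Projection to frequencies `≲ 2^k`. -/
def S (k : ℤ) (f : Sch n) : Sch n := T (dil k (lpφ n)) f

/-- Projection to frequencies `~ 2^k`. -/
def D (k : ℤ) (f : Sch n) : Sch n := T (dil k (lpψ n)) f

lemma fourier_S (k : ℤ) (f : Sch n) (ξ : Rn n) : 𝓕 (S k f) ξ = dil k (lpφ n) ξ * 𝓕 f ξ := fourier_T _ _ _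
lemma fourier_D (k : ℤ) (f : Sch n) (ξ : Rn n) : 𝓕 (D k f) ξ = dil k (lpψ n) ξ * 𝓕 f ξ := fourier_T _ _ _

lemma S_sub_S (k : ℤ) (f : Sch n) : S k f - S (k - 1) f = D k f := by
  refine fourier_injective fun ξ => ?_
  rw [fourier_sub_apply, fourier_S, fourier_S, fourier_D, dil_lpψ, sub_apply]; ring

lemma S_succ (k : ℤ) (f : Sch n) : S (k + 1) f = S k f + D (k + 1) f := by
  rw [← S_sub_S, add_sub_cancel_right]; abel

lemma tendsto_fourierInv_mul {f : Sch n} {θ : ℕ → Sch n} {ℓ : ℂ}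
    (h1 : ∀ j ξ, ‖θ j ξ‖ ≤ 1) (h2 : ∀ ξ ≠ 0, Tendsto (fun j => θ j ξ) atTop (𝓝 ℓ)) (hn : 1 ≤ n) (x : Rn n) :
    Tendsto (fun j => T (θ j) f x) atTop (𝓝 (ℓ * f x)) := by
  have e : ℓ * f x = ∫ ξ, fourierChar (inner ℝ ξ x) • (ℓ * 𝓕 f ξ) := by
    conv_lhs => rw [← fourierInv_fourier_eq (E := Sch n) (F := Sch n) f,
      fourierInv_coe, fourierInv_eq, ← integral_const_mul]
    congr 1; ext ξ; simp only [Circle.smul_def, smul_eq_mul]; ring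
  rw [e]
  have e2 : ∀ j, T (θ j) f x = ∫ ξ, fourierChar (inner ℝ ξ x) • (θ j ξ * 𝓕 f ξ) := fun j => by
    rw [T_eq, fourierInv_eq]
  simp_rw [e2]
  refine tendsto_integral_of_dominated_convergence (fun ξ => ‖𝓕 f ξ‖) ?_ (𝓕 f).integrable.norm ?_ ?_
  · intro j
    refine Continuous.aestronglyMeasurable ?_
    have := continuous_fourierChar
    have := (θ j).continuous
    have := (𝓕 f).continuous
    fun_prop
  · refine fun j => ae_of_all _ fun ξ => ?_
    rw [Circle.norm_smul, norm_mul]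
    exact mul_le_of_le_one_left (norm_nonneg _) (h1 j ξ)
  · have : Nonempty (Fin n) := ⟨⟨0, hn⟩⟩
    have : ∀ᵐ ξ : Rn n, ξ ≠ 0 := by simp [ae_iff, measure_singleton]
    filter_upwards [this] with ξ hξ
    exact ((h2 ξ hξ).mul_const _).const_smul _

lemma tendsto_S_atTop (hn : 1 ≤ n) (k : ℤ) (f : Sch n) (x : Rn n) :
    Tendsto (fun j : ℕ => S (k + j) f x) atTop (𝓝 (f x)) := by
  have := tendsto_fourierInv_mul (f := f) (θ := fun j => dil (k + j) (lpφ n)) (ℓ := 1)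
    (fun j ξ => norm_dil_lpφ_le _ _) (fun ξ _ => ?_) hn x
  · simpa [S] using this
  have h : Tendsto (fun j : ℕ => (2 : ℝ) ^ k * 2 ^ j) atTop atTop :=
    (tendsto_pow_atTop_atTop_of_one_lt one_lt_two).const_mul_atTop (by positivity)
  refine tendsto_const_nhds.congr' ?_
  filter_upwards [h.eventually_ge_atTop ‖ξ‖] with j hj
  rw [dil_lpφ_one]
  rwa [zpow_add₀ two_ne_zero, zpow_natCast]

lemma tendsto_S_atBot (hn : 1 ≤ n) (k : ℤ) (f : Sch n) (x : Rn n) :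
    Tendsto (fun j : ℕ => S (k - j) f x) atTop (𝓝 0) := by
  have := tendsto_fourierInv_mul (f := f) (θ := fun j => dil (k - j) (lpφ n)) (ℓ := 0)
    (fun j ξ => norm_dil_lpφ_le _ _) (fun ξ hξ => ?_) hn x
  · simpa [S] using this
  have h : Tendsto (fun j : ℕ => (2 : ℝ) ^ j * ‖ξ‖) atTop atTop :=
    (tendsto_pow_atTop_atTop_of_one_lt one_lt_two).atTop_mul_const (by positivity)
  refine tendsto_const_nhds.congr' ?_
  filter_upwards [h.eventually_ge_atTop (2 ^ (k + 1))] with j hj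
  rw [dil_lpφ_zero]
  rw [show k - j + 1 = (k + 1) - j by ring, zpow_sub₀ two_ne_zero, zpow_natCast, div_le_iff₀ (by positivity), mul_comm]
  exact hj

lemma nL_add_le {p : ℝ} (hp : 1 ≤ p) (f g : Sch n) : nL p (f + g : Sch n) ≤ nL p f + nL p g :=
  eLpNorm'_add_le f.continuous.aestronglyMeasurable g.continuous.aestronglyMeasurable hp

lemma nL_neg {p : ℝ} (f : Sch n) : nL p (-f : Sch n) = nL p f :=
  eLpNorm'_congr_norm_ae (ae_of_all _ fun _ => norm_neg _)

lemma nL_sub_le {p : ℝ} (hp : 1 ≤ p) (f g : Sch n) : nL p (f - g : Sch n) ≤ nL p f + nL p g := by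
  rw [sub_eq_add_neg]; exact (nL_add_le hp _ _).trans_eq (by rw [nL_neg])

lemma nL_of_tendsto {p : ℝ} (hp : 0 < p) {f : Sch n} {g : ℕ → Sch n} {C : ℝ≥0∞}
    (h : ∀ x, Tendsto (fun j => g j x) atTop (𝓝 (f x))) (hC : ∀ j, nL p (g j) ≤ C) : nL p f ≤ C := by
  refine (Lp.eLpNorm'_lim_le_liminf_eLpNorm' hp (fun j => (g j).continuous.aestronglyMeasurable)
    (ae_of_all _ h)).trans ?_
  exact (liminf_le_liminf (Eventually.of_forall hC)).trans (by simp)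

lemma nL_S_sub_le {p : ℝ} (hp : 1 ≤ p) (k : ℤ) (f : Sch n) (m : ℕ) :
    nL p (S (k + m) f - S k f : Sch n) ≤ ∑ j ∈ range m, nL p (D (k + 1 + j) f) := by
  induction m with
  | zero =>
    rw [Finset.sum_range_zero, Nat.cast_zero, add_zero, sub_self]
    have : ⇑(0 : Sch n) = 0 := rfl
    rw [nL, this, eLpNorm'_zero (by linarith)]
  | succ m ih =>
    rw [sum_range_succ]
    have e : S (k + (m + 1 : ℕ)) f - S k f = (S (k + m) f - S k f) + D (k + 1 + m) f := by
      have := S_succ (k + m) f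
      rw [show k + ((m + 1 : ℕ) : ℤ) = k + m + 1 by push_cast; ring, this, show k + 1 + (m : ℤ) = k + m + 1 by ring]
      abel
    rw [e]
    exact (nL_add_le hp _ _).trans (by gcongr)

lemma nL_sub_S_le (hn : 1 ≤ n) {p : ℝ} (hp : 1 ≤ p) (k : ℤ) (f : Sch n) :
    nL p (f - S k f : Sch n) ≤ ∑' j : ℕ, nL p (D (k + 1 + j) f) := by
  refine nL_of_tendsto (by linarith) (g := fun m : ℕ => S (k + m) f - S k f) (fun x => ?_) fun m =>
    (nL_S_sub_le hp k f m).trans (ENNReal.sum_le_tsum _)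
  exact (tendsto_S_atTop hn k f x).sub_const _

lemma nL_S_le_tsum (hn : 1 ≤ n) {p : ℝ} (hp : 1 ≤ p) (k : ℤ) (f : Sch n) :
    nL p (S k f) ≤ ∑' j : ℕ, nL p (D (k - j) f) := by
  refine nL_of_tendsto (by linarith) (g := fun m : ℕ => S k f - S (k - m) f) (fun x => ?_) fun m => ?_
  · simpa using (tendsto_S_atBot hn k f x).const_sub (S k f x)
  · have h := nL_S_sub_le hp (k - m) f m
    rw [sub_add_cancel] at h
    refine h.trans (le_trans (le_of_eq ?_) (ENNReal.sum_le_tsum (range m)))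
    rw [← Finset.sum_range_reflect]
    refine Finset.sum_congr rfl fun j hj => ?_
    congr 3
    have := Finset.mem_range.1 hj
    omega

lemma nL_le_tsum (hn : 1 ≤ n) {p : ℝ} (hp : 1 ≤ p) (k : ℤ) (f : Sch n) :
    nL p f ≤ ∑' j : ℕ, nL p (D (k - j) f) + ∑' j : ℕ, nL p (D (k + 1 + j) f) := by
  have h := nL_add_le hp (S k f) (f - S k f)
  rw [add_sub_cancel] at h
  exact h.trans (add_le_add (nL_S_le_tsum hn hp k f) (nL_sub_S_le hn hp k f))

/-! ### Multiplier bounds and Bernstein's inequality -/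

lemma nL_eq_eLpNorm {p : ℝ} (hp : 0 < p) (f : Rn n → ℂ) : eLpNorm f (ofReal p) volume = nL p f := by
  rw [eLpNorm_eq_eLpNorm' (by simpa using hp) ofReal_ne_top, ENNReal.toReal_ofReal hp.le]

lemma nL_fourierInv_mul_le {p : ℝ} (hp : 1 ≤ p) (θ : Sch n) (k : ℤ) {h : Rn n → ℂ} (hh : Integrable h) :
    nL p (𝓕⁻ fun ξ => dil k θ ξ * h ξ) ≤ nL 1 (𝓕⁻ θ : Sch n) * nL p (𝓕⁻ h) := by
  have := eLpNorm_fourierInv_mul_le (dil k θ) hh (p := ofReal p) (by simpa using hp) ofReal_ne_top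
  rw [nL_eq_eLpNorm (by linarith), nL_eq_eLpNorm (by linarith), ← ofReal_one, nL_eq_eLpNorm one_pos] at this
  have e := eLpNorm'_fourierInv_dil k θ one_pos
  rw [nL, nL, e] at this
  simpa using this

lemma nL_T_dil_le {p : ℝ} (hp : 1 ≤ p) (θ : Sch n) (k : ℤ) (f : Sch n) :
    nL p (T (dil k θ) f) ≤ nL 1 (𝓕⁻ θ : Sch n) * nL p f := by
  have := nL_fourierInv_mul_le hp θ k (𝓕 f).integrable
  rw [← T_eq, ← fourierInv_coe, fourierInv_fourier_eq] at this
  exact this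

lemma nL_ne_top {p : ℝ} (hp : 0 < p) (f : Sch n) : nL p f ≠ ∞ := by
  rw [← nL_eq_eLpNorm hp]; exact (f.memLp _ volume).2.ne

/-- `f` has Fourier support in the ball of radius `2^k`. -/
def BL (k : ℤ) (f : Sch n) : Prop := ∀ ξ, 2 ^ k < ‖ξ‖ → 𝓕 f ξ = 0

lemma BL.S_eq {k : ℤ} {f : Sch n} (h : BL k f) : S k f = f := by
  refine fourier_injective fun ξ => ?_
  rw [fourier_S]
  rcases le_or_gt ‖ξ‖ (2 ^ k) with h1 | h1
  · rw [dil_lpφ_one h1, one_mul]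
  · rw [h ξ h1, mul_zero]

lemma BL_T {k : ℤ} {θ f : Sch n} (h : ∀ ξ, 2 ^ k < ‖ξ‖ → θ ξ = 0) : BL k (T θ f) := fun ξ hξ => by
  rw [fourier_T, h ξ hξ, zero_mul]

lemma BL_S (k : ℤ) (f : Sch n) : BL (k + 1) (S k f) := BL_T fun _ h => dil_lpφ_zero h.le
lemma BL_D (k : ℤ) (f : Sch n) : BL (k + 1) (D k f) := BL_T fun _ h => dil_lpψ_high h.le

lemma BL.T {k : ℤ} {f : Sch n} (h : BL k f) (θ : Sch n) : BL k (T θ f) := fun ξ hξ => by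
  rw [fourier_T, h ξ hξ, mul_zero]

lemma bernstein_top {p : ℝ} (hp : 1 < p) : ∃ C ≠ ∞, ∀ (k : ℤ) (f : Sch n), BL k f → ∀ x,
    ‖f x‖ₑ ≤ C * ofReal (((2 : ℝ) ^ k) ^ (n / p)) * nL p f := by
  have hpq := (HolderConjugate.conjExponent hp).symm
  set q := conjExponent p
  refine ⟨nL q (𝓕⁻ (lpφ n) : Sch n), nL_ne_top hpq.pos _, fun k f hf x => ?_⟩
  have := enorm_fourierInv_mul_le (dil k (lpφ n)) (𝓕 f).integrable hpq x
  rw [← T_eq, ← fourierInv_coe, fourierInv_fourier_eq,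
    eLpNorm'_fourierInv_dil _ _ hpq.pos] at this
  have e : T (dil k (lpφ n)) f = f := hf.S_eq
  have e2 : 1 - 1 / q = 1 / p := by have := hpq.inv_add_inv_eq_one; simp only [one_div]; linarith
  rw [e, e2, mul_one_div, mul_comm (ofReal _)] at this
  exact this

lemma nL_le_interp {p q : ℝ} (hp : 0 < p) (hpq : p ≤ q) (f : Sch n) {M : ℝ≥0∞} (hM : ∀ x, ‖f x‖ₑ ≤ M) :
    nL q f ≤ nL p f ^ (p / q) * M ^ (1 - p / q) := by
  have hq : 0 < q := hp.trans_le hpq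
  unfold nL eLpNorm'
  calc (∫⁻ x, ‖f x‖ₑ ^ q) ^ (1 / q) ≤ ((∫⁻ x, ‖f x‖ₑ ^ p) * M ^ (q - p)) ^ (1 / q) := by
        gcongr
        rw [← lintegral_mul_const _ (f.continuous.enorm.measurable.pow_const p)]
        refine lintegral_mono fun x => ?_
        calc ‖f x‖ₑ ^ q = ‖f x‖ₑ ^ p * ‖f x‖ₑ ^ (q - p) := by
              rw [← ENNReal.rpow_add_of_nonneg _ _ hp.le (by linarith)]; ring_nf
          _ ≤ _ := mul_le_mul_right (ENNReal.rpow_le_rpow (hM x) (by linarith)) _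
    _ = _ := by
        rw [mul_rpow_of_nonneg _ _ (by positivity), ← ENNReal.rpow_mul, ← ENNReal.rpow_mul]
        congr 2 <;> field_simp

lemma nL_bernstein {p q : ℝ} (hp : 1 < p) (hpq : p ≤ q) : ∃ C ≠ ∞,
    ∀ (k : ℤ) (f : Sch n), BL k f →
    nL q f ≤ C * ofReal (((2 : ℝ) ^ k) ^ (n * (1 / p - 1 / q))) * nL p f := by
  obtain ⟨C, hC, H⟩ := bernstein_top (n := n) hp
  have hq : 0 < q := by linarith
  have h1 : 0 ≤ 1 - p / q := by rw [sub_nonneg, div_le_one hq]; exact hpq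
  refine ⟨C ^ (1 - p / q), ENNReal.rpow_ne_top_of_nonneg h1 hC, fun k f hf => ?_⟩
  refine (nL_le_interp (by linarith) hpq f (H k f hf)).trans_eq ?_
  rw [mul_rpow_of_nonneg _ _ h1, mul_rpow_of_nonneg _ _ h1,
    ofReal_rpow_of_nonneg (by positivity) h1, ← rpow_mul (by positivity), mul_comm, mul_assoc,
    ← ENNReal.rpow_add_of_nonneg _ _ h1 (by positivity)]
  simp only [sub_add_cancel, ENNReal.rpow_one]
  congr 4
  have : p ≠ 0 := by linarith
  field_simp

/-! ### Fourier supports of products -/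

/-- Product of Schwartz functions. -/
def smul2 (f g : Sch n) : Sch n := SchwartzMap.smulLeftCLM ℂ (f : Rn n → ℂ) g

lemma smul2_apply (f g : Sch n) (x : Rn n) : smul2 f g x = f x * g x := by
  rw [smul2, smulLeftCLM_apply_apply f.hasTemperateGrowth, smul_eq_mul]

lemma fourier_eq_fourierInv_neg (f : Sch n) (ξ : Rn n) :
    𝓕 f ξ = (𝓕⁻ f : Sch n) (-ξ) := by
  rw [fourier_coe, fourierInv_coe, fourierInv_eq_fourier_neg, neg_neg]

lemma fourier_smul2_eq_zero {f g : Sch n} {r s : ℝ} (hf : ∀ ξ, r < ‖ξ‖ → 𝓕 f ξ = 0)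
    (hg : ∀ ξ, s < ‖ξ‖ → 𝓕 g ξ = 0) {ξ : Rn n} (h : r + s < ‖ξ‖) : 𝓕 (smul2 f g) ξ = 0 := by
  have e : ⇑(smul2 f g) = fun x => f x * g x := by ext x; exact smul2_apply f g x
  rw [fourier_eq_fourierInv_neg, fourierInv_coe, e, fourierInv_mul_eq f g.integrable]
  refine integral_eq_zero_of_ae (ae_of_all _ fun y => ?_)
  simp only [Pi.zero_apply, mul_eq_zero, ← fourierInv_coe]
  rcases lt_or_ge r ‖y‖ with h1 | h1
  · left; rw [← neg_neg y, ← fourier_eq_fourierInv_neg]; exact hf _ (by rwa [norm_neg])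
  · right
    rw [← neg_neg (-ξ - y), ← fourier_eq_fourierInv_neg]
    refine hg _ ?_
    have := norm_sub_norm_le (ξ) (-y)
    rw [norm_neg] at this
    rw [show -(-ξ - y) = ξ - -y by abel]
    linarith

lemma fourier_sconj (f : Sch n) (ξ : Rn n) : 𝓕 (sconj f) ξ = starRingEnd ℂ (𝓕 f (-ξ)) := by
  rw [fourier_eq_fourierInv_neg, fourierInv_sconj]

lemma cub_eq_smul2 (f : Sch n) : cub f = smul2 (smul2 f (sconj f)) f := by
  ext x
  rw [cub_apply, smul2_apply, smul2_apply, sconj_apply, mul_conj']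

lemma fourier_cub_eq_zero {f : Sch n} {r : ℝ} (hf : ∀ ξ, r < ‖ξ‖ → 𝓕 f ξ = 0) {ξ : Rn n}
    (h : 3 * r < ‖ξ‖) : 𝓕 (cub f) ξ = 0 := by
  have h1 : ∀ ξ, r < ‖ξ‖ → 𝓕 (sconj f) ξ = 0 := fun ξ hξ => by
    rw [fourier_sconj, hf _ (by rwa [norm_neg]), map_zero]
  rw [cub_eq_smul2]
  exact fourier_smul2_eq_zero (fun ξ hξ => fourier_smul2_eq_zero hf h1 hξ) hf (by linarith)

lemma D_cub_S (k : ℤ) (f : Sch n) : D k (cub (S (k - 4) f)) = 0 := by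
  refine fourier_injective fun ξ => ?_
  have e0 : (𝓕 (0 : Sch n)) ξ = 0 := by
    rw [show 𝓕 (0 : Sch n) = 0 from map_zero (SchwartzMap.fourierTransformCLM ℂ)]; rfl
  rw [fourier_D, e0]
  rcases le_or_gt ‖ξ‖ (2 ^ (k - 1)) with h | h
  · rw [dil_lpψ_low h, zero_mul]
  · rw [fourier_cub_eq_zero (r := 2 ^ (k - 3)) ?_ ?_, mul_zero]
    · have := BL_S (k - 4) f
      rwa [show k - 4 + 1 = k - 3 by ring] at this
    · refine lt_trans ?_ h
      rw [show k - 1 = (k - 3) + 2 by ring, zpow_add₀ two_ne_zero]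
      have : (0 : ℝ) < 2 ^ (k - 3) := by positivity
      norm_num; linarith

lemma D_cub_eq (k : ℤ) (f : Sch n) : D k (cub f) = D k (cub f - cub (S (k - 4) f)) := by
  have := D_cub_S k f
  rw [D] at this ⊢
  rw [D, T_sub, this, sub_zero]

section Laplacian

/-! ### The bi-Laplacian on Schwartz functions -/

open scoped Laplacian LineDeriv

def lapS (f : Sch n) : Sch n := Δ f

def bi (f : Sch n) : Sch n := lapS (lapS f)

lemma fourier_lapS (f : Sch n) (ξ : Rn n) : 𝓕 (lapS f) ξ = -((2 * π * ‖ξ‖) ^ 2 : ℝ) * 𝓕 f ξ := by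
  have h : (fun ξ : Rn n => ‖ξ‖ ^ 2).HasTemperateGrowth := by fun_prop
  rw [lapS, SchwartzMap.laplacian_eq_fourierMultiplierCLM, fourier_smul,
    SchwartzMap.fourierMultiplierCLM_apply, fourier_fourierInv_eq,
    smul_apply, smulLeftCLM_apply_apply h, real_smul, real_smul]
  push_cast; ring

lemma lap_coe (f : Sch n) : lap f = lapS f := by
  ext x
  rw [lapS, SchwartzMap.laplacian_eq_sum (EuclideanSpace.basisFun (Fin n) ℝ)]
  simp only [lap, sum_apply, EuclideanSpace.basisFun_apply]
  refine Finset.sum_congr rfl fun i _ => ?_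
  rw [SchwartzMap.lineDerivOp_apply_eq_fderiv]
  rfl

lemma bilap_coe (f : Sch n) : bilap f = bi f := by
  rw [bi, ← lap_coe, ← lap_coe]; rfl

lemma fourier_bi (f : Sch n) (ξ : Rn n) : 𝓕 (bi f) ξ = om ξ * 𝓕 f ξ := by
  rw [bi, fourier_lapS, fourier_lapS, om]; push_cast; ring

lemma bi_sub (f g : Sch n) : bi (f - g) = bi f - bi g :=
  fourier_injective fun ξ => by simp only [fourier_bi, fourier_sub_apply]; ring

lemma bi_T (θ f : Sch n) : bi (T θ f) = T θ (bi f) :=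
  fourier_injective fun ξ => by simp only [fourier_bi, fourier_T]; ring

lemma contDiff_pd {E : Type*} [NormedAddCommGroup E] [NormedSpace ℝ E] {f : E → Rn n → ℂ}
    (h : ContDiff ℝ (⊤ : ℕ∞) (fun p : E × Rn n => f p.1 p.2)) (i : Fin n) :
    ContDiff ℝ (⊤ : ℕ∞) (fun p : E × Rn n => pd i (f p.1) p.2) := by
  unfold pd
  have := ContDiff.fderiv (𝕜 := ℝ) (f := fun (p : E × Rn n) (x : Rn n) => f p.1 x) (g := fun p : E × Rn n => p.2)
    (m := (⊤ : ℕ∞)) (n := (⊤ : ℕ∞)) ?_ contDiff_snd (by simp)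
  · exact this.clm_apply contDiff_const
  · exact h.comp (by fun_prop : ContDiff ℝ (⊤ : ℕ∞) fun q : (E × Rn n) × Rn n => (q.1.1, q.2))

lemma contDiff_lap {E : Type*} [NormedAddCommGroup E] [NormedSpace ℝ E] {f : E → Rn n → ℂ}
    (h : ContDiff ℝ (⊤ : ℕ∞) (fun p : E × Rn n => f p.1 p.2)) :
    ContDiff ℝ (⊤ : ℕ∞) (fun p : E × Rn n => lap (f p.1) p.2) :=
  ContDiff.sum fun i _ => contDiff_pd (f := fun t x => pd i (f t) x) (contDiff_pd h i) i

lemma contDiff_lapS {u : ℝ → Sch n} (h : ContDiff ℝ (⊤ : ℕ∞) (fun p : ℝ × Rn n => u p.1 p.2)) :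
    ContDiff ℝ (⊤ : ℕ∞) (fun p : ℝ × Rn n => lapS (u p.1) p.2) := by
  have := contDiff_lap (f := fun t x => u t x) h
  simpa only [lap_coe] using this

/-! ### `L²` norms and Plancherel -/

lemma nL_two_eq (f : Sch n) : nL 2 f = ofReal ‖L2 f‖ := by
  rw [← nL_eq_eLpNorm two_pos, SchwartzMap.norm_toLp, ofReal_toReal]
  · simp
  · exact (f.memLp 2 volume).2.ne

lemma norm_L2_fourier (f : Sch n) : ‖L2 (𝓕 f)‖ = ‖L2 f‖ := SchwartzMap.norm_fourier_toL2_eq f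

lemma norm_L2_le_of_fourier {f g : Sch n} {c : ℝ} (h : ∀ ξ, ‖𝓕 f ξ‖ ≤ c * ‖𝓕 g ξ‖) :
    ‖L2 f‖ ≤ c * ‖L2 g‖ := by
  rw [← norm_L2_fourier, ← norm_L2_fourier g]; exact norm_L2_le_of_forall h

lemma norm_L2_T_le {θ f : Sch n} {c : ℝ} (h : ∀ ξ, ‖θ ξ‖ ≤ c) : ‖L2 (T θ f)‖ ≤ c * ‖L2 f‖ :=
  norm_L2_le_of_fourier fun ξ => by rw [fourier_T, norm_mul]; gcongr; exact h ξ

lemma norm_L2_S_le (k : ℤ) (f : Sch n) : ‖L2 (S k f)‖ ≤ ‖L2 f‖ := by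
  simpa [S] using norm_L2_T_le (f := f) (norm_dil_lpφ_le k)

lemma norm_L2_D_le (k : ℤ) (f : Sch n) : ‖L2 (D k f)‖ ≤ 2 * ‖L2 f‖ :=
  norm_L2_T_le (norm_dil_lpψ_le k)

lemma L2_add (f g : Sch n) : L2 (f + g) = L2 f + L2 g := (toLpCLM ℂ ℂ 2 volume).map_add f g
lemma L2_smul (c : ℂ) (f : Sch n) : L2 (c • f) = c • L2 f := (toLpCLM ℂ ℂ 2 volume).map_smul c f
lemma L2_zero : L2 (0 : Sch n) = 0 := (toLpCLM ℂ ℂ 2 volume).map_zero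

lemma inner_L2_fourier (f g : Sch n) : inner ℂ (L2 (𝓕 f)) (L2 (𝓕 g)) = inner ℂ (L2 f) (L2 g) := by
  rw [show L2 (𝓕 f) = Lp.fourierTransformₗᵢ (Rn n) ℂ (L2 f) from (toLp_fourier_eq f).symm,
    show L2 (𝓕 g) = Lp.fourierTransformₗᵢ (Rn n) ℂ (L2 g) from (toLp_fourier_eq g).symm,
    LinearIsometryEquiv.inner_map_map]

lemma inner_L2_eq (f g : Sch n) : inner ℂ (L2 f) (L2 g) = ∫ x, starRingEnd ℂ (f x) * g x := by
  have := inner_toL2_toL2_eq f g volume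
  rw [this]; congr 1; ext x; rw [RCLike.inner_apply, mul_comm]

lemma inner_L2_eq_fourier (f g : Sch n) :
    inner ℂ (L2 f) (L2 g) = ∫ ξ, starRingEnd ℂ (𝓕 f ξ) * 𝓕 g ξ := by
  rw [← inner_L2_fourier, inner_L2_eq]

/-- Self-adjoint multipliers can be moved across the inner product. -/
lemma inner_L2_symm {f g f' g' : Sch n} {m : Rn n → ℝ} (hf : ∀ ξ, 𝓕 f' ξ = m ξ * 𝓕 f ξ)
    (hg : ∀ ξ, 𝓕 g' ξ = m ξ * 𝓕 g ξ) : inner ℂ (L2 f') (L2 g) = inner ℂ (L2 f) (L2 g') := by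
  rw [inner_L2_eq_fourier, inner_L2_eq_fourier]
  congr 1; ext ξ
  rw [hf, hg, map_mul, conj_ofReal]; ring

lemma norm_bi_sq_le (f : Sch n) : ‖L2 (bi f)‖ ^ 2 ≤ ‖L2 f‖ * ‖L2 (bi (bi f))‖ := by
  have h : inner ℂ (L2 (bi f)) (L2 (bi f)) = inner ℂ (L2 f) (L2 (bi (bi f))) :=
    inner_L2_symm (fourier_bi f) (fourier_bi (bi f))
  have h2 := inner_self_eq_norm_sq_to_K (𝕜 := ℂ) (L2 (bi f))
  rw [h] at h2
  calc ‖L2 (bi f)‖ ^ 2 = ‖inner ℂ (L2 f) (L2 (bi (bi f)))‖ := by rw [h2]; simp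
    _ ≤ _ := norm_inner_le_norm _ _

/-! ### Differentiability in `L²` -/

lemma norm_L2_sub_le_of_hasDerivAt {f g : ℝ → Sch n} {a b C : ℝ} (hab : a ≤ b)
    (hg : Continuous fun p : ℝ × Rn n => g p.1 p.2)
    (hd : ∀ t ∈ Icc a b, ∀ x, HasDerivAt (fun τ => f τ x) (g t x) t)
    (hC : ∀ t ∈ Icc a b, ‖L2 (g t)‖ ≤ C) : ‖L2 (f b) - L2 (f a)‖ ≤ C * (b - a) := by
  have hC0 : 0 ≤ C := (norm_nonneg _).trans (hC a ⟨le_rfl, hab⟩)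
  have hgx : ∀ x, Continuous fun t => g t x := fun x => hg.comp (by fun_prop : Continuous fun t : ℝ => (t, x))
  have h1 : ∀ x, ‖f b x - f a x‖ₑ ≤ ∫⁻ t in Icc a b, ‖g t x‖ₑ := fun x => by
    rw [← intervalIntegral.integral_eq_sub_of_hasDerivAt (f := fun τ => f τ x) (f' := fun τ => g τ x)
      (fun t ht => hd t (by rwa [uIcc_of_le hab] at ht) x) ((hgx x).intervalIntegrable _ _),
      integral_of_le hab]
    refine (enorm_integral_le_lintegral_enorm _).trans ?_
    exact lintegral_mono_set Set.Ioc_subset_Icc_self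
  have h2 : ∀ x, ‖f b x - f a x‖ₑ ^ (2 : ℝ) ≤ ofReal (b - a) * ∫⁻ t in Icc a b, ‖g t x‖ₑ ^ (2 : ℝ) := fun x => by
    have := lintegral_mul_le_Lp_mul_Lq (volume.restrict (Icc a b)) HolderConjugate.two_two
      (f := fun _ => 1) (g := fun t => ‖g t x‖ₑ) aemeasurable_const (hgx x).enorm.measurable.aemeasurable
    simp only [Pi.mul_apply, one_mul, ENNReal.one_rpow, lintegral_const, Measure.restrict_apply_univ,
      volume_Icc] at this
    calc _ ≤ (ofReal (b - a) ^ (1 / 2 : ℝ) * (∫⁻ t in Icc a b, ‖g t x‖ₑ ^ (2 : ℝ)) ^ (1 / 2 : ℝ)) ^ (2 : ℝ) :=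
          ENNReal.rpow_le_rpow ((h1 x).trans this) (by norm_num)
      _ = _ := by
          rw [mul_rpow_of_nonneg _ _ (by norm_num), ← ENNReal.rpow_mul, ← ENNReal.rpow_mul]; norm_num
  have h3 : ∀ h : Sch n, ∫⁻ x, ‖h x‖ₑ ^ (2 : ℝ) = ofReal (‖L2 h‖) ^ (2 : ℝ) := fun h => by
    rw [← nL_two_eq, nL, eLpNorm', ← ENNReal.rpow_mul]; norm_num
  have hm : Measurable fun p : Rn n × ℝ => ‖g p.2 p.1‖ₑ ^ (2 : ℝ) :=
    (hg.comp continuous_swap).enorm.measurable.pow_const _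
  have h4 : ofReal (‖L2 (f b - f a)‖) ^ (2 : ℝ) ≤ (ofReal (C * (b - a))) ^ (2 : ℝ) := by
    rw [← h3]
    calc _ ≤ ∫⁻ x, ofReal (b - a) * ∫⁻ t in Icc a b, ‖g t x‖ₑ ^ (2 : ℝ) := lintegral_mono h2
      _ = ofReal (b - a) * ∫⁻ t in Icc a b, ∫⁻ x, ‖g t x‖ₑ ^ (2 : ℝ) := by
        rw [lintegral_const_mul _ hm.lintegral_prod_right', lintegral_lintegral_swap hm.aemeasurable]
      _ ≤ ofReal (b - a) * ∫⁻ t in Icc a b, ofReal C ^ (2 : ℝ) := by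
        refine mul_le_mul_right (setLIntegral_mono measurable_const fun t ht => ?_) _
        rw [h3]
        exact ENNReal.rpow_le_rpow (ofReal_le_ofReal (hC t ht)) (by norm_num)
      _ = _ := by
        rw [lintegral_const, Measure.restrict_apply_univ, volume_Icc, ofReal_mul hC0,
          mul_rpow_of_nonneg _ _ (by norm_num), ENNReal.rpow_two, ENNReal.rpow_two]
        ring
  rw [← L2_sub]
  have h5 := (ENNReal.rpow_le_rpow_iff (by norm_num)).1 h4
  exact (ofReal_le_ofReal_iff (mul_nonneg hC0 (by linarith))).1 h5

lemma hasDerivAt_L2 {f g : ℝ → Sch n} {a b t : ℝ} (ht : t ∈ Ioo a b)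
    (hg : Continuous fun p : ℝ × Rn n => g p.1 p.2)
    (hd : ∀ t ∈ Icc a b, ∀ x, HasDerivAt (fun τ => f τ x) (g t x) t)
    (hc : ContinuousOn (fun t => L2 (g t)) (Icc a b)) : HasDerivAt (fun τ => L2 (f τ)) (L2 (g t)) t := by
  have hgt := (hc.continuousAt (Icc_mem_nhds ht.1 ht.2))
  rw [hasDerivAt_iff_isLittleO, Asymptotics.isLittleO_iff]
  intro ε hε
  obtain ⟨r, hr, hball⟩ := Metric.eventually_nhds_iff_ball.1
    ((Metric.tendsto_nhds.1 hgt ε hε).and (Icc_mem_nhds ht.1 ht.2))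
  filter_upwards [Metric.ball_mem_nhds t hr] with τ hτ
  have hseg : ∀ s ∈ Set.uIcc t τ, s ∈ ball t r := fun s hs =>
    (convex_ball t r).ordConnected.uIcc_subset (Metric.mem_ball_self hr) hτ hs
  have key : ∀ c d, c ≤ d → (∀ s ∈ Icc c d, s ∈ ball t r) →
      ‖L2 (f d) - L2 (f c) - (d - c : ℝ) • L2 (g t)‖ ≤ ε * (d - c) := by
    intro c d hcd hs
    have := norm_L2_sub_le_of_hasDerivAt (f := fun s => f s - (s : ℂ) • g t) (g := fun s => g s - g t) (C := ε) hcd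
      (hg.sub ((g t).continuous.comp continuous_snd)) (fun s hs' x => ?_) (fun s hs' => ?_)
    · convert this using 2
      rw [L2_sub, L2_sub, L2_smul, L2_smul, Complex.coe_smul, Complex.coe_smul, sub_smul]; abel
    · have h1 := hd s (hball s (hs s hs')).2 x
      have h2 : HasDerivAt (fun τ : ℝ => (τ : ℂ) * g t x) (1 * g t x) s :=
        (HasDerivAt.ofReal_comp (hasDerivAt_id s)).mul_const _
      exact (h1.sub h2).congr_deriv (by simp)
    · have := (hball s (hs s hs')).1
      rw [dist_eq_norm, ← L2_sub] at this
      exact this.le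
  rcases le_total t τ with h | h
  · rw [norm_of_nonneg (by linarith)]
    exact key t τ h (by rwa [uIcc_of_le h] at hseg)
  · have := key τ t h (by rwa [Set.uIcc_of_ge h] at hseg)
    have e : L2 (f τ) - L2 (f t) - (τ - t) • L2 (g t) = -(L2 (f t) - L2 (f τ) - (t - τ) • L2 (g t)) := by
      rw [show τ - t = -(t - τ) by ring, neg_smul]; abel
    rw [norm_of_nonpos (by linarith), e, norm_neg]
    exact this.trans_eq (by ring)

lemma HasDerivAt.L2_T {v : ℝ → Sch n} {w : Sch n} {t : ℝ}
    (h : HasDerivAt (fun τ => L2 (v τ)) (L2 w) t) (θ : Sch n) :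
    HasDerivAt (fun τ => L2 (T θ (v τ))) (L2 (T θ w)) t := by
  obtain ⟨c, hc⟩ : ∃ c, ∀ ξ, ‖θ ξ‖ ≤ c := ⟨_, (norm_le_seminorm ℝ θ)⟩
  rw [hasDerivAt_iff_isLittleO] at h ⊢
  refine Asymptotics.IsBigO.trans_isLittleO (Asymptotics.IsBigO.of_bound c (Eventually.of_forall fun τ => ?_)) h
  have e : ∀ a b w : Sch n, L2 a - L2 b - (τ - t) • L2 w = L2 (a - b - ((τ - t : ℝ) : ℂ) • w) := fun a b w => by
    rw [L2_sub, L2_sub, L2_smul, Complex.coe_smul]; rfl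
  rw [e, e, ← T_sub, ← T_smul, ← T_sub]
  exact norm_L2_T_le hc

lemma ContinuousOn.L2_T {v : ℝ → Sch n} {J : Set ℝ}
    (h : ContinuousOn (fun τ => L2 (v τ)) J) (θ : Sch n) :
    ContinuousOn (fun τ => L2 (T θ (v τ))) J := by
  obtain ⟨c, hc⟩ : ∃ c, ∀ ξ, ‖θ ξ‖ ≤ c := ⟨_, (norm_le_seminorm ℝ θ)⟩
  intro t ht
  have h := h t ht
  rw [ContinuousWithinAt, tendsto_iff_norm_sub_tendsto_zero] at h ⊢
  refine squeeze_zero (fun _ => norm_nonneg _) (fun τ => ?_) (by simpa using h.const_mul c)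
  rw [← L2_sub, ← T_sub, ← L2_sub]
  exact norm_L2_T_le hc

end Laplacian

/-! ### Summation over frequencies -/

lemma tsum_le_of_geometric {a : ℕ → ℝ≥0∞} {c r : ℝ} (hr : 0 ≤ r) (hr1 : r < 1)
    (h : ∀ j, a j ≤ ofReal (c * r ^ j)) : ∑' j, a j ≤ ofReal (c / (1 - r)) := by
  rcases le_total c 0 with hc | hc
  · have : ∀ j, a j = 0 := fun j => le_antisymm ((h j).trans_eq (ENNReal.ofReal_of_nonpos
      (mul_nonpos_of_nonpos_of_nonneg hc (pow_nonneg hr j)))) zero_le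
    simp [this]
  refine (ENNReal.tsum_le_tsum h).trans ?_
  have hs := (summable_geometric_of_lt_one hr hr1).mul_left c
  rw [← ENNReal.ofReal_tsum_of_nonneg (fun j => mul_nonneg hc (pow_nonneg hr j)) hs, tsum_mul_left,
    tsum_geometric_of_lt_one hr hr1, div_eq_mul_inv]

/-- The supremum norm. -/
def sN (f : Rn n → ℂ) : ℝ≥0∞ := ⨆ x, ‖f x‖ₑ

lemma le_sN (f : Rn n → ℂ) (x : Rn n) : ‖f x‖ₑ ≤ sN f := le_iSup (fun x => ‖f x‖ₑ) x

lemma sN_le {f : Rn n → ℂ} {C : ℝ≥0∞} (h : ∀ x, ‖f x‖ₑ ≤ C) : sN f ≤ C := iSup_le h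

lemma sN_of_tendsto {f : Sch n} {g : ℕ → Sch n} {C : ℝ≥0∞}
    (h : ∀ x, Tendsto (fun m => g m x) atTop (𝓝 (f x))) (hg : ∀ m, sN (g m) ≤ C) : sN f ≤ C :=
  sN_le fun x => le_of_tendsto (h x).enorm (Eventually.of_forall fun m => (le_sN _ x).trans (hg m))

lemma sN_add_le (f g : Sch n) : sN (f + g : Sch n) ≤ sN f + sN g :=
  sN_le fun x => (enorm_add_le _ _).trans (add_le_add (le_sN _ x) (le_sN _ x))

lemma sN_S_sub_le (k : ℤ) (f : Sch n) (m : ℕ) :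
    sN (S (k + m) f - S k f : Sch n) ≤ ∑ j ∈ range m, sN (D (k + 1 + j) f) := by
  induction m with
  | zero => exact sN_le fun x => by simp
  | succ m ih =>
    have e : S (k + (m + 1 : ℕ)) f - S k f = (S (k + m) f - S k f) + D (k + 1 + m) f := by
      rw [Nat.cast_succ, ← add_assoc, S_succ, show k + (m : ℤ) + 1 = k + 1 + m by ring]; abel
    rw [e, sum_range_succ]
    exact (sN_add_le _ _).trans (add_le_add ih le_rfl)

lemma sN_sub_S_le (hn : 1 ≤ n) (k : ℤ) (f : Sch n) :
    sN (f - S k f : Sch n) ≤ ∑' j : ℕ, sN (D (k + 1 + j) f) := by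
  refine sN_of_tendsto (g := fun m : ℕ => S (k + m) f - S k f) (fun x => ?_) fun m =>
    (sN_S_sub_le k f m).trans (ENNReal.sum_le_tsum _)
  exact (tendsto_S_atTop hn k f x).sub_const _

lemma D_T (k : ℤ) (θ f : Sch n) : D k (T θ f) = T θ (D k f) :=
  fourier_injective fun ξ => by simp only [fourier_D, fourier_T]; ring

lemma D_bi (k : ℤ) (f : Sch n) : D k (bi f) = bi (D k f) := (bi_T _ _).symm
lemma S_bi (k : ℤ) (f : Sch n) : S k (bi f) = bi (S k f) := (bi_T _ _).symm

lemma norm_L2_bi_le_of_BL {k : ℤ} {f : Sch n} (h : BL k f) :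
    ‖L2 (bi f)‖ ≤ (2 * π) ^ 4 * (2 ^ k) ^ 4 * ‖L2 f‖ := by
  refine norm_L2_le_of_fourier fun ξ => ?_
  rcases le_or_gt ‖ξ‖ (2 ^ k) with hξ | hξ
  · rw [fourier_bi, norm_mul, om]
    rw [norm_real, norm_of_nonneg (by positivity), ← mul_pow]
    gcongr
  · rw [fourier_bi, h ξ hξ]; simp

lemma BL.bi {k : ℤ} {f : Sch n} (h : BL k f) : BL k (bi f) := fun ξ hξ => by
  rw [fourier_bi, h ξ hξ, mul_zero]

/-! ### A quantitative class of regular functions -/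

/-- Membership in a ball of a weighted Besov space of order ten. -/
def NB (R : ℝ) (f : Sch n) : Prop :=
  ‖L2 f‖ ≤ R ∧ ∀ k : ℤ, ‖L2 (D k f)‖ ≤ R * ((2 : ℝ) ^ k)⁻¹ ^ 10

lemma NB.nonneg {R : ℝ} {f : Sch n} (h : NB R f) : 0 ≤ R := (norm_nonneg _).trans h.1

lemma NB.mono {R R' : ℝ} {f : Sch n} (h : NB R f) (hR : R ≤ R') : NB R' f :=
  ⟨h.1.trans hR, fun k => (h.2 k).trans (by gcongr)⟩

lemma two_zpow_add_nat (k : ℤ) (j : ℕ) : (2 : ℝ) ^ (k + j) = 2 ^ k * 2 ^ j := by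
  rw [zpow_add₀ two_ne_zero, zpow_natCast]

lemma two_zpow_sub_nat (k : ℤ) (j : ℕ) : (2 : ℝ) ^ (k - j) = 2 ^ k * (1 / 2) ^ j := by
  rw [zpow_sub₀ two_ne_zero, zpow_natCast, one_div, inv_pow, div_eq_mul_inv]

lemma NB.norm_bi_bi_le (hn : 1 ≤ n) {R : ℝ} {f : Sch n} (h : NB R f) :
    ‖L2 (bi (bi f))‖ ≤ 4 * (2 * π) ^ 8 * 2 ^ 8 * R := by
  have hR := h.nonneg
  have key : ∀ (k : ℤ) (g : Sch n), BL k g → ‖L2 (bi (bi g))‖ ≤ (2 * π) ^ 8 * (2 ^ k) ^ 8 * ‖L2 g‖ := by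
    intro k g hg
    calc _ ≤ (2 * π) ^ 4 * (2 ^ k) ^ 4 * ((2 * π) ^ 4 * (2 ^ k) ^ 4 * ‖L2 g‖) :=
          (norm_L2_bi_le_of_BL hg.bi).trans (by gcongr; exact norm_L2_bi_le_of_BL hg)
      _ = _ := by ring
  have h1 := nL_add_le one_le_two (S 0 (bi (bi f))) (bi (bi f) - S 0 (bi (bi f)))
  rw [add_sub_cancel] at h1
  have h2 : nL 2 (S 0 (bi (bi f))) ≤ ofReal ((2 * π) ^ 8 * 2 ^ 8 * R) := by
    rw [nL_two_eq, S_bi, S_bi]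
    refine ofReal_le_ofReal ((key _ _ (BL_S 0 f)).trans ?_)
    rw [zero_add, zpow_one]
    gcongr
    exact (norm_L2_S_le _ _).trans h.1
  have h3 : nL 2 (bi (bi f) - S 0 (bi (bi f)) : Sch n) ≤
      ofReal ((2 * π) ^ 8 * 2 ^ 8 * R / (1 - 1 / 2)) := by
    refine (nL_sub_S_le hn one_le_two 0 _).trans (tsum_le_of_geometric (by norm_num) (by norm_num) fun j => ?_)
    rw [nL_two_eq, D_bi, D_bi]
    refine ofReal_le_ofReal ((key _ _ (BL_D _ f)).trans ?_)
    have e : (2 : ℝ) ^ ((0 : ℤ) + 1 + j) = 2 * 2 ^ j := by rw [zero_add, two_zpow_add_nat, zpow_one]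
    have e2 : (2 : ℝ) ^ ((0 : ℤ) + 1 + j + 1) = 2 * (2 * 2 ^ j) := by
      rw [zpow_add_one₀ two_ne_zero, e]; ring
    have h4 := h.2 (0 + 1 + j)
    rw [e] at h4
    rw [e2]
    have hp : (1 : ℝ) ≤ 2 ^ j := one_le_pow₀ one_le_two
    calc _ ≤ (2 * π) ^ 8 * (2 * (2 * 2 ^ j)) ^ 8 * (R * (2 * 2 ^ j)⁻¹ ^ 10) := by gcongr
      _ = (2 * π) ^ 8 * 2 ^ 8 * R * ((2 * 2 ^ j)⁻¹ ^ 2) := by field_simp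
      _ ≤ (2 * π) ^ 8 * 2 ^ 8 * R * (1 / 2) ^ j := by
        gcongr
        rw [one_div, inv_pow, inv_pow]
        gcongr
        nlinarith
  have h5 := h1.trans (add_le_add h2 h3)
  rw [nL_two_eq, ← ofReal_add (by positivity) (by positivity)] at h5
  refine ((ofReal_le_ofReal_iff (by positivity)).1 h5).trans ?_
  have : 0 ≤ (2 * π) ^ 8 * 2 ^ 8 * R := by positivity
  calc _ = 3 * ((2 * π) ^ 8 * 2 ^ 8 * R) := by ring
    _ ≤ 4 * ((2 * π) ^ 8 * 2 ^ 8 * R) := by gcongr; norm_num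
    _ = _ := by ring

lemma exists_sup_bound (hn : 1 ≤ n) (hn' : n ≤ 14) : ∃ C > 0, ∀ (R : ℝ) (f : Sch n), NB R f →
    ∀ x, ‖f x‖ ≤ C * R := by
  obtain ⟨C, hC, hB⟩ := bernstein_top (n := n) one_lt_two
  refine ⟨C.toReal * 2 ^ 10 * 3 + 1, by positivity, fun R f h x => ?_⟩
  have hR := h.nonneg
  have hCe : C = ofReal C.toReal := (ofReal_toReal hC).symm
  have hpow : ∀ a : ℝ, 1 ≤ a → a ^ ((n : ℝ) / 2) ≤ a ^ 7 := fun a ha => by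
    rw [← rpow_natCast]
    refine rpow_le_rpow_of_exponent_le ha ?_
    have : (n : ℝ) ≤ 14 := by exact_mod_cast hn'
    push_cast; linarith
  have h1 := sN_add_le (S 0 f) (f - S 0 f)
  rw [add_sub_cancel] at h1
  have h2 : sN (S 0 f) ≤ ofReal (C.toReal * 2 ^ 10 * R) := by
    refine sN_le fun y => (hB _ _ (BL_S 0 f) y).trans ?_
    rw [nL_two_eq]
    nth_rw 1 [hCe]
    rw [← ofReal_mul (by positivity), ← ofReal_mul (by positivity), zero_add, zpow_one]
    refine ofReal_le_ofReal ?_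
    gcongr
    · exact (hpow 2 one_le_two).trans (by norm_num)
    · exact (norm_L2_S_le _ _).trans h.1
  have h3 : sN (f - S 0 f : Sch n) ≤ ofReal (C.toReal * 2 ^ 10 * R / (1 - 1 / 2)) := by
    refine (sN_sub_S_le hn 0 _).trans (tsum_le_of_geometric (by norm_num) (by norm_num) fun j => ?_)
    refine sN_le fun y => (hB _ _ (BL_D _ f) y).trans ?_
    have e : (2 : ℝ) ^ ((0 : ℤ) + 1 + j) = 2 * 2 ^ j := by rw [zero_add, two_zpow_add_nat, zpow_one]
    have e2 : (2 : ℝ) ^ ((0 : ℤ) + 1 + j + 1) = 2 * (2 * 2 ^ j) := by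
      rw [zpow_add_one₀ two_ne_zero, e]; ring
    rw [nL_two_eq]
    nth_rw 1 [hCe]
    rw [← ofReal_mul (by positivity), ← ofReal_mul (by positivity)]
    refine ofReal_le_ofReal ?_
    have h4 := h.2 (0 + 1 + j)
    rw [e] at h4
    rw [e2]
    have hp : (1 : ℝ) ≤ 2 ^ j := one_le_pow₀ one_le_two
    calc _ ≤ C.toReal * (2 * (2 * 2 ^ j)) ^ 7 * (R * (2 * 2 ^ j)⁻¹ ^ 10) := by
          gcongr
          exact hpow _ (by linarith)
      _ = C.toReal * 2 ^ 7 * R * ((2 * 2 ^ j)⁻¹ ^ 3) := by field_simp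
      _ ≤ C.toReal * 2 ^ 10 * R * (1 / 2) ^ j := by
        have : (2 * (2 : ℝ) ^ j)⁻¹ ^ 3 ≤ (1 / 2) ^ j := by
          rw [one_div, inv_pow, inv_pow]
          gcongr
          nlinarith [mul_nonneg (sub_nonneg.2 hp) (sub_nonneg.2 hp)]
        gcongr; norm_num; norm_num
  have h5 := (le_sN f x).trans (h1.trans (add_le_add h2 h3))
  rw [← ofReal_add (by positivity) (by positivity), ← ofReal_norm] at h5
  refine ((ofReal_le_ofReal_iff (by positivity)).1 h5).trans ?_
  calc _ = (C.toReal * 2 ^ 10 * 3 + 1) * R - R := by ring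
    _ ≤ _ := sub_le_self _ hR

/-! ### Regular solutions -/

def rhs (f : Sch n) : Sch n := I • (bi f + cub f)

structure IsSol (u : ℝ → Sch n) (a b : ℝ) : Prop where
  smooth : ContDiff ℝ (⊤ : ℕ∞) fun p : ℝ × Rn n => u p.1 p.2
  deriv : ∀ t ∈ Icc a b, ∀ x, HasDerivAt (fun τ => u τ x) (rhs (u t) x) t

structure NiceSol (u : ℝ → Sch n) (a b R : ℝ) : Prop extends IsSol u a b where
  nb : ∀ t ∈ Icc a b, NB R (u t)

variable {u : ℝ → Sch n} {a b R : ℝ}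

lemma rhs_apply (f : Sch n) (x : Rn n) : rhs f x = I * (bi f x + cub f x) := rfl

lemma L2_rhs (f : Sch n) : L2 (rhs f) = I • (L2 (bi f) + L2 (cub f)) := by
  rw [rhs, L2_smul, L2_add]

lemma IsSol.mono {c d : ℝ} (h : IsSol u a b) (hc : a ≤ c) (hd : d ≤ b) : IsSol u c d :=
  ⟨h.smooth, fun t ht => h.deriv t ⟨hc.trans ht.1, ht.2.trans hd⟩⟩

lemma NiceSol.mono {c d : ℝ} (h : NiceSol u a b R) (hc : a ≤ c) (hd : d ≤ b) :
    NiceSol u c d R :=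
  ⟨h.toIsSol.mono hc hd, fun t ht => h.nb t ⟨hc.trans ht.1, ht.2.trans hd⟩⟩

lemma IsSol.continuous (h : IsSol u a b) :
    Continuous fun p : ℝ × Rn n => u p.1 p.2 := h.smooth.continuous

lemma IsSol.continuous_rhs (h : IsSol u a b) :
    Continuous fun p : ℝ × Rn n => rhs (u p.1) p.2 := by
  have h1 : Continuous fun p : ℝ × Rn n => bi (u p.1) p.2 :=
    (contDiff_lapS (u := fun t => lapS (u t)) (contDiff_lapS h.smooth)).continuous
  have h2 : Continuous fun p : ℝ × Rn n => cub (u p.1) p.2 := by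
    simp only [cub_apply]
    have := h.continuous
    fun_prop
  exact continuous_const.mul (h1.add h2)

lemma norm_L2_cub_le {f : Sch n} {B : ℝ} (hB : ∀ x, ‖f x‖ ≤ B) : ‖L2 (cub f)‖ ≤ B ^ 2 * ‖L2 f‖ := by
  refine norm_L2_le_of_forall fun x => ?_
  rw [cub_apply, norm_mul, norm_pow, norm_real, norm_norm]
  gcongr
  exact hB x

namespace NiceSol

lemma exists_bound (hn : 1 ≤ n) (hn' : n ≤ 14) (h : NiceSol u a b R) : ∃ B, ∀ t ∈ Icc a b, ∀ x, ‖u t x‖ ≤ B := by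
  obtain ⟨C, -, hC⟩ := exists_sup_bound hn hn'
  exact ⟨C * R, fun t ht => hC R _ (h.nb t ht)⟩

lemma exists_norm_rhs_le (hn : 1 ≤ n) (hn' : n ≤ 14) (h : NiceSol u a b R) :
    ∃ C, ∀ t ∈ Icc a b, ‖L2 (rhs (u t))‖ ≤ C := by
  obtain ⟨B, hB⟩ := h.exists_bound hn hn'
  refine ⟨√(R * (4 * (2 * π) ^ 8 * 2 ^ 8 * R)) + B ^ 2 * R, fun t ht => ?_⟩
  have hR := (h.nb t ht).nonneg
  rw [L2_rhs, norm_smul, norm_I, one_mul]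
  refine (norm_add_le _ _).trans (add_le_add (le_sqrt_of_sq_le ?_) ?_)
  · exact (norm_bi_sq_le _).trans (mul_le_mul (h.nb t ht).1 ((h.nb t ht).norm_bi_bi_le hn) (norm_nonneg _) hR)
  · exact (norm_L2_cub_le (hB t ht)).trans (by gcongr; exact (h.nb t ht).1)

lemma continuousOn_L2 (hn : 1 ≤ n) (hn' : n ≤ 14) (h : NiceSol u a b R) :
    ContinuousOn (fun t => L2 (u t)) (Icc a b) := by
  obtain ⟨C, hC⟩ := h.exists_norm_rhs_le hn hn'
  have key : ∀ s ∈ Icc a b, ∀ t ∈ Icc a b, s ≤ t → ‖L2 (u t) - L2 (u s)‖ ≤ C * (t - s) := fun s hs t ht hst =>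
    norm_L2_sub_le_of_hasDerivAt hst h.continuous_rhs (fun τ hτ => h.deriv τ ⟨hs.1.trans hτ.1, hτ.2.trans ht.2⟩)
      fun τ hτ => hC τ ⟨hs.1.trans hτ.1, hτ.2.trans ht.2⟩
  have : LipschitzOnWith C.toNNReal (fun t => L2 (u t)) (Icc a b) := by
    refine LipschitzOnWith.of_dist_le_mul fun s hs t ht => ?_
    have hC0 : 0 ≤ C := (norm_nonneg _).trans (hC s hs)
    rw [coe_toNNReal _ hC0, dist_eq_norm, dist_eq]
    rcases le_total s t with hst | hst
    · rw [norm_sub_rev, abs_sub_comm, abs_of_nonneg (by linarith)]; exact key s hs t ht hst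
    · rw [abs_of_nonneg (by linarith)]; exact key t ht s hs hst
  exact this.continuousOn

lemma continuousOn_bi (hn : 1 ≤ n) (hn' : n ≤ 14) (h : NiceSol u a b R) :
    ContinuousOn (fun t => L2 (bi (u t))) (Icc a b) := by
  intro t ht
  have h1 := h.continuousOn_L2 hn hn' t ht
  rw [ContinuousWithinAt, tendsto_iff_norm_sub_tendsto_zero] at h1 ⊢
  set C := 4 * (2 * π) ^ 8 * 2 ^ 8 * R with hC
  have h2 : Tendsto (fun τ => √(‖L2 (u τ) - L2 (u t)‖ * (C + C))) (𝓝[Icc a b] t) (𝓝 0) := by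
    simpa using (h1.mul_const (C + C)).sqrt
  refine squeeze_zero' (Eventually.of_forall fun _ => norm_nonneg _) ?_ h2
  filter_upwards [self_mem_nhdsWithin] with τ hτ
  rw [← L2_sub, ← L2_sub, ← bi_sub]
  refine le_sqrt_of_sq_le ((norm_bi_sq_le _).trans (mul_le_mul_of_nonneg_left ?_ (norm_nonneg _)))
  rw [bi_sub, bi_sub, L2_sub]
  exact (norm_sub_le _ _).trans (add_le_add ((h.nb τ hτ).norm_bi_bi_le hn) ((h.nb t ht).norm_bi_bi_le hn))

lemma continuousOn_cub (hn : 1 ≤ n) (hn' : n ≤ 14) (h : NiceSol u a b R) :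
    ContinuousOn (fun t => L2 (cub (u t))) (Icc a b) := by
  obtain ⟨B, hB⟩ := h.exists_bound hn hn'
  exact ContinuousOn.cub (h.continuousOn_L2 hn hn') hB

lemma continuousOn_rhs (hn : 1 ≤ n) (hn' : n ≤ 14) (h : NiceSol u a b R) :
    ContinuousOn (fun t => L2 (rhs (u t))) (Icc a b) := by
  simp only [L2_rhs]
  exact ((h.continuousOn_bi hn hn').add (h.continuousOn_cub hn hn')).const_smul I

lemma hasDerivAt_L2 (hn : 1 ≤ n) (hn' : n ≤ 14) (h : NiceSol u a b R) {t : ℝ} (ht : t ∈ Ioo a b) :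
    HasDerivAt (fun τ => L2 (u τ)) (L2 (rhs (u t))) t :=
  _root_.hasDerivAt_L2 ht h.continuous_rhs h.deriv (h.continuousOn_rhs hn hn')

end NiceSol

/-! ### Differentiating quadratic and quartic functionals -/

lemma hasDerivAt_quad {θ : Sch n} {θr : Rn n → ℝ} (hθ : ∀ ξ, θ ξ = θr ξ) {v : ℝ → Sch n}
    {w : Sch n} {t : ℝ} (h : HasDerivAt (fun τ => L2 (v τ)) (L2 w) t) :
    HasDerivAt (fun τ => (inner ℂ (L2 (T θ (v τ))) (L2 (v τ))).re) (2 * (inner ℂ (L2 (T θ (v t))) (L2 w)).re) t := by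
  have h1 := (h.L2_T θ).inner ℂ h
  have h2 := (reCLM.hasFDerivAt (x := inner ℂ (L2 (T θ (v t))) (L2 (v t)))).comp_hasDerivAt t h1
  refine h2.congr_deriv ?_
  rw [show inner ℂ (L2 (T θ w)) (L2 (v t)) = inner ℂ (L2 w) (L2 (T θ (v t))) from
    inner_L2_symm (m := θr) (fun ξ => by rw [fourier_T, hθ]) (fun ξ => by rw [fourier_T, hθ])]
  rw [reCLM_apply, add_re, ← inner_conj_symm (L2 w), conj_re]; ring

lemma abs_pow_four_sub_le {z w : ℂ} {B : ℝ} (hz : ‖z‖ ≤ B) (hw : ‖w‖ ≤ B) :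
    |‖w‖ ^ 4 - ‖z‖ ^ 4 - 4 * (starRingEnd ℂ ((‖z‖ : ℂ) ^ 2 * z) * (w - z)).re| ≤ 6 * B ^ 2 * ‖w - z‖ ^ 2 := by
  have hB : 0 ≤ B := (norm_nonneg z).trans hz
  have e : (starRingEnd ℂ ((‖z‖ : ℂ) ^ 2 * z) * (w - z)).re = ‖z‖ ^ 2 * (starRingEnd ℂ z * (w - z)).re := by
    rw [map_mul, map_pow, conj_ofReal, mul_assoc, ← Complex.ofReal_pow, Complex.re_ofReal_mul]
  have e2 : ‖w‖ ^ 2 - ‖z‖ ^ 2 = 2 * (starRingEnd ℂ z * (w - z)).re + ‖w - z‖ ^ 2 := by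
    rw [sq_norm, sq_norm, sq_norm]
    simp only [Complex.normSq_apply, mul_re, conj_re, conj_im, sub_re, Complex.sub_im]
    ring
  have e3 : ‖w‖ ^ 4 - ‖z‖ ^ 4 - 4 * (‖z‖ ^ 2 * (starRingEnd ℂ z * (w - z)).re) =
      (‖w‖ - ‖z‖) ^ 2 * (‖w‖ + ‖z‖) ^ 2 + 2 * ‖z‖ ^ 2 * ‖w - z‖ ^ 2 := by
    linear_combination 2 * ‖z‖ ^ 2 * e2
  rw [e, e3, abs_of_nonneg (by positivity)]
  have h1 : (‖w‖ - ‖z‖) ^ 2 ≤ ‖w - z‖ ^ 2 := sq_le_sq' (by linarith [norm_sub_norm_le z w, norm_sub_rev z w]) (norm_sub_norm_le w z)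
  calc _ ≤ ‖w - z‖ ^ 2 * (B + B) ^ 2 + 2 * B ^ 2 * ‖w - z‖ ^ 2 := by gcongr
    _ = _ := by ring

lemma abs_Q4_sub_le {f g : Sch n} {B : ℝ} (hf : ∀ x, ‖f x‖ ≤ B) (hg : ∀ x, ‖g x‖ ≤ B) :
    |Q4 g - Q4 f - 4 * (inner ℂ (L2 (cub f)) (L2 (g - f))).re| ≤ 6 * B ^ 2 * ‖L2 g - L2 f‖ ^ 2 := by
  have hi : Integrable fun x => starRingEnd ℂ (cub f x) * (g - f) x := by
    have := ((smul2 (sconj (cub f)) (g - f))).integrable (μ := volume)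
    refine this.congr (Eventually.of_forall fun x => ?_)
    simp [smul2_apply, sconj_apply]
  have e : (inner ℂ (L2 (cub f)) (L2 (g - f))).re = ∫ x, (starRingEnd ℂ (cub f x) * (g - f) x).re := by
    rw [inner_L2_eq]; exact (integral_re hi).symm
  have hi2 : Integrable fun x => ‖(g - f) x‖ ^ 2 := by
    have := ((g - f).memLp 2 volume).integrable_norm_pow (p := 2) two_ne_zero
    exact this
  have i1 : Integrable fun x => ‖g x‖ ^ 4 - ‖f x‖ ^ 4 := (integrable_pow_four g).sub (integrable_pow_four f)
  have i2 : Integrable fun x => 4 * (starRingEnd ℂ (cub f x) * (g - f) x).re := hi.re.const_mul 4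
  rw [e, Q4, Q4, ← integral_sub (integrable_pow_four g) (integrable_pow_four f), ← integral_const_mul,
    ← integral_sub i1 i2, ← L2_sub, norm_L2_sq, ← integral_const_mul]
  refine (abs_integral_le_integral_abs).trans (integral_mono (i1.sub i2).abs (hi2.const_mul _) fun x => ?_)
  · have := abs_pow_four_sub_le (hf x) (hg x)
    simpa [cub_apply] using this

lemma hasDerivAt_Q4 {v : ℝ → Sch n} {w : Sch n} {t B : ℝ}
    (h : HasDerivAt (fun τ => L2 (v τ)) (L2 w) t) (hB : ∀ᶠ τ in 𝓝 t, ∀ x, ‖v τ x‖ ≤ B) :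
    HasDerivAt (fun τ => Q4 (v τ)) (4 * (inner ℂ (L2 (cub (v t))) (L2 w)).re) t := by
  have h1 := (hasDerivAt_const t (L2 (cub (v t)))).inner ℂ h
  have h2 := ((reCLM.hasFDerivAt (x := inner ℂ (L2 (cub (v t))) (L2 (v t)))).comp_hasDerivAt t h1).const_mul 4
  have h3 : HasDerivAt (fun τ => Q4 (v τ) - 4 * (inner ℂ (L2 (cub (v t))) (L2 (v τ))).re) 0 t := by
    rw [hasDerivAt_iff_isLittleO]
    have ho : (fun τ => L2 (v τ) - L2 (v t)) =O[𝓝 t] fun τ => τ - t := h.isBigO_sub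
    have ho2 : (fun τ => ‖L2 (v τ) - L2 (v t)‖ ^ 2) =o[𝓝 t] fun τ => τ - t := by
      have h4 : (fun τ => ‖L2 (v τ) - L2 (v t)‖ ^ 2) =O[𝓝 t] fun τ => (τ - t) ^ 2 := ho.norm_left.pow 2
      refine h4.trans_isLittleO ?_
      have h5 : (fun τ : ℝ => τ - t) =o[𝓝 t] fun _ => (1 : ℝ) := by
        rw [Asymptotics.isLittleO_one_iff]
        have : Continuous fun τ : ℝ => τ - t := by fun_prop
        simpa using this.tendsto t
      simpa [sq] using h5.mul_isBigO (Asymptotics.isBigO_refl (fun τ : ℝ => τ - t) (𝓝 t))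
    refine Asymptotics.IsBigO.trans_isLittleO (Asymptotics.IsBigO.of_bound (6 * B ^ 2) ?_) ho2
    filter_upwards [hB] with τ hτ
    have h6 := abs_Q4_sub_le hB.self_of_nhds hτ
    rw [L2_sub, inner_sub_right, sub_re] at h6
    rw [norm_eq_abs, norm_of_nonneg (by positivity)]
    refine le_trans (le_of_eq ?_) h6
    congr 1; simp; ring
  have h7 := h3.add h2
  refine (h7.congr_deriv (by simp)).congr_of_eventuallyEq (Eventually.of_forall fun τ => ?_)
  simp

/-! ### The modified energy and its time derivative -/

lemma NB.lowpass {R : ℝ} {f : Sch n} (h : NB R f) (k : ℤ) : NB R (S k f) :=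
  ⟨(norm_L2_S_le k f).trans h.1, fun j => by
    rw [_root_.S, D_T]; exact (norm_L2_S_le k (D j f)).trans (h.2 j)⟩

/-- Quadratic part given by the multiplier `θ`, quartic part evaluated at low frequencies. -/
def modE (θ : Sch n) (l : ℤ) (f : Sch n) : ℝ :=
  1 / 2 * (inner ℂ (L2 (T θ f)) (L2 f)).re + 1 / 4 * Q4 (S l f)

/-- The time derivative of the modified energy. -/
def incr (θ : Sch n) (l : ℤ) (f : Sch n) : ℝ :=
  -(inner ℂ (L2 (T θ (f - S l f))) (L2 (cub f))).im
    - (inner ℂ (L2 (bi (S l f))) (L2 (cub f - cub (S l f)))).im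
    - (inner ℂ (L2 (S l (cub (S l f)))) (L2 (cub f - cub (S l f)))).im

lemma S_add (k : ℤ) (f g : Sch n) : S k (f + g) = S k f + S k g := T_add _ _ _
lemma S_sub (k : ℤ) (f g : Sch n) : S k (f - g) = S k f - S k g := T_sub _ _ _
lemma S_smul (k : ℤ) (c : ℂ) (f : Sch n) : S k (c • f) = c • S k f := T_smul _ _ _

lemma dil_lpφ_real (k : ℤ) (ξ : Rn n) : dil k (lpφ n) ξ = ((bmp n (((2 : ℝ) ^ k)⁻¹ • ξ) : ℝ) : ℂ) := rfl

lemma inner_S_symm (k : ℤ) (f g : Sch n) : inner ℂ (L2 (S k f)) (L2 g) = inner ℂ (L2 f) (L2 (S k g)) :=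
  inner_L2_symm (fun ξ => by rw [fourier_S, dil_lpφ_real]) (fun ξ => by rw [fourier_S, dil_lpφ_real])

lemma inner_bi_symm (f g : Sch n) : inner ℂ (L2 (bi f)) (L2 g) = inner ℂ (L2 f) (L2 (bi g)) :=
  inner_L2_symm (fourier_bi f) (fourier_bi g)

lemma im_inner_eq_zero {f g : Sch n} (h : inner ℂ (L2 f) (L2 g) = inner ℂ (L2 g) (L2 f)) :
    (inner ℂ (L2 f) (L2 g)).im = 0 := by
  have := inner_conj_symm (L2 f) (L2 g) (𝕜 := ℂ)
  rw [h] at this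
  have h2 := congrArg Complex.im this
  rw [conj_im, h] at *
  linarith

lemma incr_eq {θ : Sch n} {θr : Rn n → ℝ} (hθ : ∀ ξ, θ ξ = θr ξ) {l : ℤ}
    (hl : ∀ ξ, ‖ξ‖ ≤ 2 ^ (l + 1) → θ ξ = om ξ) (f : Sch n) :
    (inner ℂ (L2 (T θ f)) (L2 (rhs f))).re + (inner ℂ (L2 (cub (S l f))) (L2 (S l (rhs f)))).re = incr θ l f := by
  set w := S l f
  have h1 : T θ w = bi w := fourier_injective fun ξ => by
    rw [fourier_T, fourier_bi]
    rcases le_or_gt ‖ξ‖ (2 ^ (l + 1)) with h | h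
    · rw [hl ξ h]
    · rw [BL_S l f ξ h]; simp
  have e1 : inner ℂ (L2 (T θ f)) (L2 (rhs f)) = I * (inner ℂ (L2 (T θ f)) (L2 (bi f)) + inner ℂ (L2 (T θ f)) (L2 (cub f))) := by
    rw [L2_rhs, inner_smul_right, inner_add_right]
  have e2 : S l (rhs f) = I • (bi w + S l (cub f)) := by
    rw [rhs, S_smul, S_add, S_bi]
  have e3 : inner ℂ (L2 (cub w)) (L2 (S l (rhs f))) = I * (inner ℂ (L2 (cub w)) (L2 (bi w)) + inner ℂ (L2 (S l (cub w))) (L2 (cub f))) := by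
    rw [e2, L2_smul, L2_add, inner_smul_right, inner_add_right, inner_S_symm]
  have e4 : (inner ℂ (L2 (T θ f)) (L2 (bi f))).im = 0 := by
    apply im_inner_eq_zero
    rw [inner_bi_symm]
    have : inner ℂ (L2 (T θ f)) (L2 (bi f)) = inner ℂ (L2 f) (L2 (T θ (bi f))) :=
      inner_L2_symm (m := θr) (fun ξ => by rw [fourier_T, hθ]) (fun ξ => by rw [fourier_T, hθ])
    rw [this, bi_T]
  have e5 : (inner ℂ (L2 (S l (cub w))) (L2 (cub w))).im = 0 := im_inner_eq_zero (inner_S_symm _ _ _)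
  have e6 : (inner ℂ (L2 (cub w)) (L2 (bi w))).im = -(inner ℂ (L2 (bi w)) (L2 (cub w))).im := by
    rw [← inner_conj_symm, conj_im]
  have e7 : T θ (f - w) = T θ f - bi w := by rw [T_sub, h1]
  rw [incr, show S l f = w from rfl, e1, e3, L2_sub (cub f), inner_sub_right, inner_sub_right, e7, L2_sub, inner_sub_left]
  simp only [mul_re, Complex.I_re, Complex.I_im, add_re, add_im, Complex.sub_im]
  rw [e4, e5, e6]; ring

namespace NiceSol

lemma exists_bound_S (hn : 1 ≤ n) (hn' : n ≤ 14) (h : NiceSol u a b R) :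
    ∃ B, ∀ t ∈ Icc a b, ∀ k x, ‖S k (u t) x‖ ≤ B := by
  obtain ⟨C, -, hC⟩ := exists_sup_bound hn hn'
  exact ⟨C * R, fun t ht k => hC R _ ((h.nb t ht).lowpass k)⟩

lemma hasDerivAt_modE (hn : 1 ≤ n) (hn' : n ≤ 14) (h : NiceSol u a b R) {θ : Sch n}
    {θr : Rn n → ℝ} (hθ : ∀ ξ, θ ξ = θr ξ) {l : ℤ} (hl : ∀ ξ, ‖ξ‖ ≤ 2 ^ (l + 1) → θ ξ = om ξ) {t : ℝ}
    (ht : t ∈ Ioo a b) : HasDerivAt (fun τ => modE θ l (u τ)) (incr θ l (u t)) t := by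
  have h1 := h.hasDerivAt_L2 hn hn' ht
  obtain ⟨B, hB⟩ := h.exists_bound_S hn hn'
  have h2 := hasDerivAt_Q4 (h1.L2_T (dil l (lpφ n))) (B := B)
    (by filter_upwards [Icc_mem_nhds ht.1 ht.2] with τ hτ x using hB τ hτ l x)
  refine (((hasDerivAt_quad hθ h1).const_mul (1 / 2)).add (h2.const_mul (1 / 4))).congr_deriv ?_
  rw [← incr_eq hθ hl]
  simp only [S]; ring

lemma continuousOn_inner_re {J : Set ℝ} {f g : ℝ → LL n} (hf : ContinuousOn f J) (hg : ContinuousOn g J) :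
    ContinuousOn (fun t => (inner ℂ (f t) (g t)).re) J :=
  Complex.continuous_re.comp_continuousOn (ContinuousOn.inner (𝕜 := ℂ) hf hg)

lemma continuousOn_modE (hn : 1 ≤ n) (hn' : n ≤ 14) (h : NiceSol u a b R) (θ : Sch n) (l : ℤ) :
    ContinuousOn (fun t => modE θ l (u t)) (Icc a b) := by
  have h1 := h.continuousOn_L2 hn hn'
  obtain ⟨B, hB⟩ := h.exists_bound_S hn hn'
  exact ((continuousOn_inner_re (h1.L2_T θ) h1).const_smul (1 / 2 : ℝ)).add
    ((continuousOn_Q4 (h1.L2_T (dil l (lpφ n))) fun t ht x => hB t ht l x).const_smul (1 / 4 : ℝ))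

lemma continuousOn_incr (hn : 1 ≤ n) (hn' : n ≤ 14) (h : NiceSol u a b R) {θ : Sch n}
    {θr : Rn n → ℝ} (hθ : ∀ ξ, θ ξ = θr ξ) {l : ℤ} (hl : ∀ ξ, ‖ξ‖ ≤ 2 ^ (l + 1) → θ ξ = om ξ) :
    ContinuousOn (fun t => incr θ l (u t)) (Icc a b) := by
  have h1 := h.continuousOn_L2 hn hn'
  obtain ⟨B, hB⟩ := h.exists_bound_S hn hn'
  simp only [← incr_eq hθ hl]
  exact (continuousOn_inner_re (h1.L2_T θ) (h.continuousOn_rhs hn hn')).add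
    (continuousOn_inner_re (ContinuousOn.cub (h1.L2_T (dil l (lpφ n))) fun t ht x => hB t ht l x)
      ((h.continuousOn_rhs hn hn').L2_T (dil l (lpφ n))))

lemma modE_sub (hn : 1 ≤ n) (hn' : n ≤ 14) (h : NiceSol u a b R) {θ : Sch n}
    {θr : Rn n → ℝ} (hθ : ∀ ξ, θ ξ = θr ξ) {l : ℤ} (hl : ∀ ξ, ‖ξ‖ ≤ 2 ^ (l + 1) → θ ξ = om ξ) (hab : a ≤ b) :
    modE θ l (u b) - modE θ l (u a) = ∫ t in a..b, incr θ l (u t) := by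
  refine (integral_eq_sub_of_hasDerivAt_of_le hab (h.continuousOn_modE hn hn' θ l)
    (fun t ht => h.hasDerivAt_modE hn hn' hθ hl ht) ?_).symm
  exact ContinuousOn.intervalIntegrable (by rw [uIcc_of_le hab]; exact h.continuousOn_incr hn hn' hθ hl)

/-- Conservation of mass. -/
lemma norm_eq (hn : 1 ≤ n) (hn' : n ≤ 14) (h : NiceSol u a b R) {s t : ℝ} (hs : s ∈ Icc a b) (ht : t ∈ Icc a b) :
    ‖L2 (u s)‖ = ‖L2 (u t)‖ := by
  have h1 := h.continuousOn_L2 hn hn'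
  have key : ∀ t ∈ Icc a b, ‖L2 (u t)‖ ^ 2 = ‖L2 (u a)‖ ^ 2 := by
    intro t ht
    have h2 := integral_eq_sub_of_hasDerivAt_of_le (f := fun τ => ‖L2 (u τ)‖ ^ 2) (f' := fun _ => 0) ht.1
      ((h1.mono (Set.Icc_subset_Icc_right ht.2)).norm.pow 2) (fun τ hτ => ?_) intervalIntegrable_const
    · rw [intervalIntegral.integral_zero] at h2; linarith
    · have h3 := h.hasDerivAt_L2 hn hn' (t := τ) ⟨hτ.1, hτ.2.trans_le ht.2⟩
      have h4 := (reCLM.hasFDerivAt (x := inner ℂ (L2 (u τ)) (L2 (u τ)))).comp_hasDerivAt τ (h3.inner ℂ h3)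
      have e : ∀ f : Sch n, Complex.re (inner ℂ (L2 f) (L2 f)) = ‖L2 f‖ ^ 2 := fun f => by
        rw [inner_self_eq_norm_sq_to_K]; norm_cast
      refine (h4.congr_deriv ?_).congr_of_eventuallyEq (Eventually.of_forall fun σ => (e (u σ)).symm)
      have e1 : (inner ℂ (L2 (u τ)) (L2 (bi (u τ)))).im = 0 := im_inner_eq_zero (inner_bi_symm _ _).symm
      have e2 : (inner ℂ (L2 (u τ)) (L2 (cub (u τ)))).im = 0 := by
        rw [← inner_conj_symm, inner_cub_self, conj_ofReal, Complex.ofReal_im]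
      have e3 : (inner ℂ (L2 (u τ)) (L2 (rhs (u τ)))).re = 0 := by
        rw [L2_rhs, inner_smul_right, inner_add_right, mul_re, add_im, e1, e2]; simp
      rw [reCLM_apply, add_re, e3, ← inner_conj_symm, conj_re, e3, add_zero]
  have := (key s hs).trans (key t ht).symm
  exact (pow_left_inj₀ (norm_nonneg _) (norm_nonneg _) two_ne_zero).1 this

end NiceSol

/-! ### A priori bounds from conservation of mass and energy -/

lemma exists_schwartz {g : Rn n → ℝ} {r : ℝ} (hg : ContDiff ℝ (⊤ : ℕ∞) g) (h0 : ∀ ξ, r ≤ ‖ξ‖ → g ξ = 0) :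
    ∃ θ : Sch n, ∀ ξ, θ ξ = g ξ := by
  have hc : HasCompactSupport g := by
    refine HasCompactSupport.intro (isCompact_closedBall (0 : Rn n) r) fun x hx => h0 x ?_
    rw [Metric.mem_closedBall, dist_zero_right, not_le] at hx
    exact hx.le
  exact ⟨HasCompactSupport.toSchwartzMap (f := fun x => ((g x : ℝ) : ℂ))
    (hc.comp_left (g := fun r : ℝ => (r : ℂ)) Complex.ofReal_zero) (Complex.ofRealCLM.contDiff.comp hg), fun _ => rfl⟩

lemma integrable_quad (θ f : Sch n) : Integrable fun ξ => starRingEnd ℂ (θ ξ * 𝓕 f ξ) * 𝓕 f ξ := by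
  refine ((smul2 (sconj (𝓕 (T θ f))) (𝓕 f))).integrable (μ := volume) |>.congr (Eventually.of_forall fun x => ?_)
  simp [smul2_apply, sconj_apply, fourier_T]

lemma quad_eq {θ : Sch n} {θr : Rn n → ℝ} (hθ : ∀ ξ, θ ξ = θr ξ) (f : Sch n) :
    Integrable (fun ξ => θr ξ * ‖𝓕 f ξ‖ ^ 2) ∧ (inner ℂ (L2 (T θ f)) (L2 f)).re = ∫ ξ, θr ξ * ‖𝓕 f ξ‖ ^ 2 := by
  have e : ∀ ξ, (starRingEnd ℂ (θ ξ * 𝓕 f ξ) * 𝓕 f ξ).re = θr ξ * ‖𝓕 f ξ‖ ^ 2 := fun ξ => by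
    rw [hθ, map_mul, conj_ofReal, mul_assoc, mul_comm (starRingEnd ℂ _), mul_conj, sq_norm,
      ← Complex.ofReal_mul, Complex.ofReal_re]
  have h := integrable_quad θ f
  refine ⟨h.re.congr (Eventually.of_forall e), ?_⟩
  rw [inner_L2_eq_fourier]
  simp_rw [fourier_T]
  rw [← integral_congr_ae (Eventually.of_forall e)]
  exact (integral_re h).symm

lemma quad_lower {θ χ : Sch n} {θr : Rn n → ℝ} (hθ : ∀ ξ, θ ξ = θr ξ) {A : ℝ}
    (hA : ∀ ξ, A * ‖χ ξ‖ ^ 2 ≤ θr ξ) (f : Sch n) :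
    A * ‖L2 (T χ f)‖ ^ 2 ≤ (inner ℂ (L2 (T θ f)) (L2 f)).re := by
  obtain ⟨h1, h2⟩ := quad_eq hθ f
  rw [h2, ← norm_L2_fourier, norm_L2_sq, ← integral_const_mul]
  refine integral_mono (((𝓕 (T χ f)).memLp 2 volume).integrable_norm_pow (p := 2) two_ne_zero |>.const_mul A) h1 fun ξ => ?_
  simp only
  rw [fourier_T, norm_mul, mul_pow, ← mul_assoc]
  gcongr
  exact hA ξ

lemma lpψ_energy (k : ℤ) (ξ : Rn n) : (π * 2 ^ k) ^ 4 / 4 * ‖dil k (lpψ n) ξ‖ ^ 2 ≤ om ξ := by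
  have h0 : 0 ≤ om ξ := by unfold om; positivity
  rcases le_or_gt ‖ξ‖ (2 ^ (k - 1)) with h | h
  · rw [dil_lpψ_low h]; simpa using h0
  · rw [zpow_sub_one₀ two_ne_zero] at h
    have h1 : π * 2 ^ k ≤ 2 * π * ‖ξ‖ := by nlinarith [pi_pos]
    calc _ ≤ (π * 2 ^ k) ^ 4 / 4 * 2 ^ 2 := by gcongr; exact norm_dil_lpψ_le k ξ
      _ = (π * 2 ^ k) ^ 4 := by ring
      _ ≤ _ := by unfold om; gcongr

lemma NB.norm_sub_S_le (hn : 1 ≤ n) {R : ℝ} {f : Sch n} (h : NB R f) (l : ℕ) :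
    ‖L2 (f - S l f)‖ ≤ 2 * R * (1 / 2) ^ l := by
  have hR := h.nonneg
  have h1 : nL 2 (f - S l f : Sch n) ≤ ofReal (R * (1 / 2) ^ l / (1 - 1 / 2)) := by
    refine (nL_sub_S_le hn one_le_two l f).trans (tsum_le_of_geometric (by norm_num) (by norm_num) fun j => ?_)
    rw [nL_two_eq]
    refine ofReal_le_ofReal ((h.2 _).trans ?_)
    have hp : (1 : ℝ) ≤ 2 ^ (l + j) := one_le_pow₀ one_le_two
    have e : (2 : ℝ) ^ ((l : ℤ) + 1 + j) = 2 ^ (l + j) * 2 := by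
      rw [show (l : ℤ) + 1 + j = (l + j : ℕ) + 1 by push_cast; ring, zpow_add_one₀ two_ne_zero, zpow_natCast]
    have : ((2 : ℝ) ^ (l + j) * 2)⁻¹ ≤ (2 ^ (l + j))⁻¹ := by gcongr; linarith
    calc _ ≤ R * ((2 : ℝ) ^ ((l : ℤ) + 1 + j))⁻¹ ^ 1 := by
          gcongr R * ?_
          refine pow_le_pow_of_le_one (by positivity) (inv_le_one_of_one_le₀ ?_) (by norm_num)
          rw [e]; linarith
      _ ≤ R * (2 ^ (l + j))⁻¹ := by rw [pow_one, e]; gcongr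
      _ = _ := by rw [one_div, inv_pow, inv_pow, pow_add, mul_inv]; ring
  rw [nL_two_eq, ofReal_le_ofReal_iff (by positivity)] at h1
  refine h1.trans_eq (by ring)

lemma abs_im_inner_le (f g : Sch n) : |(inner ℂ (L2 f) (L2 g)).im| ≤ ‖L2 f‖ * ‖L2 g‖ :=
  (Complex.abs_im_le_norm _).trans (norm_inner_le_norm _ _)

lemma cut_exists (l : ℤ) : ∃ θ : Sch n, ∀ ξ, θ ξ = ((om ξ * bmp n (((2 : ℝ) ^ l)⁻¹ • ξ) : ℝ) : ℂ) := by
  refine exists_schwartz (r := 2 ^ (l + 1)) (contDiff_om.mul ((bmp n).contDiff.comp (contDiff_const_smul _))) fun ξ h => ?_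
  have := dil_lpφ_zero h
  rw [dil_lpφ_real] at this
  rw [Complex.ofReal_eq_zero.1 this, mul_zero]

lemma exists_incr_bound (hn : 1 ≤ n) (hn' : n ≤ 14) (R : ℝ) : ∃ C, ∀ f : Sch n, NB R f → ∀ (l : ℕ)
    (θ : Sch n), (∀ ξ, ‖θ ξ‖ ≤ om ξ) → |incr θ l f| ≤ C * (√((1 / 2) ^ l) + (1 / 2) ^ l) := by
  obtain ⟨C, hC, hsup⟩ := exists_sup_bound (n := n) hn hn'
  set A := 4 * (2 * π) ^ 8 * 2 ^ 8 * R
  set B := C * R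
  refine ⟨√(2 * R * (A + A)) * (B ^ 2 * R) + (√(R * A) + B ^ 2 * R) * (3 * B ^ 2 * (2 * R)), fun f hf l θ hθ => ?_⟩
  have hR := hf.nonneg
  have hA : 0 ≤ A := by positivity
  have hw := hf.lowpass l
  have hfl := hf.norm_sub_S_le hn l
  have hT : ∀ g, ‖L2 (T θ g)‖ ≤ ‖L2 (bi g)‖ := fun g => by
    rw [← one_mul ‖L2 (bi g)‖]
    refine norm_L2_le_of_fourier fun ξ => ?_
    rw [fourier_T, fourier_bi, norm_mul, norm_mul, one_mul]
    gcongr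
    refine (hθ ξ).trans ?_
    rw [norm_real]; exact le_abs_self _
  have h1 : ‖L2 (T θ (f - S l f))‖ ≤ √(2 * R * (A + A)) * √((1 / 2) ^ l) := by
    rw [← sqrt_mul (by positivity)]
    refine (hT _).trans (le_sqrt_of_sq_le ((norm_bi_sq_le _).trans ?_))
    have : ‖L2 (bi (bi (f - S l f)))‖ ≤ A + A := by
      rw [bi_sub, bi_sub, L2_sub]
      exact (norm_sub_le _ _).trans (add_le_add (hf.norm_bi_bi_le hn) (hw.norm_bi_bi_le hn))
    calc _ ≤ (2 * R * (1 / 2) ^ l) * (A + A) := by gcongr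
      _ = _ := by ring
  have h2 : ‖L2 (cub f)‖ ≤ B ^ 2 * R := (norm_L2_cub_le (hsup R f hf)).trans (by gcongr; exact hf.1)
  have h3 : ‖L2 (bi (S l f))‖ ≤ √(R * A) :=
    le_sqrt_of_sq_le ((norm_bi_sq_le _).trans (mul_le_mul hw.1 (hw.norm_bi_bi_le hn) (norm_nonneg _) hR))
  have h4 : ‖L2 (cub f - cub (S l f))‖ ≤ 3 * B ^ 2 * (2 * R) * (1 / 2) ^ l := by
    rw [L2_sub]
    refine (norm_L2_cub_sub_le (hsup R f hf) (hsup R _ hw)).trans ?_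
    rw [← L2_sub, mul_assoc (3 * B ^ 2)]
    gcongr
  have h5 : ‖L2 (S l (cub (S l f)))‖ ≤ B ^ 2 * R :=
    (norm_L2_S_le _ _).trans ((norm_L2_cub_le (hsup R _ hw)).trans (by gcongr; exact hw.1))
  have e1 := abs_im_inner_le (T θ (f - S l f)) (cub f)
  have e2 := abs_im_inner_le (bi (S l f)) (cub f - cub (S l f))
  have e3 := abs_im_inner_le (S l (cub (S l f))) (cub f - cub (S l f))
  have t1 : |incr θ l f| ≤ ‖L2 (T θ (f - S l f))‖ * ‖L2 (cub f)‖ + ‖L2 (bi (S l f))‖ * ‖L2 (cub f - cub (S l f))‖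
      + ‖L2 (S l (cub (S l f)))‖ * ‖L2 (cub f - cub (S l f))‖ := by
    rw [incr]
    refine (abs_sub _ _).trans (add_le_add ((abs_sub _ _).trans (add_le_add ?_ e2)) e3)
    rwa [abs_neg]
  set q := (1 / 2 : ℝ) ^ l
  have hq : 0 ≤ q := by positivity
  calc _ ≤ √(2 * R * (A + A)) * √q * (B ^ 2 * R) + √(R * A) * (3 * B ^ 2 * (2 * R) * q)
      + B ^ 2 * R * (3 * B ^ 2 * (2 * R) * q) := t1.trans (by gcongr)
    _ = √(2 * R * (A + A)) * (B ^ 2 * R) * √q + (√(R * A) + B ^ 2 * R) * (3 * B ^ 2 * (2 * R)) * q := by ring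
    _ ≤ (√(2 * R * (A + A)) * (B ^ 2 * R) + (√(R * A) + B ^ 2 * R) * (3 * B ^ 2 * (2 * R))) * √q +
        (√(2 * R * (A + A)) * (B ^ 2 * R) + (√(R * A) + B ^ 2 * R) * (3 * B ^ 2 * (2 * R))) * q := by
      gcongr
      · exact le_add_of_nonneg_right (by positivity)
      · exact le_add_of_nonneg_left (by positivity)
    _ = _ := by ring

lemma Q4_le {f : Sch n} {B : ℝ} (hB : ∀ x, ‖f x‖ ≤ B) : Q4 f ≤ B ^ 2 * ‖L2 f‖ ^ 2 := by
  rw [norm_L2_sq, Q4, ← integral_const_mul]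
  refine integral_mono (integrable_pow_four f) ((f.memLp 2 volume).integrable_norm_pow (p := 2) two_ne_zero |>.const_mul _)
    fun x => ?_
  simp only
  rw [show ‖f x‖ ^ 4 = ‖f x‖ ^ 2 * ‖f x‖ ^ 2 by ring]
  gcongr
  exact hB x

/-- Regular solutions are controlled in the energy space by their regularity at a single time. -/
lemma apriori (hn : 1 ≤ n) (hn' : n ≤ 14) (R₀ : ℝ) : ∃ H > 0, ∀ (u : ℝ → Sch n) (a b R c : ℝ),
    NiceSol u a b R → c ∈ Icc a b → NB R₀ (u c) → ∀ t ∈ Icc a b,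
    ‖L2 (u t)‖ ≤ R₀ ∧ ∀ k : ℤ, ‖L2 (D k (u t))‖ ≤ H * ((2 : ℝ) ^ k)⁻¹ ^ 2 := by
  obtain ⟨C, hC, hsup⟩ := exists_sup_bound (n := n) hn hn'
  set A := 4 * (2 * π) ^ 8 * 2 ^ 8 * R₀ with hA
  set H₀ := 1 / 2 * (√(R₀ * A) * R₀) + 1 / 4 * ((C * R₀) ^ 2 * R₀ ^ 2) with hH₀
  refine ⟨√(8 * H₀ / π ^ 4) + 1, by positivity, fun u a b R c h hc hN t ht => ⟨?_, fun k => ?_⟩⟩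
  · rw [h.norm_eq hn hn' ht hc]; exact hN.1
  have hR₀ := hN.nonneg
  have hA0 : 0 ≤ A := by positivity
  obtain ⟨CI, hCI⟩ := exists_incr_bound (n := n) hn hn' R
  choose θ hθ using fun l : ℕ => cut_exists (n := n) ((l : ℤ) + 1)
  have hθ1 : ∀ (l : ℕ) (ξ : Rn n), ‖ξ‖ ≤ 2 ^ ((l : ℤ) + 1) → θ l ξ = om ξ := fun l ξ hξ => by
    have := dil_lpφ_one hξ
    rw [dil_lpφ_real, Complex.ofReal_eq_one] at this
    rw [hθ, this, mul_one]
  have hom : ∀ ξ : Rn n, 0 ≤ om ξ := fun ξ => by unfold om; positivity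
  have hθ2 : ∀ (l : ℕ) (ξ : Rn n), ‖θ l ξ‖ ≤ om ξ := fun l ξ => by
    rw [hθ, norm_real, norm_of_nonneg (mul_nonneg (hom ξ) (bmp n).nonneg)]
    exact mul_le_of_le_one_right (hom ξ) (bmp n).le_one
  set e : ℕ → ℝ := fun l => CI * (√((1 / 2) ^ l) + (1 / 2) ^ l) * |t - c|
  have hd : ∀ l : ℕ, |modE (θ l) l (u t) - modE (θ l) l (u c)| ≤ e l := by
    intro l
    have key : ∀ s ∈ Icc a b, ∀ s' ∈ Icc a b, s ≤ s' → |modE (θ l) l (u s') - modE (θ l) l (u s)| ≤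
        CI * (√((1 / 2) ^ l) + (1 / 2) ^ l) * |s' - s| := fun s hs s' hs' hss => by
      have h1 := h.mono hs.1 hs'.2
      rw [h1.modE_sub hn hn' (hθ l) (hθ1 l) hss, ← norm_eq_abs]
      refine intervalIntegral.norm_integral_le_of_norm_le_const fun τ hτ => ?_
      rw [Set.uIoc_of_le hss] at hτ
      exact hCI _ (h1.nb τ ⟨hτ.1.le, hτ.2⟩) l _ (hθ2 l)
    rcases le_total t c with htc | htc
    · rw [abs_sub_comm]; simp only [e]; rw [abs_sub_comm t c]; exact key t ht c hc htc
    · exact key c hc t ht htc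
  have hup : ∀ l : ℕ, modE (θ l) l (u c) ≤ H₀ := by
    intro l
    rw [modE, hH₀]
    have h1 : ‖L2 (T (θ l) (u c))‖ ≤ √(R₀ * A) := by
      refine le_trans ?_ (le_sqrt_of_sq_le ((norm_bi_sq_le (u c)).trans
        (mul_le_mul hN.1 (hN.norm_bi_bi_le hn) (norm_nonneg _) hR₀)))
      rw [← one_mul ‖L2 (bi (u c))‖]
      refine norm_L2_le_of_fourier fun ξ => ?_
      rw [fourier_T, fourier_bi, norm_mul, norm_mul, one_mul]
      gcongr
      exact (hθ2 l ξ).trans (by rw [norm_real]; exact le_abs_self _)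
    have h2 : (inner ℂ (L2 (T (θ l) (u c))) (L2 (u c))).re ≤ √(R₀ * A) * R₀ :=
      (Complex.re_le_norm _).trans ((norm_inner_le_norm _ _).trans (by gcongr; exact hN.1))
    have h3 : Q4 (S l (u c)) ≤ (C * R₀) ^ 2 * R₀ ^ 2 :=
      (Q4_le (hsup R₀ _ (hN.lowpass l))).trans (by gcongr; exact (hN.lowpass l).1)
    linarith
  have hlow : ∀ l : ℕ, k ≤ l → (π * 2 ^ k) ^ 4 / 4 * ‖L2 (D k (u t))‖ ^ 2 ≤ 2 * (H₀ + e l) := by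
    intro l hl
    have h1 := quad_lower (χ := dil k (lpψ n)) (hθ l) (A := (π * 2 ^ k) ^ 4 / 4) (fun ξ => ?_) (u t)
    · have h2 := hd l
      have h3 := hup l
      have h4 := Q4_nonneg (S l (u t))
      have h5 := (abs_le.1 h2).2
      rw [D]
      rw [modE] at h5
      linarith
    · rcases le_or_gt ‖ξ‖ (2 ^ ((l : ℤ) + 1)) with hξ | hξ
      · have := hθ1 l ξ hξ
        rw [hθ, Complex.ofReal_inj] at this
        rw [this]
        exact lpψ_energy k ξ
      · rw [dil_lpψ_high ((zpow_le_zpow_right₀ one_le_two (by omega)).trans hξ.le)]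
        simpa using mul_nonneg (hom ξ) (bmp n).nonneg
  have hlim : Tendsto (fun l => 2 * (H₀ + e l)) atTop (𝓝 (2 * H₀)) := by
    have h1 : Tendsto (fun l : ℕ => (1 / 2 : ℝ) ^ l) atTop (𝓝 0) := tendsto_pow_atTop_nhds_zero_of_lt_one (by norm_num) (by norm_num)
    have h2 := ((h1.sqrt.add h1).const_mul CI).mul_const |t - c|
    have := (h2.const_add H₀).const_mul 2
    simp only [sqrt_zero, add_zero, mul_zero, zero_mul] at this
    exact this
  have hfin : (π * 2 ^ k) ^ 4 / 4 * ‖L2 (D k (u t))‖ ^ 2 ≤ 2 * H₀ := by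
    refine ge_of_tendsto hlim ?_
    filter_upwards [eventually_ge_atTop k.toNat] with l hl
    exact hlow l (by omega)
  have h6 : ‖L2 (D k (u t))‖ * (2 ^ k) ^ 2 ≤ √(8 * H₀ / π ^ 4) := by
    refine le_sqrt_of_sq_le ?_
    rw [le_div_iff₀ (by positivity)]
    calc _ = 4 * ((π * 2 ^ k) ^ 4 / 4 * ‖L2 (D k (u t))‖ ^ 2) := by ring
      _ ≤ 4 * (2 * H₀) := by gcongr
      _ = _ := by ring
  rw [inv_pow, ← div_eq_mul_inv, le_div_iff₀ (by positivity)]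
  linarith

/-! ### Families of Schwartz functions that are continuous in `L²` and bounded -/

structure Good (v : ℝ → Sch n) (a b : ℝ) : Prop where
  cont : ContinuousOn (fun t => L2 (v t)) (Icc a b)
  bdd : ∃ B, ∀ t ∈ Icc a b, ∀ x, ‖v t x‖ ≤ B

namespace Good

variable {v w : ℝ → Sch n} {a b : ℝ}

lemma sub (h : Good v a b) (h' : Good w a b) : Good (fun t => v t - w t) a b := by
  obtain ⟨B, hB⟩ := h.bdd
  obtain ⟨B', hB'⟩ := h'.bdd
  refine ⟨?_, B + B', fun t ht x => (norm_sub_le _ _).trans (add_le_add (hB t ht x) (hB' t ht x))⟩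
  simp only [L2_sub]
  exact h.cont.sub h'.cont

lemma cub (h : Good v a b) : Good (fun t => cub (v t)) a b := by
  obtain ⟨B, hB⟩ := h.bdd
  refine ⟨h.cont.cub hB, B ^ 2 * B, fun t ht x => ?_⟩
  have := hB t ht x
  rw [cub_apply, norm_mul, norm_pow, norm_real, norm_norm]
  gcongr

lemma T (h : Good v a b) (θ : Sch n) : Good (fun t => T θ (v t)) a b := by
  obtain ⟨C, hC⟩ := isCompact_Icc.exists_bound_of_continuousOn h.cont
  refine ⟨h.cont.L2_T θ, (nL 2 (𝓕⁻ θ : Sch n) * ofReal C).toReal, fun t ht x => ?_⟩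
  have h1 := enorm_fourierInv_mul_le θ (𝓕 (v t)).integrable (p := 2) (q := 2) (HolderConjugate.two_two) x
  rw [← T_eq, ← fourierInv_coe, fourierInv_fourier_eq] at h1
  have h2 := h1.trans (mul_le_mul_right ((nL_two_eq (v t)).le.trans (ofReal_le_ofReal (hC t ht))) _)
  rw [← toReal_enorm]
  exact ENNReal.toReal_mono (ENNReal.mul_ne_top (nL_ne_top two_pos _) ofReal_ne_top) h2

lemma S (h : Good v a b) (k : ℤ) : Good (fun t => S k (v t)) a b := h.T _
lemma D (h : Good v a b) (k : ℤ) : Good (fun t => D k (v t)) a b := h.T _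

lemma exists_nL_le (h : Good v a b) {p : ℝ} (hp : 2 ≤ p) : ∃ C ≠ ∞, ∀ t ∈ Icc a b, nL p (v t) ≤ C := by
  obtain ⟨C, hC⟩ := isCompact_Icc.exists_bound_of_continuousOn h.cont
  obtain ⟨B, hB⟩ := h.bdd
  have h1 : 0 ≤ 1 - 2 / p := by rw [sub_nonneg, div_le_one (by linarith)]; exact hp
  refine ⟨ofReal C ^ (2 / p) * ofReal B ^ (1 - 2 / p), by finiteness, fun t ht => ?_⟩
  refine (nL_le_interp two_pos hp (v t) (M := ofReal B) fun x => ?_).trans ?_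
  · rw [← ofReal_norm]; exact ofReal_le_ofReal (hB t ht x)
  · gcongr
    rw [nL_two_eq]; exact ofReal_le_ofReal (hC t ht)

lemma continuousOn_nL (h : Good v a b) {p : ℝ} (hp : 2 ≤ p) : ContinuousOn (fun t => nL p (v t)) (Icc a b) := by
  have hp0 : 0 < p := by linarith
  obtain ⟨B, hB⟩ := h.bdd
  have h1 : 0 ≤ 1 - 2 / p := by rw [sub_nonneg, div_le_one hp0]; exact hp
  intro t ht
  have hd : Tendsto (fun s => nL p (v s - v t : Sch n)) (𝓝[Icc a b] t) (𝓝 0) := by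
    have h2 : Tendsto (fun s => ofReal ‖L2 (v s) - L2 (v t)‖ ^ (2 / p) * ofReal (B + B) ^ (1 - 2 / p))
        (𝓝[Icc a b] t) (𝓝 0) := by
      have h3 := tendsto_iff_norm_sub_tendsto_zero.1 (h.cont t ht)
      have h4 := (ENNReal.tendsto_ofReal h3).ennrpow_const (2 / p)
      rw [ENNReal.ofReal_zero, ENNReal.zero_rpow_of_pos (by positivity)] at h4
      have h5 := ENNReal.Tendsto.mul_const h4 (b := ofReal (B + B) ^ (1 - 2 / p)) (Or.inr (by finiteness))
      rwa [zero_mul] at h5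
    refine tendsto_of_tendsto_of_tendsto_of_le_of_le' tendsto_const_nhds h2 (Eventually.of_forall fun _ => zero_le) ?_
    filter_upwards [self_mem_nhdsWithin] with s hs
    refine (nL_le_interp two_pos hp _ (M := ofReal (B + B)) fun x => ?_).trans ?_
    · rw [← ofReal_norm]
      exact ofReal_le_ofReal ((norm_sub_le _ _).trans (add_le_add (hB s hs x) (hB t ht x)))
    · rw [nL_two_eq, L2_sub]
  refine tendsto_of_tendsto_of_tendsto_of_le_of_le (g := fun s => nL p (v t) - nL p (v s - v t : Sch n))
    (h := fun s => nL p (v t) + nL p (v s - v t : Sch n)) ?_ ?_ ?_ ?_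
  · have := ENNReal.Tendsto.sub (tendsto_const_nhds (x := nL p (v t)) (f := 𝓝[Icc a b] t)) hd (Or.inl (nL_ne_top hp0 _))
    rwa [tsub_zero] at this
  · have := (tendsto_const_nhds (x := nL p (v t)) (f := 𝓝[Icc a b] t)).add hd
    rwa [add_zero] at this
  · intro s
    rw [tsub_le_iff_right]
    have := nL_sub_le (p := p) (by linarith) (v s) (v s - v t)
    rwa [sub_sub_cancel] at this
  · intro s
    have := nL_add_le (p := p) (by linarith) (v t) (v s - v t)
    rwa [add_sub_cancel] at this

lemma aemeasurable_nL (h : Good v a b) {p : ℝ} (hp : 2 ≤ p) :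
    AEMeasurable (fun t => nL p (v t)) (volume.restrict (Icc a b)) :=
  (h.continuousOn_nL hp).aemeasurable measurableSet_Icc

end Good

lemma NiceSol.good (hn : 1 ≤ n) (hn' : n ≤ 14) (h : NiceSol u a b R) : Good u a b :=
  ⟨h.continuousOn_L2 hn hn', h.exists_bound hn hn'⟩

/-! ### Lebesgue norms in time -/

def tL (q a b : ℝ) (g : ℝ → ℝ≥0∞) : ℝ≥0∞ := (∫⁻ t in Icc a b, g t ^ q) ^ (1 / q)

section tL
variable {q a b : ℝ} {f g : ℝ → ℝ≥0∞}

lemma tL_mono (hq : 0 < q) (h : ∀ t ∈ Icc a b, f t ≤ g t) : tL q a b f ≤ tL q a b g := by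
  unfold tL
  gcongr ?_ ^ _
  exact setLIntegral_mono' measurableSet_Icc fun t ht => ENNReal.rpow_le_rpow (h t ht) hq.le

lemma tL_mono_set {c d : ℝ} (hq : 0 < q) (hc : a ≤ c) (hd : d ≤ b) : tL q c d f ≤ tL q a b f := by
  unfold tL
  gcongr ?_ ^ _
  exact lintegral_mono_set (Icc_subset_Icc hc hd)

lemma tL_const_mul (hq : 0 < q) {c : ℝ≥0∞} (hc : c ≠ ∞) : tL q a b (fun t => c * f t) = c * tL q a b f := by
  unfold tL
  simp_rw [mul_rpow_of_nonneg _ _ hq.le]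
  rw [lintegral_const_mul' _ _ (by finiteness), mul_rpow_of_nonneg _ _ (by positivity), ← ENNReal.rpow_mul,
    mul_one_div_cancel hq.ne', ENNReal.rpow_one]

lemma tL_add_le (hq : 1 ≤ q) (hf : AEMeasurable f (volume.restrict (Icc a b)))
    (hg : AEMeasurable g (volume.restrict (Icc a b))) : tL q a b (fun t => f t + g t) ≤ tL q a b f + tL q a b g :=
  ENNReal.lintegral_Lp_add_le hf hg hq

lemma tL_sum_le (hq : 1 ≤ q) {F : ℕ → ℝ → ℝ≥0∞} (hF : ∀ j, AEMeasurable (F j) (volume.restrict (Icc a b))) (m : ℕ) :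
    tL q a b (fun t => ∑ j ∈ range m, F j t) ≤ ∑ j ∈ range m, tL q a b (F j) := by
  induction m with
  | zero => simp [tL, ENNReal.zero_rpow_of_pos (zero_lt_one.trans_le hq), ENNReal.zero_rpow_of_pos (inv_pos.2 (zero_lt_one.trans_le hq))]
  | succ m ih =>
    simp only [sum_range_succ]
    refine (tL_add_le hq ?_ (hF m)).trans (by gcongr)
    exact Finset.aemeasurable_fun_sum _ fun j _ => hF j

lemma tL_tsum_le (hq : 1 ≤ q) {F : ℕ → ℝ → ℝ≥0∞} (hF : ∀ j, AEMeasurable (F j) (volume.restrict (Icc a b))) :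
    tL q a b (fun t => ∑' j, F j t) ≤ ∑' j, tL q a b (F j) := by
  have hq0 : 0 < q := by linarith
  have e : ∀ t, (∑' j, F j t) ^ q = ⨆ m, (∑ j ∈ range m, F j t) ^ q := fun t => by
    rw [ENNReal.tsum_eq_iSup_nat]; exact (ENNReal.orderIsoRpow q hq0).map_iSup _
  unfold tL
  simp_rw [e]
  rw [lintegral_iSup' (fun m => ((Finset.aemeasurable_fun_sum _ fun j _ => hF j).pow_const _))
    (Eventually.of_forall fun t i j hij => ENNReal.rpow_le_rpow (Finset.sum_le_sum_of_subset (by simpa using hij)) hq0.le)]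
  rw [one_div, ENNReal.rpow_inv_le_iff hq0]
  refine iSup_le fun m => ?_
  rw [← ENNReal.rpow_inv_le_iff hq0, ← one_div]
  exact (tL_sum_le hq hF m).trans (ENNReal.sum_le_tsum _)

lemma lintegral_mul_le_tL (hf : AEMeasurable f (volume.restrict (Icc a b)))
    (hg : AEMeasurable g (volume.restrict (Icc a b))) :
    ∫⁻ t in Icc a b, f t * g t ≤ tL 2 a b f * tL 2 a b g :=
  lintegral_mul_le_Lp_mul_Lq _ HolderConjugate.two_two hf hg

lemma tL_two_sq : tL 2 a b (fun t => f t ^ 2) = tL 4 a b f ^ 2 := by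
  unfold tL
  rw [← ENNReal.rpow_natCast, ← ENNReal.rpow_mul]
  simp_rw [← ENNReal.rpow_natCast, ← ENNReal.rpow_mul]
  norm_num

/-- `L²_t` and `L^∞_t` control `L⁴_t`. -/
lemma tL_four_le {A B : ℝ≥0∞} (hg : ∀ t ∈ Icc a b, f t ≤ g t) (hh : ∀ t ∈ Icc a b, f t ≤ B)
    (hB : B ≠ ∞) (hA : tL 2 a b g ≤ A) : tL 4 a b f ≤ A ^ (1 / 2 : ℝ) * B ^ (1 / 2 : ℝ) := by
  have h1 : ∫⁻ t in Icc a b, f t ^ (4 : ℝ) ≤ (∫⁻ t in Icc a b, g t ^ (2 : ℝ)) * B ^ (2 : ℝ) := by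
    rw [← lintegral_mul_const' _ _ (by finiteness)]
    refine setLIntegral_mono' measurableSet_Icc fun t ht => ?_
    rw [show (4 : ℝ) = 2 + 2 by norm_num, ENNReal.rpow_add_of_nonneg _ _ two_pos.le two_pos.le]
    exact mul_le_mul' (ENNReal.rpow_le_rpow (hg t ht) two_pos.le) (ENNReal.rpow_le_rpow (hh t ht) two_pos.le)
  calc tL 4 a b f ≤ ((∫⁻ t in Icc a b, g t ^ (2 : ℝ)) * B ^ (2 : ℝ)) ^ (1 / 4 : ℝ) := ENNReal.rpow_le_rpow h1 (by norm_num)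
    _ = tL 2 a b g ^ (1 / 2 : ℝ) * B ^ (1 / 2 : ℝ) := by
      rw [tL, mul_rpow_of_nonneg _ _ (by norm_num), ← ENNReal.rpow_mul, ← ENNReal.rpow_mul]
      norm_num
    _ ≤ _ := by gcongr

end tL

/-! ### Linear estimates for frequency-localised solutions -/

lemma nL_four_pow (f : Sch n) : nL 4 f ^ (4 : ℝ) = ofReal (Q4 f) := by
  unfold nL eLpNorm' Q4
  rw [← ENNReal.rpow_mul, one_div_mul_cancel (by norm_num), ENNReal.rpow_one,
    ofReal_integral_eq_lintegral_ofReal (integrable_pow_four f) (ae_of_all _ fun _ => by positivity)]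
  refine lintegral_congr fun x => ?_
  rw [ofReal_pow (norm_nonneg _), ofReal_norm, ← ENNReal.rpow_natCast]
  norm_num

lemma nL_four_sq (f : Sch n) : nL 4 f ^ (2 : ℝ) = ofReal √(Q4 f) := by
  rw [sqrt_eq_rpow, ← ofReal_rpow_of_nonneg (Q4_nonneg f) (by norm_num), ← nL_four_pow, ← ENNReal.rpow_mul]
  norm_num

lemma Good.lintegral_nL_two {v : ℝ → Sch n} {a b : ℝ} (hab : a ≤ b) (h : Good v a b) :
    ∫⁻ t in Icc a b, nL 2 (v t) = ofReal (∫ t in a..b, ‖L2 (v t)‖) := by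
  have hc : ContinuousOn (fun t => ‖L2 (v t)‖) (Icc a b) := h.cont.norm
  rw [integral_of_le hab, ← integral_Icc_eq_integral_Ioc,
    ofReal_integral_eq_lintegral_ofReal hc.integrableOn_Icc (ae_of_all _ fun _ => norm_nonneg _)]
  simp only [nL_two_eq]

lemma fourier_T_rhs (θ f : Sch n) (ξ : Rn n) :
    𝓕 (T θ (rhs f)) ξ = I * (om ξ * 𝓕 (T θ f) ξ + 𝓕 (T θ (cub f)) ξ) := by
  rw [fourier_T, rhs, fourier_smul_apply, fourier_add_apply, fourier_bi, fourier_T, fourier_T]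
  ring

lemma NiceSol.duhamel (hn : 1 ≤ n) (hn' : n ≤ 14) (h : NiceSol u a b R)
    (θ : Sch n) {t : ℝ} (ht : t ∈ Icc a b) :
    nL 2 (T θ (u t)) ≤ nL 2 (T θ (u a)) + ∫⁻ τ in Icc a b, nL 2 (T θ (cub (u τ))) := by
  have ha : Good u a t := (h.mono le_rfl ht.2).good hn hn'
  have hv := ha.T θ
  have hΦ := ha.cub.T θ
  refine le_trans ?_ (add_le_add_right (lintegral_mono_set (Icc_subset_Icc le_rfl ht.2)) _)
  rw [hΦ.lintegral_nL_two ht.1, nL_two_eq, nL_two_eq, ← ofReal_add (norm_nonneg _)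
    (intervalIntegral.integral_nonneg ht.1 fun _ _ => norm_nonneg _)]
  refine ofReal_le_ofReal (le_of_forall_pos_le_add fun ε hε => ?_)
  set Q : ℝ → ℝ := fun τ => ‖L2 (T θ (u τ))‖ ^ 2 with hQ
  have hcont : ContinuousOn (fun τ => √(Q τ + ε ^ 2)) (Icc a t) := ((hv.cont.norm.pow 2).add continuousOn_const).sqrt
  have hder : ∀ τ ∈ Ioo a t, HasDerivAt (fun τ => √(Q τ + ε ^ 2))
      ((-2 * (inner ℂ (L2 (T θ (u τ))) (L2 (T θ (cub (u τ))))).im) / (2 * √(Q τ + ε ^ 2))) τ := by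
    intro τ hτ
    have h1 := ((h.mono le_rfl ht.2).hasDerivAt_L2 hn hn' hτ).L2_T θ
    have h2 := reCLM.hasFDerivAt.comp_hasDerivAt τ (h1.inner ℂ h1)
    have eQ : (fun τ => reCLM (inner ℂ (L2 (T θ (u τ))) (L2 (T θ (u τ))))) = Q := by
      funext τ
      rw [inner_self_eq_norm_sq_to_K]
      simp [hQ, ← Complex.ofReal_pow]
    have e1 : T θ (rhs (u τ)) = I • (bi (T θ (u τ)) + T θ (cub (u τ))) := by
      rw [rhs, T_smul, T_add, bi_T]
    have e2 := im_inner_eq_zero (inner_bi_symm (T θ (u τ)) (T θ (u τ))).symm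
    have e3 := inner_re_symm (𝕜 := ℂ) (L2 (T θ (rhs (u τ)))) (L2 (T θ (u τ)))
    have h2 : HasDerivAt Q (-2 * (inner ℂ (L2 (T θ (u τ))) (L2 (T θ (cub (u τ))))).im) τ := by
      rw [← eQ]
      refine h2.congr_deriv ?_
      simp only [RCLike.re_to_complex] at e3
      rw [reCLM_apply, add_re, e3, e1, L2_smul, L2_add, inner_smul_right, inner_add_right]
      rw [Complex.I_mul_re, add_im, e2]
      ring
    exact (h2.add_const (ε ^ 2)).sqrt (by positivity)
  have key := intervalIntegral.sub_le_integral_of_hasDeriv_right_of_le ht.1 hcont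
    (fun τ hτ => (hder τ hτ).hasDerivWithinAt) (φ := fun τ => ‖L2 (T θ (cub (u τ)))‖) hΦ.cont.norm.integrableOn_Icc
    (fun τ _ => ?_)
  · have h1 : ‖L2 (T θ (u t))‖ ≤ √(Q t + ε ^ 2) := le_sqrt_of_sq_le (by simp only [hQ]; nlinarith)
    have h2 : √(Q a + ε ^ 2) ≤ ‖L2 (T θ (u a))‖ + ε := sqrt_le_iff.2 ⟨by positivity, by
      simp only [hQ]; nlinarith [norm_nonneg (L2 (T θ (u a)))]⟩
    linarith
  · have h0 : 0 < √(Q τ + ε ^ 2) := sqrt_pos.2 (by positivity)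
    rw [div_le_iff₀ (by positivity)]
    have h1 : ‖L2 (T θ (u τ))‖ ≤ √(Q τ + ε ^ 2) := le_sqrt_of_sq_le (by simp only [hQ]; nlinarith)
    have h2 := (abs_le.1 (abs_im_inner_le (T θ (u τ)) (T θ (cub (u τ))))).1
    nlinarith [norm_nonneg (L2 (T θ (cub (u τ))))]

lemma NiceSol.strichartz (hn : 5 ≤ n) (hn' : n ≤ 14) : ∃ C ≠ ∞, ∀ (u : ℝ → Sch n) a b R, a ≤ b →
    NiceSol u a b R → ∀ (k : ℤ) (θ : Sch n), (∀ ξ, θ ξ ≠ 0 → 2 ^ (k - 1) ≤ ‖ξ‖ ∧ ‖ξ‖ ≤ 2 ^ (k + 1)) →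
    tL 2 a b (fun t => nL 4 (T θ (u t))) ≤ C * ofReal (((2 : ℝ) ^ k) ^ ((n : ℝ) / 4 - 2)) *
      (nL 2 (T θ (u a)) + ∫⁻ τ in Icc a b, nL 2 (T θ (cub (u τ)))) := by
  have hb1 : ∀ ξ : Rn n, ‖ξ‖ ≤ 1 → bmp n ξ = 1 := fun ξ h => (bmp n).one_of_mem_closedBall (by simpa [bmp] using h)
  have hb0 : ∀ ξ : Rn n, 2 ≤ ‖ξ‖ → bmp n ξ = 0 := fun ξ h => (bmp n).zero_of_le_dist (by simpa [bmp] using h)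
  obtain ⟨C, hC, H⟩ := _root_.strichartz hn (χ := fun ξ => bmp n ((1 / 2 : ℝ) • ξ) - bmp n ((4 : ℝ) • ξ)) (r := 1 / 4) (R := 4)
    (((bmp n).contDiff.comp (contDiff_const_smul _)).sub ((bmp n).contDiff.comp (contDiff_const_smul _))) (by norm_num)
    (fun ξ h => by
      rw [hb1, hb1, sub_self] <;> rw [norm_smul] <;> norm_num <;> linarith)
    (fun ξ h => by
      rw [hb0, hb0, sub_self] <;> rw [norm_smul] <;> norm_num <;> linarith)
    (fun ξ => by
      rcases le_or_gt ‖ξ‖ 2 with h | h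
      · rw [hb1 ((1 / 2 : ℝ) • ξ) (by rw [norm_smul]; norm_num; linarith), sub_nonneg]; exact (bmp n).le_one
      · rw [hb0 ((4 : ℝ) • ξ) (by rw [norm_smul]; norm_num; linarith), sub_zero]; exact (bmp n).nonneg)
    (fun ξ => by
      have h1 := (bmp n).le_one (x := (1 / 2 : ℝ) • ξ)
      have h2 := (bmp n).nonneg (x := (4 : ℝ) • ξ)
      linarith)
  refine ⟨ofReal √C, ofReal_ne_top, fun u a b R hab h k θ hθ => ?_⟩
  have hg := h.good (by omega) hn'
  have hv := hg.T θ
  have hΦ := hg.cub.T θ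
  have hk : (0 : ℝ) < 2 ^ k := by positivity
  have main := H (2 ^ k) hk a b hab (fun t => T θ (u t)) (fun t => T θ (rhs (u t))) (fun t => T θ (cub (u t))) ?_ hv.cont hΦ.cont
    (fun t ht => (h.hasDerivAt_L2 (by omega) hn' ht).L2_T θ) (fun t _ ξ => fourier_T_rhs θ (u t) ξ) hv.bdd
  · have hi : ∫⁻ t in Icc a b, nL 4 (T θ (u t)) ^ (2 : ℝ) = ofReal (∫ t in a..b, √(Q4 (T θ (u t)))) := by
      obtain ⟨B, hB⟩ := hv.bdd
      have hc := (continuousOn_Q4 hv.cont hB).sqrt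
      rw [integral_of_le hab, ← integral_Icc_eq_integral_Ioc,
        ofReal_integral_eq_lintegral_ofReal hc.integrableOn_Icc (ae_of_all _ fun _ => sqrt_nonneg _)]
      simp only [nL_four_sq]
    have h0 : 0 ≤ ∫ t in a..b, ‖L2 (T θ (cub (u t)))‖ := intervalIntegral.integral_nonneg hab fun _ _ => norm_nonneg _
    rw [tL, hi, hΦ.lintegral_nL_two hab, nL_two_eq, ← ofReal_add (norm_nonneg _) h0,
      ← ofReal_mul (by positivity), ← ofReal_mul (by positivity),
      ofReal_rpow_of_nonneg (intervalIntegral.integral_nonneg hab fun _ _ => sqrt_nonneg _) (by norm_num)]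
    refine ofReal_le_ofReal ?_
    rw [← sqrt_eq_rpow]
    refine sqrt_le_iff.2 ⟨by positivity, main.trans_eq ?_⟩
    rw [mul_pow, mul_pow, sq_sqrt hC.le, ← rpow_mul_natCast hk.le]
    congr 3
    push_cast; ring
  · intro t _ ξ hξ
    rw [fourier_T] at hξ
    obtain ⟨h1, h2⟩ := hθ ξ (left_ne_zero_of_mul hξ)
    rw [zpow_sub_one₀ two_ne_zero] at h1
    rw [zpow_add_one₀ two_ne_zero] at h2
    have e : ‖((2 : ℝ) ^ k)⁻¹ • ξ‖ = ‖ξ‖ / 2 ^ k := by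
      rw [norm_smul, norm_inv, norm_of_nonneg hk.le, div_eq_inv_mul]
    rw [hb1, hb0, sub_zero]
    · rw [norm_smul, e, norm_of_nonneg (by norm_num), mul_div_assoc', le_div_iff₀ hk]; linarith
    · rw [norm_smul, e, norm_of_nonneg (by norm_num), mul_div_assoc', div_le_iff₀ hk]; linarith

/-! ### Nonlinear and frequency-localised estimates in space -/

lemma nL_mul_sq_le {p q r : ℝ} (hp : 0 < p) (hpq : 2 * p < q) (hpqr : 1 / p = 2 / q + 1 / r) {f h : Rn n → ℂ}
    (hf : Continuous f) (hh : Continuous h) :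
    (∫⁻ x, (‖f x‖ₑ ^ 2 * ‖h x‖ₑ) ^ p) ^ (1 / p) ≤ nL q f ^ 2 * nL r h := by
  have hq : 0 < q := by linarith
  refine (ENNReal.lintegral_Lp_mul_le_Lq_mul_Lr hp (q := q / 2) (r := r) (by linarith) (by rw [hpqr]; congr 1; field_simp)
    volume (f := fun x => ‖f x‖ₑ ^ 2) (g := fun x => ‖h x‖ₑ) (hf.enorm.measurable.pow_const 2).aemeasurable hh.enorm.aemeasurable).trans_eq ?_
  unfold nL eLpNorm'
  congr 1
  rw [← ENNReal.rpow_natCast, ← ENNReal.rpow_mul]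
  simp_rw [← ENNReal.rpow_natCast, ← ENNReal.rpow_mul]
  congr 2
  · funext x; congr 1; push_cast; ring
  · push_cast; field_simp

lemma nL_cub_sub_le {p q r : ℝ} (hp : 1 ≤ p) (hpq : 2 * p < q) (hpqr : 1 / p = 2 / q + 1 / r) (f g : Sch n) :
    nL p (cub f - cub g : Sch n) ≤ ofReal (3 / 2) * ((nL q f ^ 2 + nL q g ^ 2) * nL r (f - g : Sch n)) := by
  have hp0 : 0 < p := by linarith
  have h1 : ∀ x, ‖(cub f - cub g : Sch n) x‖ₑ ≤
      ofReal (3 / 2) * (‖f x‖ₑ ^ 2 * ‖(f - g) x‖ₑ + ‖g x‖ₑ ^ 2 * ‖(f - g) x‖ₑ) := fun x => by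
    simp_rw [← ofReal_norm]
    rw [← ofReal_pow (norm_nonneg _), ← ofReal_pow (norm_nonneg _), ← ofReal_mul (by positivity),
      ← ofReal_mul (by positivity), ← ofReal_add (by positivity) (by positivity),
      ← ofReal_mul (by positivity)]
    refine ofReal_le_ofReal ?_
    rw [sub_apply, sub_apply, cub_apply, cub_apply]
    exact (norm_cubic_sub_le (f x) (g x)).trans_eq (by ring)
  have hm : ∀ h : Sch n, AEMeasurable (fun x => ‖h x‖ₑ ^ 2 * ‖(f - g) x‖ₑ) volume := fun h =>
    ((h.continuous.enorm.measurable.pow_const 2).mul (f - g).continuous.enorm.measurable).aemeasurable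
  calc nL p (cub f - cub g : Sch n)
      ≤ (∫⁻ x, (ofReal (3 / 2) * (‖f x‖ₑ ^ 2 * ‖(f - g) x‖ₑ + ‖g x‖ₑ ^ 2 * ‖(f - g) x‖ₑ)) ^ p) ^ (1 / p) := by
        unfold nL eLpNorm'
        gcongr with x
        exact h1 x
    _ = ofReal (3 / 2) * (∫⁻ x, (‖f x‖ₑ ^ 2 * ‖(f - g) x‖ₑ + ‖g x‖ₑ ^ 2 * ‖(f - g) x‖ₑ) ^ p) ^ (1 / p) := by
        simp_rw [mul_rpow_of_nonneg _ _ hp0.le]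
        rw [lintegral_const_mul' _ _ (by finiteness), mul_rpow_of_nonneg _ _ (by positivity), ← ENNReal.rpow_mul,
          mul_one_div_cancel hp0.ne', ENNReal.rpow_one]
    _ ≤ _ := by
        gcongr
        refine (ENNReal.lintegral_Lp_add_le (hm f) (hm g) hp).trans ?_
        rw [add_mul]
        exact add_le_add (nL_mul_sq_le hp0 hpq hpqr f.continuous (f - g).continuous)
          (nL_mul_sq_le hp0 hpq hpqr g.continuous (f - g).continuous)

lemma nL_two_D_le (k : ℤ) (f : Sch n) : nL 2 (D k f) ≤ 2 * nL 2 f := by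
  rw [nL_two_eq, nL_two_eq]
  refine (ofReal_le_ofReal (norm_L2_D_le k f)).trans_eq ?_
  rw [ofReal_mul two_pos.le]; simp

/-- The nonlinearity at frequency `2^k` only sees the part of `f` at frequencies `≳ 2^k`. -/
lemma exists_nL_D_cub_le {q r : ℝ} (hq : 4 < q) (hqr : 1 / 2 = 2 / q + 1 / r) : ∃ C ≠ ∞,
    ∀ (k : ℤ) (f : Sch n), nL 2 (D k (cub f)) ≤ C * (nL q f ^ 2 * nL r (f - S (k - 4) f : Sch n)) := by
  refine ⟨2 * (ofReal (3 / 2) * (1 + nL 1 (𝓕⁻ (lpφ n) : Sch n) ^ 2)), ?_, fun k f => ?_⟩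
  · have := nL_ne_top (n := n) one_pos (𝓕⁻ (lpφ n) : Sch n)
    finiteness
  rw [D_cub_eq]
  refine (nL_two_D_le k _).trans ?_
  rw [mul_assoc]
  gcongr
  refine (nL_cub_sub_le one_le_two (by linarith) hqr f (S (k - 4) f)).trans ?_
  rw [mul_assoc]
  refine mul_le_mul_right ?_ _
  rw [← mul_assoc]
  refine mul_le_mul_left ?_ _
  rw [add_mul, one_mul, ← mul_pow]
  gcongr
  exact nL_T_dil_le (by linarith) _ _ _

lemma exists_bernstein_D {p q : ℝ} (hp : 1 < p) (hpq : p ≤ q) : ∃ C ≠ ∞, ∀ (k : ℤ) (f : Sch n),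
    BL (k + 1) f → nL q f ≤ C * ofReal (((2 : ℝ) ^ k) ^ (n / p - n / q)) * nL p f := by
  obtain ⟨C, hC, H⟩ := nL_bernstein (n := n) hp hpq
  refine ⟨C * ofReal (2 ^ (n / p - n / q)), by finiteness, fun k f hf => (H _ _ hf).trans_eq ?_⟩
  rw [show (n : ℝ) * (1 / p - 1 / q) = n / p - n / q by ring, zpow_add_one₀ two_ne_zero, mul_comm ((2 : ℝ) ^ k) 2,
    mul_rpow two_pos.le (by positivity), ofReal_mul (by positivity), mul_assoc C]
  try ring

lemma LpN_eq_nL (p : ℝ) (f : Rn n → ℂ) : LpN p f = nL p f := rfl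

lemma integrable_norm_rpow_mul (hn : 5 ≤ n) {σ : ℝ} (hσ : 0 ≤ σ) (hσ1 : σ ≤ 9 / 2) (f : Sch n) :
    Integrable fun ξ => ((‖ξ‖ ^ (-σ) : ℝ) : ℂ) * f ξ := by
  have h1 := integrable_ball_norm_rpow hn 1
  obtain ⟨M, hM⟩ : ∃ M, ∀ x, ‖f x‖ ≤ M := ⟨_, norm_le_seminorm ℝ f⟩
  refine ((h1.mul_const M).add f.integrable.norm).mono' ?_ (Eventually.of_forall fun ξ => ?_)
  · exact (Measurable.mul (by fun_prop) f.continuous.measurable).aestronglyMeasurable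
  · rw [norm_mul, norm_real, norm_of_nonneg (by positivity)]
    have hM0 : 0 ≤ M := (norm_nonneg _).trans (hM 0)
    simp only [Pi.add_apply]
    by_cases hξ : ‖ξ‖ < 1
    · rw [Set.indicator_of_mem (by simpa using hξ)]
      rcases (norm_nonneg ξ).eq_or_lt with h0 | h0
      · rcases hσ.eq_or_lt with rfl | hσ'
        · rw [← h0]; norm_num
        · rw [← h0, zero_rpow (by linarith), zero_rpow (by norm_num)]; norm_num
      · have : ‖ξ‖ ^ (-σ) ≤ ‖ξ‖ ^ (-(9 / 2) : ℝ) := rpow_le_rpow_of_exponent_ge h0 hξ.le (by linarith)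
        have h2 : ‖ξ‖ ^ (-σ) * ‖f ξ‖ ≤ ‖ξ‖ ^ (-(9 / 2) : ℝ) * M := by gcongr; exact hM ξ
        linarith [norm_nonneg (f ξ)]
    · rw [Set.indicator_of_notMem (by simpa using hξ), zero_mul, zero_add]
      refine mul_le_of_le_one_left (norm_nonneg _) (rpow_le_one_of_one_le_of_nonpos (not_lt.1 hξ) (by linarith))

lemma exists_norm_rpow_mul_lpψ (σ : ℝ) : ∃ θ : Sch n, ∀ ξ, θ ξ = ((‖ξ‖ ^ σ : ℝ) : ℂ) * lpψ n ξ := by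
  have hψ : ∀ ξ, lpψ n ξ = ((bmp n ξ - bmp n ((2 : ℝ) • ξ) : ℝ) : ℂ) := fun ξ => by
    rw [lpψ, sub_apply, dil_lpφ_real, Complex.ofReal_sub]
    congr 3
    norm_num
  have hlow : ∀ ξ : Rn n, ‖ξ‖ ≤ 1 / 2 → bmp n ξ - bmp n ((2 : ℝ) • ξ) = 0 := fun ξ h => by
    rw [(bmp n).one_of_mem_closedBall, (bmp n).one_of_mem_closedBall, sub_self] <;> simp [bmp, norm_smul] <;> linarith
  have hhigh : ∀ ξ : Rn n, 2 ≤ ‖ξ‖ → bmp n ξ - bmp n ((2 : ℝ) • ξ) = 0 := fun ξ h => by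
    rw [(bmp n).zero_of_le_dist, (bmp n).zero_of_le_dist, sub_self] <;> simp [bmp, norm_smul] <;> linarith
  have hc : ContDiff ℝ (⊤ : ℕ∞) fun ξ : Rn n => ‖ξ‖ ^ σ * (bmp n ξ - bmp n ((2 : ℝ) • ξ)) := by
    rw [contDiff_iff_contDiffAt]
    intro ξ
    by_cases h : ξ = 0
    · subst h
      refine (contDiffAt_const (c := (0 : ℝ))).congr_of_eventuallyEq ?_
      filter_upwards [Metric.ball_mem_nhds (0 : Rn n) (by norm_num : (0 : ℝ) < 1 / 2)] with η hη
      rw [hlow η (by simpa using (mem_ball_zero_iff.1 hη).le), mul_zero]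
    · exact ((contDiffAt_norm ℝ h).rpow_const_of_ne (norm_ne_zero_iff.2 h)).mul
        ((bmp n).contDiff.sub ((bmp n).contDiff.comp (contDiff_const_smul _))).contDiffAt
  obtain ⟨θ, hθ⟩ := exists_schwartz (r := 2) hc fun ξ h => by rw [hhigh ξ h, mul_zero]
  exact ⟨θ, fun ξ => by rw [hθ, hψ]; push_cast; ring⟩

/-- The Morawetz-type norm controls every Littlewood–Paley piece. -/
lemma exists_nL_D_le_absGrad (hn : 5 ≤ n) {σ p : ℝ} (hσ : 0 ≤ σ) (hσ1 : σ ≤ 9 / 2) (hp : 4 ≤ p) :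
    ∃ C ≠ ∞, ∀ (k : ℤ) (f : Sch n),
    nL p (D k f) ≤ C * ofReal (((2 : ℝ) ^ k) ^ (σ + n / 4 - n / p)) * LpN 4 (absGrad (-σ) f) := by
  obtain ⟨θ, hθ⟩ := exists_norm_rpow_mul_lpψ (n := n) σ
  obtain ⟨C, hC, HB⟩ := exists_bernstein_D (n := n) (p := 4) (q := p) (by norm_num) hp
  refine ⟨C * nL 1 (𝓕⁻ θ : Sch n), ENNReal.mul_ne_top hC (nL_ne_top one_pos _), fun k f => ?_⟩
  refine (HB k _ (BL_D k f)).trans ?_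
  have hk : (0 : ℝ) < 2 ^ k := by positivity
  have h1 : nL 4 (D k f) ≤ ofReal (((2 : ℝ) ^ k) ^ σ) * (nL 1 (𝓕⁻ θ : Sch n) * LpN 4 (absGrad (-σ) f)) := by
    have e : (fun ξ => dil k (lpψ n) ξ * 𝓕 f ξ) = ((((2 : ℝ) ^ k) ^ σ : ℝ) : ℂ) •
        fun ξ => dil k θ ξ * (((‖ξ‖ ^ (-σ) : ℝ) : ℂ) * 𝓕 f ξ) := by
      funext ξ
      simp only [Pi.smul_apply, smul_eq_mul, dil_apply, hθ]
      by_cases h : ξ = 0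
      · have h0 : lpψ n 0 = 0 := by
          have := dil_lpψ_low (n := n) (k := 0) (ξ := 0) (by simp)
          rwa [dil_apply, smul_zero] at this
        subst h
        rw [smul_zero, h0]; ring
      · have hξ : 0 < ‖ξ‖ := norm_pos_iff.2 h
        have : ((2 : ℝ) ^ k) ^ σ * ((‖((2 : ℝ) ^ k)⁻¹ • ξ‖) ^ σ * ‖ξ‖ ^ (-σ)) = 1 := by
          rw [norm_smul, norm_inv, norm_of_nonneg hk.le, mul_rpow (by positivity) hξ.le, inv_rpow hk.le,
            rpow_neg hξ.le]
          field_simp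
        calc _ = ((((2 : ℝ) ^ k) ^ σ * ((‖((2 : ℝ) ^ k)⁻¹ • ξ‖) ^ σ * ‖ξ‖ ^ (-σ)) : ℝ) : ℂ) *
              (lpψ n (((2 : ℝ) ^ k)⁻¹ • ξ) * 𝓕 f ξ) := by rw [this]; simp
          _ = _ := by push_cast; ring
    have e2 : ⇑(D k f) = ((((2 : ℝ) ^ k) ^ σ : ℝ) : ℂ) • 𝓕⁻ (fun ξ => dil k θ ξ * (((‖ξ‖ ^ (-σ) : ℝ) : ℂ) * 𝓕 f ξ)) := by
      rw [D, T_eq, e]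
      ext x
      simp only [fourierInv_eq, Pi.smul_apply]
      rw [← integral_smul]
      congr 1; ext ξ
      exact smul_comm _ _ _
    have h2 := nL_fourierInv_mul_le (p := 4) (by norm_num) θ k (integrable_norm_rpow_mul hn hσ hσ1 (𝓕 f))
    rw [e2, nL, eLpNorm'_const_smul _ (by norm_num), ← ofReal_norm, norm_real, norm_of_nonneg (by positivity)]
    refine mul_le_mul_right (h2.trans_eq ?_) _
    rw [LpN_eq_nL]; rfl
  calc _ ≤ C * ofReal (((2 : ℝ) ^ k) ^ ((n : ℝ) / 4 - n / p)) *
      (ofReal (((2 : ℝ) ^ k) ^ σ) * (nL 1 (𝓕⁻ θ : Sch n) * LpN 4 (absGrad (-σ) f))) := by gcongr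
    _ = _ := by
      rw [show σ + (n : ℝ) / 4 - n / p = ((n : ℝ) / 4 - n / p) + σ by ring, rpow_add hk, ofReal_mul (by positivity)]
      ring

/-! ### Persistence of frequency-localised bounds -/

/-- Admissible decreasing weights on dyadic frequencies. -/
structure Wt (ν : ℤ → ℝ) : Prop where
  pos : ∀ k, 0 < ν k
  half : ∀ k, ν (k + 1) ≤ ν k / 2
  slow : ∀ k, ν k ≤ 2 ^ 10 * ν (k + 1)

namespace Wt
variable {ν : ℤ → ℝ}

lemma add_nat_le (h : Wt ν) (k : ℤ) (j : ℕ) : ν (k + j) ≤ ν k * (1 / 2) ^ j := by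
  induction j with
  | zero => simp
  | succ j ih =>
    have := h.half (k + j)
    rw [Nat.cast_succ, ← add_assoc, pow_succ]
    linarith

lemma le_add_nat (h : Wt ν) (k : ℤ) (j : ℕ) : ν k ≤ (2 ^ 10) ^ j * ν (k + j) := by
  induction j with
  | zero => simp
  | succ j ih =>
    rw [Nat.cast_succ, ← add_assoc, pow_succ, mul_assoc]
    exact ih.trans (mul_le_mul_of_nonneg_left (h.slow _) (by positivity))

lemma zero_le_mul (h : Wt ν) (k : ℤ) : min 1 (((2 : ℝ) ^ k)⁻¹ ^ 10) * ν 0 ≤ ν k := by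
  have h0 := (h.pos 0).le
  rcases Int.eq_nat_or_neg k with ⟨j, rfl | rfl⟩
  · have := h.le_add_nat 0 j
    rw [zero_add] at this
    calc _ ≤ ((2 : ℝ) ^ (j : ℤ))⁻¹ ^ 10 * ν 0 := by gcongr; exact min_le_right _ _
      _ ≤ ((2 : ℝ) ^ (j : ℤ))⁻¹ ^ 10 * ((2 ^ 10) ^ j * ν j) := by gcongr
      _ = ν j := by
        rw [zpow_natCast, ← mul_assoc, inv_pow, pow_right_comm, inv_mul_cancel₀ (by positivity), one_mul]
  · have := h.add_nat_le (-j) j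
    rw [neg_add_cancel] at this
    calc _ ≤ 1 * ν 0 := by gcongr; exact min_le_left _ _
      _ ≤ ν (-j) * (1 / 2) ^ j := by rwa [one_mul]
      _ ≤ _ := mul_le_of_le_one_right (h.pos _).le (pow_le_one₀ (by norm_num) (by norm_num))

end Wt

lemma NB.norm_sub_S_zpow_le (hn : 1 ≤ n) {R : ℝ} {f : Sch n} (h : NB R f) (l : ℤ) :
    ‖L2 (f - S l f)‖ ≤ 2 * R * ((2 : ℝ) ^ l)⁻¹ ^ 10 := by
  have hR := h.nonneg
  have h1 : nL 2 (f - S l f : Sch n) ≤ ofReal (R * ((2 : ℝ) ^ l)⁻¹ ^ 10 / (1 - 1 / 2)) := by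
    refine (nL_sub_S_le hn one_le_two l f).trans (tsum_le_of_geometric (by norm_num) (by norm_num) fun j => ?_)
    rw [nL_two_eq]
    refine ofReal_le_ofReal ((h.2 _).trans ?_)
    rw [two_zpow_add_nat, zpow_add_one₀ two_ne_zero, mul_inv, mul_inv, mul_pow, mul_pow, mul_assoc, mul_assoc R]
    gcongr
    have : ((2 : ℝ) ^ j)⁻¹ ^ 10 ≤ (1 / 2) ^ j := by
      rw [← inv_pow, ← pow_mul, one_div]
      exact pow_le_pow_of_le_one (by norm_num) (by norm_num) (by omega)
    calc _ ≤ 1 * ((2 : ℝ) ^ j)⁻¹ ^ 10 := by gcongr; norm_num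
      _ ≤ _ := by rwa [one_mul]
  rw [nL_two_eq] at h1
  refine ((ofReal_le_ofReal_iff (by positivity)).1 h1).trans_eq ?_
  ring

lemma exists_norm_D_cub_le (hn : 1 ≤ n) (hn' : n ≤ 14) (R : ℝ) : ∃ E : ℝ, 0 ≤ E ∧ ∀ f : Sch n, NB R f → ∀ k : ℤ,
    ‖L2 (D k (cub f))‖ ≤ E * min 1 (((2 : ℝ) ^ k)⁻¹ ^ 10) := by
  obtain ⟨C, hC, hsup⟩ := exists_sup_bound (n := n) hn hn'
  refine ⟨2 * (3 * (C * R) ^ 2 * (2 * |R| * 16 ^ 10)), by positivity, fun f hf k => ?_⟩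
  have hR := hf.nonneg
  rw [abs_of_nonneg hR, mul_min_of_nonneg _ _ (by positivity), mul_one]
  refine le_min ?_ ?_
  · refine (norm_L2_D_le k _).trans ?_
    have := norm_L2_cub_le (hsup R f hf)
    refine mul_le_mul_of_nonneg_left (this.trans ?_) two_pos.le
    calc (C * R) ^ 2 * ‖L2 f‖ ≤ (C * R) ^ 2 * R := by gcongr; exact hf.1
      _ = 1 * (C * R) ^ 2 * (1 * R * 1) := by ring
      _ ≤ 3 * (C * R) ^ 2 * (2 * R * 16 ^ 10) := by gcongr <;> norm_num
  · rw [D_cub_eq]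
    refine (norm_L2_D_le k _).trans ?_
    rw [L2_sub]
    have := norm_L2_cub_sub_le (hsup R f hf) (hsup R _ (hf.lowpass (k - 4)))
    rw [← L2_sub] at this
    rw [mul_assoc]
    refine mul_le_mul_of_nonneg_left ((this.trans (mul_le_mul_of_nonneg_left (hf.norm_sub_S_zpow_le hn _) (by positivity))).trans_eq ?_) two_pos.le
    rw [zpow_sub₀ two_ne_zero, inv_div, div_eq_mul_inv, mul_pow]
    norm_num
    ring

/-- Initial size plus Duhamel forcing at frequency `2^k`. -/
def Amp (u : ℝ → Sch n) (a b : ℝ) (k : ℤ) : ℝ≥0∞ :=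
  nL 2 (D k (u a)) + ∫⁻ τ in Icc a b, nL 2 (D k (cub (u τ)))

lemma NiceSol.nL_D_le_Amp (hn : 1 ≤ n) (hn' : n ≤ 14) (h : NiceSol u a b R) (k : ℤ)
    {t : ℝ} (ht : t ∈ Icc a b) : nL 2 (D k (u t)) ≤ Amp u a b k := h.duhamel hn hn' _ ht

lemma NiceSol.exists_lintegral_D_cub_le (hn : 1 ≤ n) (hn' : n ≤ 14) (h : NiceSol u a b R) :
    ∃ E : ℝ, 0 ≤ E ∧ ∀ k : ℤ, ∫⁻ τ in Icc a b, nL 2 (D k (cub (u τ))) ≤ ofReal (E * min 1 (((2 : ℝ) ^ k)⁻¹ ^ 10)) := by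
  obtain ⟨E, hE, H⟩ := exists_norm_D_cub_le (n := n) hn hn' R
  refine ⟨E * |b - a|, by positivity, fun k => ?_⟩
  calc _ ≤ ∫⁻ τ in Icc a b, ofReal (E * min 1 (((2 : ℝ) ^ k)⁻¹ ^ 10)) :=
        setLIntegral_mono' measurableSet_Icc fun t ht => by
          rw [nL_two_eq]; exact ofReal_le_ofReal (H _ (h.nb t ht) k)
    _ = ofReal (E * min 1 (((2 : ℝ) ^ k)⁻¹ ^ 10)) * ofReal (b - a) := by
        rw [setLIntegral_const, volume_Icc]
    _ ≤ ofReal (E * min 1 (((2 : ℝ) ^ k)⁻¹ ^ 10)) * ofReal |b - a| := by gcongr; exact le_abs_self _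
    _ = _ := by rw [← ofReal_mul (by positivity)]; congr 1; ring

lemma NiceSol.Amp_ne_top (hn : 1 ≤ n) (hn' : n ≤ 14) (h : NiceSol u a b R) (k : ℤ) :
    Amp u a b k ≠ ∞ := by
  obtain ⟨E, -, H⟩ := h.exists_lintegral_D_cub_le hn hn'
  exact ENNReal.add_ne_top.2 ⟨nL_ne_top two_pos _, ((H k).trans_lt ENNReal.ofReal_lt_top).ne⟩

lemma NiceSol.strichartz_D (hn : 5 ≤ n) (hn' : n ≤ 14) : ∃ C ≠ ∞, ∀ (u : ℝ → Sch n) a b R, a ≤ b →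
    NiceSol u a b R → ∀ (k : ℤ),
    tL 2 a b (fun t => nL 4 (D k (u t))) ≤ C * ofReal (((2 : ℝ) ^ k) ^ ((n : ℝ) / 4 - 2)) * Amp u a b k := by
  obtain ⟨C, hC, H⟩ := NiceSol.strichartz hn hn'
  refine ⟨C, hC, fun u a b R hab hu k => H u a b R hab hu k _ fun ξ hξ => ⟨?_, ?_⟩⟩
  · by_contra! h; exact hξ (dil_lpψ_low h.le)
  · by_contra! h; exact hξ (dil_lpψ_high h.le)

lemma rpow_add_ofReal {k : ℤ} (x y : ℝ) : ofReal (((2 : ℝ) ^ k) ^ x) * ofReal (((2 : ℝ) ^ k) ^ y) =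
    ofReal (((2 : ℝ) ^ k) ^ (x + y)) := by
  rw [← ofReal_mul (by positivity), ← rpow_add (by positivity)]

lemma NiceSol.exists_lintegral_D_cub_le_mul (hn : 5 ≤ n) (hn' : n ≤ 7) : ∃ C ≠ ∞,
    ∀ (u : ℝ → Sch n) a b R, a ≤ b → NiceSol u a b R → ∀ (ν : ℤ → ℝ), Wt ν → ∀ Q : ℝ≥0∞,
    (∀ k, Amp u a b k ≤ Q * ofReal (ν k)) → ∀ k, ∫⁻ τ in Icc a b, nL 2 (D k (cub (u τ))) ≤
      C * tL 4 a b (fun t => nL n (u t)) ^ 2 * Q * ofReal (ν k) := by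
  have hn5 : (5 : ℝ) ≤ n := by exact_mod_cast hn
  have hn7 : (n : ℝ) ≤ 7 := by exact_mod_cast hn'
  have hn4 : (0 : ℝ) < n - 4 := by linarith
  set r : ℝ := 2 * n / (n - 4) with hr
  have hr4 : 4 ≤ r := by rw [hr, le_div_iff₀ hn4]; linarith
  have hr0 : 1 / 2 = 2 / (n : ℝ) + 1 / r := by rw [hr]; field_simp; ring
  obtain ⟨C1, hC1, H1⟩ := exists_nL_D_cub_le (n := n) (q := n) (r := r) (by linarith) hr0
  obtain ⟨C2, hC2, H2⟩ := NiceSol.strichartz_D (n := n) hn (by omega)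
  obtain ⟨C3, hC3, H3⟩ := exists_bernstein_D (n := n) (p := 4) (q := r) (by norm_num) hr4
  refine ⟨C1 * (C3 * C2 * ofReal (2 ^ 31)), by finiteness, fun u a b R hab hu ν hν Q hQ k => ?_⟩
  have hg := hu.good (by omega) (by omega)
  have hD : ∀ k, tL 2 a b (fun t => nL r (D k (u t))) ≤ C3 * C2 * Q * ofReal (ν k) := fun k =>
    calc _ ≤ tL 2 a b (fun t => (C3 * ofReal (((2 : ℝ) ^ k) ^ ((n : ℝ) / 4 - n / r))) * nL 4 (D k (u t))) :=
          tL_mono two_pos fun t _ => H3 k _ (BL_D k _)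
      _ = C3 * ofReal (((2 : ℝ) ^ k) ^ ((n : ℝ) / 4 - n / r)) * tL 2 a b (fun t => nL 4 (D k (u t))) :=
          tL_const_mul two_pos (by finiteness)
      _ ≤ C3 * ofReal (((2 : ℝ) ^ k) ^ ((n : ℝ) / 4 - n / r)) *
          (C2 * ofReal (((2 : ℝ) ^ k) ^ ((n : ℝ) / 4 - 2)) * (Q * ofReal (ν k))) := by
          gcongr; exact (H2 u a b R hab hu k).trans (by gcongr; exact hQ k)
      _ = C3 * C2 * Q * ofReal (ν k) * (ofReal (((2 : ℝ) ^ k) ^ ((n : ℝ) / 4 - n / r)) *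
          ofReal (((2 : ℝ) ^ k) ^ ((n : ℝ) / 4 - 2))) := by ring
      _ = _ := by
          rw [rpow_add_ofReal, show (n : ℝ) / 4 - n / r + (n / 4 - 2) = 0 by rw [hr]; field_simp; ring, rpow_zero,
            ofReal_one, mul_one]
  have hS : tL 2 a b (fun t => nL r (u t - S (k - 4) (u t) : Sch n)) ≤
      C3 * C2 * Q * (ofReal (2 ^ 31) * ofReal (ν k)) :=
    calc _ ≤ tL 2 a b (fun t => ∑' j : ℕ, nL r (D (k - 4 + 1 + j) (u t))) :=
          tL_mono two_pos fun t _ => nL_sub_S_le (by omega) (by linarith) _ _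
      _ ≤ ∑' j : ℕ, tL 2 a b (fun t => nL r (D (k - 4 + 1 + j) (u t))) :=
          tL_tsum_le one_le_two fun j => (hg.D _).aemeasurable_nL (by linarith)
      _ ≤ ∑' j : ℕ, C3 * C2 * Q * ofReal (ν (k - 4 + 1 + j)) := ENNReal.tsum_le_tsum fun j => hD _
      _ = C3 * C2 * Q * ∑' j : ℕ, ofReal (ν (k - 4 + 1 + j)) := ENNReal.tsum_mul_left
      _ ≤ _ := by
          gcongr
          refine (tsum_le_of_geometric (by norm_num) (by norm_num) fun j =>
            ofReal_le_ofReal (hν.add_nat_le (k - 4 + 1) j)).trans ?_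
          rw [← ofReal_mul (by positivity)]
          refine ofReal_le_ofReal ?_
          have := hν.le_add_nat (k - 4 + 1) 3
          rw [show k - 4 + 1 + ((3 : ℕ) : ℤ) = k by push_cast; ring] at this
          norm_num at this ⊢
          linarith
  calc _ ≤ ∫⁻ τ in Icc a b, C1 * (nL n (u τ) ^ 2 * nL r (u τ - S (k - 4) (u τ) : Sch n)) :=
        lintegral_mono fun τ => H1 k (u τ)
    _ = C1 * ∫⁻ τ in Icc a b, (nL n (u τ) ^ 2 * nL r (u τ - S (k - 4) (u τ) : Sch n)) :=
        lintegral_const_mul' _ _ hC1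
    _ ≤ C1 * (tL 2 a b (fun t => nL n (u t) ^ 2) * tL 2 a b (fun t => nL r (u t - S (k - 4) (u t) : Sch n))) := by
        gcongr
        exact lintegral_mul_le_tL ((hg.aemeasurable_nL (by linarith)).pow_const 2) ((hg.sub (hg.S _)).aemeasurable_nL (by linarith))
    _ ≤ C1 * (tL 4 a b (fun t => nL n (u t)) ^ 2 * (C3 * C2 * Q * (ofReal (2 ^ 31) * ofReal (ν k)))) := by
        rw [tL_two_sq]; gcongr
    _ = _ := by ring

/-- A small spacetime norm propagates weighted frequency bounds. -/
lemma NiceSol.exists_persist (hn : 5 ≤ n) (hn' : n ≤ 7) : ∃ η : ℝ, 0 < η ∧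
    ∀ (u : ℝ → Sch n) a b R, a ≤ b → NiceSol u a b R → tL 4 a b (fun t => nL n (u t)) ≤ ofReal η →
    ∀ (ν : ℤ → ℝ), Wt ν → ∀ B : ℝ≥0∞, (∀ k, nL 2 (D k (u a)) ≤ B * ofReal (ν k)) →
      ∀ k, Amp u a b k ≤ 2 * B * ofReal (ν k) := by
  obtain ⟨C, hC, H⟩ := NiceSol.exists_lintegral_D_cub_le_mul (n := n) hn hn'
  obtain ⟨η, hη, hCη⟩ : ∃ η : ℝ, 0 < η ∧ C * ofReal η ^ 2 ≤ 2⁻¹ := by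
    refine ⟨√((2 * (C.toReal + 1))⁻¹), by positivity, ?_⟩
    rw [← ofReal_pow (by positivity), sq_sqrt (by positivity)]
    nth_rw 1 [← ofReal_toReal hC]
    rw [← ofReal_mul (by positivity), show (2 : ℝ≥0∞)⁻¹ = ofReal 2⁻¹ by
      rw [ENNReal.ofReal_inv_of_pos two_pos]; simp]
    refine ofReal_le_ofReal ?_
    rw [mul_inv, ← mul_assoc, mul_comm C.toReal, mul_assoc]
    refine mul_le_of_le_one_right (by positivity) ?_
    rw [← div_eq_mul_inv, div_le_one (by positivity)]; linarith
  refine ⟨η, hη, fun u a b R hab hu hX ν hν B hB => ?_⟩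
  set A : ℤ → ℝ≥0∞ := fun k => ∫⁻ τ in Icc a b, nL 2 (D k (cub (u τ))) with hA
  set M : ℝ≥0∞ := ⨆ k, A k / ofReal (ν k) with hM
  have hν0 : ∀ k, ofReal (ν k) ≠ 0 := fun k => by simpa using hν.pos k
  have hAM : ∀ k, A k ≤ M * ofReal (ν k) := fun k =>
    (ENNReal.div_le_iff (hν0 k) ofReal_ne_top).1 (le_iSup (fun k => A k / ofReal (ν k)) k)
  have hMtop : M ≠ ∞ := by
    obtain ⟨E, hE, hE'⟩ := hu.exists_lintegral_D_cub_le (by omega) (by omega)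
    refine ne_top_of_le_ne_top (ofReal_ne_top (r := E / ν 0)) (iSup_le fun k => ?_)
    rw [ENNReal.div_le_iff (hν0 k) ofReal_ne_top, ← ofReal_mul (div_nonneg hE (hν.pos 0).le)]
    refine (hE' k).trans (ofReal_le_ofReal ?_)
    rw [div_mul_eq_mul_div, le_div_iff₀ (hν.pos 0), mul_assoc]
    exact mul_le_mul_of_nonneg_left (hν.zero_le_mul k) hE
  have hAmp : ∀ k, Amp u a b k ≤ (B + M) * ofReal (ν k) := fun k => by
    rw [add_mul]; exact add_le_add (hB k) (hAM k)
  have hM2 : M ≤ 2⁻¹ * (B + M) := iSup_le fun k => by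
    rw [ENNReal.div_le_iff (hν0 k) ofReal_ne_top]
    refine (H u a b R hab hu ν hν _ hAmp k).trans ?_
    gcongr
    exact le_trans (by gcongr) hCη
  have hMB : M ≤ B := by
    have h2 : 2⁻¹ * M ≠ ∞ := ENNReal.mul_ne_top (by simp) hMtop
    have h3 : 2⁻¹ * M + 2⁻¹ * M ≤ 2⁻¹ * B + 2⁻¹ * M := by
      rw [← add_mul, ENNReal.inv_two_add_inv_two, one_mul, ← mul_add]; exact hM2
    have h4 := ENNReal.le_of_add_le_add_right h2 h3
    have h5 := mul_le_mul_right h4 2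
    rwa [← mul_assoc, ← mul_assoc, ENNReal.mul_inv_cancel two_ne_zero (by simp), one_mul, one_mul] at h5
  intro k
  refine (hAmp k).trans ?_
  rw [two_mul]
  gcongr

/-! ### Smallness of spacetime norms -/

lemma NiceSol.exists_tL_four_D_le (hn : 5 ≤ n) (hn' : n ≤ 14) {p : ℝ} (hp : 4 ≤ p) : ∃ C ≠ ∞,
    ∀ (u : ℝ → Sch n) a b R, a ≤ b → NiceSol u a b R → ∀ k : ℤ,
    tL 4 a b (fun t => nL p (D k (u t))) ≤ C * ofReal (((2 : ℝ) ^ k) ^ ((n : ℝ) / 2 - n / p - 1)) * Amp u a b k := by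
  obtain ⟨C2, hC2, H2⟩ := NiceSol.strichartz_D (n := n) hn hn'
  obtain ⟨C3, hC3, H3⟩ := exists_bernstein_D (n := n) (p := 4) (q := p) (by norm_num) hp
  obtain ⟨C4, hC4, H4⟩ := exists_bernstein_D (n := n) (p := 2) (q := p) (by norm_num) (by linarith)
  refine ⟨(C3 * C2) ^ (1 / 2 : ℝ) * C4 ^ (1 / 2 : ℝ), by finiteness, fun u a b R hab hu k => ?_⟩
  have hA := hu.Amp_ne_top (by omega) hn' k
  set K : ℝ := (2 : ℝ) ^ k with hK
  have hK0 : 0 < K := by positivity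
  have h1 : tL 2 a b (fun t => (C3 * ofReal (K ^ ((n : ℝ) / 4 - n / p))) * nL 4 (D k (u t))) ≤
      C3 * C2 * ofReal (K ^ ((n : ℝ) / 2 - n / p - 2)) * Amp u a b k := by
    rw [tL_const_mul two_pos (by finiteness)]
    calc _ ≤ C3 * ofReal (K ^ ((n : ℝ) / 4 - n / p)) * (C2 * ofReal (K ^ ((n : ℝ) / 4 - 2)) * Amp u a b k) := by
          gcongr; exact H2 u a b R hab hu k
      _ = C3 * C2 * (ofReal (K ^ ((n : ℝ) / 4 - n / p)) * ofReal (K ^ ((n : ℝ) / 4 - 2))) * Amp u a b k := by ring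
      _ = _ := by rw [rpow_add_ofReal]; congr 4; ring
  refine (tL_four_le (fun t _ => H3 k _ (BL_D k (u t))) (B := C4 * ofReal (K ^ ((n : ℝ) / 2 - n / p)) * Amp u a b k)
    (fun t ht => (H4 k _ (BL_D k (u t))).trans ?_) (by finiteness) h1).trans_eq ?_
  · gcongr; exact hu.nL_D_le_Amp (by omega) hn' k ht
  · have hh : (0 : ℝ) ≤ 1 / 2 := by norm_num
    simp_rw [mul_rpow_of_nonneg _ _ hh]
    rw [ofReal_rpow_of_pos (by positivity), ofReal_rpow_of_pos (by positivity), ← rpow_mul hK0.le, ← rpow_mul hK0.le]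
    calc _ = C3 ^ (1 / 2 : ℝ) * C2 ^ (1 / 2 : ℝ) * C4 ^ (1 / 2 : ℝ) * (ofReal (K ^ (((n : ℝ) / 2 - n / p - 2) * (1 / 2))) *
          ofReal (K ^ (((n : ℝ) / 2 - n / p) * (1 / 2)))) * (Amp u a b k ^ (1 / 2 : ℝ) * Amp u a b k ^ (1 / 2 : ℝ)) := by ring
      _ = _ := by
        rw [rpow_add_ofReal, ← ENNReal.rpow_add_of_nonneg _ _ hh hh, add_halves, ENNReal.rpow_one]
        congr 4; ring

/-- The spacetime norm of the hypothesis, with general time interval. -/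
def Mor (u : ℝ → Sch n) (a b : ℝ) : ℝ≥0∞ := tL 4 a b fun t => LpN 4 (absGrad (-(((n : ℝ) - 5) / 4)) (u t))

lemma Mor_mono {c d : ℝ} (hc : a ≤ c) (hd : d ≤ b) : Mor u c d ≤ Mor u a b :=
  tL_mono_set (by norm_num) hc hd

lemma two_zpow_rpow_add_nat (k : ℤ) (j : ℕ) (e : ℝ) : ((2 : ℝ) ^ (k + j)) ^ e = ((2 : ℝ) ^ k) ^ e * ((2 : ℝ) ^ e) ^ j := by
  rw [two_zpow_add_nat, mul_rpow (by positivity) (by positivity), ← rpow_natCast, ← rpow_mul two_pos.le,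
    ← rpow_natCast, ← rpow_mul two_pos.le, mul_comm e]

lemma two_zpow_rpow_sub_nat (k : ℤ) (j : ℕ) (e : ℝ) : ((2 : ℝ) ^ (k - j)) ^ e = ((2 : ℝ) ^ k) ^ e * ((2 : ℝ) ^ (-e)) ^ j := by
  rw [two_zpow_sub_nat, mul_rpow (by positivity) (by positivity), ← rpow_natCast, ← rpow_mul (by norm_num),
    ← rpow_natCast, ← rpow_mul two_pos.le, one_div, inv_rpow two_pos.le, ← rpow_neg two_pos.le]
  congr 2; ring

/-- High frequencies are controlled by the amplitudes and low frequencies by the Morawetz-type norm. -/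
lemma NiceSol.exists_tL_four_le (hn : 5 ≤ n) (hn' : n ≤ 7) {p γ : ℝ} (hp : (n : ℝ) ≤ p) (hγ : 0 < γ) : ∃ C ≠ ∞,
    ∀ (u : ℝ → Sch n) a b R, a ≤ b → NiceSol u a b R → ∀ Q : ℝ≥0∞,
    (∀ k : ℤ, 0 ≤ k → Amp u a b k ≤ Q * ofReal (((2 : ℝ) ^ k) ^ (-((n : ℝ) / 2 - n / p - 1) - γ))) → ∀ k₀ : ℤ, 0 ≤ k₀ →
    tL 4 a b (fun t => nL p (u t)) ≤ C * (ofReal (((2 : ℝ) ^ k₀) ^ (((n : ℝ) - 5) / 4 + n / 4 - n / p)) * Mor u a b +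
      Q * ofReal (((2 : ℝ) ^ k₀) ^ (-γ))) := by
  have hn5 : (5 : ℝ) ≤ n := by exact_mod_cast hn
  have hn7 : (n : ℝ) ≤ 7 := by exact_mod_cast hn'
  set e : ℝ := ((n : ℝ) - 5) / 4 + n / 4 - n / p with he
  have he0 : 0 < e := by
    have : (n : ℝ) / p ≤ 1 := (div_le_one (by linarith)).2 hp
    linarith
  obtain ⟨C1, hC1, H1⟩ := exists_nL_D_le_absGrad (n := n) hn (σ := ((n : ℝ) - 5) / 4) (p := p) (by linarith) (by linarith) (by linarith)
  obtain ⟨C2, hC2, H2⟩ := NiceSol.exists_tL_four_D_le (n := n) hn (by omega) (p := p) (by linarith)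
  have hr : (2 : ℝ) ^ (-e) < 1 := rpow_lt_one_of_one_lt_of_neg one_lt_two (by linarith)
  have hr2 : (2 : ℝ) ^ (-γ) < 1 := rpow_lt_one_of_one_lt_of_neg one_lt_two (by linarith)
  refine ⟨C1 * ofReal (1 / (1 - 2 ^ (-e))) + C2 * ofReal (1 / (1 - 2 ^ (-γ))), by finiteness,
    fun u a b R hab hu Q hQ k₀ hk₀ => ?_⟩
  have hg := hu.good (by omega) (by omega)
  have hp1 : 1 ≤ p := by linarith
  have hp2 : 2 ≤ p := by linarith
  have h41 : (1 : ℝ) ≤ 4 := by norm_num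
  have h4 : (0 : ℝ) < 4 := by norm_num
  have hm : ∀ k, AEMeasurable (fun t => nL p (D k (u t))) (volume.restrict (Icc a b)) := fun k => (hg.D k).aemeasurable_nL hp2
  have hlow : ∑' j : ℕ, tL 4 a b (fun t => nL p (D (k₀ - j) (u t))) ≤
      C1 * ofReal (1 / (1 - 2 ^ (-e))) * (ofReal (((2 : ℝ) ^ k₀) ^ e) * Mor u a b) := by
    calc _ ≤ ∑' j : ℕ, C1 * Mor u a b * ofReal (((2 : ℝ) ^ (k₀ - j)) ^ e) := by
          refine ENNReal.tsum_le_tsum fun j => (tL_mono h4 fun t _ => H1 (k₀ - j) (u t)).trans_eq ?_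
          rw [tL_const_mul h4 (by finiteness), Mor]; ring
      _ = C1 * Mor u a b * ∑' j : ℕ, ofReal (((2 : ℝ) ^ (k₀ - j)) ^ e) := ENNReal.tsum_mul_left
      _ ≤ C1 * Mor u a b * ofReal (((2 : ℝ) ^ k₀) ^ e / (1 - 2 ^ (-e))) := by
          gcongr
          exact tsum_le_of_geometric (by positivity) hr fun j => by rw [two_zpow_rpow_sub_nat]
      _ = _ := by
          rw [div_eq_mul_one_div, ofReal_mul (by positivity)]; ring
  have hhigh : ∑' j : ℕ, tL 4 a b (fun t => nL p (D (k₀ + 1 + j) (u t))) ≤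
      C2 * ofReal (1 / (1 - 2 ^ (-γ))) * (Q * ofReal (((2 : ℝ) ^ k₀) ^ (-γ))) := by
    calc _ ≤ ∑' j : ℕ, C2 * Q * ofReal (((2 : ℝ) ^ (k₀ + 1 + j)) ^ (-γ)) := by
          refine ENNReal.tsum_le_tsum fun j => (H2 u a b R hab hu _).trans ?_
          calc _ ≤ C2 * ofReal (((2 : ℝ) ^ (k₀ + 1 + j)) ^ ((n : ℝ) / 2 - n / p - 1)) *
                (Q * ofReal (((2 : ℝ) ^ (k₀ + 1 + j)) ^ (-((n : ℝ) / 2 - n / p - 1) - γ))) := by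
                gcongr; exact hQ _ (by omega)
            _ = C2 * Q * (ofReal (((2 : ℝ) ^ (k₀ + 1 + j)) ^ ((n : ℝ) / 2 - n / p - 1)) *
                ofReal (((2 : ℝ) ^ (k₀ + 1 + j)) ^ (-((n : ℝ) / 2 - n / p - 1) - γ))) := by ring
            _ ≤ _ := by rw [rpow_add_ofReal]; apply le_of_eq; congr 3; ring
      _ = C2 * Q * ∑' j : ℕ, ofReal (((2 : ℝ) ^ (k₀ + 1 + j)) ^ (-γ)) := ENNReal.tsum_mul_left
      _ ≤ C2 * Q * ofReal (((2 : ℝ) ^ k₀) ^ (-γ) / (1 - 2 ^ (-γ))) := by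
          gcongr
          refine tsum_le_of_geometric (by positivity) hr2 fun j => ?_
          rw [two_zpow_rpow_add_nat]
          refine ofReal_le_ofReal (mul_le_mul_of_nonneg_right ?_ (by positivity))
          refine rpow_le_rpow_of_nonpos (by positivity) ?_ (by linarith)
          exact zpow_le_zpow_right₀ one_le_two (by omega)
      _ = _ := by
          rw [div_eq_mul_one_div, ofReal_mul (by positivity)]; ring
  calc _ ≤ tL 4 a b (fun t => ∑' j : ℕ, nL p (D (k₀ - j) (u t)) + ∑' j : ℕ, nL p (D (k₀ + 1 + j) (u t))) :=
        tL_mono h4 fun t _ => nL_le_tsum (by omega) hp1 k₀ (u t)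
    _ ≤ tL 4 a b (fun t => ∑' j : ℕ, nL p (D (k₀ - j) (u t))) + tL 4 a b (fun t => ∑' j : ℕ, nL p (D (k₀ + 1 + j) (u t))) :=
        tL_add_le h41 (AEMeasurable.tsum fun j => hm _) (AEMeasurable.tsum fun j => hm _)
    _ ≤ _ := (add_le_add ((tL_tsum_le h41 fun j => hm _).trans hlow) ((tL_tsum_le h41 fun j => hm _).trans hhigh))
    _ ≤ _ := by
        rw [add_mul, mul_add, mul_add]
        exact add_le_add le_self_add le_add_self

lemma Good.continuousOn_tL {v : ℝ → Sch n} {a b p : ℝ} (hab : a ≤ b) (h : Good v a b) (hp : 2 ≤ p) :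
    ContinuousOn (fun τ => (tL 4 a τ fun t => nL p (v t)).toReal) (Icc a b) := by
  have hc : ContinuousOn (fun t => (nL p (v t)).toReal ^ (4 : ℕ)) (Icc a b) :=
    ((ENNReal.continuousOn_toReal).comp (h.continuousOn_nL hp) fun t _ => nL_ne_top (by linarith) _).pow 4
  have h1 : ContinuousOn (fun τ => ∫ t in a..τ, (nL p (v t)).toReal ^ (4 : ℕ)) (Icc a b) := by
    have := intervalIntegral.continuousOn_primitive_interval (μ := volume) (f := fun t => (nL p (v t)).toReal ^ (4 : ℕ)) (a := a) (b := b)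
      (by rw [uIcc_of_le hab]; exact hc.integrableOn_Icc)
    rwa [uIcc_of_le hab] at this
  refine (h1.rpow_const (p := 1 / 4) fun t _ => Or.inr (by norm_num)).congr fun τ hτ => ?_
  have hc' := hc.mono (Set.Icc_subset_Icc_right hτ.2)
  simp only [tL]
  rw [integral_of_le hτ.1, ← integral_Icc_eq_integral_Ioc, integral_eq_lintegral_of_nonneg_ae
    (ae_of_all _ fun _ => by positivity) (hc'.aestronglyMeasurable measurableSet_Icc), ← ENNReal.toReal_rpow]
  congr 2
  refine lintegral_congr fun t => ?_
  rw [← ENNReal.toReal_pow, ofReal_toReal (ENNReal.pow_ne_top (nL_ne_top (by linarith) _)), ← ENNReal.rpow_natCast]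
  norm_num

lemma NiceSol.tL_ne_top (hn : 5 ≤ n) (hn' : n ≤ 14) {p : ℝ} (h : NiceSol u a b R) (hp : 2 ≤ p) :
    tL 4 a b (fun t => nL p (u t)) ≠ ∞ := by
  obtain ⟨C, hC, H⟩ := (h.good (by omega) hn').exists_nL_le hp
  refine ne_top_of_le_ne_top ?_ (tL_mono (by norm_num) H)
  rw [tL, setLIntegral_const, volume_Icc]
  finiteness

/-- Closing lemma: frequency bounds at the initial time and a small Morawetz-type norm make the critical norm small. -/
lemma NiceSol.exists_small (hn : 5 ≤ n) (hn' : n ≤ 7) {η γ : ℝ} (hη : 0 < η) (hγ : 0 < γ) (B : ℝ≥0∞) (hB : B ≠ ∞) : ∃ δ : ℝ, 0 < δ ∧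
    ∀ (u : ℝ → Sch n) a b R, a ≤ b → NiceSol u a b R → ∀ (ν : ℤ → ℝ), Wt ν →
    (∀ k : ℤ, 0 ≤ k → ν k ≤ ((2 : ℝ) ^ k) ^ (2 - (n : ℝ) / 2 - γ)) → (∀ k, nL 2 (D k (u a)) ≤ B * ofReal (ν k)) →
    Mor u a b ≤ ofReal δ → tL 4 a b (fun t => nL n (u t)) ≤ ofReal η := by
  obtain ⟨η₀, hη₀, H⟩ := NiceSol.exists_persist (n := n) hn hn'
  obtain ⟨C, hC, HX⟩ := NiceSol.exists_tL_four_le (n := n) hn hn' (p := n) (γ := γ) le_rfl hγ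
  have hn5 : (5 : ℝ) ≤ n := by exact_mod_cast hn
  set ρ := min η η₀ with hρ
  have hρ0 : 0 < ρ := lt_min hη hη₀
  set Q : ℝ := (C * (2 * B)).toReal with hQ
  obtain ⟨j, hj⟩ := exists_pow_lt_of_lt_one (show 0 < ρ / 4 / (Q + 1) by positivity)
    (rpow_lt_one_of_one_lt_of_neg one_lt_two (by linarith : -γ < 0))
  set E : ℝ := ((2 : ℝ) ^ (j : ℤ)) ^ (((n : ℝ) - 5) / 4 + n / 4 - n / n) with hE
  refine ⟨ρ / 4 / ((C.toReal + 1) * E), by positivity, fun u a b R hab hu ν hν hν2 hBν hM => ?_⟩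
  have key : ∀ τ ∈ Icc a b, tL 4 a τ (fun t => nL n (u t)) ≤ ofReal ρ →
      tL 4 a τ (fun t => nL n (u t)) ≤ ofReal (ρ / 2) := by
    intro τ hτ hX
    have hu' := hu.mono le_rfl hτ.2
    have hA := H u a τ R hτ.1 hu' (hX.trans (ofReal_le_ofReal (min_le_right _ _))) ν hν B hBν
    refine (HX u a τ R hτ.1 hu' (2 * B) (fun k hk => (hA k).trans ?_) j (by positivity)).trans ?_
    · gcongr
      refine (hν2 k hk).trans_eq ?_
      rw [div_self (by linarith)]; ring_nf
    rw [mul_add, show ρ / 2 = ρ / 4 + ρ / 4 by ring, ofReal_add (by positivity) (by positivity)]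
    refine add_le_add ?_ ?_
    · calc _ ≤ C * (ofReal E * ofReal (ρ / 4 / ((C.toReal + 1) * E))) := by
            gcongr; exact (Mor_mono le_rfl hτ.2).trans hM
        _ = ofReal (C.toReal * (E * (ρ / 4 / ((C.toReal + 1) * E)))) := by
            rw [ofReal_mul (by positivity), ofReal_mul (by positivity), ofReal_toReal hC]
        _ ≤ _ := by
            refine ofReal_le_ofReal ?_
            have hE0 : 0 < E := by positivity
            calc C.toReal * (E * (ρ / 4 / ((C.toReal + 1) * E))) = C.toReal / (C.toReal + 1) * (ρ / 4) := by field_simp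
              _ ≤ 1 * (ρ / 4) := by
                gcongr
                rw [div_le_one (by positivity)]; linarith
              _ = _ := one_mul _
    · calc C * (2 * B * ofReal (((2 : ℝ) ^ (j : ℤ)) ^ (-γ))) = ofReal (Q * ((2 : ℝ) ^ (-γ)) ^ j) := by
            rw [ofReal_mul (by positivity), hQ, ofReal_toReal (by finiteness), ← mul_assoc]
            congr 2
            have := two_zpow_rpow_add_nat 0 j (-γ)
            rwa [zero_add, zpow_zero, one_rpow, one_mul] at this
        _ ≤ _ := by
            refine ofReal_le_ofReal ?_
            rw [lt_div_iff₀ (by positivity)] at hj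
            have : 0 ≤ ((2 : ℝ) ^ (-γ)) ^ j := by positivity
            nlinarith
  by_contra! hcon
  have hcon2 : ofReal ρ < tL 4 a b (fun t => nL n (u t)) := lt_of_le_of_lt (ofReal_le_ofReal (min_le_left _ _)) hcon
  have hfin : ∀ τ ∈ Icc a b, tL 4 a τ (fun t => nL n (u t)) ≠ ∞ := fun τ hτ =>
    (hu.mono le_rfl hτ.2).tL_ne_top hn (by omega) (by linarith)
  have hcont := (hu.good (by omega) (by omega)).continuousOn_tL hab (p := n) (by linarith)
  have h0 : (tL 4 a a fun t => nL n (u t)).toReal = 0 := by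
    simp [tL]
  have hb : ρ ≤ (tL 4 a b fun t => nL n (u t)).toReal :=
    (ENNReal.ofReal_le_iff_le_toReal (hfin b ⟨hab, le_rfl⟩)).1 hcon2.le
  obtain ⟨τ, hτ, hτρ⟩ := intermediate_value_Icc hab hcont ⟨h0.le.trans hρ0.le, hb⟩
  simp only at hτρ
  have e : tL 4 a τ (fun t => nL n (u t)) = ofReal ρ := by
    rw [← hτρ, ofReal_toReal (hfin τ hτ)]
  have := key τ hτ e.le
  rw [e, ofReal_le_ofReal_iff (by positivity)] at this
  linarith

/-! ### Time reversal -/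

lemma bmp_neg (ξ : Rn n) : bmp n (-ξ) = bmp n ξ := (bmp n).neg ξ

lemma dil_lpφ_neg (k : ℤ) (ξ : Rn n) : dil k (lpφ n) (-ξ) = dil k (lpφ n) ξ := by
  rw [dil_lpφ_real, dil_lpφ_real, smul_neg, bmp_neg]

lemma T_sconj {θ : Sch n} (h : ∀ ξ, starRingEnd ℂ (θ (-ξ)) = θ ξ) (f : Sch n) :
    T θ (sconj f) = sconj (T θ f) :=
  fourier_injective fun ξ => by rw [fourier_T, fourier_sconj, fourier_sconj, fourier_T, map_mul, h]

lemma D_sconj (k : ℤ) (f : Sch n) : D k (sconj f) = sconj (D k f) := by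
  refine T_sconj (fun ξ => ?_) f
  rw [dil_lpψ, sub_apply, sub_apply, dil_lpφ_neg, dil_lpφ_neg, dil_lpφ_real, dil_lpφ_real, map_sub, conj_ofReal, conj_ofReal]

lemma bi_sconj (f : Sch n) : bi (sconj f) = sconj (bi f) :=
  fourier_injective fun ξ => by
    rw [fourier_bi, fourier_sconj, fourier_sconj, fourier_bi, map_mul, conj_ofReal, om, om, norm_neg]

lemma nL_sconj (p : ℝ) (f : Sch n) : nL p (sconj f) = nL p f := by
  simp [nL, eLpNorm', sconj_apply]

lemma norm_L2_sconj (f : Sch n) : ‖L2 (sconj f)‖ = ‖L2 f‖ := by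
  have := nL_sconj 2 f
  rwa [nL_two_eq, nL_two_eq, ENNReal.ofReal_eq_ofReal_iff (norm_nonneg _) (norm_nonneg _)] at this

lemma NB.sconj {R : ℝ} {f : Sch n} (h : NB R f) : NB R (sconj f) :=
  ⟨by rw [norm_L2_sconj]; exact h.1, fun k => by rw [D_sconj, norm_L2_sconj]; exact h.2 k⟩

lemma rhs_sconj (f : Sch n) (x : Rn n) : rhs (sconj f) x = -starRingEnd ℂ (rhs f x) := by
  rw [rhs_apply, rhs_apply, bi_sconj, cub_apply, cub_apply, sconj_apply, sconj_apply, map_mul, map_add, map_mul, conj_I,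
    Complex.norm_conj, map_pow, conj_ofReal]
  ring

/-- The time-reversed solution. -/
def rev (c : ℝ) (u : ℝ → Sch n) (t : ℝ) : Sch n := sconj (u (c - t))

lemma IsSol.rev (h : IsSol u a b) (c : ℝ) : IsSol (rev c u) (c - b) (c - a) := by
  refine ⟨?_, fun t ht x => ?_⟩
  · exact Complex.conjCLE.contDiff.comp (h.smooth.comp ((contDiff_const.sub contDiff_fst).prodMk contDiff_snd))
  · have h1 := h.deriv (c - t) ⟨by linarith [ht.2], by linarith [ht.1]⟩ x
    have h2 := h1.scomp t ((hasDerivAt_id t).const_sub c)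
    have h3 := Complex.conjCLE.hasFDerivAt.comp_hasDerivAt t h2
    refine h3.congr_deriv ?_
    rw [_root_.rev, rhs_sconj]
    simp

lemma NiceSol.rev (h : NiceSol u a b R) (c : ℝ) : NiceSol (rev c u) (c - b) (c - a) R :=
  ⟨h.toIsSol.rev c, fun t ht => (h.nb _ ⟨by linarith [ht.2], by linarith [ht.1]⟩).sconj⟩

lemma absGrad_sconj (σ : ℝ) (f : Sch n) (x : Rn n) : absGrad σ (sconj f) x = starRingEnd ℂ (absGrad σ f x) := by
  unfold absGrad fmul
  rw [fourierInv_eq', fourierInv_eq', ← integral_conj, ← integral_neg_eq_self]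
  congr 1; ext ξ
  have h := fourier_sconj f (-ξ)
  rw [neg_neg, fourier_coe, fourier_coe] at h
  dsimp only
  rw [h, norm_neg, inner_neg_left, smul_eq_mul, smul_eq_mul, map_mul, map_mul, ← exp_conj, conj_ofReal]
  congr 2
  simp only [map_mul, conj_I, conj_ofReal]
  push_cast; ring

lemma Mor_rev (u : ℝ → Sch n) (a b c : ℝ) : Mor (rev c u) (c - b) (c - a) = Mor u a b := by
  have h1 : ∀ t, LpN 4 (absGrad (-(((n : ℝ) - 5) / 4)) (rev c u t)) = LpN 4 (absGrad (-(((n : ℝ) - 5) / 4)) (u (c - t))) := fun t => by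
    simp only [LpN, rev, absGrad_sconj]
    congr 2; ext x
    congr 2
    exact RCLike.nnnorm_conj _
  unfold Mor tL
  simp_rw [h1]
  congr 1
  have h2 := (Measure.measurePreserving_sub_left (volume : Measure ℝ) c).setLIntegral_comp_preimage_emb
    (Homeomorph.subLeft c).measurableEmbedding (fun t => LpN 4 (absGrad (-(((n : ℝ) - 5) / 4)) (u t)) ^ (4 : ℝ)) (Icc a b)
  rw [← h2]
  congr 2
  ext t; simp only [Set.mem_Icc, Set.mem_preimage]
  constructor <;> rintro ⟨h, h'⟩ <;> constructor <;> linarith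

/-! ### Local uniform regularity of solutions with finite Morawetz-type norm -/

lemma Wt_zpow_inv {e : ℕ} (h1 : 1 ≤ e) (h2 : e ≤ 10) : Wt fun k : ℤ => ((2 : ℝ) ^ k)⁻¹ ^ e := by
  have h : ∀ k : ℤ, ((2 : ℝ) ^ (k + 1))⁻¹ ^ e = ((2 : ℝ) ^ k)⁻¹ ^ e * (1 / 2) ^ e := fun k => by
    rw [zpow_add_one₀ two_ne_zero, mul_inv, mul_pow]; norm_num
  refine ⟨fun k => by positivity, fun k => ?_, fun k => ?_⟩
  · rw [h]
    have : ((1 : ℝ) / 2) ^ e ≤ 1 / 2 := pow_le_of_le_one (by norm_num) (by norm_num) (by omega)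
    linarith [mul_le_mul_of_nonneg_left this (show 0 ≤ ((2 : ℝ) ^ k)⁻¹ ^ e by positivity)]
  · have : (1 : ℝ) ≤ 2 ^ 10 * (1 / 2) ^ e := by
      calc (1 : ℝ) = 2 ^ 10 * (1 / 2) ^ 10 := by norm_num
        _ ≤ _ := by
          gcongr 2 ^ 10 * ?_
          exact pow_le_pow_of_le_one (by norm_num) (by norm_num) h2
    rw [h]
    have h0 : 0 < ((2 : ℝ) ^ k)⁻¹ ^ e := by positivity
    nlinarith

lemma zpow_inv_le {e : ℕ} (h1 : 2 ≤ e) (hn : n ≤ 7) {k : ℤ} (hk : 0 ≤ k) :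
    ((2 : ℝ) ^ k)⁻¹ ^ e ≤ ((2 : ℝ) ^ k) ^ (2 - (n : ℝ) / 2 - 1 / 2) := by
  have hn7 : (n : ℝ) ≤ 7 := by exact_mod_cast hn
  have he : (2 : ℝ) ≤ e := by exact_mod_cast h1
  rw [← rpow_natCast, inv_rpow (by positivity), ← rpow_neg (by positivity)]
  exact rpow_le_rpow_of_exponent_le (one_le_zpow₀ one_le_two hk) (by linarith)

lemma nL_two_le_iff {f : Sch n} {c d : ℝ} (hc : 0 ≤ c) (hd : 0 ≤ d) :
    nL 2 f ≤ ofReal c * ofReal d ↔ ‖L2 f‖ ≤ c * d := by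
  rw [nL_two_eq, ← ofReal_mul hc, ofReal_le_ofReal_iff (by positivity)]

/-- Propagation of regularity, once the solution has some energy-type bound at the initial time. -/
lemma NiceSol.exists_propagate (hn : 5 ≤ n) (hn' : n ≤ 7) {e : ℕ} (he : 2 ≤ e) (he' : e ≤ 10) {H : ℝ} (hH : 0 ≤ H) : ∃ δ : ℝ, 0 < δ ∧
    ∀ (u : ℝ → Sch n) (a b R R₀ : ℝ), a ≤ b → NiceSol u a b R → NB R₀ (u a) →
    (∀ k, ‖L2 (D k (u a))‖ ≤ H * ((2 : ℝ) ^ k)⁻¹ ^ e) → Mor u a b ≤ ofReal δ → ∀ t ∈ Icc a b, NB (2 * R₀) (u t) := by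
  obtain ⟨η, hη, hP⟩ := NiceSol.exists_persist (n := n) hn hn'
  obtain ⟨δ, hδ, hS⟩ := NiceSol.exists_small (n := n) hn hn' hη (γ := 1 / 2) (by norm_num) (ofReal H) (by finiteness)
  refine ⟨δ, hδ, fun u a b R R₀ hab hu h0 hD hM t ht => ?_⟩
  have hR₀ := h0.nonneg
  have h1 := hS u a b R hab hu _ (Wt_zpow_inv (by omega) he') (fun k hk => zpow_inv_le he hn' hk)
    (fun k => (nL_two_le_iff hH (by positivity)).2 (hD k)) hM
  have h2 := hP u a b R hab hu h1 _ (Wt_zpow_inv (e := 10) (by norm_num) le_rfl) (ofReal R₀)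
    (fun k => (nL_two_le_iff hR₀ (by positivity)).2 (h0.2 k))
  refine ⟨?_, fun k => ?_⟩
  · rw [hu.norm_eq (by omega) (by omega) ht ⟨le_rfl, hab⟩]
    linarith [h0.1]
  · refine (nL_two_le_iff (by positivity) (by positivity)).1 ((hu.nL_D_le_Amp (by omega) (by omega) k ht).trans ((h2 k).trans_eq ?_))
    rw [ofReal_mul (by norm_num), ofReal_ofNat]

/-- Smallness of the Morawetz-type norm on short intervals. -/
lemma exists_Mor_le {δ : ℝ} (h : Mor u a b ≠ ∞) (hδ : 0 < δ) :
    ∃ ρ > 0, ∀ c d, a ≤ c → d ≤ b → d - c < ρ → Mor u c d ≤ ofReal δ := by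
  have h' : ∫⁻ t in Icc a b, LpN 4 (absGrad (-(((n : ℝ) - 5) / 4)) (u t)) ^ (4 : ℝ) ≠ ∞ := by
    intro h'
    rw [Mor, tL, h', ENNReal.top_rpow_of_pos (by norm_num)] at h
    exact h rfl
  obtain ⟨ρ, hρ, H⟩ := exists_pos_setLIntegral_lt_of_measure_lt h' (ε := ofReal δ ^ (4 : ℝ))
    (by simp [hδ.not_ge])
  obtain ⟨ρ', -, hρ', hρ''⟩ := ENNReal.lt_iff_exists_real_btwn.1 hρ
  refine ⟨ρ', ENNReal.ofReal_pos.1 hρ', fun c d hc hd hcd => ?_⟩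
  have h1 := H (Icc c d) (lt_of_le_of_lt (Measure.restrict_apply_le _ _) (by
    rw [volume_Icc]
    exact lt_of_le_of_lt (ofReal_le_ofReal hcd.le) hρ''))
  rw [Measure.restrict_restrict measurableSet_Icc, Set.inter_eq_left.2 (Icc_subset_Icc hc hd)] at h1
  rw [Mor, tL, one_div, ENNReal.rpow_inv_le_iff (by norm_num)]
  exact h1.le

/-- Regularity extends to the endpoint of an interval, with a bound depending only on the data at this endpoint. -/
lemma exists_extend_left (hn : 5 ≤ n) (hn' : n ≤ 7) {R₀ : ℝ} (hR₀ : 0 ≤ R₀) : ∃ δ : ℝ, 0 < δ ∧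
    ∀ (u : ℝ → Sch n) (c t : ℝ), c ≤ t → IsSol u c t → NB R₀ (u c) →
    (∀ c' ∈ Ioc c t, ∃ R, NiceSol u c' t R) → Mor u c t ≤ ofReal δ → ∀ s ∈ Icc c t, NB (2 * R₀) (u s) := by
  obtain ⟨δ, hδ, hF⟩ := NiceSol.exists_propagate (n := n) hn hn' (e := 10) (by norm_num) le_rfl hR₀
  refine ⟨δ, hδ, fun u c t hct hu h0 hnice hM => ?_⟩
  suffices ∃ R, NiceSol u c t R by
    obtain ⟨R, hR⟩ := this
    exact hF u c t R R₀ hct hR h0 h0.2 hM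
  rcases hct.eq_or_lt with rfl | hlt
  · refine ⟨R₀, hu, fun s hs => ?_⟩
    rwa [le_antisymm hs.2 hs.1]
  obtain ⟨Rt, hRt⟩ := hnice t ⟨hlt, le_rfl⟩
  obtain ⟨A, hA, hap⟩ := apriori (n := n) (by omega) (by omega) Rt
  have hap' : ∀ s ∈ Ioc c t, ∀ k : ℤ, ‖L2 (D k (u s))‖ ≤ A * ((2 : ℝ) ^ k)⁻¹ ^ 2 := fun s hs => by
    obtain ⟨R, hR⟩ := hnice s hs
    exact (hap u s t R t hR ⟨hs.2, le_rfl⟩ (hRt.nb t ⟨le_rfl, le_rfl⟩) s ⟨le_rfl, hs.2⟩).2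
  obtain ⟨δ', hδ', hB⟩ := NiceSol.exists_propagate (n := n) hn hn' (e := 2) le_rfl (by norm_num) hA.le
  obtain ⟨ρ, hρ, hMρ⟩ := exists_Mor_le (ne_top_of_le_ne_top (by finiteness) hM) hδ'
  set τ := min t (c + ρ / 2) with hτ
  have hτt : τ ≤ t := min_le_left _ _
  have hcτ : c < τ := lt_min hlt (by linarith)
  have hτρ : τ - c < ρ := by linarith [min_le_right t (c + ρ / 2)]
  obtain ⟨Rτ, hRτ⟩ := hnice τ ⟨hcτ, hτt⟩
  have hnear : ∀ s ∈ Ioc c τ, NB (2 * Rτ) (u s) := fun s hs => by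
    obtain ⟨R, hR⟩ := hnice s ⟨hs.1, hs.2.trans hτt⟩
    have h1 := (hR.mono le_rfl hτt).rev (s + τ)
    rw [add_sub_cancel_right, add_sub_cancel_left] at h1
    have e1 : rev (s + τ) u s = sconj (u τ) := by rw [rev, add_sub_cancel_left]
    have e2 : rev (s + τ) u τ = sconj (u s) := by rw [rev, add_sub_cancel_right]
    have h2 := hB _ s τ R Rτ hs.2 h1 (by rw [e1]; exact (hRτ.nb τ ⟨le_rfl, hτt⟩).sconj)
      (fun k => by rw [e1, D_sconj, norm_L2_sconj]; exact hap' τ ⟨hcτ, hτt⟩ k)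
      (by
        have := Mor_rev u s τ (s + τ)
        rw [add_sub_cancel_right, add_sub_cancel_left] at this
        rw [this]
        exact hMρ s τ hs.1.le hτt (by linarith [hs.1])) τ ⟨hs.2, le_rfl⟩
    rw [e2] at h2
    refine ⟨by simpa [norm_L2_sconj] using h2.1, fun k => by simpa [D_sconj, norm_L2_sconj] using h2.2 k⟩
  refine ⟨max R₀ (max (2 * Rτ) Rτ), hu, fun s hs => ?_⟩
  rcases hs.1.eq_or_lt with rfl | hs1
  · exact h0.mono (le_max_left _ _)
  rcases le_total s τ with h | h
  · exact (hnear s ⟨hs1, h⟩).mono ((le_max_left _ _).trans (le_max_right _ _))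
  · exact (hRτ.nb s ⟨h, hs.2⟩).mono ((le_max_right _ _).trans (le_max_right _ _))

lemma NB.of_sconj {R : ℝ} {f : Sch n} (h : NB R (_root_.sconj f)) : NB R f :=
  ⟨by simpa [norm_L2_sconj] using h.1, fun k => by simpa [D_sconj, norm_L2_sconj] using h.2 k⟩

lemma exists_extend_right (hn : 5 ≤ n) (hn' : n ≤ 7) {R₀ : ℝ} (hR₀ : 0 ≤ R₀) : ∃ δ : ℝ, 0 < δ ∧
    ∀ (u : ℝ → Sch n) (t c : ℝ), t ≤ c → IsSol u t c → NB R₀ (u c) →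
    (∀ c' ∈ Set.Ico t c, ∃ R, NiceSol u t c' R) → Mor u t c ≤ ofReal δ → ∀ s ∈ Icc t c, NB (2 * R₀) (u s) := by
  obtain ⟨δ, hδ, H⟩ := exists_extend_left (n := n) hn hn' hR₀
  refine ⟨δ, hδ, fun u t c htc hu h0 hnice hM s hs => NB.of_sconj ?_⟩
  have e : ∀ r, rev (t + c) u (t + c - r) = sconj (u r) := fun r => by rw [rev, sub_sub_cancel]
  have e1 := hu.rev (t + c)
  have e2 := Mor_rev u t c (t + c)
  have e3 := e c
  rw [add_sub_cancel_right] at e1 e2 e3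
  rw [add_sub_cancel_left] at e1 e2
  have := H (rev (t + c) u) t c htc e1 (by rw [e3]; exact h0.sconj) (fun c' hc' => ?_) (e2.le.trans hM) (t + c - s)
    ⟨by linarith [hs.2], by linarith [hs.1]⟩
  · rwa [e] at this
  · obtain ⟨R, hR⟩ := hnice (t + c - c') ⟨by linarith [hc'.2], by linarith [hc'.1]⟩
    have := hR.rev (t + c)
    rw [sub_sub_cancel, add_sub_cancel_left] at this
    exact ⟨R, this⟩

lemma norm_fourier_iterate_lapS (f : Sch n) (m : ℕ) (ξ : Rn n) :
    ‖𝓕 (lapS^[m] f) ξ‖ = ((2 * π * ‖ξ‖) ^ 2) ^ m * ‖𝓕 f ξ‖ := by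
  induction m with
  | zero => simp
  | succ m ih =>
    rw [Function.iterate_succ_apply', fourier_lapS, norm_mul, norm_neg, norm_real, ih, norm_of_nonneg (by positivity)]
    ring

lemma NB.of_iterate_lapS {R : ℝ} {f : Sch n} (h1 : ‖L2 f‖ ≤ R) (h2 : ‖L2 (lapS^[5] f)‖ ≤ R) : NB (2 * R) f := by
  have hR : 0 ≤ R := (norm_nonneg _).trans h1
  refine ⟨by linarith, fun k => ?_⟩
  have : ‖L2 (D k f)‖ ≤ 2 * ((2 : ℝ) ^ k)⁻¹ ^ 10 * ‖L2 (lapS^[5] f)‖ := by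
    refine norm_L2_le_of_fourier fun ξ => ?_
    rw [fourier_D, norm_mul, norm_fourier_iterate_lapS]
    rcases le_total ‖ξ‖ ((2 : ℝ) ^ (k - 1)) with h | h
    · rw [dil_lpψ_low h]; simp; positivity
    · have h3 : (2 : ℝ) ^ k ≤ 2 * π * ‖ξ‖ := by
        calc (2 : ℝ) ^ k = 2 * 1 * 2 ^ (k - 1) := by rw [zpow_sub_one₀ two_ne_zero]; ring
          _ ≤ _ := by gcongr; linarith [pi_gt_three]
      calc _ ≤ 2 * ‖𝓕 f ξ‖ := by gcongr; exact norm_dil_lpψ_le k ξ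
        _ = 2 * ((2 : ℝ) ^ k)⁻¹ ^ 10 * ((((2 : ℝ) ^ k) ^ 2) ^ 5 * ‖𝓕 f ξ‖) := by field_simp
        _ ≤ _ := by gcongr
  refine this.trans ?_
  nlinarith [show (0 : ℝ) ≤ ((2 : ℝ) ^ k)⁻¹ ^ 10 by positivity]

lemma isClosed_norm_L2_le {v : ℝ → Sch n} (h : Continuous fun p : ℝ × Rn n => v p.1 p.2) {R : ℝ} (hR : 0 ≤ R) :
    IsClosed {t : ℝ | ‖L2 (v t)‖ ≤ R} := by
  refine IsSeqClosed.isClosed fun s t hs hst => ?_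
  have h1 : ∀ f : Sch n, ‖L2 f‖ ≤ R ↔ nL 2 f ≤ ofReal R := fun f => by
    rw [nL_two_eq, ofReal_le_ofReal_iff hR]
  simp only [Set.mem_ofPred_eq, h1] at hs ⊢
  refine nL_of_tendsto (by norm_num) (fun x => ?_) hs
  exact ((h.comp (Continuous.prodMk_left x)).tendsto t).comp hst

/-- A smooth solution in the Schwartz class with finite Morawetz-type norm is uniformly regular. -/
lemma IsSol.exists_niceSol (hn : 5 ≤ n) (hn' : n ≤ 7) (hu : IsSol u a b)
    (hM : Mor u a b ≠ ∞) : ∃ R, NiceSol u a b R := by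
  set U : Set ℝ := {t | ∃ R ρ : ℝ, 0 < ρ ∧ ∀ s ∈ Icc a b, |s - t| < ρ → NB R (u s)} with hU
  have hUo : IsOpen U := by
    rw [Metric.isOpen_iff]
    rintro t ⟨R, ρ, hρ, H⟩
    refine ⟨ρ / 2, by positivity, fun t' ht' => ⟨R, ρ / 2, by positivity, fun s hs hst => H s hs ?_⟩⟩
    rw [Metric.mem_ball, dist_eq] at ht'
    linarith [abs_sub_le s t' t]
  have hcpt : ∀ c d, a ≤ c → d ≤ b → (∀ t ∈ Icc c d, t ∈ U) → ∃ R, NiceSol u c d R := by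
    intro c d hc hd H
    suffices ∃ R, ∀ t ∈ Icc c d ∩ Icc a b, NB R (u t) by
      obtain ⟨R, hR⟩ := this
      exact ⟨R, hu.mono hc hd, fun t ht => hR t ⟨ht, hc.trans ht.1, ht.2.trans hd⟩⟩
    refine isCompact_Icc.induction_on (p := fun s : Set ℝ => ∃ R, ∀ t ∈ s ∩ Icc a b, NB R (u t)) ⟨0, by simp⟩ ?_ ?_ ?_
    · rintro s t hst ⟨R, hR⟩
      exact ⟨R, fun r hr => hR r ⟨hst hr.1, hr.2⟩⟩
    · rintro s t ⟨R, hR⟩ ⟨R', hR'⟩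
      refine ⟨max R R', fun r hr => ?_⟩
      rcases hr.1 with h | h
      · exact (hR r ⟨h, hr.2⟩).mono (le_max_left _ _)
      · exact (hR' r ⟨h, hr.2⟩).mono (le_max_right _ _)
    · intro t ht
      obtain ⟨R, ρ, hρ, HR⟩ := H t ht
      refine ⟨ball t ρ, mem_nhdsWithin_of_mem_nhds (Metric.ball_mem_nhds t hρ), R, fun s hs => HR s hs.2 ?_⟩
      rw [← dist_eq]; exact hs.1
  set P : Set ℝ := Icc a b \ U with hP
  have hPc : IsClosed P := isClosed_Icc.sdiff hUo
  rcases P.eq_empty_or_nonempty with hPe | ⟨p, hp⟩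
  · exact hcpt a b le_rfl le_rfl (Set.sdiff_eq_empty.1 hPe)
  exfalso
  have : CompleteSpace P := hPc.completeSpace_coe
  have : Nonempty P := ⟨⟨p, hp⟩⟩
  set A : ℕ → Set ℝ := fun j => {t | ‖L2 (u t)‖ ≤ j} ∩ {t | ‖L2 (lapS^[5] (u t))‖ ≤ j} with hA
  have hAc : ∀ j, IsClosed (A j) := fun j => by
    refine (isClosed_norm_L2_le hu.continuous (Nat.cast_nonneg j)).inter (isClosed_norm_L2_le (v := fun t => lapS^[5] (u t)) ?_ (Nat.cast_nonneg j))
    exact (contDiff_lapS (u := fun t => lapS^[4] (u t)) (contDiff_lapS (u := fun t => lapS^[3] (u t))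
      (contDiff_lapS (u := fun t => lapS^[2] (u t)) (contDiff_lapS (u := fun t => lapS (u t)) (contDiff_lapS hu.smooth))))).continuous
  obtain ⟨j, ⟨⟨t₀, ht₀P⟩, ht₀⟩⟩ := nonempty_interior_of_iUnion_of_closed (f := fun j => ((↑) : P → ℝ) ⁻¹' A j)
    (fun j => (hAc j).preimage continuous_subtype_val) (by
      refine Set.eq_univ_of_forall fun t => Set.mem_iUnion.2 ?_
      obtain ⟨j, hj⟩ := exists_nat_ge (max ‖L2 (u t)‖ ‖L2 (lapS^[5] (u t))‖)
      exact ⟨j, (le_max_left _ _).trans hj, (le_max_right _ _).trans hj⟩)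
  obtain ⟨ρ, hρ, hball⟩ := Metric.mem_nhds_iff.1 (mem_interior_iff_mem_nhds.1 ht₀)
  have hPA : ∀ t ∈ P, |t - t₀| < ρ → NB (2 * j) (u t) := fun t ht h => by
    have := hball (show (⟨t, ht⟩ : P) ∈ ball ⟨t₀, ht₀P⟩ ρ by rw [Metric.mem_ball, Subtype.dist_eq, dist_eq]; exact h)
    exact NB.of_iterate_lapS this.1 this.2
  obtain ⟨δ₁, hδ₁, H₁⟩ := exists_extend_left (n := n) hn hn' (R₀ := 2 * j) (by positivity)
  obtain ⟨δ₂, hδ₂, H₂⟩ := exists_extend_right (n := n) hn hn' (R₀ := 2 * j) (by positivity)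
  obtain ⟨ρ₁, hρ₁, hM₁⟩ := exists_Mor_le hM hδ₁
  obtain ⟨ρ₂, hρ₂, hM₂⟩ := exists_Mor_le hM hδ₂
  refine ht₀P.2 ⟨2 * (2 * j), min ρ (min ρ₁ ρ₂), by positivity, fun t ht htd => ?_⟩
  have hd1 := htd.trans_le (min_le_left _ _)
  have hd2 := htd.trans_le ((min_le_right _ _).trans (min_le_left _ _))
  have hd3 := htd.trans_le ((min_le_right _ _).trans (min_le_right _ _))
  have hab := ht₀P.1
  rcases le_total t₀ t with h | h
  · rw [abs_of_nonneg (sub_nonneg.2 h)] at hd1 hd2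
    have hK : IsCompact (P ∩ Icc t₀ t) := isCompact_Icc.inter_left hPc
    obtain ⟨c, ⟨hcP, hc⟩, hcmax⟩ := hK.exists_isMaxOn ⟨t₀, ht₀P, le_rfl, h⟩ continuousOn_id
    refine H₁ u c t hc.2 (hu.mono hcP.1.1 ht.2) (hPA c hcP ?_) (fun c' hc' => ?_) (hM₁ c t hcP.1.1 ht.2 ?_) t ⟨hc.2, le_rfl⟩
    · rw [abs_of_nonneg (sub_nonneg.2 hc.1)]; linarith [hc.2]
    · refine hcpt c' t (hcP.1.1.trans hc'.1.le) ht.2 fun s hs => ?_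
      by_contra hsU
      have := hcmax ⟨⟨⟨hcP.1.1.trans (hc'.1.le.trans hs.1), hs.2.trans ht.2⟩, hsU⟩, hc.1.trans (hc'.1.le.trans hs.1), hs.2⟩
      simp only [Set.mem_ofPred_eq, id] at this
      linarith [hc'.1, hs.1]
    · linarith [hc.1]
  · rw [abs_of_nonpos (sub_nonpos.2 h)] at hd1 hd3
    have hK : IsCompact (P ∩ Icc t t₀) := isCompact_Icc.inter_left hPc
    obtain ⟨c, ⟨hcP, hc⟩, hcmin⟩ := hK.exists_isMinOn ⟨t₀, ht₀P, h, le_rfl⟩ continuousOn_id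
    refine H₂ u t c hc.1 (hu.mono ht.1 hcP.1.2) (hPA c hcP ?_) (fun c' hc' => ?_) (hM₂ t c ht.1 hcP.1.2 ?_) t ⟨le_rfl, hc.1⟩
    · rw [abs_of_nonpos (sub_nonpos.2 hc.2)]; linarith [hc.1]
    · refine hcpt t c' ht.1 (hc'.2.le.trans hcP.1.2) fun s hs => ?_
      by_contra hsU
      have := hcmin ⟨⟨⟨ht.1.trans hs.1, hs.2.trans (hc'.2.le.trans hcP.1.2)⟩, hsU⟩, hs.1, hs.2.trans (hc'.2.le.trans hc.2)⟩
      simp only [Set.mem_ofPred_eq, id] at this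
      linarith [hc'.2, hs.2]
    · linarith [hc.2]

/-! ### Multilinear estimates in space -/

lemma lintegral_mul_four_le {p q r s : ℝ} (hp : 0 < p) (hq : 0 < q) (hr : 0 < r) (hs : 0 < s) (h : 1 / p + 1 / q + 1 / r + 1 / s = 1)
    (a b c d : Sch n) :
    ∫⁻ x, ‖a x‖ₑ * ‖b x‖ₑ * ‖c x‖ₑ * ‖d x‖ₑ ≤ nL p a * nL q b * nL r c * nL s d := by
  have := ENNReal.lintegral_prod_norm_pow_le (μ := (volume : Measure (Rn n))) (Finset.univ : Finset (Fin 4))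
    (f := ![fun x => ‖a x‖ₑ ^ p, fun x => ‖b x‖ₑ ^ q, fun x => ‖c x‖ₑ ^ r, fun x => ‖d x‖ₑ ^ s])
    (p := ![1 / p, 1 / q, 1 / r, 1 / s]) (by
      have := fun (f : Sch n) (p : ℝ) => (f.continuous.enorm.measurable.pow_const p).aemeasurable (μ := volume)
      intro i _; fin_cases i <;> exact this _ _)
    (by simpa [Fin.sum_univ_four] using h) (by intro i _; fin_cases i <;> simp <;> positivity)
  simp only [Fin.prod_univ_four, Matrix.cons_val] at this
  have e : ∀ (t : ℝ) (z : ℝ≥0∞), 0 < t → (z ^ t) ^ (1 / t) = z := fun t z ht => by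
    rw [← ENNReal.rpow_mul, mul_one_div_cancel ht.ne', ENNReal.rpow_one]
  simp only [e _ _ hp, e _ _ hq, e _ _ hr, e _ _ hs] at this
  exact this

lemma enorm_inner_L2_le (f g : Sch n) : ‖inner ℂ (L2 f) (L2 g)‖ₑ ≤ ∫⁻ x, ‖f x‖ₑ * ‖g x‖ₑ := by
  rw [inner_L2_eq]
  refine (enorm_integral_le_lintegral_enorm _).trans_eq (lintegral_congr fun x => ?_)
  rw [enorm_mul, RCLike.enorm_conj]

lemma enorm_inner_L2_le_nL (f g : Sch n) : ‖inner ℂ (L2 f) (L2 g)‖ₑ ≤ nL 2 f * nL 2 g := by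
  rw [nL_two_eq, nL_two_eq, ← ofReal_mul (norm_nonneg _), ← ofReal_norm]
  exact ofReal_le_ofReal (norm_inner_le_norm _ _)

lemma SchwartzMap.measurable_enorm (f : Sch n) : Measurable fun x => ‖f x‖ₑ := f.continuous.enorm.measurable

lemma enorm_inner_cub_sub_le (A f v : Sch n) :
    ‖inner ℂ (L2 A) (L2 (cub f - cub v : Sch n))‖ₑ ≤
      5 * (nL 4 A * nL 4 (f - v : Sch n) * nL 4 v ^ 2 +
        nL 6 A * nL 6 (f - v : Sch n) * nL 3 (f - v : Sch n) ^ 2) := by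
  set y := f - v with hy
  have h1 := lintegral_mul_four_le (p := 4) (q := 4) (r := 4) (s := 4) (by norm_num) (by norm_num) (by norm_num) (by norm_num)
    (by norm_num) A y v v
  have h2 := lintegral_mul_four_le (p := 6) (q := 6) (r := 3) (s := 3) (by norm_num) (by norm_num) (by norm_num) (by norm_num)
    (by norm_num) A y y y
  have mA := A.measurable_enorm
  have mv := v.measurable_enorm
  have my := y.measurable_enorm
  rw [sq, sq, ← mul_assoc, ← mul_assoc]
  refine (enorm_inner_L2_le A _).trans (le_trans ?_ (mul_le_mul_right (add_le_add h1 h2) _))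
  have m1 : Measurable fun x => ‖A x‖ₑ * ‖y x‖ₑ * ‖v x‖ₑ * ‖v x‖ₑ := by fun_prop
  rw [← lintegral_add_left m1, ← lintegral_const_mul _ (by fun_prop)]
  refine lintegral_mono fun x => ?_
  have h3 : ‖(cub f - cub v : Sch n) x‖ ≤ 5 * (‖v x‖ ^ 2 + ‖y x‖ ^ 2) * ‖y x‖ := by
    rw [sub_apply, cub_apply, cub_apply]
    refine (norm_cubic_sub_le _ _).trans ?_
    have e : y x = f x - v x := by rw [hy, sub_apply]
    rw [← e]
    refine mul_le_mul_of_nonneg_right ?_ (norm_nonneg _)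
    have h4 : ‖f x‖ ≤ ‖v x‖ + ‖y x‖ := by
      rw [e]
      simpa using norm_add_le (v x) (f x - v x)
    nlinarith [norm_nonneg (f x), norm_nonneg (v x), norm_nonneg (y x), sq_nonneg (‖v x‖ - ‖y x‖)]
  have h5 : ‖(cub f - cub v : Sch n) x‖ₑ ≤ 5 * (‖v x‖ₑ ^ 2 + ‖y x‖ₑ ^ 2) * ‖y x‖ₑ := by
    simp_rw [← ofReal_norm]
    refine (ofReal_le_ofReal h3).trans_eq ?_
    rw [ofReal_mul (by positivity), ofReal_mul (by positivity), ofReal_add (by positivity) (by positivity),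
      ofReal_pow (norm_nonneg _), ofReal_pow (norm_nonneg _), ofReal_ofNat]
  refine (mul_le_mul_right h5 _).trans_eq ?_
  ring

lemma enorm_inner_cub_sub_le' (G f w : Sch n) :
    ‖inner ℂ (L2 G) (L2 (cub f - cub w : Sch n))‖ₑ ≤
      2 * nL 2 G * ((nL 8 f ^ 2 + nL 8 w ^ 2) * nL 4 (f - w : Sch n)) := by
  refine (enorm_inner_L2_le_nL _ _).trans ?_
  have := nL_cub_sub_le (n := n) (p := 2) (q := 8) (r := 4) (by norm_num) (by norm_num) (by norm_num) f w
  calc _ ≤ nL 2 G * (ofReal (3 / 2) * ((nL 8 f ^ 2 + nL 8 w ^ 2) * nL 4 (f - w : Sch n))) := by gcongr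
    _ ≤ nL 2 G * (2 * ((nL 8 f ^ 2 + nL 8 w ^ 2) * nL 4 (f - w : Sch n))) := by
      gcongr
      rw [← ofReal_ofNat 2]
      exact ofReal_le_ofReal (by norm_num)
    _ = _ := by ring

lemma inner_L2_eq_zero {f g : Sch n} (h : ∀ ξ, 𝓕 f ξ = 0 ∨ 𝓕 g ξ = 0) : inner ℂ (L2 f) (L2 g) = 0 := by
  rw [inner_L2_eq_fourier]
  refine integral_eq_zero_of_ae (ae_of_all _ fun ξ => ?_)
  rcases h ξ with h | h <;> simp [h]

/-- The linearization of the cubic nonlinearity at `v`. -/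
def cubLin (v h : Sch n) : Sch n :=
  (2 : ℂ) • smul2 (smul2 v (sconj v)) h + smul2 (smul2 v v) (sconj h)

lemma cubLin_apply (v h : Sch n) (x : Rn n) :
    cubLin v h x = 2 * (v x * starRingEnd ℂ (v x) * h x) + v x * v x * starRingEnd ℂ (h x) := by
  simp only [cubLin, add_apply, smul_apply, smul2_apply, sconj_apply, smul_eq_mul]

lemma inner_cubLin_eq_zero {A v z : Sch n} {k : ℤ} (hA : BL k A) (hv : BL k v)
    (hz : ∀ ξ, ‖ξ‖ ≤ 2 ^ (k + 2) → 𝓕 z ξ = 0) : inner ℂ (L2 A) (L2 (cubLin v z)) = 0 := by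
  have conj_BL : ∀ {f : Sch n}, BL k f → BL k (sconj f) := fun hf ξ hξ => by
    rw [fourier_sconj, hf _ (by rwa [norm_neg]), map_zero]
  have hk : (2 : ℝ) ^ k + 2 ^ k + 2 ^ k ≤ 2 ^ (k + 2) := by
    rw [zpow_add₀ two_ne_zero]
    have : (0 : ℝ) < 2 ^ k := by positivity
    norm_num; linarith
  have key : ∀ {f g h : Sch n}, BL k f → BL k g → BL k h → inner ℂ (L2 (smul2 (smul2 f g) h)) (L2 z) = 0 :=
    fun hf hg hh => inner_L2_eq_zero fun ξ => by
      rcases le_or_gt ‖ξ‖ (2 ^ (k + 2)) with h | h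
      · exact Or.inr (hz ξ h)
      · exact Or.inl (fourier_smul2_eq_zero (fun ξ hξ => fourier_smul2_eq_zero hf hg hξ) hh (hk.trans_lt h))
  have k1 := key hA hv (conj_BL hv)
  have k2 := key (conj_BL hA) hv hv
  rw [cubLin, L2_add, L2_smul, inner_add_right, inner_smul_right]
  have e1 : inner ℂ (L2 A) (L2 (smul2 (smul2 v (sconj v)) z)) = inner ℂ (L2 (smul2 (smul2 A v) (sconj v))) (L2 z) := by
    rw [inner_L2_eq, inner_L2_eq]
    congr 1; ext x
    simp only [smul2_apply, sconj_apply, map_mul, Complex.conj_conj]; ring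
  have e2 : inner ℂ (L2 A) (L2 (smul2 (smul2 v v) (sconj z))) = starRingEnd ℂ (inner ℂ (L2 (smul2 (smul2 (sconj A) v) v)) (L2 z)) := by
    rw [inner_L2_eq, inner_L2_eq, ← integral_conj]
    congr 1; ext x
    simp only [smul2_apply, sconj_apply, map_mul, Complex.conj_conj]; ring
  rw [e1, e2, k1, k2, map_zero, mul_zero, add_zero]

lemma norm_cub_taylor_le (v h : ℂ) :
    ‖(‖v + h‖ : ℂ) ^ 2 * (v + h) - (‖v‖ : ℂ) ^ 2 * v - (2 * (v * starRingEnd ℂ v * h) + v * v * starRingEnd ℂ h)‖ ≤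
      3 * ‖v‖ * ‖h‖ ^ 2 + ‖h‖ ^ 3 := by
  have e : (‖v + h‖ : ℂ) ^ 2 * (v + h) - (‖v‖ : ℂ) ^ 2 * v - (2 * (v * starRingEnd ℂ v * h) + v * v * starRingEnd ℂ h) =
      2 * (v * h * starRingEnd ℂ h) + starRingEnd ℂ v * h * h + h * h * starRingEnd ℂ h := by
    rw [← mul_conj', ← mul_conj', map_add]; ring
  rw [e]
  refine (norm_add_le _ _).trans (add_le_add ((norm_add_le _ _).trans_eq ?_) (le_of_eq ?_))
  · simp only [norm_mul, RCLike.norm_conj, Complex.norm_ofNat]; ring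
  · simp only [norm_mul, RCLike.norm_conj]; ring

lemma enorm_inner_cub_taylor_le (A v f : Sch n) :
    ‖inner ℂ (L2 A) (L2 (cub f - cub v - cubLin v (f - v) : Sch n))‖ₑ ≤
      3 * (nL 4 A * nL 4 v * nL 4 (f - v : Sch n) ^ 2 +
        nL 6 A * nL 3 (f - v : Sch n) * nL 4 (f - v : Sch n) ^ 2) := by
  set y := f - v with hy
  have h1 := lintegral_mul_four_le (p := 4) (q := 4) (r := 4) (s := 4) (by norm_num) (by norm_num) (by norm_num) (by norm_num)
    (by norm_num) A v y y
  have h2 := lintegral_mul_four_le (p := 6) (q := 3) (r := 4) (s := 4) (by norm_num) (by norm_num) (by norm_num) (by norm_num)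
    (by norm_num) A y y y
  have mA := A.measurable_enorm
  have mv := v.measurable_enorm
  have my := y.measurable_enorm
  rw [sq, ← mul_assoc, ← mul_assoc]
  refine (enorm_inner_L2_le A _).trans (le_trans ?_ (mul_le_mul_right (add_le_add h1 h2) _))
  have m1 : Measurable fun x => ‖A x‖ₑ * ‖v x‖ₑ * ‖y x‖ₑ * ‖y x‖ₑ := by fun_prop
  rw [← lintegral_add_left m1, ← lintegral_const_mul _ (by fun_prop)]
  refine lintegral_mono fun x => ?_
  have e : f x = v x + y x := by rw [hy, sub_apply]; ring
  have h3 := norm_cub_taylor_le (v x) (y x)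
  have h5 : ‖(cub f - cub v - cubLin v y : Sch n) x‖ₑ ≤ 3 * ‖v x‖ₑ * ‖y x‖ₑ ^ 2 + ‖y x‖ₑ ^ 3 := by
    rw [sub_apply, sub_apply, cub_apply, cub_apply, cubLin_apply, e]
    simp_rw [← ofReal_norm]
    refine (ofReal_le_ofReal h3).trans_eq ?_
    rw [ofReal_add (by positivity) (by positivity), ofReal_mul (by positivity), ofReal_mul (by positivity),
      ofReal_pow (norm_nonneg _), ofReal_pow (norm_nonneg _), ofReal_ofNat]
  calc _ ≤ ‖A x‖ₑ * (3 * ‖v x‖ₑ * ‖y x‖ₑ ^ 2 + ‖y x‖ₑ ^ 3) := mul_le_mul_right h5 _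
    _ ≤ ‖A x‖ₑ * (3 * ‖v x‖ₑ * ‖y x‖ₑ ^ 2 + 3 * ‖y x‖ₑ ^ 3) := by
      gcongr
      exact le_mul_of_one_le_left' (by norm_num)
    _ = _ := by ring

/-- Cubic interactions of low frequencies with high ones have no linear part in the latter. -/
lemma enorm_inner_cub_sub_cub_le {A v f g : Sch n} {k : ℤ} (hA : BL k A) (hv : BL k v)
    (hz : ∀ ξ, ‖ξ‖ ≤ 2 ^ (k + 2) → 𝓕 (f - g) ξ = 0) :
    ‖inner ℂ (L2 A) (L2 (cub f - cub g : Sch n))‖ₑ ≤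
      3 * (nL 4 A * nL 4 v * nL 4 (f - v : Sch n) ^ 2 +
        nL 6 A * nL 3 (f - v : Sch n) * nL 4 (f - v : Sch n) ^ 2) +
      3 * (nL 4 A * nL 4 v * nL 4 (g - v : Sch n) ^ 2 +
        nL 6 A * nL 3 (g - v : Sch n) * nL 4 (g - v : Sch n) ^ 2) := by
  have e : (cub f - cub g : Sch n) =
      (cub f - cub v - cubLin v (f - v)) - (cub g - cub v - cubLin v (g - v)) + cubLin v (f - g) := by
    ext x
    simp only [add_apply, sub_apply, cubLin_apply, map_sub]; ring
  rw [e, L2_add, L2_sub, inner_add_right, inner_sub_right, inner_cubLin_eq_zero hA hv hz, add_zero]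
  exact enorm_sub_le.trans (add_le_add (enorm_inner_cub_taylor_le A v f) (enorm_inner_cub_taylor_le A v g))

/-! ### Powers of two -/

/-- The power `2 ^ x` as an extended nonnegative real. -/
def E2 (x : ℝ) : ℝ≥0∞ := 2 ^ x

lemma E2_add (x y : ℝ) : E2 x * E2 y = E2 (x + y) := (ENNReal.rpow_add _ _ two_ne_zero ENNReal.ofNat_ne_top).symm

lemma E2_ne_top (x : ℝ) : E2 x ≠ ∞ := by
  rw [E2, Ne, ENNReal.rpow_eq_top_iff]; simp

lemma E2_zero : E2 0 = 1 := ENNReal.rpow_zero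

lemma E2_le {x y : ℝ} (h : x ≤ y) : E2 x ≤ E2 y := ENNReal.rpow_le_rpow_of_exponent_le (by norm_num) h

lemma E2_pow (x : ℝ) (m : ℕ) : E2 x ^ m = E2 (m * x) := by
  rw [E2, E2, ← ENNReal.rpow_natCast, ← ENNReal.rpow_mul, mul_comm]

lemma ofReal_two_rpow (x : ℝ) : ofReal ((2 : ℝ) ^ x) = E2 x := by
  rw [← ofReal_rpow_of_pos two_pos, ofReal_ofNat, E2]

lemma ofReal_zpow_rpow (k : ℤ) (e : ℝ) : ofReal (((2 : ℝ) ^ k) ^ e) = E2 (k * e) := by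
  rw [← rpow_intCast, ← rpow_mul two_pos.le, ofReal_two_rpow]

lemma tsum_E2 (x c : ℝ) : ∑' j : ℕ, E2 (x + c * j) = (1 - E2 c)⁻¹ * E2 x := by
  simp_rw [← E2_add, mul_comm c, ← E2_pow]
  rw [ENNReal.tsum_mul_left, ENNReal.tsum_geometric, mul_comm]

lemma geom_ne_top {c : ℝ} (hc : c < 0) : (1 - E2 c)⁻¹ ≠ ∞ := by
  rw [Ne, ENNReal.inv_eq_top, tsub_eq_zero_iff_le, not_le, ← E2_zero]
  exact ENNReal.rpow_lt_rpow_of_exponent_lt (by norm_num) ENNReal.ofNat_ne_top hc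

/-! ### Estimates for high frequencies -/

lemma NiceSol.exists_tL_two_T_D_le (hn : 5 ≤ n) (hn' : n ≤ 14) {p : ℝ} (hp : 4 ≤ p) : ∃ C ≠ ∞,
    ∀ (u : ℝ → Sch n) a b R, a ≤ b → NiceSol u a b R → ∀ (k : ℤ) (θ : Sch n) (c : ℝ),
    (∀ ξ, 2 ^ (k - 1) ≤ ‖ξ‖ → ‖ξ‖ ≤ 2 ^ (k + 1) → ‖θ ξ‖ ≤ c) →
    tL 2 a b (fun t => nL p (T θ (D k (u t)))) ≤ C * E2 (k * (n / 2 - n / p - 2)) * (ofReal c * Amp u a b k) := by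
  obtain ⟨C, hC, H⟩ := NiceSol.strichartz (n := n) hn hn'
  obtain ⟨C', hC', H'⟩ := exists_bernstein_D (n := n) (p := 4) (q := p) (by norm_num) hp
  refine ⟨C' * C, by finiteness, fun u a b R hab hu k θ c hθ => ?_⟩
  have e : ∀ f, T (smul2 θ (dil k (lpψ n))) f = T θ (D k f) := fun f => fourier_injective fun ξ => by
    rw [fourier_T, fourier_T, fourier_D, smul2_apply, mul_assoc]
  have hs : ∀ ξ : Rn n, dil k (lpψ n) ξ ≠ 0 → 2 ^ (k - 1) ≤ ‖ξ‖ ∧ ‖ξ‖ ≤ 2 ^ (k + 1) := fun ξ hξ =>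
    ⟨le_of_not_ge fun h => hξ (dil_lpψ_low h), le_of_not_ge fun h => hξ (dil_lpψ_high h)⟩
  have h2 : ∀ f : Sch n, nL 2 (T θ (D k f)) ≤ ofReal c * nL 2 (D k f) := fun f => by
    by_cases hc : 0 ≤ c
    · rw [nL_two_eq, nL_two_eq, ← ofReal_mul hc]
      refine ofReal_le_ofReal (norm_L2_le_of_fourier fun ξ => ?_)
      rw [fourier_T, norm_mul]
      by_cases hξ : dil k (lpψ n) ξ = 0
      · simp [fourier_D, hξ]
      · exact mul_le_mul_of_nonneg_right (hθ ξ (hs ξ hξ).1 (hs ξ hξ).2) (norm_nonneg _)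
    · have : T θ (D k f) = 0 := fourier_injective fun ξ => by
        have h0 : dil k (lpψ n) ξ = 0 := by
          by_contra hξ
          exact hc ((norm_nonneg _).trans (hθ ξ (hs ξ hξ).1 (hs ξ hξ).2))
        rw [fourier_T, fourier_D, h0]; simp
      rw [this, nL_two_eq, L2_zero]; simp
  have h1 := H u a b R hab hu k (smul2 θ (dil k (lpψ n))) fun ξ hξ => by
    rw [smul2_apply] at hξ
    exact hs ξ (right_ne_zero_of_mul hξ)
  simp only [e, ofReal_zpow_rpow] at h1 H'
  have h3 : tL 2 a b (fun t => nL p (T θ (D k (u t)))) ≤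
      C' * E2 (k * (n / 4 - n / p)) * tL 2 a b (fun t => nL 4 (T θ (D k (u t)))) := by
    have := E2_ne_top (k * ((n : ℝ) / 4 - n / p))
    rw [← tL_const_mul two_pos (by finiteness)]
    exact tL_mono two_pos fun t _ => H' k _ ((BL_D k _).T θ)
  refine h3.trans ?_
  have h4 : nL 2 (T θ (D k (u a))) + ∫⁻ τ in Icc a b, nL 2 (T θ (D k (cub (u τ)))) ≤ ofReal c * Amp u a b k := by
    rw [Amp, mul_add]
    refine add_le_add (h2 _) ?_
    rw [← lintegral_const_mul' _ _ ofReal_ne_top]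
    exact lintegral_mono fun t => h2 _
  calc _ ≤ C' * E2 (k * (n / 4 - n / p)) * (C * E2 (k * (n / 4 - 2)) * (ofReal c * Amp u a b k)) := by
        gcongr; exact h1.trans (mul_le_mul_right h4 _)
    _ = C' * C * (E2 (k * (n / 4 - n / p)) * E2 (k * (n / 4 - 2))) * (ofReal c * Amp u a b k) := by ring
    _ = _ := by rw [E2_add]; congr 3; ring

/-- Bounds for the amplitudes at frequencies above `2 ^ l`. -/
def HighAmp (u : ℝ → Sch n) (a b β : ℝ) (l : ℤ) (Q : ℝ≥0∞) : Prop :=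
  ∀ k : ℤ, l - 4 ≤ k → Amp u a b k ≤ Q * E2 (-2 * k + β * (k - l))

lemma HighAmp.exists_tL_two_T_D_le (hn : 5 ≤ n) (hn' : n ≤ 14) {p : ℝ} (hp : 4 ≤ p) : ∃ C ≠ ∞,
    ∀ (u : ℝ → Sch n) a b R, a ≤ b → NiceSol u a b R → ∀ (β : ℝ) (l : ℤ) (Q : ℝ≥0∞), HighAmp u a b β l Q →
    ∀ (k : ℤ) (θ : Sch n) (c : ℝ), 0 ≤ c → l - 4 ≤ k →
    (∀ ξ, 2 ^ (k - 1) ≤ ‖ξ‖ → ‖ξ‖ ≤ 2 ^ (k + 1) → ‖θ ξ‖ ≤ c * 2 ^ (4 * k - 2 * β * (k - l))) →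
    tL 2 a b (fun t => nL p (T θ (D k (u t)))) ≤ C * (ofReal c * Q) * E2 (k * (n / 2 - n / p) - β * (k - l)) := by
  obtain ⟨C, hC, H⟩ := NiceSol.exists_tL_two_T_D_le (n := n) hn hn' hp
  refine ⟨C, hC, fun u a b R hab hu β l Q hA k θ c hc hk hθ => (H u a b R hab hu k θ _ hθ).trans ?_⟩
  rw [ofReal_mul hc, ofReal_two_rpow]
  calc _ ≤ C * E2 (k * (n / 2 - n / p - 2)) * (ofReal c * E2 (4 * k - 2 * β * (k - l)) *
        (Q * E2 (-2 * k + β * (k - l)))) := by gcongr; exact hA k hk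
    _ = C * (ofReal c * Q) * (E2 (k * (n / 2 - n / p - 2)) * E2 (4 * k - 2 * β * (k - l)) * E2 (-2 * k + β * (k - l))) := by ring
    _ = _ := by rw [E2_add, E2_add]; congr 2; ring

lemma HighAmp.exists_tL_two_sub_S_le (hn : 5 ≤ n) (hn' : n ≤ 14) {p β : ℝ} (hp : 4 ≤ p) (hβ : (n : ℝ) / 2 - n / p - 4 + β < 0) :
    ∃ C ≠ ∞,
    ∀ (u : ℝ → Sch n) a b R, a ≤ b → NiceSol u a b R → ∀ (l : ℤ) (Q : ℝ≥0∞), HighAmp u a b β l Q →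
    ∀ q : ℤ, l - 5 ≤ q →
    tL 2 a b (fun t => nL p (u t - S q (u t) : Sch n)) ≤ C * Q * E2 (q * (n / 2 - n / p - 4) + β * (q - l)) := by
  obtain ⟨C, hC, H⟩ := NiceSol.exists_tL_two_T_D_le (n := n) hn hn' hp
  have := geom_ne_top hβ
  have := E2_ne_top ((n : ℝ) / 2 - n / p - 4 + β)
  refine ⟨C * E2 (n / 2 - n / p - 4 + β) * (1 - E2 (n / 2 - n / p - 4 + β))⁻¹, by finiteness, fun u a b R hab hu l Q hA q hq => ?_⟩
  have hg := hu.good (by omega) hn'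
  have h1 : ∀ j : ℕ, tL 2 a b (fun t => nL p (D (q + 1 + j) (u t))) ≤
      C * Q * E2 (q * (n / 2 - n / p - 4) + β * (q - l) + (n / 2 - n / p - 4 + β) + (n / 2 - n / p - 4 + β) * j) := fun j => by
    have := H u a b R hab hu (q + 1 + j) (dil (q + 1 + j + 1) (lpφ n)) 1 fun ξ _ _ => norm_dil_lpφ_le _ ξ
    have e : ∀ t, T (dil (q + 1 + j + 1) (lpφ n)) (D (q + 1 + j) (u t)) = D (q + 1 + j) (u t) := fun t => (BL_D _ _).S_eq
    simp only [e, ofReal_one, one_mul] at this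
    refine this.trans ?_
    calc _ ≤ C * E2 (((q + 1 + j : ℤ) : ℝ) * (n / 2 - n / p - 2)) * (Q * E2 (-2 * ((q + 1 + j : ℤ) : ℝ) + β * (((q + 1 + j : ℤ) : ℝ) - l))) := by
          gcongr; exact hA _ (by omega)
      _ = C * Q * (E2 (((q + 1 + j : ℤ) : ℝ) * (n / 2 - n / p - 2)) * E2 (-2 * ((q + 1 + j : ℤ) : ℝ) + β * (((q + 1 + j : ℤ) : ℝ) - l))) := by
          ring
      _ = _ := by rw [E2_add]; congr 2; push_cast; ring
  calc _ ≤ tL 2 a b (fun t => ∑' j : ℕ, nL p (D (q + 1 + j) (u t))) :=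
        tL_mono two_pos fun t _ => nL_sub_S_le (by omega) (by linarith) q (u t)
    _ ≤ ∑' j : ℕ, tL 2 a b (fun t => nL p (D (q + 1 + j) (u t))) :=
        tL_tsum_le one_le_two fun j => (hg.D _).aemeasurable_nL (by linarith)
    _ ≤ _ := ENNReal.tsum_le_tsum h1
    _ = _ := by
      rw [ENNReal.tsum_mul_left, tsum_E2, ← E2_add (q * (n / 2 - n / p - 4) + β * (q - l)) (n / 2 - n / p - 4 + β)]; ring

lemma HighAmp.exists_nL_D_le (hn : 5 ≤ n) (hn' : n ≤ 14) {p : ℝ} (hp : 2 ≤ p) : ∃ C ≠ ∞,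
    ∀ (u : ℝ → Sch n) a b R, NiceSol u a b R → ∀ (β : ℝ) (l : ℤ) (Q : ℝ≥0∞), HighAmp u a b β l Q →
    ∀ k : ℤ, l - 4 ≤ k → ∀ t ∈ Icc a b, nL p (D k (u t)) ≤ C * Q * E2 (k * (n / 2 - n / p - 2) + β * (k - l)) := by
  obtain ⟨C, hC, H⟩ := exists_bernstein_D (n := n) (p := 2) (q := p) (by norm_num) hp
  simp only [ofReal_zpow_rpow] at H
  refine ⟨C, hC, fun u a b R hu β l Q hA k hk t ht => (H k _ (BL_D k _)).trans ?_⟩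
  calc _ ≤ C * E2 (k * (n / 2 - n / p)) * (Q * E2 (-2 * k + β * (k - l))) := by
        gcongr; exact (hu.nL_D_le_Amp (by omega) hn' k ht).trans (hA k hk)
    _ = C * Q * (E2 (k * (n / 2 - n / p)) * E2 (-2 * k + β * (k - l))) := by ring
    _ = _ := by rw [E2_add]; congr 2; ring

lemma HighAmp.exists_nL_sub_S_le (hn : 5 ≤ n) (hn' : n ≤ 14) {p β : ℝ} (hp : 2 ≤ p) (hβ : (n : ℝ) / 2 - n / p - 2 + β < 0) :
    ∃ C ≠ ∞,
    ∀ (u : ℝ → Sch n) a b R, NiceSol u a b R → ∀ (l : ℤ) (Q : ℝ≥0∞), HighAmp u a b β l Q →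
    ∀ q : ℤ, l - 5 ≤ q → ∀ t ∈ Icc a b,
    nL p (u t - S q (u t) : Sch n) ≤ C * Q * E2 (q * (n / 2 - n / p - 2) + β * (q - l)) := by
  obtain ⟨C, hC, H⟩ := HighAmp.exists_nL_D_le (n := n) hn hn' hp
  have := geom_ne_top hβ
  have := E2_ne_top ((n : ℝ) / 2 - n / p - 2 + β)
  refine ⟨C * E2 (n / 2 - n / p - 2 + β) * (1 - E2 (n / 2 - n / p - 2 + β))⁻¹, by finiteness, fun u a b R hu l Q hA q hq t ht => ?_⟩
  have h1 : ∀ j : ℕ, nL p (D (q + 1 + j) (u t)) ≤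
      C * Q * E2 (q * (n / 2 - n / p - 2) + β * (q - l) + (n / 2 - n / p - 2 + β) + (n / 2 - n / p - 2 + β) * j) := fun j => by
    refine (H u a b R hu β l Q hA (q + 1 + j) (by omega) t ht).trans_eq ?_
    congr 2; push_cast; ring
  calc _ ≤ ∑' j : ℕ, nL p (D (q + 1 + j) (u t)) := nL_sub_S_le (by omega) (by linarith) q (u t)
    _ ≤ _ := ENNReal.tsum_le_tsum h1
    _ = _ := by
      rw [ENNReal.tsum_mul_left, tsum_E2, ← E2_add (q * (n / 2 - n / p - 2) + β * (q - l)) (n / 2 - n / p - 2 + β)]; ring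

lemma S_S_of_lt {m l : ℤ} (h : m < l) (f : Sch n) : S m (S l f) = S m f := fourier_injective fun ξ => by
  rw [fourier_S, fourier_S, fourier_S]
  rcases le_or_gt ‖ξ‖ (2 ^ l) with h1 | h1
  · rw [dil_lpφ_one h1, one_mul]
  · rw [dil_lpφ_zero (k := m) ((zpow_le_zpow_right₀ one_le_two (by omega)).trans h1.le), zero_mul, zero_mul]

lemma exists_nL_S_le : ∃ C ≠ ∞, ∀ {p : ℝ}, 1 ≤ p → ∀ (k : ℤ) (f : Sch n), nL p (S k f) ≤ C * nL p f :=
  ⟨_, nL_ne_top one_pos _, fun hp k f => nL_T_dil_le hp (lpφ n) k f⟩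

/-- Growth of the low-pass cutoffs in `L⁴`. -/
lemma HighAmp.exists_nL_S_le (hn : 5 ≤ n) (hn' : n ≤ 7) {β : ℝ} (hβ : 3 * β ≤ 8 - n) : ∃ C ≠ ∞,
    ∀ (u : ℝ → Sch n) a b R, NiceSol u a b R → ∀ (l : ℤ) (Q W : ℝ≥0∞), 0 ≤ l → HighAmp u a b β l Q →
    ∀ t ∈ Icc a b, nL 4 (S l (u t)) ≤ W → ∀ m : ℤ, l - 8 ≤ m →
    nL 4 (S m (u t)) ≤ C * (W + Q) * E2 ((m - l) * ((8 - n) / 12)) := by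
  have hn7 : (n : ℝ) ≤ 7 := by exact_mod_cast hn'
  obtain ⟨C₁, hC₁, H₁⟩ := _root_.exists_nL_S_le (n := n)
  obtain ⟨C₂, hC₂, H₂⟩ := HighAmp.exists_nL_D_le (n := n) hn (by omega) (p := 4) (by norm_num)
  set c : ℝ := (8 - n) / 12 with hc
  have hc0 : 0 < c := by rw [hc]; linarith
  have := geom_ne_top (neg_lt_zero.2 hc0)
  have := E2_ne_top (8 * c)
  set Cd := 1 + C₁ with hCd
  refine ⟨C₁ * E2 (8 * c) + Cd * C₂ * (1 - E2 (-c))⁻¹, by finiteness, fun u a b R hu l Q W hl hA t ht hW m hm => ?_⟩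
  have hl' : (0 : ℝ) ≤ l := by exact_mod_cast hl
  have hm' : (l : ℝ) - 8 ≤ m := by exact_mod_cast hm
  set f := u t with hf
  have e : S m f = S m (S l f) + S m (f - S l f) := by rw [S_sub, add_sub_cancel]
  have h1 : nL 4 (S m (S l f)) ≤ C₁ * E2 (8 * c) * W * E2 ((m - l) * c) := by
    refine (H₁ (by norm_num) m _).trans ((mul_le_mul_right hW _).trans ?_)
    rw [show C₁ * E2 (8 * c) * W * E2 ((m - l) * c) = C₁ * W * (E2 (8 * c) * E2 ((m - l) * c)) by ring, E2_add]
    refine le_mul_of_one_le_right' ?_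
    rw [← E2_zero]; exact E2_le (by nlinarith)
  have h2 : ∀ j : ℕ, nL 4 (D (m - j) (f - S l f)) ≤ Cd * C₂ * Q * E2 ((m - l) * c + -c * j) := fun j => by
    by_cases hj : l ≤ m - j
    · have e2 : D (m - j) (f - S l f) = D (m - j) f - S l (D (m - j) f) := by
        have : D (m - j) (S l f) = S l (D (m - j) f) := D_T _ _ _
        rw [← this]; exact T_sub _ _ _
      have hj' : (0 : ℝ) ≤ ((m - j : ℤ) : ℝ) - l := by rw [sub_nonneg]; exact_mod_cast hj
      calc nL 4 (D (m - j) (f - S l f)) ≤ nL 4 (D (m - j) f) + C₁ * nL 4 (D (m - j) f) := by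
            rw [e2]; exact (nL_sub_le (by norm_num) _ _).trans (add_le_add_right (H₁ (by norm_num) l _) _)
        _ = Cd * nL 4 (D (m - j) f) := by rw [hCd]; ring
        _ ≤ Cd * (C₂ * Q * E2 (((m - j : ℤ) : ℝ) * (n / 2 - n / 4 - 2) + β * (((m - j : ℤ) : ℝ) - l))) := by
            gcongr; exact H₂ u a b R hu β l Q hA _ (by omega) t ht
        _ ≤ Cd * (C₂ * Q * E2 ((m - l) * c + -c * j)) := by
            gcongr
            refine E2_le ?_
            have e3 : (m - l) * c + -c * j = (((m - j : ℤ) : ℝ) - l) * c := by push_cast; ring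
            rw [e3, hc]
            nlinarith
        _ = _ := by ring
    · have : D (m - j) (f - S l f) = 0 := fourier_injective fun ξ => by
        rw [fourier_D, fourier_sub_apply, fourier_S]
        rcases le_or_gt ‖ξ‖ (2 ^ l) with h1 | h1
        · rw [dil_lpφ_one h1]; simp
        · rw [dil_lpψ_high ((zpow_le_zpow_right₀ one_le_two (by omega)).trans h1.le)]; simp
      rw [this]
      refine (eLpNorm'_zero (by norm_num)).trans_le zero_le
  have h3 : nL 4 (S m (f - S l f)) ≤ Cd * C₂ * (1 - E2 (-c))⁻¹ * Q * E2 ((m - l) * c) := by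
    refine (nL_S_le_tsum (by omega) (by norm_num) m _).trans ((ENNReal.tsum_le_tsum h2).trans_eq ?_)
    rw [ENNReal.tsum_mul_left, tsum_E2]; ring
  rw [e]
  refine (nL_add_le (by norm_num) _ _).trans ((add_le_add h1 h3).trans ?_)
  rw [← add_mul]
  gcongr
  calc _ ≤ C₁ * E2 (8 * c) * W + Cd * C₂ * (1 - E2 (-c))⁻¹ * Q + (C₁ * E2 (8 * c) * Q + Cd * C₂ * (1 - E2 (-c))⁻¹ * W) := le_self_add
    _ = _ := by ring

/-! ### The increment of the modified energy -/

/-- Control of the high frequencies and of the low-pass cutoff of a solution at the frequency `2 ^ l`. -/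
structure Controlled (u : ℝ → Sch n) (a b R β : ℝ) (l : ℤ) (P : ℝ≥0∞) : Prop extends NiceSol u a b R where
  le : a ≤ b
  nonneg : 0 ≤ l
  amp : HighAmp u a b β l P
  low : ∀ t ∈ Icc a b, nL 4 (S l (u t)) ≤ P
  fin : P ≠ ∞

lemma lintegral_mul_mul_le_tL {a b : ℝ} {f g h : ℝ → ℝ≥0∞} {c : ℝ≥0∞} (hf : AEMeasurable f (volume.restrict (Icc a b)))
    (hg : AEMeasurable g (volume.restrict (Icc a b))) (hc : c ≠ ∞) (hh : ∀ t ∈ Icc a b, h t ≤ c) :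
    ∫⁻ t in Icc a b, f t * g t * h t ≤ tL 2 a b f * tL 2 a b g * c := by
  calc _ ≤ ∫⁻ t in Icc a b, f t * g t * c := setLIntegral_mono' measurableSet_Icc fun t ht => by gcongr; exact hh t ht
    _ = (∫⁻ t in Icc a b, f t * g t) * c := lintegral_mul_const' _ _ hc
    _ ≤ _ := by gcongr; exact lintegral_mul_le_tL hf hg

lemma Good.aemeasurable_inner {v w : ℝ → Sch n} {a b : ℝ} (hv : Good v a b) (hw : Good w a b) :
    AEMeasurable (fun t => ‖inner ℂ (L2 (v t)) (L2 (w t))‖ₑ) (volume.restrict (Icc a b)) :=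
  (ContinuousOn.inner (𝕜 := ℂ) hv.cont hw.cont).enorm.aemeasurable measurableSet_Icc

lemma Controlled.exists_lintegral_piece_le (hn : 5 ≤ n) (hn' : n ≤ 7) {β : ℝ} (hβ0 : 0 ≤ β) (hβ : 3 * β ≤ 8 - n) :
    ∃ C ≠ ∞, ∀ (u : ℝ → Sch n) a b R l P, Controlled u a b R β l P →
    ∀ (k q : ℤ) (θ : Sch n) (c : ℝ), 0 ≤ c → l - 4 ≤ k → l - 5 ≤ q → k - 4 ≤ q → q ≤ k + 4 →
    (∀ ξ, 2 ^ (k - 1) ≤ ‖ξ‖ → ‖ξ‖ ≤ 2 ^ (k + 1) → ‖θ ξ‖ ≤ c * 2 ^ (4 * k - 2 * β * (k - l))) →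
    ∫⁻ t in Icc a b, ‖inner ℂ (L2 (T θ (D k (u t)))) (L2 (cub (u t) - cub (S q (u t)) : Sch n))‖ₑ ≤
      C * (ofReal c * P ^ 4) * E2 (l * ((n - 8) / 2) - (k - l) * ((8 - n) / 3)) := by
  have h5 : (5 : ℝ) ≤ n := by exact_mod_cast hn
  have h7 : (n : ℝ) ≤ 7 := by exact_mod_cast hn'
  obtain ⟨A₄, hA₄, HA₄⟩ := HighAmp.exists_tL_two_T_D_le (n := n) hn (by omega) (p := 4) le_rfl
  obtain ⟨A₆, hA₆, HA₆⟩ := HighAmp.exists_tL_two_T_D_le (n := n) hn (by omega) (p := 6) (by norm_num)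
  obtain ⟨B₄, hB₄, HB₄⟩ := HighAmp.exists_tL_two_sub_S_le (n := n) hn (by omega) (p := 4) (β := β) le_rfl (by linarith)
  obtain ⟨B₆, hB₆, HB₆⟩ := HighAmp.exists_tL_two_sub_S_le (n := n) hn (by omega) (p := 6) (β := β) (by norm_num) (by linarith)
  obtain ⟨C₃, hC₃, HC₃⟩ := HighAmp.exists_nL_sub_S_le (n := n) hn (by omega) (p := 3) (β := β) (by norm_num) (by linarith)
  obtain ⟨C₄, hC₄, HC₄⟩ := HighAmp.exists_nL_S_le (n := n) hn hn' hβ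
  have := E2_ne_top 64
  refine ⟨5 * (A₄ * B₄ * (C₄ * 2) ^ 2 * E2 64 + A₆ * B₆ * C₃ ^ 2 * E2 64), by finiteness,
    fun u a b R l P h k q θ c hc hk hq hkq hqk hθ => ?_⟩
  have hu := h.toNiceSol
  have hP := h.fin
  have hl0 : (0 : ℝ) ≤ l := by exact_mod_cast h.nonneg
  have hk' : (l : ℝ) - 4 ≤ k := by exact_mod_cast hk
  have hkq' : (k : ℝ) - 4 ≤ q := by exact_mod_cast hkq
  have hqk' : (q : ℝ) ≤ k + 4 := by exact_mod_cast hqk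
  have g := hu.good (by omega) (by omega)
  have gA := (g.D k).T θ
  have gy := g.sub (g.S q)
  have m : ∀ {p : ℝ}, 2 ≤ p → AEMeasurable (fun t => nL p (T θ (D k (u t)))) (volume.restrict (Icc a b)) := fun hp => gA.aemeasurable_nL hp
  have m' : ∀ {p : ℝ}, 2 ≤ p → AEMeasurable (fun t => nL p (u t - S q (u t) : Sch n)) (volume.restrict (Icc a b)) :=
    fun hp => gy.aemeasurable_nL hp
  set V : ℝ≥0∞ := C₄ * (P + P) * E2 ((q - l) * ((8 - n) / 12)) with hV
  set Z : ℝ≥0∞ := C₃ * P * E2 (q * (n / 2 - n / 3 - 2) + β * (q - l)) with hZ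
  have hVt : V ≠ ∞ := by have := E2_ne_top ((q - l) * ((8 - n) / 12)); finiteness
  have hZt : Z ≠ ∞ := by have := E2_ne_top (q * (n / 2 - n / 3 - 2) + β * (q - l)); finiteness
  have i1 := lintegral_mul_mul_le_tL (c := V ^ 2) (h := fun t => nL 4 (S q (u t)) ^ 2) (m (p := 4) (by norm_num)) (m' (p := 4) (by norm_num)) (by finiteness)
    fun t ht => by gcongr; exact HC₄ u a b R hu l P P h.nonneg h.amp t ht (h.low t ht) q (by omega)
  have i2 := lintegral_mul_mul_le_tL (c := Z ^ 2) (h := fun t => nL 3 (u t - S q (u t) : Sch n) ^ 2) (m (p := 6) (by norm_num)) (m' (p := 6) (by norm_num)) (by finiteness)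
    fun t ht => by gcongr; exact HC₃ u a b R hu l P h.amp q hq t ht
  have e1 : E2 (k * (n / 2 - n / 4) - β * (k - l)) * E2 (q * (n / 2 - n / 4 - 4) + β * (q - l)) * E2 ((q - l) * ((8 - n) / 12)) ^ 2 ≤
      E2 64 * E2 (l * ((n - 8) / 2) - (k - l) * ((8 - n) / 3)) := by
    rw [E2_pow, E2_add, E2_add, E2_add]
    refine E2_le ?_
    push_cast
    have : ((q : ℝ) - k) * (n / 4 - 4 + β + (8 - n) / 6) ≤ 64 := by nlinarith
    linarith
  have e2 : E2 (k * (n / 2 - n / 6) - β * (k - l)) * E2 (q * (n / 2 - n / 6 - 4) + β * (q - l)) * E2 (q * (n / 2 - n / 3 - 2) + β * (q - l)) ^ 2 ≤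
      E2 64 * E2 (l * ((n - 8) / 2) - (k - l) * ((8 - n) / 3)) := by
    rw [E2_pow, E2_add, E2_add, E2_add]
    refine E2_le ?_
    push_cast
    have h1 : ((q : ℝ) - k) * (2 * n / 3 - 8 + 3 * β) ≤ 32 := by nlinarith
    have h2 : ((k : ℝ) - l) * (n - 8 + 2 * β + (8 - n) / 3) ≤ 32 := by nlinarith
    have h3 : (l : ℝ) * (n - 8) ≤ l * ((n - 8) / 2) := by nlinarith
    linarith
  calc _ ≤ ∫⁻ t in Icc a b, 5 * (nL 4 (T θ (D k (u t))) * nL 4 (u t - S q (u t) : Sch n) * nL 4 (S q (u t)) ^ 2 +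
        nL 6 (T θ (D k (u t))) * nL 6 (u t - S q (u t) : Sch n) * nL 3 (u t - S q (u t) : Sch n) ^ 2) :=
        lintegral_mono fun t => enorm_inner_cub_sub_le _ _ _
    _ = 5 * ((∫⁻ t in Icc a b, nL 4 (T θ (D k (u t))) * nL 4 (u t - S q (u t) : Sch n) * nL 4 (S q (u t)) ^ 2) +
        ∫⁻ t in Icc a b, nL 6 (T θ (D k (u t))) * nL 6 (u t - S q (u t) : Sch n) * nL 3 (u t - S q (u t) : Sch n) ^ 2) := by
        rw [lintegral_const_mul' _ _ (by finiteness), lintegral_add_left']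
        exact ((m (by norm_num)).mul (m' (by norm_num))).mul (((g.S q).aemeasurable_nL (by norm_num)).pow_const 2)
    _ ≤ 5 * (A₄ * (ofReal c * P) * E2 (k * (n / 2 - n / 4) - β * (k - l)) * (B₄ * P * E2 (q * (n / 2 - n / 4 - 4) + β * (q - l))) * V ^ 2 +
        A₆ * (ofReal c * P) * E2 (k * (n / 2 - n / 6) - β * (k - l)) * (B₆ * P * E2 (q * (n / 2 - n / 6 - 4) + β * (q - l))) * Z ^ 2) := by
        gcongr 5 * (?_ + ?_)
        · refine i1.trans ?_
          gcongr
          · exact HA₄ u a b R h.le hu β l P h.amp k θ c hc hk hθ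
          · exact HB₄ u a b R h.le hu l P h.amp q hq
        · refine i2.trans ?_
          gcongr
          · exact HA₆ u a b R h.le hu β l P h.amp k θ c hc hk hθ
          · exact HB₆ u a b R h.le hu l P h.amp q hq
    _ ≤ _ := (le_of_eq (by rw [hV, hZ]; ring)).trans ((mul_le_mul_right
        (add_le_add (mul_le_mul_right e1 (A₄ * B₄ * (C₄ * 2) ^ 2 * (ofReal c * P ^ 4)))
          (mul_le_mul_right e2 (A₆ * B₆ * C₃ ^ 2 * (ofReal c * P ^ 4)))) 5).trans_eq (by ring))

lemma inner_T_S_sub_S (θ g f : Sch n) (k : ℤ) (m : ℕ) :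
    inner ℂ (L2 (T θ (S (k + m) f - S k f))) (L2 g) = ∑ i ∈ range m, inner ℂ (L2 (T θ (D (k + 1 + i) f))) (L2 g) := by
  induction m with
  | zero => rw [Nat.cast_zero, add_zero, T_sub, sub_self, L2_zero, inner_zero_left, Finset.sum_range_zero]
  | succ m ih =>
    rw [sum_range_succ, ← ih, ← inner_add_left, ← L2_add, ← T_add, Nat.cast_succ, ← add_assoc, S_succ,
      show k + m + 1 = k + 1 + (m : ℤ) by ring]
    congr 3; abel

/-- The contribution of the high frequencies to the increment. -/
lemma Controlled.exists_lintegral_high_le (hn : 5 ≤ n) (hn' : n ≤ 7) {β : ℝ} (hβ0 : 0 ≤ β) (hβ : 3 * β ≤ 8 - n) :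
    ∃ C ≠ ∞, ∀ (u : ℝ → Sch n) a b R l P, Controlled u a b R β l P →
    ∀ (θ : Sch n) (c : ℝ) (m : ℕ), 0 ≤ c →
    (∀ k : ℤ, l < k → ∀ ξ, 2 ^ (k - 1) ≤ ‖ξ‖ → ‖ξ‖ ≤ 2 ^ (k + 1) → ‖θ ξ‖ ≤ c * 2 ^ (4 * k - 2 * β * (k - l))) →
    (∀ ξ, 2 ^ (l + m) ≤ ‖ξ‖ → θ ξ = 0) →
    ∫⁻ t in Icc a b, ‖inner ℂ (L2 (T θ (u t - S l (u t)))) (L2 (cub (u t)))‖ₑ ≤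
      C * (ofReal c * P ^ 4) * E2 (l * ((n - 8) / 2)) := by
  have h7 : (n : ℝ) ≤ 7 := by exact_mod_cast hn'
  obtain ⟨C, hC, H⟩ := Controlled.exists_lintegral_piece_le hn hn' hβ0 hβ
  have hg := geom_ne_top (c := -((8 - n) / 3)) (by linarith)
  have hE := E2_ne_top (-((8 - n) / 3))
  refine ⟨C * ((1 - E2 (-((8 - n) / 3)))⁻¹ * E2 (-((8 - n) / 3))), by finiteness, fun u a b R l P h θ c m hc hθ h0 => ?_⟩
  have g := h.toNiceSol.good (by omega) (by omega)
  have e : ∀ t, inner ℂ (L2 (T θ (u t - S l (u t)))) (L2 (cub (u t))) = ∑ i ∈ range m,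
      inner ℂ (L2 (T θ (D (l + 1 + i) (u t)))) (L2 (cub (u t) - cub (S (l + 1 + i - 4) (u t)) : Sch n)) := fun t => by
    have e1 : T θ (u t - S l (u t)) = T θ (S (l + m) (u t) - S l (u t)) := fourier_injective fun ξ => by
      rw [fourier_T, fourier_T]
      rcases le_or_gt (2 ^ (l + m) : ℝ) ‖ξ‖ with h1 | h1
      · rw [h0 ξ h1, zero_mul, zero_mul]
      · rw [fourier_sub_apply, fourier_sub_apply, fourier_S (l + m), dil_lpφ_one h1.le, one_mul]
    rw [e1, inner_T_S_sub_S]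
    refine Finset.sum_congr rfl fun i _ => ?_
    rw [L2_sub, inner_sub_right, sub_eq_self.2]
    refine inner_L2_eq_zero fun ξ => ?_
    set k : ℤ := l + 1 + i
    rcases le_or_gt ‖ξ‖ (2 ^ (k - 1)) with h1 | h1
    · left; rw [fourier_T, fourier_D, dil_lpψ_low h1, zero_mul, mul_zero]
    · right
      refine fourier_cub_eq_zero (r := 2 ^ (k - 4 + 1)) (BL_S _ _) (lt_of_le_of_lt ?_ h1)
      rw [show k - 1 = (k - 4 + 1) + 2 by ring, zpow_add₀ two_ne_zero (k - 4 + 1) 2]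
      have : (0 : ℝ) < 2 ^ (k - 4 + 1) := by positivity
      linarith
  simp_rw [e]
  calc _ ≤ ∫⁻ t in Icc a b, ∑ i ∈ range m, ‖inner ℂ (L2 (T θ (D (l + 1 + i) (u t)))) (L2 (cub (u t) - cub (S (l + 1 + i - 4) (u t)) : Sch n))‖ₑ :=
        lintegral_mono fun t => enorm_sum_le _ _
    _ = ∑ i ∈ range m, ∫⁻ t in Icc a b, ‖inner ℂ (L2 (T θ (D (l + 1 + i) (u t)))) (L2 (cub (u t) - cub (S (l + 1 + i - 4) (u t)) : Sch n))‖ₑ :=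
        lintegral_finsetSum' _ fun i _ => ((g.D _).T θ).aemeasurable_inner (g.cub.sub (g.S _).cub)
    _ ≤ ∑ i ∈ range m, C * (ofReal c * P ^ 4) * E2 ((l * ((n - 8) / 2) + -((8 - n) / 3)) + -((8 - n) / 3) * i) := by
        refine Finset.sum_le_sum fun i _ => (H u a b R l P h (l + 1 + i) (l + 1 + i - 4) θ c hc (by omega) (by omega) (by omega) (by omega)
          (hθ _ (by omega))).trans_eq ?_
        push_cast; congr 2; ring
    _ ≤ ∑' i : ℕ, C * (ofReal c * P ^ 4) * E2 ((l * ((n - 8) / 2) + -((8 - n) / 3)) + -((8 - n) / 3) * i) :=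
        ENNReal.sum_le_tsum _
    _ = _ := by rw [ENNReal.tsum_mul_left, tsum_E2, ← E2_add]; ring

lemma exists_nL_bi_S_le : ∃ C ≠ ∞, ∀ {p : ℝ}, 1 ≤ p → ∀ (k : ℤ) (f : Sch n),
    nL p (bi (S k f)) ≤ C * E2 (4 * k) * nL p f := by
  obtain ⟨ρ, hρ⟩ := cut_exists (n := n) 0
  refine ⟨_, nL_ne_top one_pos (𝓕⁻ ρ : Sch n), fun {p} hp k f => ?_⟩
  have e : bi (S k f) = ((2 : ℂ) ^ (4 * k)) • T (dil k ρ) f := fourier_injective fun ξ => by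
    rw [fourier_bi, fourier_S, dil_lpφ_real, fourier_smul_apply, fourier_T, dil_apply, hρ, om_eq, om_eq, norm_smul, zpow_zero, inv_one, one_smul,
      norm_inv, norm_zpow, norm_two, zpow_mul']
    push_cast
    have : (2 : ℂ) ^ k ≠ 0 := zpow_ne_zero _ two_ne_zero
    field_simp
  have h1 : nL p (bi (S k f)) = E2 (4 * k) * nL p (T (dil k ρ) f) := by
    rw [e, show ⇑((2 : ℂ) ^ (4 * k) • T (dil k ρ) f) = (2 : ℂ) ^ (4 * k) • ⇑(T (dil k ρ) f) from rfl, nL,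
      eLpNorm'_const_smul _ (by linarith)]
    congr 1
    rw [← ofReal_norm, norm_zpow, Complex.norm_two, ← rpow_intCast, ofReal_two_rpow]
    push_cast; rfl
  rw [h1, mul_comm _ (E2 _), mul_assoc]
  gcongr
  exact nL_T_dil_le hp ρ k f

lemma nL_cub_le (f : Sch n) : nL (4 / 3) (cub f) ≤ 2 * nL 4 f ^ 3 := by
  have h := nL_cub_sub_le (n := n) (p := 4 / 3) (q := 4) (r := 4) (by norm_num) (by norm_num) (by norm_num) f 0
  have e : cub (0 : Sch n) = 0 := by ext x; simp [cub_apply]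
  have e2 : nL 4 ((0 : Sch n) : Rn n → ℂ) = 0 := eLpNorm'_zero (by norm_num)
  rw [e, sub_zero, sub_zero, e2, zero_pow two_ne_zero, add_zero] at h
  refine h.trans ?_
  rw [← pow_succ]
  gcongr
  rw [← ofReal_ofNat]
  exact ofReal_le_ofReal (by norm_num)

/-- The contribution of the low frequencies to the increment. -/
lemma Controlled.exists_lintegral_low_le (hn : 5 ≤ n) (hn' : n ≤ 7) {β : ℝ} (hβ0 : 0 ≤ β) (hβ : 3 * β ≤ 8 - n) :
    ∃ C ≠ ∞, ∀ (u : ℝ → Sch n) a b R l P, Controlled u a b R β l P →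
    ∫⁻ t in Icc a b, ‖inner ℂ (L2 (bi (S (l - 4) (u t)))) (L2 (cub (u t) - cub (S l (u t)) : Sch n))‖ₑ ≤
      C * P ^ 4 * E2 (l * ((n - 8) / 2)) := by
  have h5 : (5 : ℝ) ≤ n := by exact_mod_cast hn
  have h7 : (n : ℝ) ≤ 7 := by exact_mod_cast hn'
  obtain ⟨C₀, hC₀, H₀⟩ := exists_nL_S_le (n := n)
  obtain ⟨C₁, hC₁, H₁⟩ := exists_nL_bi_S_le (n := n)
  obtain ⟨C₂, hC₂, H₂⟩ := nL_bernstein (n := n) (p := 4) (q := 6) (by norm_num) (by norm_num)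
  obtain ⟨C₃, hC₃, H₃⟩ := HighAmp.exists_nL_sub_S_le (n := n) hn (by omega) (p := 3) (β := β) (by norm_num) (by linarith)
  obtain ⟨C₄, hC₄, H₄⟩ := HighAmp.exists_tL_two_sub_S_le (n := n) hn (by omega) (p := 4) (β := β) le_rfl (by linarith)
  have := E2_ne_top 64
  refine ⟨3 * (1 + C₀ ^ 2) * (C₁ * C₀ * C₄ ^ 2 * E2 64) + 3 * (1 + C₀ ^ 3) * (C₂ * C₁ * C₃ * C₄ ^ 2 * E2 64), by finiteness,
    fun u a b R l P h => ?_⟩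
  have hu := h.toNiceSol
  have hP := h.fin
  have hl0 : (0 : ℝ) ≤ l := by exact_mod_cast h.nonneg
  have g := hu.good (by omega) (by omega)
  set w : ℝ → Sch n := fun t => S (l - 4) (u t) with hw
  set y : ℝ → Sch n := fun t => u t - w t with hy
  have gy : Good y a b := g.sub (g.S (l - 4))
  have my := gy.aemeasurable_nL (p := 4) (by norm_num)
  set A : ℝ≥0∞ := C₁ * E2 (4 * (l - 4)) * P with hA
  set Z : ℝ≥0∞ := C₂ * E2 ((l - 3) * (n * (1 / 4 - 1 / 6))) * A with hZ
  set Y : ℝ≥0∞ := C₃ * P * E2 ((l - 4) * (n / 2 - n / 3 - 2) + β * ((l - 4) - l)) with hY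
  set y₂ : ℝ≥0∞ := C₄ * P * E2 ((l - 4) * (n / 2 - n / 4 - 4) + β * ((l - 4) - l)) with hy₂
  have hAt : A ≠ ∞ := by have := E2_ne_top (4 * (l - 4)); finiteness
  have hZt : Z ≠ ∞ := by have := E2_ne_top ((l - 3) * (n * (1 / 4 - 1 / 6))); finiteness
  have hYt : Y ≠ ∞ := by have := E2_ne_top ((l - 4) * (n / 2 - n / 3 - 2) + β * ((l - 4) - l)); finiteness
  have hS : ∀ t, w t = S (l - 4) (S l (u t)) := fun t => (S_S_of_lt (show l - 4 < l by omega) (u t)).symm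
  have bA : ∀ t ∈ Icc a b, nL 4 (bi (w t)) ≤ A := fun t ht => by
    rw [hS]
    refine (H₁ (by norm_num) _ _).trans ?_
    rw [hA]; push_cast
    gcongr; exact h.low t ht
  have bv : ∀ t ∈ Icc a b, nL 4 (w t) ≤ C₀ * P := fun t ht => by
    rw [hS]
    refine (H₀ (by norm_num) _ _).trans ?_
    gcongr; exact h.low t ht
  have hBL : ∀ t, BL (l - 3) (w t) := fun t => by
    have := BL_S (l - 4) (u t); rwa [show l - 4 + 1 = l - 3 by ring] at this
  have bZ : ∀ t ∈ Icc a b, nL 6 (bi (w t)) ≤ Z := fun t ht => by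
    refine (H₂ (l - 3) _ (hBL t).bi).trans ?_
    rw [ofReal_zpow_rpow, hZ]; push_cast
    gcongr; exact bA t ht
  have bY : ∀ t ∈ Icc a b, nL 3 (y t) ≤ Y := fun t ht => by
    refine (H₃ u a b R hu l P h.amp (l - 4) (by omega) t ht).trans_eq ?_
    rw [hY]; push_cast; rfl
  have by₂ : tL 2 a b (fun t => nL 4 (y t)) ≤ y₂ := by
    refine (H₄ u a b R h.le hu l P h.amp (l - 4) (by omega)).trans_eq ?_
    rw [hy₂]; push_cast; rfl
  have main : ∀ t, ‖inner ℂ (L2 (bi (w t))) (L2 (cub (u t) - cub (S l (u t)) : Sch n))‖ₑ ≤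
      3 * (1 + C₀ ^ 2) * (nL 4 (y t) * nL 4 (y t) * (nL 4 (bi (w t)) * nL 4 (w t))) +
        3 * (1 + C₀ ^ 3) * (nL 4 (y t) * nL 4 (y t) * (nL 6 (bi (w t)) * nL 3 (y t))) := fun t => by
    have h1 := enorm_inner_cub_sub_cub_le (f := u t) (g := S l (u t)) (hBL t).bi (hBL t) fun ξ hξ => by
      rw [fourier_sub_apply, fourier_S, dil_lpφ_one (hξ.trans (zpow_le_zpow_right₀ one_le_two (by omega))), one_mul, sub_self]
    have e : S l (u t) - w t = S l (y t) := by
      have : BL l (w t) := fun ξ hξ => hBL t ξ ((zpow_le_zpow_right₀ one_le_two (by omega)).trans_lt hξ)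
      rw [hy, S_sub, this.S_eq]
    rw [e] at h1
    refine h1.trans ?_
    calc _ ≤ 3 * (nL 4 (bi (w t)) * nL 4 (w t) * nL 4 (y t) ^ 2 +
        nL 6 (bi (w t)) * nL 3 (y t) * nL 4 (y t) ^ 2) +
        3 * (nL 4 (bi (w t)) * nL 4 (w t) * (C₀ * nL 4 (y t)) ^ 2 +
        nL 6 (bi (w t)) * (C₀ * nL 3 (y t)) * (C₀ * nL 4 (y t)) ^ 2) := by
          gcongr
          · exact H₀ (by norm_num) _ _
          · exact H₀ (by norm_num) _ _
          · exact H₀ (by norm_num) _ _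
      _ = _ := by ring
  have i1 := lintegral_mul_mul_le_tL (c := A * (C₀ * P)) (h := fun t => nL 4 (bi (w t)) * nL 4 (w t)) my my (by finiteness)
    fun t ht => mul_le_mul' (bA t ht) (bv t ht)
  have i2 := lintegral_mul_mul_le_tL (c := Z * Y) (h := fun t => nL 6 (bi (w t)) * nL 3 (y t)) my my (by finiteness)
    fun t ht => mul_le_mul' (bZ t ht) (bY t ht)
  have gA : Good (fun t => bi (S (l - 4) (u t))) a b := by
    obtain ⟨ρ, hρ⟩ := cut_exists (n := n) (l - 4)
    have : ∀ t, bi (S (l - 4) (u t)) = T ρ (u t) := fun t => fourier_injective fun ξ => by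
      rw [fourier_bi, fourier_S, fourier_T, hρ, dil_lpφ_real]; push_cast; ring
    simp_rw [this]; exact g.T ρ
  have e1 : E2 (4 * (l - 4)) * E2 ((l - 4) * (n / 2 - n / 4 - 4) + β * ((l - 4) - l)) ^ 2 ≤ E2 64 * E2 (l * ((n - 8) / 2)) := by
    rw [E2_pow, E2_add, E2_add]
    refine E2_le ?_
    push_cast
    nlinarith
  have e2 : E2 ((l - 3) * (n * (1 / 4 - 1 / 6))) * E2 (4 * (l - 4)) * E2 ((l - 4) * (n / 2 - n / 3 - 2) + β * ((l - 4) - l)) *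
      E2 ((l - 4) * (n / 2 - n / 4 - 4) + β * ((l - 4) - l)) ^ 2 ≤ E2 64 * E2 (l * ((n - 8) / 2)) := by
    rw [E2_pow, E2_add, E2_add, E2_add, E2_add]
    refine E2_le ?_
    push_cast
    nlinarith
  calc _ ≤ ∫⁻ t in Icc a b, (3 * (1 + C₀ ^ 2) * (nL 4 (y t) * nL 4 (y t) * (nL 4 (bi (w t)) * nL 4 (w t))) +
        3 * (1 + C₀ ^ 3) * (nL 4 (y t) * nL 4 (y t) * (nL 6 (bi (w t)) * nL 3 (y t)))) := lintegral_mono fun t => main t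
    _ = 3 * (1 + C₀ ^ 2) * (∫⁻ t in Icc a b, nL 4 (y t) * nL 4 (y t) * (nL 4 (bi (w t)) * nL 4 (w t))) +
        3 * (1 + C₀ ^ 3) * (∫⁻ t in Icc a b, nL 4 (y t) * nL 4 (y t) * (nL 6 (bi (w t)) * nL 3 (y t))) := by
        rw [lintegral_add_left', lintegral_const_mul' _ _ (by finiteness), lintegral_const_mul' _ _ (by finiteness)]
        exact ((my.mul my).mul ((gA.aemeasurable_nL (by norm_num)).mul ((g.S _).aemeasurable_nL (by norm_num)))).const_mul _
    _ ≤ 3 * (1 + C₀ ^ 2) * (y₂ * y₂ * (A * (C₀ * P))) + 3 * (1 + C₀ ^ 3) * (y₂ * y₂ * (Z * Y)) := by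
        gcongr
        · refine i1.trans ?_; gcongr
        · refine i2.trans ?_; gcongr
    _ ≤ _ := (le_of_eq (by rw [hy₂, hZ, hY, hA]; ring)).trans ((add_le_add
        (mul_le_mul_right e1 (3 * (1 + C₀ ^ 2) * (C₁ * C₀ * C₄ ^ 2) * P ^ 4))
        (mul_le_mul_right e2 (3 * (1 + C₀ ^ 3) * (C₂ * C₁ * C₃ * C₄ ^ 2) * P ^ 4))).trans_eq (by ring))

/-- The contribution of the nonlinear term to the increment. -/
lemma Controlled.exists_lintegral_cub_le (hn : 5 ≤ n) (hn' : n ≤ 7) {β : ℝ} (hβ : 3 * β ≤ 8 - n) :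
    ∃ C ≠ ∞, ∀ (u : ℝ → Sch n) a b R l P, Controlled u a b R β l P →
    ∫⁻ t in Icc a b, ‖inner ℂ (L2 (S l (cub (S l (u t))))) (L2 (cub (u t) - cub (S l (u t)) : Sch n))‖ₑ ≤
      C * tL 4 a b (fun t => nL 8 (u t)) ^ 2 * P ^ 4 * E2 (l * ((n - 8) / 2)) := by
  have h5 : (5 : ℝ) ≤ n := by exact_mod_cast hn
  have h7 : (n : ℝ) ≤ 7 := by exact_mod_cast hn'
  obtain ⟨C₀, hC₀, H₀⟩ := exists_nL_S_le (n := n)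
  obtain ⟨C₂, hC₂, H₂⟩ := nL_bernstein (n := n) (p := 4 / 3) (q := 2) (by norm_num) (by norm_num)
  obtain ⟨C₄, hC₄, H₄⟩ := HighAmp.exists_tL_two_sub_S_le (n := n) hn (by omega) (p := 4) (β := β) le_rfl (by linarith)
  have := E2_ne_top 64
  refine ⟨2 * (1 + C₀ ^ 2) * (C₂ * C₀ * 2 * C₄) * E2 64, by finiteness, fun u a b R l P h => ?_⟩
  have hu := h.toNiceSol
  have hP := h.fin
  have g := hu.good (by omega) (by omega)
  set G : ℝ≥0∞ := C₂ * E2 ((l + 1) * (n * (1 / (4 / 3) - 1 / 2))) * (C₀ * (2 * P ^ 3)) with hG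
  have hGt : G ≠ ∞ := by have := E2_ne_top ((l + 1) * (n * (1 / (4 / 3) - 1 / 2))); finiteness
  have bG : ∀ t ∈ Icc a b, nL 2 (S l (cub (S l (u t)))) ≤ G := fun t ht => by
    refine (H₂ (l + 1) _ (BL_S _ _)).trans ?_
    rw [ofReal_zpow_rpow, hG]; push_cast
    gcongr
    refine (H₀ (by norm_num) _ _).trans ?_
    gcongr
    refine (nL_cub_le _).trans ?_
    gcongr; exact h.low t ht
  have i1 := lintegral_mul_mul_le_tL (f := fun t => nL 8 (u t) ^ 2) (c := G) (h := fun t => nL 2 (S l (cub (S l (u t)))))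
    ((g.aemeasurable_nL (p := 8) (by norm_num)).pow_const 2) ((g.sub (g.S l)).aemeasurable_nL (p := 4) (by norm_num)) hGt bG
  have e1 : E2 ((l + 1) * (n * (1 / (4 / 3) - 1 / 2))) * E2 (l * (n / 2 - n / 4 - 4) + β * (l - l)) ≤ E2 64 * E2 (l * ((n - 8) / 2)) := by
    rw [E2_add, E2_add]
    exact E2_le (by nlinarith)
  calc _ ≤ ∫⁻ t in Icc a b, 2 * (1 + C₀ ^ 2) * (nL 8 (u t) ^ 2 * nL 4 (u t - S l (u t) : Sch n) * nL 2 (S l (cub (S l (u t))))) := by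
        refine lintegral_mono fun t => (enorm_inner_cub_sub_le' _ _ _).trans ?_
        calc _ ≤ 2 * nL 2 (S l (cub (S l (u t)))) * ((nL 8 (u t) ^ 2 + (C₀ * nL 8 (u t)) ^ 2) * nL 4 (u t - S l (u t) : Sch n)) := by
              gcongr; exact H₀ (by norm_num) _ _
          _ = _ := by ring
    _ ≤ 2 * (1 + C₀ ^ 2) * (tL 4 a b (fun t => nL 8 (u t)) ^ 2 * (C₄ * P * E2 (l * (n / 2 - n / 4 - 4) + β * (l - l))) * G) := by
        rw [lintegral_const_mul' _ _ (by finiteness), ← tL_two_sq]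
        gcongr
        refine i1.trans ?_
        gcongr
        exact H₄ u a b R h.le hu l P h.amp l (by omega)
    _ ≤ _ := (le_of_eq (by rw [hG]; ring)).trans ((mul_le_mul_right e1
        (2 * (1 + C₀ ^ 2) * (C₂ * C₀ * 2 * C₄) * tL 4 a b (fun t => nL 8 (u t)) ^ 2 * P ^ 4)).trans_eq (by ring))

/-- The increment of the modified energy is small. -/
lemma Controlled.exists_lintegral_incr_le (hn : 5 ≤ n) (hn' : n ≤ 7) {β : ℝ} (hβ0 : 0 ≤ β) (hβ : 3 * β ≤ 8 - n) :
    ∃ C ≠ ∞, ∀ (u : ℝ → Sch n) a b R l P, Controlled u a b R β l P →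
    ∀ (θ : Sch n) (c : ℝ) (m : ℕ), 0 ≤ c →
    (∀ k : ℤ, l - 4 ≤ k → ∀ ξ, 2 ^ (k - 1) ≤ ‖ξ‖ → ‖ξ‖ ≤ 2 ^ (k + 1) → ‖θ ξ‖ ≤ c * 2 ^ (4 * k - 2 * β * (k - l))) →
    (∀ ξ, 2 ^ (l + m) ≤ ‖ξ‖ → θ ξ = 0) → (∀ ξ, ‖ξ‖ ≤ 2 ^ (l + 1) → θ ξ = om ξ) →
    ∫⁻ t in Icc a b, ‖incr θ l (u t)‖ₑ ≤
      C * (ofReal c + 1) * (1 + tL 4 a b (fun t => nL 8 (u t)) ^ 2) * P ^ 4 * E2 (l * ((n - 8) / 2)) := by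
  have h5 : (5 : ℝ) ≤ n := by exact_mod_cast hn
  have h7 : (n : ℝ) ≤ 7 := by exact_mod_cast hn'
  obtain ⟨C₁, hC₁, H₁⟩ := Controlled.exists_lintegral_high_le hn hn' hβ0 hβ
  obtain ⟨C₂, hC₂, H₂⟩ := Controlled.exists_lintegral_piece_le hn hn' hβ0 hβ
  obtain ⟨C₃, hC₃, H₃⟩ := Controlled.exists_lintegral_low_le hn hn' hβ0 hβ
  obtain ⟨C₄, hC₄, H₄⟩ := Controlled.exists_lintegral_cub_le hn hn' hβ
  have := E2_ne_top 64
  refine ⟨C₁ + 4 * C₂ * E2 64 + C₃ + C₄, by finiteness, fun u a b R l P h θ c m hc hθ h0 hom => ?_⟩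
  have hu := h.toNiceSol
  have g := hu.good (by omega) (by omega)
  set w : ℝ → Sch n := fun t => cub (u t) - cub (S l (u t)) with hw
  have gw : Good w a b := g.cub.sub (g.S l).cub
  set X := tL 4 a b (fun t => nL 8 (u t))
  set E := E2 (l * ((n - 8) / 2))
  set K := (ofReal c + 1) * (1 + X ^ 2) with hK
  have e : ∀ t, inner ℂ (L2 (bi (S l (u t)))) (L2 (w t)) = inner ℂ (L2 (bi (S (l - 4) (u t)))) (L2 (w t)) +
      ∑ i ∈ range 4, inner ℂ (L2 (T θ (D (l - 4 + 1 + i) (u t)))) (L2 (w t)) := fun t => by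
    rw [← inner_T_S_sub_S, ← inner_add_left, ← L2_add]
    congr 2
    refine fourier_injective fun ξ => ?_
    rw [fourier_add_apply, fourier_bi, fourier_bi, fourier_T, fourier_sub_apply, show l - 4 + ((4 : ℕ) : ℤ) = l by push_cast; ring, fourier_S, fourier_S]
    rcases le_or_gt ‖ξ‖ (2 ^ (l + 1)) with h1 | h1
    · rw [hom ξ h1]; ring
    · rw [dil_lpφ_zero h1.le, dil_lpφ_zero (k := l - 4) ((zpow_le_zpow_right₀ one_le_two (by omega)).trans h1.le)]; ring
  have main : ∀ t, ‖incr θ l (u t)‖ₑ ≤ ‖inner ℂ (L2 (T θ (u t - S l (u t)))) (L2 (cub (u t)))‖ₑ +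
      (‖inner ℂ (L2 (bi (S (l - 4) (u t)))) (L2 (w t))‖ₑ + (∑ i ∈ range 4, ‖inner ℂ (L2 (T θ (D (l - 4 + 1 + i) (u t)))) (L2 (w t))‖ₑ +
      ‖inner ℂ (L2 (S l (cub (S l (u t))))) (L2 (w t))‖ₑ)) := fun t => by
    have him : ∀ z : ℂ, ‖z.im‖ₑ ≤ ‖z‖ₑ := fun z => by
      rw [← ofReal_norm, ← ofReal_norm]; exact ofReal_le_ofReal (Complex.abs_im_le_norm z)
    rw [incr, sub_eq_add_neg, sub_eq_add_neg, add_assoc]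
    refine (enorm_add_le _ _).trans (add_le_add (by rw [enorm_neg]; exact him _) ?_)
    refine (enorm_add_le _ _).trans ?_
    rw [enorm_neg, enorm_neg, ← add_assoc]
    refine add_le_add ((him _).trans ?_) (him _)
    change ‖inner ℂ (L2 (bi (S l (u t)))) (L2 (w t))‖ₑ ≤ _
    rw [e t]
    exact (enorm_add_le _ _).trans (by gcongr; exact enorm_sum_le _ _)
  have m2 : ∀ i ∈ range 4, AEMeasurable (fun t => ‖inner ℂ (L2 (T θ (D (l - 4 + 1 + (i : ℕ)) (u t)))) (L2 (w t))‖ₑ) (volume.restrict (Icc a b)) :=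
    fun i _ => ((g.D _).T θ).aemeasurable_inner gw
  have m4 : AEMeasurable (fun t => ‖inner ℂ (L2 (S l (cub (S l (u t))))) (L2 (w t))‖ₑ) (volume.restrict (Icc a b)) :=
    ((g.S l).cub.S l).aemeasurable_inner gw
  have m1 : AEMeasurable (fun t => ‖inner ℂ (L2 (T θ (u t - S l (u t)))) (L2 (cub (u t)))‖ₑ) (volume.restrict (Icc a b)) :=
    ((g.sub (g.S l)).T θ).aemeasurable_inner g.cub
  calc _ ≤ ∫⁻ t in Icc a b, _ := lintegral_mono main
    _ ≤ C₁ * (ofReal c * P ^ 4) * E + (C₃ * P ^ 4 * E + (∑ i ∈ range 4, C₂ * (ofReal c * P ^ 4) * (E2 64 * E) + C₄ * X ^ 2 * P ^ 4 * E)) := by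
        rw [lintegral_add_left' m1, lintegral_add_right', lintegral_add_right' _ m4, lintegral_finsetSum' _ m2]
        on_goal 2 => exact (Finset.aemeasurable_fun_sum _ m2).add m4
        refine add_le_add (H₁ u a b R l P h θ c m hc (fun k hk => hθ k (by omega)) h0) (add_le_add (H₃ u a b R l P h)
          (add_le_add (Finset.sum_le_sum fun i hi => ?_) (H₄ u a b R l P h)))
        have hi4 : i < 4 := Finset.mem_range.1 hi
        have hi4' : (i : ℝ) ≤ 3 := by exact_mod_cast Nat.lt_succ_iff.1 hi4
        refine (H₂ u a b R l P h (l - 4 + 1 + i) l θ c hc (by omega) (by omega) (by omega) (by omega) (hθ _ (by omega))).trans ?_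
        gcongr
        rw [E2_add]
        refine E2_le ?_
        push_cast
        nlinarith [(Nat.cast_nonneg i : (0 : ℝ) ≤ i)]
    _ = (C₁ * ofReal c + 4 * C₂ * E2 64 * ofReal c + C₃ + C₄ * X ^ 2) * P ^ 4 * E := by
        rw [Finset.sum_const, Finset.card_range, nsmul_eq_mul]; push_cast; ring
    _ ≤ (C₁ * K + 4 * C₂ * E2 64 * K +
        C₃ * K + C₄ * K) * P ^ 4 * E := by
        have j1 : ofReal c ≤ K := le_self_add.trans (le_mul_of_one_le_right' le_self_add)
        have j2 : (1 : ℝ≥0∞) ≤ K := one_le_mul le_add_self le_self_add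
        have j3 : X ^ 2 ≤ K := le_add_self.trans (le_mul_of_one_le_left' le_add_self)
        gcongr (_ * ?_ + _ * ?_ + ?_ + _ * ?_) * _ * _
        exact le_mul_of_one_le_right' j2
    _ = _ := by rw [hK]; ring

/-! ### The smoothing operator on Schwartz functions -/

lemma IsISymbol.hasTemperateGrowth {N s : ℝ} {m : Rn n → ℝ} (hN : 0 < N) (hs : s < 2) (hm : IsISymbol N s m) :
    m.HasTemperateGrowth := by
  obtain ⟨hc, -, -, -, hh⟩ := hm
  refine ⟨hc, fun i => ?_⟩
  obtain ⟨C, hC⟩ := (isCompact_closedBall (0 : Rn n) (3 * N)).exists_bound_of_continuousOn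
    (hc.continuous_iteratedFDeriv (m := i) (by exact_mod_cast le_top)).continuousOn
  refine ⟨0, C, fun ξ => ?_⟩
  rw [pow_zero, mul_one]
  rcases le_or_gt ‖ξ‖ (3 * N) with h | h
  · exact hC ξ (by simpa using h)
  set r := ‖ξ‖ / (3 * N) with hr
  have hr1 : 1 < r := by rw [hr, one_lt_div (by positivity)]; exact h
  have hr0 : 0 < r := by linarith
  have hξ : ‖r⁻¹ • ξ‖ = 3 * N := by
    rw [norm_smul, norm_inv, norm_of_nonneg hr0.le, hr]
    have : 0 < ‖ξ‖ := by linarith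
    field_simp
  have e : m =ᶠ[𝓝 ξ] r ^ (-(2 - s)) • fun x => m (r⁻¹ • x) := by
    have hcont : Continuous fun x : Rn n => ‖r⁻¹ • x‖ := by fun_prop
    filter_upwards [hcont.continuousAt.eventually (lt_mem_nhds (show 2 * N < ‖r⁻¹ • ξ‖ by linarith))] with x hx
    have hx' := hx
    rw [norm_smul, norm_inv, norm_of_nonneg hr0.le, inv_mul_eq_div, lt_div_iff₀ hr0] at hx'
    have hx0 : 2 * N < ‖x‖ := by nlinarith
    rw [Pi.smul_apply, hh x hx0.le, hh _ hx.le, norm_smul, norm_inv, norm_of_nonneg hr0.le, smul_eq_mul, rpow_neg hr0.le,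
      show N / (r⁻¹ * ‖x‖) = r * (N / ‖x‖) by field_simp, mul_rpow hr0.le (by positivity), inv_mul_cancel_left₀ (by positivity)]
  have hi : ContDiff ℝ i m := hc.of_le (by exact_mod_cast le_top)
  rw [(e.iteratedFDeriv ℝ i).eq_of_nhds, iteratedFDeriv_const_smul_apply (f := fun x => m (r⁻¹ • x)) (hi.comp (contDiff_const_smul _)).contDiffAt,
    iteratedFDeriv_comp_const_smul _ hi, norm_smul, norm_smul, norm_pow, norm_inv, norm_of_nonneg hr0.le,
    norm_of_nonneg (by positivity : (0:ℝ) ≤ r ^ (-(2 - s)))]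
  have h1 : r ^ (-(2 - s)) ≤ 1 := rpow_le_one_of_one_le_of_nonpos hr1.le (by linarith)
  have h2 : r⁻¹ ^ i ≤ 1 := pow_le_one₀ (by positivity) (inv_le_one_of_one_le₀ hr1.le)
  calc _ ≤ 1 * (1 * C) := by
        gcongr
        exact hC _ (by simp [hξ])
    _ = C := by ring

/-- The multiplier with symbol `m` on Schwartz functions. -/
def J (m : Rn n → ℝ) (f : Sch n) : Sch n :=
  𝓕⁻ (SchwartzMap.smulLeftCLM ℂ m (𝓕 f))

lemma fourier_J {m : Rn n → ℝ} (hm : m.HasTemperateGrowth) (f : Sch n) (ξ : Rn n) :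
    𝓕 (J m f) ξ = m ξ * 𝓕 f ξ := by
  rw [J, fourier_fourierInv_eq, smulLeftCLM_apply_apply hm, real_smul]

lemma coe_J {m : Rn n → ℝ} (hm : m.HasTemperateGrowth) (f : Sch n) : ⇑(J m f) = Iop m f := by
  rw [J, fourierInv_coe, Iop, fmul]
  congr 1
  ext ξ
  rw [smulLeftCLM_apply_apply hm, real_smul, fourier_coe]

lemma energy_coe (f : Sch n) : Energy f = 1 / 2 * ‖L2 (lapS f)‖ ^ 2 + 1 / 4 * Q4 f := by
  have h1 : Integrable fun x => ‖lapS f x‖ ^ 2 := by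
    simpa using ((lapS f).memLp 2 volume).integrable_norm_pow (by norm_num)
  rw [Energy, norm_L2_sq, Q4, ← integral_const_mul, ← integral_const_mul, ← integral_add (h1.const_mul _) ((integrable_pow_four f).const_mul _), lap_coe]

lemma IsISymbol.bounds {N s : ℝ} {m : Rn n → ℝ} {l : ℤ} (hN : 2 ^ (l + 1) ≤ N) (hN' : N < 2 ^ (l + 2)) (hs : s < 2) (hs' : 1 ≤ s)
    (hm : IsISymbol N s m) : (∀ ξ, 0 ≤ m ξ) ∧ (∀ ξ, m ξ ≤ 1) ∧ (∀ ξ, ‖ξ‖ ≤ 2 ^ (l + 1) → m ξ = 1) ∧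
    (∀ k : ℤ, l - 4 ≤ k → ∀ ξ, 2 ^ (k - 1) ≤ ‖ξ‖ → m ξ ≤ 16 * 2 ^ (-(2 - s) * (k - l))) ∧
    (∀ k : ℤ, ∀ ξ, ‖ξ‖ ≤ 2 ^ (k + 1) → 1 ≤ 2 * m ξ * max 1 (2 ^ ((2 - s) * (k - l)))) := by
  obtain ⟨-, -, ha, h1, hh⟩ := hm
  have hN0 : 0 < N := (by positivity : (0:ℝ) < 2 ^ (l + 1)).trans_le hN
  have hβ : 0 < 2 - s := by linarith
  have h0 : ∀ ξ, m ξ ≤ 1 := fun ξ => (ha 0 ξ (by simp)).trans_eq (h1 0 (by simpa using hN0.le))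
  have hlow : ∀ ξ, N < ‖ξ‖ → (N / (2 * ‖ξ‖)) ^ (2 - s) ≤ m ξ := fun ξ h => by
    have e : ‖(2 : ℝ) • ξ‖ = 2 * ‖ξ‖ := by rw [norm_smul, norm_two]
    rw [← e, ← hh _ (by rw [e]; linarith)]
    exact ha _ _ (by rw [e]; linarith)
  have e2 : ∀ k : ℤ, ((2 : ℝ) ^ k) = 2 ^ (k : ℝ) := fun k => (rpow_intCast 2 k).symm
  refine ⟨fun ξ => ?_, h0, fun ξ h => h1 ξ (h.trans hN), fun k hk ξ h => ?_, fun k ξ h => ?_⟩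
  · rcases le_or_gt ‖ξ‖ N with h | h
    · rw [h1 ξ h]; norm_num
    · exact le_trans (by positivity) (hlow ξ h)
  · have hξ : 0 < ‖ξ‖ := lt_of_lt_of_le (by positivity) h
    have h3 : m ξ ≤ (2 * N / ‖ξ‖) ^ (2 - s) := by
      rcases le_or_gt (2 * N) ‖ξ‖ with h' | h'
      · rw [hh ξ h']; gcongr; linarith
      · exact (h0 ξ).trans (one_le_rpow ((one_le_div hξ).2 h'.le) hβ.le)
    refine h3.trans ?_
    calc (2 * N / ‖ξ‖) ^ (2 - s) ≤ (2 * 2 ^ (l + 2) / 2 ^ (k - 1)) ^ (2 - s) := by gcongr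
      _ = 2 ^ (4 * (2 - s)) * 2 ^ (-(2 - s) * (k - l)) := by
          rw [← rpow_add two_pos, show (2:ℝ) * 2 ^ (l + 2) / 2 ^ (k - 1) = 2 ^ (4 + l - k : ℝ) by
            rw [← zpow_one_add₀ two_ne_zero, e2, e2, ← rpow_sub two_pos]; push_cast; ring_nf, ← rpow_mul two_pos.le]
          ring_nf
      _ ≤ 16 * 2 ^ (-(2 - s) * (k - l)) := by
          gcongr
          exact (rpow_le_rpow_of_exponent_le one_le_two (by linarith : 4 * (2 - s) ≤ 4)).trans (by norm_num)
  · rcases le_or_gt ‖ξ‖ N with h' | h'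
    · rw [h1 ξ h']; linarith [le_max_left (1:ℝ) (2 ^ ((2 - s) * (k - l)))]
    · have h3 : (2:ℝ) ^ (-1 - (2 - s) * (k - l)) ≤ m ξ := by
        refine le_trans ?_ (hlow ξ h')
        calc (2:ℝ) ^ (-1 - (2 - s) * (k - l)) ≤ 2 ^ ((l - k - 1) * (2 - s)) :=
              rpow_le_rpow_of_exponent_le one_le_two (by nlinarith)
          _ = (2 ^ (l + 1) / 2 ^ (k + 2)) ^ (2 - s) := by
              rw [rpow_mul two_pos.le, e2, e2, ← rpow_sub two_pos]; push_cast; ring_nf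
          _ ≤ _ := by
              have : 2 * ‖ξ‖ ≤ 2 ^ (k + 2) := by
                rw [show k + 2 = k + 1 + 1 by ring, zpow_add_one₀ two_ne_zero]; linarith
              have : 0 < ‖ξ‖ := hN0.trans h'
              gcongr
      have h4 : (2:ℝ) ^ (-1 - (2 - s) * (k - l)) * 2 ^ ((2 - s) * (k - l)) = 1 / 2 := by
        rw [← rpow_add two_pos, show -1 - (2 - s) * (k - l) + (2 - s) * (k - l) = (-1 : ℝ) by ring, rpow_neg_one, one_div]
      have h5 := le_max_right (1:ℝ) (2 ^ ((2 - s) * (k - l)))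
      have h6 : (0:ℝ) < 2 ^ ((2 - s) * (k - l)) := by positivity
      have h7 : (0:ℝ) < 2 ^ (-1 - (2 - s) * (k - l)) := by positivity
      nlinarith [mul_le_mul h3 h5 h6.le (h7.le.trans h3)]

/-! ### Almost conservation of the modified energy -/

/-- The modified energy with the potential part cut off at the frequency `2 ^ l`. -/
def EJ (m : Rn n → ℝ) (l : ℤ) (f : Sch n) : ℝ := 1 / 2 * ‖L2 (lapS (J m f))‖ ^ 2 + 1 / 4 * Q4 (S l f)

lemma tendsto_modE {m : Rn n → ℝ} (hm : m.HasTemperateGrowth) {θ : ℕ → Sch n} {l : ℤ}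
    (hθ : ∀ j ξ, θ j ξ = ((om ξ * m ξ ^ 2 * bmp n (((2 : ℝ) ^ (l + 1 + j))⁻¹ • ξ) : ℝ) : ℂ)) (f : Sch n) :
    Tendsto (fun j => modE (θ j) l f) atTop (𝓝 (EJ m l f)) := by
  refine Tendsto.add_const _ (Tendsto.const_mul _ ?_)
  have e : ∀ ξ, om ξ * m ξ ^ 2 * ‖𝓕 f ξ‖ ^ 2 = ‖𝓕 (lapS (J m f)) ξ‖ ^ 2 := fun ξ => by
    rw [fourier_lapS, fourier_J hm, norm_mul, norm_neg, norm_mul, norm_real, norm_real, om, norm_of_nonneg (by positivity),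
      ← sq_abs (m ξ), norm_eq_abs]
    ring
  have hi : Integrable fun ξ => om ξ * m ξ ^ 2 * ‖𝓕 f ξ‖ ^ 2 := by
    simp_rw [e]; exact ((𝓕 (lapS (J m f))).memLp 2 volume).integrable_norm_pow (p := 2) two_ne_zero
  rw [← norm_L2_fourier, norm_L2_sq, ← integral_congr_ae (Eventually.of_forall e)]
  simp_rw [fun j => (quad_eq (hθ j) f).2]
  refine tendsto_integral_of_dominated_convergence _ (fun j => (quad_eq (hθ j) f).1.aestronglyMeasurable) hi
    (fun j => Eventually.of_forall fun ξ => ?_) (Eventually.of_forall fun ξ => ?_)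
  · have h0 : 0 ≤ om ξ * m ξ ^ 2 * ‖𝓕 f ξ‖ ^ 2 := by rw [e]; positivity
    rw [mul_right_comm, norm_mul, norm_of_nonneg h0, norm_of_nonneg (bmp n).nonneg]
    exact mul_le_of_le_one_right h0 (bmp n).le_one
  · have h : Tendsto (fun j : ℕ => (2 : ℝ) ^ (l + 1) * 2 ^ j) atTop atTop :=
      (tendsto_pow_atTop_atTop_of_one_lt one_lt_two).const_mul_atTop (by positivity)
    refine tendsto_const_nhds.congr' ?_
    filter_upwards [h.eventually_ge_atTop ‖ξ‖] with j hj
    have := dil_lpφ_one (n := n) (k := l + 1 + j) (ξ := ξ) (by rwa [zpow_add₀ two_ne_zero, zpow_natCast])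
    rw [dil_lpφ_real] at this
    rw [Complex.ofReal_eq_one.1 this, mul_one]

lemma Controlled.exists_EJ_sub_le (hn : 5 ≤ n) (hn' : n ≤ 7) {s : ℝ} (hs : s < 2) (hs' : 1 ≤ s) (hβ : 3 * (2 - s) ≤ 8 - n) :
    ∃ C ≠ ∞, ∀ (u : ℝ → Sch n) a b R l P, Controlled u a b R (2 - s) l P →
    ∀ N (m : Rn n → ℝ), IsISymbol N s m → 2 ^ (l + 1) ≤ N → N < 2 ^ (l + 2) → ∀ t ∈ Icc a b,
    ‖EJ m l (u t) - EJ m l (u a)‖ₑ ≤ C * (1 + tL 4 a b (fun t => nL 8 (u t)) ^ 2) * P ^ 4 * E2 (l * ((n - 8) / 2)) := by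
  obtain ⟨C, hC, H⟩ := Controlled.exists_lintegral_incr_le hn hn' (by linarith : 0 ≤ 2 - s) hβ
  refine ⟨C * (ofReal ((2 * π) ^ 4 * 16 * 256) + 1), by finiteness, fun u a b R l P h N m hm hN hN' t ht => ?_⟩
  have hN0 : 0 < N := (by positivity : (0:ℝ) < 2 ^ (l + 1)).trans_le hN
  have hg := hm.hasTemperateGrowth hN0 hs
  obtain ⟨b0, b1, b2, b3, -⟩ := hm.bounds hN hN' hs hs'
  have hex : ∀ j : ℕ, ∃ θ : Sch n, ∀ ξ, θ ξ = ((om ξ * m ξ ^ 2 * bmp n (((2 : ℝ) ^ (l + 1 + j))⁻¹ • ξ) : ℝ) : ℂ) := fun j => by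
    refine exists_schwartz (r := 2 ^ (l + 1 + j + 1)) ((contDiff_om.mul (hm.1.pow 2)).mul ((bmp n).contDiff.comp (contDiff_const_smul _))) fun ξ h => ?_
    have := dil_lpφ_zero h
    rw [dil_lpφ_real] at this
    rw [Complex.ofReal_eq_zero.1 this, mul_zero]
  choose θ hθ using hex
  have hdil : ∀ j ξ, θ j ξ = om ξ * m ξ ^ 2 * dil (l + 1 + j) (lpφ n) ξ := fun j ξ => by
    rw [hθ, dil_lpφ_real]; push_cast; ring
  have om0 : ∀ ξ : Rn n, 0 ≤ om ξ := fun ξ => by unfold om; positivity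
  have hlow : ∀ j ξ, ‖ξ‖ ≤ 2 ^ (l + 1) → θ j ξ = om ξ := fun j ξ hξ => by
    rw [hdil, b2 ξ hξ, dil_lpφ_one (hξ.trans (zpow_le_zpow_right₀ one_le_two (by omega)))]; simp
  have key : ∀ j, ‖modE (θ j) l (u t) - modE (θ j) l (u a)‖ₑ ≤
      C * (ofReal ((2 * π) ^ 4 * 16 * 256) + 1) * (1 + tL 4 a b (fun t => nL 8 (u t)) ^ 2) * P ^ 4 * E2 (l * ((n - 8) / 2)) := fun j => by
    refine le_trans ?_ (H u a b R l P h (θ j) ((2 * π) ^ 4 * 16 * 256) (j + 2) (by positivity) (fun k hk ξ h1 h2 => ?_) (fun ξ hξ => ?_) (hlow j))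
    · rw [(h.toNiceSol.mono le_rfl ht.2).modE_sub (by omega) (by omega) (hθ j) (hlow j) ht.1, integral_of_le ht.1]
      exact (enorm_integral_le_lintegral_enorm _).trans (lintegral_mono_set (Set.Ioc_subset_Icc_self.trans (Set.Icc_subset_Icc_right ht.2)))
    · rw [hdil, norm_mul]
      have hm2 : m ξ ^ 2 ≤ (16 * 2 ^ (-(2 - s) * (k - l))) ^ 2 := by gcongr; exacts [b0 ξ, b3 k hk ξ h1]
      have hom : om ξ ≤ (2 * π) ^ 4 * 16 * 2 ^ (4 * k : ℝ) := by
        calc om ξ ≤ (2 * π * 2 ^ (k + 1)) ^ 4 := by unfold om; gcongr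
          _ = _ := by
            rw [zpow_add_one₀ two_ne_zero, ← rpow_intCast, mul_comm (4:ℝ), rpow_mul two_pos.le, show (4:ℝ) = (4:ℕ) by norm_num, rpow_natCast]
            ring
      have hn1 : ‖(om ξ : ℂ) * m ξ ^ 2‖ = om ξ * m ξ ^ 2 := by
        rw [← Complex.ofReal_pow, ← Complex.ofReal_mul, norm_real, norm_of_nonneg (mul_nonneg (om0 ξ) (sq_nonneg _))]
      calc _ ≤ (om ξ * m ξ ^ 2) * 1 := by rw [hn1]; gcongr; exacts [mul_nonneg (om0 ξ) (sq_nonneg _), norm_dil_lpφ_le _ _]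
        _ ≤ ((2 * π) ^ 4 * 16 * 2 ^ (4 * k : ℝ)) * (16 * 2 ^ (-(2 - s) * (k - l))) ^ 2 * 1 := by gcongr
        _ = (2 * π) ^ 4 * 16 * 256 * (2 ^ (4 * k : ℝ) * (2 ^ (-(2 - s) * (k - l)) * 2 ^ (-(2 - s) * (k - l)))) := by ring
        _ = _ := by rw [← rpow_add two_pos, ← rpow_add two_pos]; ring_nf
    · rw [hdil, dil_lpφ_zero, mul_zero]
      convert hξ using 2; push_cast; omega
  exact le_of_tendsto (((tendsto_modE hg hθ (u t)).sub (tendsto_modE hg hθ (u a))).enorm) (Eventually.of_forall key)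

lemma norm_pow_four_sub_le (f v v' : ℂ) :
    |‖f‖ ^ 4 - ‖v‖ ^ 4 - 4 * (starRingEnd ℂ ((‖v'‖ : ℂ) ^ 2 * v') * (f - v)).re| ≤
      6 * (‖v - v'‖ * ‖f - v‖ * ‖v‖ * ‖v‖) + 6 * (‖v - v'‖ * ‖f - v‖ * ‖v'‖ * ‖v'‖) +
      (6 * (‖f - v‖ * ‖f - v‖ * ‖f‖ * ‖f‖) + 6 * (‖f - v‖ * ‖f - v‖ * ‖v‖ * ‖v‖)) := by
  have h1 := abs_pow_four_sub_le (le_max_left ‖v‖ ‖f‖) (le_max_right ‖v‖ ‖f‖)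
  have h2 : max ‖v‖ ‖f‖ ^ 2 ≤ ‖v‖ ^ 2 + ‖f‖ ^ 2 := by
    rcases max_choice ‖v‖ ‖f‖ with h | h <;> rw [h] <;> nlinarith [sq_nonneg ‖v‖, sq_nonneg ‖f‖]
  have h3 : |(starRingEnd ℂ ((‖v‖ : ℂ) ^ 2 * v - (‖v'‖ : ℂ) ^ 2 * v') * (f - v)).re| ≤ 3 / 2 * (‖v‖ ^ 2 + ‖v'‖ ^ 2) * ‖v - v'‖ * ‖f - v‖ := by
    refine (Complex.abs_re_le_norm _).trans ?_
    rw [norm_mul, RCLike.norm_conj]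
    gcongr
    exact norm_cubic_sub_le v v'
  have h4 : ‖f‖ ^ 4 - ‖v‖ ^ 4 - 4 * (starRingEnd ℂ ((‖v'‖ : ℂ) ^ 2 * v') * (f - v)).re =
      (‖f‖ ^ 4 - ‖v‖ ^ 4 - 4 * (starRingEnd ℂ ((‖v‖ : ℂ) ^ 2 * v) * (f - v)).re) +
      4 * (starRingEnd ℂ ((‖v‖ : ℂ) ^ 2 * v - (‖v'‖ : ℂ) ^ 2 * v') * (f - v)).re := by
    rw [map_sub, sub_mul, sub_re]; ring
  rw [h4]
  refine (abs_add_le _ _).trans ?_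
  rw [abs_mul, abs_of_pos (by norm_num : (0:ℝ) < 4)]
  nlinarith [mul_le_mul_of_nonneg_right h2 (sq_nonneg ‖f - v‖)]

lemma enorm_Q4_sub_le {f v v' : Sch n} (h : inner ℂ (L2 (cub v')) (L2 (f - v)) = 0) :
    ‖Q4 f - Q4 v‖ₑ ≤ 6 * (nL 4 (v - v' : Sch n) * nL 4 (f - v : Sch n) * (nL 4 v ^ 2 + nL 4 v' ^ 2)) +
      6 * (nL 4 (f - v : Sch n) ^ 2 * (nL 4 f ^ 2 + nL 4 v ^ 2)) := by
  have hi : Integrable fun x => starRingEnd ℂ (cub v' x) * (f - v) x :=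
    ((smul2 (sconj (cub v')) (f - v))).integrable (μ := volume) |>.congr (Eventually.of_forall fun x => by
      simp [smul2_apply, sconj_apply])
  have h0 : ∫ x, (starRingEnd ℂ (cub v' x) * (f - v) x).re = 0 := by
    have := integral_re hi
    rw [← inner_L2_eq, h] at this
    simpa using this
  have e : Q4 f - Q4 v = ∫ x, (‖f x‖ ^ 4 - ‖v x‖ ^ 4 - 4 * (starRingEnd ℂ (cub v' x) * (f - v) x).re) := by
    have i1 : Integrable fun x => ‖f x‖ ^ 4 - ‖v x‖ ^ 4 := (integrable_pow_four f).sub (integrable_pow_four v)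
    have i2 : Integrable fun x => 4 * (starRingEnd ℂ (cub v' x) * (f - v) x).re := hi.re.const_mul 4
    rw [integral_sub i1 i2, integral_sub (integrable_pow_four f) (integrable_pow_four v), integral_const_mul, h0, mul_zero, sub_zero, Q4, Q4]
  have hx : ∀ x, ‖‖f x‖ ^ 4 - ‖v x‖ ^ 4 - 4 * (starRingEnd ℂ (cub v' x) * (f - v) x).re‖ₑ ≤
      6 * (‖(v - v') x‖ₑ * ‖(f - v) x‖ₑ * ‖v x‖ₑ * ‖v x‖ₑ) + 6 * (‖(v - v') x‖ₑ * ‖(f - v) x‖ₑ * ‖v' x‖ₑ * ‖v' x‖ₑ) +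
      (6 * (‖(f - v) x‖ₑ * ‖(f - v) x‖ₑ * ‖f x‖ₑ * ‖f x‖ₑ) + 6 * (‖(f - v) x‖ₑ * ‖(f - v) x‖ₑ * ‖v x‖ₑ * ‖v x‖ₑ)) := fun x => by
    have := ofReal_le_ofReal (norm_pow_four_sub_le (f x) (v x) (v' x))
    rw [ofReal_add (by positivity) (by positivity), ofReal_add (by positivity) (by positivity),
      ofReal_add (by positivity) (by positivity)] at this
    have he : ∀ a b c d : ℂ, ofReal (6 * (‖a‖ * ‖b‖ * ‖c‖ * ‖d‖)) = 6 * (‖a‖ₑ * ‖b‖ₑ * ‖c‖ₑ * ‖d‖ₑ) := fun a b c d => by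
      rw [ofReal_mul (by positivity), ofReal_mul (by positivity), ofReal_mul (by positivity),
        ofReal_mul (by positivity), ofReal_ofNat]
      simp only [ofReal_norm]
    simp only [he] at this
    rw [← enorm_eq_ofReal_abs] at this
    simpa only [cub_apply, sub_apply] using this
  have m : ∀ a b c d : Sch n, Measurable fun x => 6 * (‖a x‖ₑ * ‖b x‖ₑ * ‖c x‖ₑ * ‖d x‖ₑ) := fun a b c d =>
    (((a.measurable_enorm.mul b.measurable_enorm).mul c.measurable_enorm).mul d.measurable_enorm).const_mul 6
  have b : ∀ a b c d : Sch n, ∫⁻ x, 6 * (‖a x‖ₑ * ‖b x‖ₑ * ‖c x‖ₑ * ‖d x‖ₑ) ≤ 6 * (nL 4 a * nL 4 b * nL 4 c * nL 4 d) :=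
    fun a b c d => by
      rw [lintegral_const_mul' _ _ (by norm_num)]
      gcongr
      exact lintegral_mul_four_le (by norm_num) (by norm_num) (by norm_num) (by norm_num) (by norm_num) a b c d
  rw [e]
  refine (enorm_integral_le_lintegral_enorm _).trans ((lintegral_mono hx).trans ?_)
  have m2 : ∀ a b c d p q r s : Sch n,
      Measurable fun x => 6 * (‖a x‖ₑ * ‖b x‖ₑ * ‖c x‖ₑ * ‖d x‖ₑ) + 6 * (‖p x‖ₑ * ‖q x‖ₑ * ‖r x‖ₑ * ‖s x‖ₑ) :=
    fun a b c d p q r s => (m a b c d).add (m p q r s)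
  rw [lintegral_add_left (m2 _ _ _ _ _ _ _ _), lintegral_add_left (m _ _ _ _), lintegral_add_left (m _ _ _ _)]
  refine (add_le_add (add_le_add (b _ _ _ _) (b _ _ _ _)) (add_le_add (b _ _ _ _) (b _ _ _ _))).trans_eq ?_
  ring

lemma S_J {N s : ℝ} {m : Rn n → ℝ} {l : ℤ} (hN : 2 ^ (l + 1) ≤ N) (hs : s < 2) (hm : IsISymbol N s m) (f : Sch n) :
    S l (J m f) = S l f := fourier_injective fun ξ => by
  rw [fourier_S, fourier_S, fourier_J (hm.hasTemperateGrowth ((by positivity : (0:ℝ) < 2 ^ (l + 1)).trans_le hN) hs)]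
  rcases le_or_gt ‖ξ‖ (2 ^ (l + 1)) with h | h
  · rw [hm.2.2.2.1 ξ (h.trans hN), Complex.ofReal_one, one_mul]
  · rw [dil_lpφ_zero h.le, zero_mul, zero_mul]

lemma exists_nL_J_sub_S_le (hn : 5 ≤ n) (hn' : n ≤ 7) {s : ℝ} (hs : s < 2) (hs' : 1 ≤ s) :
    ∃ C ≠ ∞, ∀ (u : ℝ → Sch n) a b R (l : ℤ) (P : ℝ≥0∞), NiceSol u a b R →
    HighAmp u a b (2 - s) l P →
    ∀ N (m : Rn n → ℝ), IsISymbol N s m → 2 ^ (l + 1) ≤ N → N < 2 ^ (l + 2) → ∀ t ∈ Icc a b,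
    nL 4 (J m (u t) - S l (u t) : Sch n) ≤ C * P * E2 (l * (n / 4 - 2)) := by
  have hn7 : (n : ℝ) ≤ 7 := by exact_mod_cast hn'
  obtain ⟨C, hC, H⟩ := exists_bernstein_D (n := n) (p := 2) (q := 4) (by norm_num) (by norm_num)
  simp only [ofReal_zpow_rpow] at H
  have hc : (n : ℝ) / 4 - 2 < 0 := by linarith
  have := geom_ne_top hc
  refine ⟨C * 16 * (1 - E2 (n / 4 - 2))⁻¹, by finiteness, fun u a b R l P hu hA N m hm hN hN' t ht => ?_⟩
  have hg := hm.hasTemperateGrowth ((by positivity : (0:ℝ) < 2 ^ (l + 1)).trans_le hN) hs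
  obtain ⟨b0, -, -, b3, -⟩ := hm.bounds hN hN' hs hs'
  have h1 : ∀ j : ℕ, nL 4 (D (l + 1 + j) (J m (u t))) ≤ C * 16 * P * E2 (l * (n / 4 - 2) + (n / 4 - 2) * j) := fun j => by
    set k : ℤ := l + 1 + j with hk
    have h2 : nL 2 (D k (J m (u t))) ≤ 16 * E2 (-(2 - s) * (k - l)) * nL 2 (D k (u t)) := by
      rw [← ofReal_two_rpow, nL_two_eq, nL_two_eq, ← ofReal_ofNat 16, ← ofReal_mul (by norm_num), ← ofReal_mul (by positivity)]
      refine ofReal_le_ofReal (norm_L2_le_of_fourier fun ξ => ?_)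
      rw [fourier_D, fourier_D, fourier_J hg]
      rcases le_or_gt ‖ξ‖ (2 ^ (k - 1)) with h | h
      · rw [dil_lpψ_low h]; simp
      · rw [mul_left_comm, norm_mul, norm_real, norm_of_nonneg (b0 ξ)]
        exact mul_le_mul_of_nonneg_right (b3 k (by omega) ξ h.le) (norm_nonneg _)
    have h3 := (hu.nL_D_le_Amp (by omega) (by omega) k ht).trans (hA k (by omega))
    calc _ ≤ C * E2 (k * (n / 2 - n / 4)) * (16 * E2 (-(2 - s) * (k - l)) * (P * E2 (-2 * k + (2 - s) * (k - l)))) := by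
          refine (H k _ (BL_D k _)).trans ?_
          gcongr
          exact h2.trans (by gcongr)
      _ = C * 16 * P * (E2 (k * (n / 2 - n / 4)) * (E2 (-(2 - s) * (k - l)) * E2 (-2 * k + (2 - s) * (k - l)))) := by ring
      _ ≤ _ := by
        rw [E2_add, E2_add]
        gcongr
        refine E2_le ?_
        rw [hk]; push_cast
        linarith
  rw [← S_J hN hs hm]
  calc _ ≤ ∑' j : ℕ, nL 4 (D (l + 1 + j) (J m (u t))) := nL_sub_S_le (by omega) (by norm_num) l _
    _ ≤ _ := ENNReal.tsum_le_tsum h1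
    _ = _ := by rw [ENNReal.tsum_mul_left, tsum_E2]; ring

/-- The quartic part of the modified energy only depends on the low frequencies, up to a small error. -/
lemma Controlled.exists_Q4_J_sub_le (hn : 5 ≤ n) (hn' : n ≤ 7) {s : ℝ} (hs : s < 2) (hs' : 1 ≤ s) :
    ∃ C ≠ ∞, ∀ (u : ℝ → Sch n) a b R l P, Controlled u a b R (2 - s) l P →
    ∀ N (m : Rn n → ℝ), IsISymbol N s m → 2 ^ (l + 1) ≤ N → N < 2 ^ (l + 2) → ∀ t ∈ Icc a b,
    ‖Q4 (J m (u t)) - Q4 (S l (u t))‖ₑ ≤ C * P ^ 4 * E2 (l * ((n - 8) / 2)) := by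
  have hn7 : (n : ℝ) ≤ 7 := by exact_mod_cast hn'
  obtain ⟨C₁, hC₁, H₁⟩ := exists_nL_J_sub_S_le hn hn' hs hs'
  obtain ⟨C₂, hC₂, H₂⟩ := HighAmp.exists_nL_D_le (n := n) hn (by omega) (p := 4) (by norm_num)
  obtain ⟨C₃, hC₃, H₃⟩ := _root_.exists_nL_S_le (n := n)
  have := E2_ne_top 6
  refine ⟨6 * ((4 * C₂ * E2 6) * C₁ * (1 + C₃ ^ 2)) + 6 * (C₁ ^ 2 * ((C₁ + 1) ^ 2 + 1)), by finiteness, fun u a b R l P h N m hm hN hN' t ht => ?_⟩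
  have hg := hm.hasTemperateGrowth ((by positivity : (0:ℝ) < 2 ^ (l + 1)).trans_le hN) hs
  have hl : (0 : ℝ) ≤ l := by exact_mod_cast h.nonneg
  set f := u t with hf
  set e := E2 (l * (n / 4 - 2)) with he
  have he1 : e ≤ 1 := by rw [he, ← E2_zero]; exact E2_le (by nlinarith)
  have he2 : e ^ 2 = E2 (l * ((n - 8) / 2)) := by rw [he, E2_pow]; congr 1; push_cast; ring
  have hz : nL 4 (J m f - S l f : Sch n) ≤ C₁ * P * e := H₁ u a b R l P h.toNiceSol h.amp N m hm hN hN' t ht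
  have hv : nL 4 (S l f) ≤ P := h.low t ht
  have hv' : nL 4 (S (l - 4) f) ≤ C₃ * P := by
    rw [← S_S_of_lt (show l - 4 < l by omega)]
    exact (H₃ (by norm_num) _ _).trans (by gcongr)
  have hJ : nL 4 (J m f) ≤ (C₁ + 1) * P := by
    calc nL 4 (J m f) = nL 4 ((J m f - S l f) + S l f : Sch n) := by rw [sub_add_cancel]
      _ ≤ C₁ * P * 1 + P := (nL_add_le (by norm_num) _ _).trans (add_le_add (hz.trans (by gcongr)) hv)
      _ = _ := by ring
  have hd : nL 4 (S l f - S (l - 4) f : Sch n) ≤ 4 * C₂ * E2 6 * P * e := by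
    have h1 := nL_S_sub_le (p := 4) (by norm_num) (l - 4) f 4
    rw [show l - 4 + ((4 : ℕ) : ℤ) = l by omega] at h1
    refine h1.trans ((Finset.sum_le_card_nsmul _ _ (C₂ * E2 6 * P * e) fun j hj => ?_).trans_eq ?_)
    · have hj4 : (j : ℝ) ≤ 3 := by
        have := Finset.mem_range.1 hj
        exact_mod_cast (show j ≤ 3 by omega)
      have hj0 : (0 : ℝ) ≤ j := j.cast_nonneg
      refine (H₂ u a b R h.toNiceSol _ l P h.amp _ (by omega) t ht).trans ?_
      rw [show C₂ * E2 6 * P * e = C₂ * P * (E2 6 * e) by ring, he, E2_add]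
      gcongr
      refine E2_le ?_
      have hn0 : (0 : ℝ) ≤ n := n.cast_nonneg
      push_cast
      nlinarith
    · rw [Finset.card_range, nsmul_eq_mul]; push_cast; ring
  have ho : inner ℂ (L2 (cub (S (l - 4) f))) (L2 (J m f - S l f)) = 0 := inner_L2_eq_zero fun ξ => by
    rcases le_or_gt ‖ξ‖ (2 ^ l) with h1 | h1
    · refine Or.inr ?_
      rw [fourier_sub_apply, fourier_J hg, fourier_S, dil_lpφ_one h1,
        hm.2.2.2.1 ξ ((h1.trans (zpow_le_zpow_right₀ one_le_two (by omega))).trans hN), Complex.ofReal_one, sub_self]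
    · refine Or.inl (fourier_cub_eq_zero (r := 2 ^ (l - 4 + 1)) (BL_S (l - 4) f) (lt_of_le_of_lt ?_ h1))
      rw [show l = l - 4 + 1 + 3 by ring, zpow_add₀ two_ne_zero (l - 4 + 1) 3, show l - 4 + 1 + 3 - 4 + 1 = l - 4 + 1 by ring]
      have : (0:ℝ) < 2 ^ (l - 4 + 1) := by positivity
      norm_num
      linarith
  refine (enorm_Q4_sub_le ho).trans ?_
  calc _ ≤ 6 * ((4 * C₂ * E2 6 * P * e) * (C₁ * P * e) * (P ^ 2 + (C₃ * P) ^ 2)) + 6 * ((C₁ * P * e) ^ 2 * (((C₁ + 1) * P) ^ 2 + P ^ 2)) := by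
        gcongr
    _ = _ := by rw [← he2]; ring

/-! ### Closing the bootstrap -/

lemma exists_E2_mul_le {A : ℝ≥0∞} (hA : A ≠ ∞) {c : ℝ} (hc : c < 0) : ∃ l₀ : ℤ, 0 ≤ l₀ ∧ ∀ l : ℤ, l₀ ≤ l → A * E2 (l * c) ≤ 1 := by
  obtain ⟨j, hj⟩ := ENNReal.exists_nat_gt hA
  have hj2 : A ≤ E2 j := hj.le.trans (by
    rw [E2, ENNReal.rpow_natCast]; exact_mod_cast j.lt_two_pow_self.le)
  refine ⟨⌈(j : ℝ) / -c⌉, Int.ceil_nonneg (div_nonneg j.cast_nonneg (by linarith)), fun l hl => ?_⟩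
  have h1 : (j : ℝ) ≤ l * -c := (div_le_iff₀ (by linarith)).1 ((Int.le_ceil _).trans (by exact_mod_cast hl))
  calc A * E2 (l * c) ≤ E2 j * E2 (l * c) := by gcongr
    _ ≤ E2 0 := by rw [E2_add]; exact E2_le (by linarith)
    _ = 1 := E2_zero

lemma nL_four_pow_nat (f : Sch n) : nL 4 f ^ 4 = ofReal (Q4 f) := by
  rw [← nL_four_pow, ← ENNReal.rpow_natCast]; norm_num

lemma Controlled.exists_pow_four_le (hn : 5 ≤ n) (hn' : n ≤ 7) {s : ℝ} (hs : s < 2) (hs' : 1 ≤ s) (hβ : 3 * (2 - s) ≤ 8 - n)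
    {Q K : ℝ≥0∞} (hQ : Q ≠ ∞) (hK : K ≠ ∞) :
    ∃ P ≠ ∞, ∃ l₀ : ℤ, 0 ≤ l₀ ∧ ∀ (u : ℝ → Sch n) a b R (l : ℤ), l₀ ≤ l → a ≤ b →
    NiceSol u a b R → HighAmp u a b (2 - s) l Q → tL 4 a b (fun t => nL 8 (u t)) ≤ K →
    ∀ N (m : Rn n → ℝ), IsISymbol N s m → 2 ^ (l + 1) ≤ N → N < 2 ^ (l + 2) → Energy (J m (u a)) ≤ 1 →
    Controlled u a b R (2 - s) l P := by
  have hn7 : (n : ℝ) ≤ 7 := by exact_mod_cast hn'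
  obtain ⟨C₁, hC₁, H₁⟩ := Controlled.exists_EJ_sub_le hn hn' hs hs' hβ
  obtain ⟨C₃, hC₃, H₃⟩ := _root_.exists_nL_S_le (n := n)
  obtain ⟨l₀, hl₀, HL⟩ := exists_E2_mul_le (A := 8 * (C₁ * (1 + K ^ 2))) (by finiteness) (c := ((n : ℝ) - 8) / 2) (by linarith)
  set E₀ := 1 + C₃ ^ 4 with hE₀
  refine ⟨2 * Q ^ 4 + 8 * E₀ + 1, by finiteness, l₀, hl₀, fun u a b R l hl hab hu hA hX N m hm hN hN' hE => ?_⟩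
  obtain ⟨C₀, hC₀, H₀⟩ := (hu.good (by omega) (by omega)).exists_nL_le (p := 4) (by norm_num)
  set Z := ⨆ t : Icc a b, nL 4 (S l (u t)) with hZ
  have hZt : Z ≠ ∞ := ne_top_of_le_ne_top (by finiteness : C₃ * C₀ ≠ ∞)
    (iSup_le fun t => (H₃ (by norm_num) l _).trans (by gcongr; exact H₀ t t.2))
  set P := max Q Z with hP
  have hPt : P ≠ ∞ := by rw [hP]; exact (max_lt hQ.lt_top hZt.lt_top).ne
  have hc : Controlled u a b R (2 - s) l P := ⟨hu, hab, hl₀.trans hl, fun k hk => (hA k hk).trans (by gcongr; exact le_max_left _ _),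
    fun t ht => (le_iSup (fun t : Icc a b => nL 4 (S l (u t))) ⟨t, ht⟩).trans (le_max_right _ _), hPt⟩
  have hEa : ofReal (EJ m l (u a)) ≤ E₀ := by
    rw [energy_coe] at hE
    have hq : nL 4 (S l (u a)) ^ 4 ≤ C₃ ^ 4 * 4 := by
      rw [← S_J hN hs hm]
      calc _ ≤ (C₃ * nL 4 (J m (u a))) ^ 4 := by gcongr; exact H₃ (by norm_num) l _
        _ = C₃ ^ 4 * ofReal (Q4 (J m (u a))) := by rw [mul_pow, nL_four_pow_nat]
        _ ≤ _ := by
          gcongr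
          rw [← ofReal_ofNat]
          exact ofReal_le_ofReal (by nlinarith [sq_nonneg ‖L2 (lapS (J m (u a)))‖])
    rw [EJ, ofReal_add (by positivity) (mul_nonneg (by norm_num) (Q4_nonneg _)), hE₀]
    refine add_le_add (ENNReal.ofReal_le_one.2 (by linarith [Q4_nonneg (J m (u a))])) ?_
    rw [ofReal_mul (by norm_num), ← nL_four_pow_nat]
    calc _ ≤ ofReal (1 / 4) * (C₃ ^ 4 * 4) := by gcongr
      _ = C₃ ^ 4 * (ofReal (1 / 4) * ofReal 4) := by rw [ofReal_ofNat]; ring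
      _ = _ := by rw [← ofReal_mul (by norm_num)]; norm_num
  have hZ4 : ∀ t ∈ Icc a b, 2 * nL 4 (S l (u t)) ^ 4 ≤ 8 * E₀ + P ^ 4 := fun t ht => by
    have h1 : ofReal (Q4 (S l (u t))) ≤ 4 * (ofReal (EJ m l (u a)) + ‖EJ m l (u t) - EJ m l (u a)‖ₑ) := by
      have h0 : 0 ≤ EJ m l (u a) := add_nonneg (by positivity) (mul_nonneg (by norm_num) (Q4_nonneg _))
      rw [enorm_eq_ofReal_abs, ← ofReal_add h0 (abs_nonneg _), ← ofReal_ofNat 4, ← ofReal_mul (by norm_num)]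
      refine ofReal_le_ofReal ?_
      have h2 : 1 / 4 * Q4 (S l (u t)) ≤ EJ m l (u t) := le_add_of_nonneg_left (by positivity)
      linarith [le_abs_self (EJ m l (u t) - EJ m l (u a))]
    rw [nL_four_pow_nat]
    calc _ ≤ 2 * (4 * (E₀ + C₁ * (1 + K ^ 2) * P ^ 4 * E2 (l * ((n - 8) / 2)))) := by
          gcongr
          refine h1.trans ?_
          gcongr
          exact (H₁ u a b R l P hc N m hm hN hN' t ht).trans (by gcongr)
      _ = 8 * E₀ + 8 * (C₁ * (1 + K ^ 2)) * E2 (l * ((n - 8) / 2)) * P ^ 4 := by ring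
      _ ≤ 8 * E₀ + 1 * P ^ 4 := by gcongr; exact HL l hl
      _ = _ := by rw [one_mul]
  have hZ5 : 2 * Z ^ 4 ≤ 8 * E₀ + P ^ 4 := by
    rw [hZ]
    have h1 : ∀ c : ℝ≥0∞, c ≤ ((8 * E₀ + P ^ 4) / 2) ^ (1 / 4 : ℝ) ↔ 2 * c ^ 4 ≤ 8 * E₀ + P ^ 4 := fun c => by
      rw [one_div, ENNReal.le_rpow_inv_iff (by norm_num), ENNReal.le_div_iff_mul_le (by simp) (by simp), mul_comm,
        ← ENNReal.rpow_natCast]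
      norm_num
    exact (h1 _).1 (iSup_le fun t => (h1 _).2 (hZ4 t t.2))
  have hP4 : P ^ 4 ≤ 2 * Q ^ 4 + 8 * E₀ := by
    have h1 : P ^ 4 ≤ Q ^ 4 + Z ^ 4 := by
      rcases max_choice Q Z with h | h <;> rw [hP, h]
      exacts [le_self_add, le_add_self]
    refine (ENNReal.add_le_add_iff_right (by finiteness : P ^ 4 ≠ ∞)).1 ?_
    calc P ^ 4 + P ^ 4 = 2 * P ^ 4 := by ring
      _ ≤ 2 * (Q ^ 4 + Z ^ 4) := by gcongr
      _ = 2 * Q ^ 4 + 2 * Z ^ 4 := by ring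
      _ ≤ 2 * Q ^ 4 + (8 * E₀ + P ^ 4) := by gcongr
      _ = _ := by ring
  have hPP : P ≤ 2 * Q ^ 4 + 8 * E₀ + 1 := by
    rcases le_total P 1 with h | h
    · exact h.trans le_add_self
    · exact ((le_self_pow h (by norm_num)).trans hP4).trans le_self_add
  exact ⟨hu, hab, hl₀.trans hl, fun k hk => (hc.amp k hk).trans (by gcongr), fun t ht => (hc.low t ht).trans hPP, by finiteness⟩

lemma NiceSol.exists_energy_sub_le (hn : 5 ≤ n) (hn' : n ≤ 7) {s : ℝ} (hs : s < 2) (hs' : 1 ≤ s) (hβ : 3 * (2 - s) ≤ 8 - n)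
    {Q K : ℝ≥0∞} (hQ : Q ≠ ∞) (hK : K ≠ ∞) :
    ∃ C ≠ ∞, ∃ l₀ : ℤ, 0 ≤ l₀ ∧ ∀ (u : ℝ → Sch n) a b R (l : ℤ), l₀ ≤ l → a ≤ b →
    NiceSol u a b R → HighAmp u a b (2 - s) l Q → tL 4 a b (fun t => nL 8 (u t)) ≤ K →
    ∀ N (m : Rn n → ℝ), IsISymbol N s m → 2 ^ (l + 1) ≤ N → N < 2 ^ (l + 2) → Energy (J m (u a)) ≤ 1 →
    ∀ t ∈ Icc a b, ‖Energy (J m (u t)) - Energy (J m (u a))‖ₑ ≤ C * E2 (l * ((n - 8) / 2)) := by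
  obtain ⟨P, hP, l₀, hl₀, H⟩ := Controlled.exists_pow_four_le hn hn' hs hs' hβ hQ hK
  obtain ⟨C₁, hC₁, H₁⟩ := Controlled.exists_EJ_sub_le hn hn' hs hs' hβ
  obtain ⟨C₂, hC₂, H₂⟩ := Controlled.exists_Q4_J_sub_le hn hn' hs hs'
  refine ⟨C₁ * (1 + K ^ 2) * P ^ 4 + 2 * (C₂ * P ^ 4), by finiteness, l₀, hl₀, fun u a b R l hl hab hu hA hX N m hm hN hN' hE t ht => ?_⟩
  have hc := H u a b R l hl hab hu hA hX N m hm hN hN' hE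
  have hq : ∀ t ∈ Icc a b, ‖1 / 4 * (Q4 (J m (u t)) - Q4 (S l (u t)))‖ₑ ≤ C₂ * P ^ 4 * E2 (l * ((n - 8) / 2)) := fun t ht => by
    rw [enorm_mul]
    refine (mul_le_of_le_one_left' ?_).trans (H₂ u a b R l P hc N m hm hN hN' t ht)
    rw [enorm_eq_ofReal (by norm_num)]
    exact ENNReal.ofReal_le_one.2 (by norm_num)
  have e : Energy (J m (u t)) - Energy (J m (u a)) = (EJ m l (u t) - EJ m l (u a)) +
      (1 / 4 * (Q4 (J m (u t)) - Q4 (S l (u t))) - 1 / 4 * (Q4 (J m (u a)) - Q4 (S l (u a)))) := by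
    rw [energy_coe, energy_coe, EJ, EJ]; ring
  rw [e]
  calc _ ≤ C₁ * (1 + K ^ 2) * P ^ 4 * E2 (l * ((n - 8) / 2)) + (C₂ * P ^ 4 * E2 (l * ((n - 8) / 2)) + C₂ * P ^ 4 * E2 (l * ((n - 8) / 2))) :=
        (enorm_add_le _ _).trans (add_le_add ((H₁ u a b R l P hc N m hm hN hN' t ht).trans (by gcongr))
          ((enorm_sub_le).trans (add_le_add (hq t ht) (hq a ⟨le_rfl, hab⟩))))
    _ = _ := by ring

/-! ### Frequency bounds for the initial data -/

def wt (β : ℝ) (l k : ℤ) : ℝ := ((2 : ℝ) ^ k)⁻¹ ^ 2 * max 1 (2 ^ (β * (k - l)))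

lemma Wt_wt {β : ℝ} (h0 : 0 ≤ β) (h1 : β ≤ 1) (l : ℤ) : Wt (wt β l) := by
  have e : ∀ k : ℤ, ((2 : ℝ) ^ (k + 1))⁻¹ ^ 2 = ((2 : ℝ) ^ k)⁻¹ ^ 2 * (1 / 4) := fun k => by
    rw [zpow_add_one₀ two_ne_zero, mul_inv, mul_pow]; norm_num
  have hp : ∀ k : ℤ, (0:ℝ) < ((2 : ℝ) ^ k)⁻¹ ^ 2 := fun k => by positivity
  refine ⟨fun k => by unfold wt; positivity, fun k => ?_, fun k => ?_⟩
  · have h2 : (2 : ℝ) ^ (β * (((k + 1 : ℤ) : ℝ) - l)) ≤ 2 * 2 ^ (β * (k - l)) := by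
      nth_rw 2 [← rpow_one 2]
      rw [← rpow_add two_pos]
      exact rpow_le_rpow_of_exponent_le one_le_two (by push_cast; linarith)
    have h3 : max 1 ((2 : ℝ) ^ (β * (((k + 1 : ℤ) : ℝ) - l))) ≤ 2 * max 1 (2 ^ (β * (k - l))) :=
      max_le (by linarith [le_max_left (1 : ℝ) (2 ^ (β * (k - l)))]) (h2.trans (by linarith [le_max_right (1 : ℝ) (2 ^ (β * (k - l)))]))
    rw [wt, wt, e]
    nlinarith [hp k]
  · have h3 : max 1 ((2 : ℝ) ^ (β * (k - l))) ≤ max 1 (2 ^ (β * (((k + 1 : ℤ) : ℝ) - l))) :=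
      max_le_max le_rfl (rpow_le_rpow_of_exponent_le one_le_two (by push_cast; linarith))
    have h4 : (0:ℝ) < max 1 (2 ^ (β * (((k + 1 : ℤ) : ℝ) - l))) := by positivity
    rw [wt, wt, e]
    nlinarith [mul_le_mul_of_nonneg_left h3 (hp k).le, mul_pos (hp k) h4]

lemma wt_le_rpow {β : ℝ} (h0 : 0 ≤ β) {l k : ℤ} (hl : 0 ≤ l) (hk : 0 ≤ k) : wt β l k ≤ ((2 : ℝ) ^ k) ^ (β - 2) := by
  have hl' : (0 : ℝ) ≤ l := by exact_mod_cast hl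
  have hk' : (0 : ℝ) ≤ k := by exact_mod_cast hk
  rw [rpow_sub (by positivity), ← rpow_intCast, ← rpow_mul two_pos.le, wt, div_eq_mul_inv, mul_comm]
  gcongr
  · exact max_le (one_le_rpow one_le_two (by positivity)) (rpow_le_rpow_of_exponent_le one_le_two (by nlinarith))
  · rw [rpow_intCast, rpow_two, inv_pow]

lemma ofReal_wt_le {β : ℝ} (h0 : 0 ≤ β) (h1 : β ≤ 1) {l k : ℤ} (hk : l - 4 ≤ k) :
    ofReal (wt β l k) ≤ 16 * E2 (-2 * k + β * (k - l)) := by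
  have hk' : (l : ℝ) - 4 ≤ k := by exact_mod_cast hk
  rw [← ofReal_two_rpow, ← ofReal_ofNat 16, ← ofReal_mul (by norm_num)]
  refine ofReal_le_ofReal ?_
  have h2 : max 1 ((2 : ℝ) ^ (β * (k - l))) ≤ 16 * 2 ^ (β * (k - l)) := by
    refine max_le ?_ (by linarith [rpow_pos_of_pos two_pos (β * ((k : ℝ) - l))])
    rw [show (16 : ℝ) = 2 ^ (4 : ℝ) by norm_num, ← rpow_add two_pos]
    exact one_le_rpow one_le_two (by nlinarith)
  have h3 : ((2 : ℝ) ^ k)⁻¹ ^ 2 = 2 ^ (-2 * k : ℝ) := by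
    rw [neg_mul, rpow_neg two_pos.le, mul_comm, rpow_mul two_pos.le, rpow_intCast, rpow_two, inv_pow]
  rw [wt, rpow_add two_pos, h3]
  nlinarith [mul_le_mul_of_nonneg_left h2 (rpow_pos_of_pos two_pos (-2 * k : ℝ)).le]

lemma nL_D_le_wt {N s : ℝ} {m : Rn n → ℝ} {l : ℤ} (hN : 2 ^ (l + 1) ≤ N) (hN' : N < 2 ^ (l + 2)) (hs : s < 2) (hs' : 1 ≤ s)
    (hm : IsISymbol N s m) {f : Sch n} (hE : Energy (J m f) ≤ 1) (k : ℤ) :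
    nL 2 (D k f) ≤ 8 * ofReal (wt (2 - s) l k) := by
  have hg := hm.hasTemperateGrowth ((by positivity : (0:ℝ) < 2 ^ (l + 1)).trans_le hN) hs
  obtain ⟨b0, -, -, -, b4⟩ := hm.bounds hN hN' hs hs'
  set w := wt (2 - s) l k with hw
  have hw0 : 0 < w := by rw [hw, wt]; positivity
  have h2 : ‖L2 (lapS (J m f))‖ ≤ 2 := by
    rw [energy_coe] at hE
    nlinarith [Q4_nonneg (J m f), norm_nonneg (L2 (lapS (J m f)))]
  have h1 : ‖L2 (D k f)‖ ≤ 4 * w * ‖L2 (lapS (J m f))‖ := norm_L2_le_of_fourier fun ξ => by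
    rw [fourier_D, fourier_lapS, fourier_J hg]
    rcases le_or_gt ‖ξ‖ (2 ^ (k - 1)) with h | h
    · rw [dil_lpψ_low h, zero_mul, norm_zero]; positivity
    rcases le_or_gt (2 ^ (k + 1)) ‖ξ‖ with h' | h'
    · rw [dil_lpψ_high h', zero_mul, norm_zero]; positivity
    have e : ‖-(((2 * π * ‖ξ‖) ^ 2 : ℝ) : ℂ) * ((m ξ : ℂ) * 𝓕 f ξ)‖ = (2 * π * ‖ξ‖) ^ 2 * (m ξ * ‖𝓕 f ξ‖) := by
      rw [norm_mul, norm_mul, norm_neg, norm_real, norm_real, norm_of_nonneg (b0 ξ), norm_of_nonneg (by positivity)]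
    rw [e, norm_mul]
    have h3 : (2 : ℝ) ^ k ≤ 2 * π * ‖ξ‖ := by
      rw [zpow_sub_one₀ two_ne_zero] at h
      nlinarith [pi_gt_three, norm_nonneg ξ]
    have h4 : 2 ≤ 4 * w * ((2 * π * ‖ξ‖) ^ 2 * m ξ) := by
      have h5 : ((2 : ℝ) ^ k) ^ 2 * w = max 1 (2 ^ ((2 - s) * (k - l))) := by
        rw [hw, wt, ← mul_assoc, ← mul_pow, mul_inv_cancel₀ (by positivity), one_pow, one_mul]
      calc (2 : ℝ) ≤ 2 * (2 * m ξ * max 1 (2 ^ ((2 - s) * (k - l)))) := by linarith [b4 k ξ h'.le]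
        _ = 4 * w * (((2 : ℝ) ^ k) ^ 2 * m ξ) := by rw [← h5]; ring
        _ ≤ _ := by gcongr; exact b0 ξ
    calc _ ≤ 2 * ‖𝓕 f ξ‖ := by gcongr; exact norm_dil_lpψ_le k ξ
      _ ≤ 4 * w * ((2 * π * ‖ξ‖) ^ 2 * m ξ) * ‖𝓕 f ξ‖ := by gcongr
      _ = _ := by ring
  rw [nL_two_eq, ← ofReal_ofNat 8, ← ofReal_mul (by norm_num)]
  exact ofReal_le_ofReal (by nlinarith)

lemma Solves4NLS.isSol (hs : ContDiff ℝ (⊤ : ℕ∞) fun p : ℝ × Rn n => u p.1 p.2)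
    (h : Solves4NLS (Icc a b) fun t x => u t x) : IsSol u a b := by
  refine ⟨hs, fun t ht x => ?_⟩
  have hd : DifferentiableAt ℝ (fun τ => u τ x) t :=
    (((hs.comp (contDiff_id.prodMk contDiff_const)).differentiable (by simp)).differentiableAt : DifferentiableAt ℝ (fun τ : ℝ => u τ x) t)
  refine hd.hasDerivAt.congr_deriv ?_
  have h1 : I * deriv (fun τ => u τ x) t + bi (u t) x + cub (u t) x = 0 := by
    rw [coe_cub, ← bilap_coe]; exact h t ht x
  rw [rhs_apply]
  linear_combination -I * h1 + deriv (fun τ => u τ x) t * Complex.I_sq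

/-- almost conservation law for the modified energy `E(Iu)`. -/
theorem stmt_17 (n : ℕ) (hn1 : 5 ≤ n) (hn2 : n ≤ 7) (s : ℝ)
    (hs1 : (n : ℝ)/2 - 2 < s) (hs2 : s < 2)
    (hs3 : max (((n : ℝ) - 2)/3) 1 ≤ s)
    (ε : ℝ) (hε : 0 < ε) :
    ∃ δ : ℝ, 0 < δ ∧ ∃ N₀ : ℝ, 1 ≤ N₀ ∧ ∃ C : ℝ, 0 < C ∧
      ∀ N : ℝ, N₀ ≤ N → ∀ m : Rn n → ℝ, IsISymbol N s m →
        ∀ T : ℝ, 0 ≤ T →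
          ∀ (u₀ : Rn n → ℂ), ContDiff ℝ (⊤ : ℕ∞) u₀ → HasCompactSupport u₀ →
            Energy (Iop m u₀) ≤ 1 →
            ∀ u : ℝ → SchwartzMap (Rn n) ℂ,
              ContDiff ℝ (⊤ : ℕ∞) (fun p : ℝ × Rn n => u p.1 p.2) →
              Solves4NLS (Set.Icc 0 T) (fun t x => u t x) →
              (∀ x, u 0 x = u₀ x) →
              MNorm (Set.Icc 0 T) (fun t x => u t x) ≤ ENNReal.ofReal δ →
              ∀ t ∈ Set.Icc (0:ℝ) T,
                |Energy (Iop m (fun x => u t x)) - Energy (Iop m u₀)|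
                  ≤ C * max (N ^ (((n : ℝ) - 8)/2 + ε)) (N ^ (-1 + ε)) := by
  have hn5 : (5 : ℝ) ≤ n := by exact_mod_cast hn1
  have hn7 : (n : ℝ) ≤ 7 := by exact_mod_cast hn2
  have hs' : 1 ≤ s := (le_max_right _ _).trans hs3
  have hβ : 3 * (2 - s) ≤ 8 - n := by linarith [(le_max_left _ _).trans hs3]
  obtain ⟨η, hη, HP⟩ := NiceSol.exists_persist hn1 hn2
  obtain ⟨δ, hδ, HS⟩ := NiceSol.exists_small hn1 hn2 hη (γ := (8 - n) / 6) (by linarith) 8 (by norm_num)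
  obtain ⟨CX, hCX, HX⟩ := NiceSol.exists_tL_four_le hn1 hn2 (p := 8) (γ := (8 - n) / 24) (by linarith) (by linarith)
  obtain ⟨C, hC, l₀, hl₀, HE⟩ := NiceSol.exists_energy_sub_le hn1 hn2 hs2 hs' hβ (Q := 256)
    (K := CX * (ofReal δ + 16)) (by norm_num) (by finiteness)
  refine ⟨δ, hδ, 2 ^ (l₀ + 2), one_le_zpow₀ one_le_two (by omega), 8 * (C.toReal + 1), by positivity,
    fun N hN m hm T hT u₀ _ _ hE u hu hsol h0 hM t ht => ?_⟩
  have hN1 : 1 ≤ N := (one_le_zpow₀ one_le_two (by omega)).trans hN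
  have hN0 : 0 < N := by linarith
  have hu₀ : u₀ = u 0 := funext fun x => (h0 x).symm
  have hg := hm.hasTemperateGrowth hN0 hs2
  rw [hu₀, ← coe_J hg] at hE ⊢
  rw [← coe_J hg]
  have hM' : Mor u 0 T ≤ ofReal δ := hM
  obtain ⟨R, hR⟩ := (hsol.isSol hu).exists_niceSol hn1 hn2 (ne_top_of_le_ne_top ofReal_ne_top hM')
  obtain ⟨l, hl1, hl2⟩ : ∃ l : ℤ, 2 ^ (l + 1) ≤ N ∧ N < 2 ^ (l + 2) := by
    refine ⟨Int.log 2 N - 1, ?_, ?_⟩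
    · simpa using Int.zpow_log_le_self (b := 2) one_lt_two hN0
    · simpa [show Int.log 2 N - 1 + 2 = Int.log 2 N + 1 by ring] using Int.lt_zpow_succ_log_self (b := 2) one_lt_two N
  have hl : l₀ ≤ l := by
    have := (zpow_lt_zpow_iff_right₀ (one_lt_two (α := ℝ))).1 (hN.trans_lt hl2)
    omega
  have hw := Wt_wt (by linarith : 0 ≤ 2 - s) (by linarith) l
  have hw2 : ∀ k : ℤ, 0 ≤ k → wt (2 - s) l k ≤ ((2 : ℝ) ^ k) ^ (2 - (n : ℝ) / 2 - (8 - n) / 6) := fun k hk =>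
    (wt_le_rpow (by linarith) (hl₀.trans hl) hk).trans (rpow_le_rpow_of_exponent_le (one_le_zpow₀ one_le_two hk) (by linarith))
  have hD := nL_D_le_wt hl1 hl2 hs2 hs' hm hE
  have hA := HP u 0 T R hT hR (HS u 0 T R hT hR _ hw hw2 hD hM') _ hw 8 hD
  have hX : tL 4 0 T (fun t => nL 8 (u t)) ≤ CX * (ofReal δ + 16) := by
    refine (HX u 0 T R hT hR 16 (fun k hk => (hA k).trans ?_) 0 le_rfl).trans ?_
    · norm_num only
      gcongr
      exact (hw2 k hk).trans (rpow_le_rpow_of_exponent_le (one_le_zpow₀ one_le_two hk) (by linarith))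
    · simp only [zpow_zero, one_rpow, ofReal_one, one_mul, mul_one]
      gcongr
  have hH : HighAmp u 0 T (2 - s) l 256 := fun k hk => (hA k).trans <| by
    calc _ ≤ 2 * 8 * (16 * E2 (-2 * k + (2 - s) * (k - l))) := by gcongr; exact ofReal_wt_le (by linarith) (by linarith) hk
      _ = _ := by rw [← mul_assoc]; norm_num
  have key := HE u 0 T R l hl hT hR hH hX N m hm hl1 hl2 hE t ht
  rw [← ofReal_toReal hC, ← ofReal_two_rpow, ← ofReal_mul ENNReal.toReal_nonneg, Real.enorm_eq_ofReal_abs,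
    ofReal_le_ofReal_iff (by positivity)] at key
  have h2l : (2 : ℝ) ^ (l * (((n : ℝ) - 8) / 2)) ≤ 8 * N ^ (((n : ℝ) - 8) / 2 + ε) := by
    have h3 : N / 4 ≤ 2 ^ l := by
      rw [zpow_add₀ two_ne_zero] at hl2
      norm_num at hl2
      linarith
    have h4 : (4 : ℝ) ^ (-(((n : ℝ) - 8) / 2)) ≤ 8 := by
      calc (4 : ℝ) ^ (-(((n : ℝ) - 8) / 2)) ≤ 4 ^ (3 / 2 : ℝ) := rpow_le_rpow_of_exponent_le (by norm_num) (by linarith)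
        _ = 8 := by rw [show (4 : ℝ) = 2 ^ (2 : ℝ) by norm_num, ← rpow_mul two_pos.le]; norm_num
    rw [rpow_mul two_pos.le, rpow_intCast]
    calc _ ≤ (N / 4) ^ (((n : ℝ) - 8) / 2) := rpow_le_rpow_of_nonpos (by positivity) h3 (by linarith)
      _ = 4 ^ (-(((n : ℝ) - 8) / 2)) * N ^ (((n : ℝ) - 8) / 2) := by
        rw [div_rpow hN0.le (by norm_num), rpow_neg (by norm_num), div_eq_mul_inv, mul_comm]
      _ ≤ _ := by gcongr; linarith
  calc _ ≤ C.toReal * 2 ^ (l * (((n : ℝ) - 8) / 2)) := key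
    _ ≤ (C.toReal + 1) * (8 * N ^ (((n : ℝ) - 8) / 2 + ε)) := by gcongr; linarith
    _ = 8 * (C.toReal + 1) * N ^ (((n : ℝ) - 8) / 2 + ε) := by ring
    _ ≤ _ := by gcongr; exact le_max_left _ _
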